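/- Fix any ε with 0 < ε < 1/7. There exists a constant C = C(ε) > 0 such that for every prime p and every residue class a with a ≢ 0 (mod p), there exist positive integers n₁, n₂, n₃, n₄, n₅, n₆, n₇, each at most C·p^(6/7+ε), such that n₁!·n₂!·n₃!·n₄!·n₅!·n₆!·n₇! ≡ a (mod p). -/

import Mathlib

namespace SevenFact

section

open Polynomial Module

section Stepanov

variable {k : Type*} [Field k] {B : Type*} [CommRing B] [Algebra k[X] B] {D : ℕ}

/-- All coordinates of `u` in the basis `b` have degree at most `n`. -/
def CoordDegLE (b : Basis (Fin D) k[X] B) (n : ℕ) (u : B) : Prop :=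
  ∀ i, (b.repr u i).natDegree ≤ n

lemma CoordDegLE.mono {b : Basis (Fin D) k[X] B} {n m : ℕ} {u : B} (h : CoordDegLE b n u)
    (hnm : n ≤ m) : CoordDegLE b m u := fun i => (h i).trans hnm

lemma CoordDegLE.sum {b : Basis (Fin D) k[X] B} {n : ℕ} {ι : Type*} (s : Finset ι) {u : ι → B}
    (h : ∀ a ∈ s, CoordDegLE b n (u a)) : CoordDegLE b n (∑ a ∈ s, u a) := by
  intro i
  rw [map_sum, Finsupp.finsetSum_apply]
  exact natDegree_sum_le_of_forall_le _ _ fun a ha => h a ha i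

lemma CoordDegLE.smul {b : Basis (Fin D) k[X] B} {n m : ℕ} {f : k[X]} (hf : f.natDegree ≤ m)
    {u : B} (h : CoordDegLE b n u) : CoordDegLE b (m + n) (f • u) := by
  intro i
  rw [map_smul, Finsupp.smul_apply, smul_eq_mul]
  exact natDegree_mul_le_of_le hf (h i)

lemma exists_coordDegLE (b : Basis (Fin D) k[X] B) {ι : Type*} [Finite ι] (f : ι → B) :
    ∃ c, ∀ i, CoordDegLE b c (f i) := by
  have := Fintype.ofFinite ι
  refine ⟨∑ i, ∑ j, (b.repr (f i) j).natDegree, fun i j => ?_⟩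
  calc (b.repr (f i) j).natDegree ≤ ∑ j, (b.repr (f i) j).natDegree :=
        Finset.single_le_sum (f := fun j => (b.repr (f i) j).natDegree) (fun _ _ => Nat.zero_le _)
          (Finset.mem_univ j)
    _ ≤ _ := Finset.single_le_sum (f := fun i => ∑ j, (b.repr (f i) j).natDegree)
          (fun _ _ => Nat.zero_le _) (Finset.mem_univ i)

lemma CoordDegLE.mul {b : Basis (Fin D) k[X] B} {c : ℕ}
    (hc : ∀ i j, CoordDegLE b c (b i * b j)) {n m : ℕ} {u v : B}
    (hu : CoordDegLE b n u) (hv : CoordDegLE b m v) : CoordDegLE b (n + m + c) (u * v) := by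
  rw [← b.sum_repr u, ← b.sum_repr v, Finset.sum_mul]
  refine CoordDegLE.sum _ fun i _ => ?_
  rw [Finset.mul_sum]
  refine CoordDegLE.sum _ fun j _ => ?_
  rw [smul_mul_smul_comm]
  exact CoordDegLE.smul (natDegree_mul_le_of_le (hu i) (hv j)) (hc i j)

lemma CoordDegLE.pow {b : Basis (Fin D) k[X] B} {c : ℕ}
    (hc : ∀ i j, CoordDegLE b c (b i * b j)) {n : ℕ} {u : B}
    (hu : CoordDegLE b n u) {q : ℕ} (hq : 0 < q) : CoordDegLE b (q * (n + c)) (u ^ q) := by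
  induction q, hq using Nat.le_induction with
  | base => simpa using hu.mono (by omega)
  | succ q hq ih =>
    rw [pow_succ]
    exact (ih.mul hc hu).mono (by ring_nf; omega)

lemma CoordDegLE.natDegree_norm {b : Basis (Fin D) k[X] B} {c : ℕ}
    (hc : ∀ i j, CoordDegLE b c (b i * b j)) {n : ℕ} {u : B}
    (hu : CoordDegLE b n u) : (Algebra.norm k[X] u).natDegree ≤ D * (n + c) := by
  have hub : ∀ j, CoordDegLE b (n + c) (u * b j) := by
    intro j
    rw [← b.sum_repr u, Finset.sum_mul]
    refine CoordDegLE.sum _ fun i _ => ?_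
    rw [smul_mul_assoc]
    exact CoordDegLE.smul (hu i) (hc i j)
  rw [Algebra.norm_eq_matrix_det b, Matrix.det_apply]
  refine natDegree_sum_le_of_forall_le _ _ fun π _ => (natDegree_smul_le _ _).trans ?_
  refine (natDegree_prod_le _ _).trans ?_
  calc _ ≤ ∑ _i : Fin D, (n + c) := Finset.sum_le_sum fun i _ => by
          rw [Algebra.leftMulMatrix_eq_repr_mul]; exact hub i _
    _ = D * (n + c) := by simp

variable [Algebra k B] [IsScalarTower k k[X] B]

lemma finite_quotient_of_ne_bot [IsDomain B] (b : Basis (Fin D) k[X] B) {I : Ideal B}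
    (hI : I ≠ ⊥) : Module.Finite k (B ⧸ I) :=
  Module.Finite.equiv (I.quotientEquivDirectSum k b hI).symm

lemma finite_quotient_span [IsDomain B] (b : Basis (Fin D) k[X] B) {f : B} (hf : f ≠ 0) :
    Module.Finite k (B ⧸ Ideal.span {f}) :=
  finite_quotient_of_ne_bot b (by simpa using hf)

/-- The points at which a nonzero function vanishes are at most as many as the degree of its
norm. -/
lemma ncard_zeros_le [IsDomain B] (b : Basis (Fin D) k[X] B) {f : B} (hf : f ≠ 0)
    (S : Set (B →ₐ[k] k)) (hS : ∀ P ∈ S, P f = 0) :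
    S.Finite ∧ S.ncard ≤ (Algebra.norm k[X] f).natDegree := by
  have := finite_quotient_span b hf
  rw [← finrank_quotient_span_eq_natDegree_norm b hf]
  have hfin : Finite ((B ⧸ Ideal.span {f}) →ₐ[k] k) := inferInstance
  let φ : S → ((B ⧸ Ideal.span {f}) →ₐ[k] k) := fun P =>
    Ideal.Quotient.liftₐ _ P.1 (by
      intro a ha
      obtain ⟨c, rfl⟩ := Ideal.mem_span_singleton'.1 ha
      rw [map_mul, hS _ P.2, mul_zero])
  have hφ : Function.Injective φ := by
    intro P P' h
    apply Subtype.ext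
    apply AlgHom.ext
    intro x
    have := congrArg (fun g => g (Ideal.Quotient.mk _ x)) h
    exact this
  have : Finite S := Finite.of_injective φ hφ
  refine ⟨Set.toFinite S, ?_⟩
  rw [← Nat.card_coe_set_eq]
  exact (Nat.card_le_card_of_injective φ hφ).trans (card_algHom_le_finrank k _ k)

lemma le_natDegree_norm_of_mem_pow [IsDedekindDomain B] (b : Basis (Fin D) k[X] B) {f : B}
    (hf : f ≠ 0) (M : Ideal B) (hM : M ≠ ⊥) (hM' : M ≠ ⊤) (n : ℕ) (hfM : f ∈ M ^ n) :
    n ≤ (Algebra.norm k[X] f).natDegree := by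
  have := finite_quotient_span b hf
  rw [← finrank_quotient_span_eq_natDegree_norm b hf]
  let π : B →ₗ[k] (B ⧸ Ideal.span {f}) := (Ideal.Quotient.mkₐ k (Ideal.span {f})).toLinearMap
  let S : ℕ → Submodule k (B ⧸ Ideal.span {f}) := fun i =>
    ((M ^ i).restrictScalars k).map π
  have hlt : ∀ i < n, S (i + 1) < S i := by
    intro i hi
    refine lt_of_le_of_ne (Submodule.map_mono ?_) ?_
    · intro x hx
      exact Ideal.pow_le_pow_right (Nat.le_succ i) hx
    · intro heq
      have hlt' := Ideal.pow_right_strictAnti M hM hM' (Nat.lt_succ_self i)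
      apply hlt'.not_ge
      intro x hx
      have hx' : π x ∈ S (i + 1) := by
        rw [heq]; exact Submodule.mem_map_of_mem (by exact hx)
      obtain ⟨y, hy, hxy⟩ := hx'
      have hy' : y ∈ M ^ (i + 1) := hy
      have hsub : y - x ∈ Ideal.span {f} := Ideal.Quotient.eq.1 hxy
      have hsub' : y - x ∈ M ^ (i + 1) := by
        refine Ideal.pow_le_pow_right (Nat.succ_le_of_lt hi) ?_
        exact (Ideal.span_singleton_le_iff_mem _).2 hfM hsub
      have : x = y - (y - x) := by ring
      rw [this]
      exact Ideal.sub_mem _ hy' hsub'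
  have hfr : ∀ i ≤ n, i ≤ Module.finrank k (S (n - i)) := by
    intro i
    induction i with
    | zero => intro _; exact Nat.zero_le _
    | succ i ih =>
      intro hi
      have h1 := ih (by omega)
      have h2 := Submodule.finrank_lt_finrank_of_lt (hlt (n - (i + 1)) (by omega))
      rw [show n - (i + 1) + 1 = n - i by omega] at h2
      omega
  exact (hfr n le_rfl).trans (Submodule.finrank_le _)

omit [Algebra k[X] B] [IsScalarTower k k[X] B] in
lemma exists_algHom_ker_eq [IsAlgClosed k] [Algebra.FiniteType k B] (M : Ideal B)
    (hM : M.IsMaximal) : ∃ P : B →ₐ[k] k, ∀ x, P x = 0 ↔ x ∈ M := by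
  let _ := Ideal.Quotient.field M
  have : Module.Finite k (B ⧸ M) := finite_of_finite_type_of_isJacobsonRing k (B ⧸ M)
  let ψ : (B ⧸ M) →ₐ[k] k := IsAlgClosed.lift
  refine ⟨ψ.comp (Ideal.Quotient.mkₐ k M), fun x => ?_⟩
  rw [AlgHom.comp_apply, map_eq_zero_iff ψ ψ.injective]
  exact Ideal.Quotient.eq_zero_iff_mem

omit [Algebra k[X] B] [IsScalarTower k k[X] B] in
lemma exists_algHom_ne_zero [IsAlgClosed k] [IsDomain B] [Algebra.FiniteType k B] {v : B}
    (hv : v ≠ 0) : ∃ P : B →ₐ[k] k, P v ≠ 0 := by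
  have : IsJacobsonRing B := isJacobsonRing_of_finiteType (A := k)
  have h : (⊥ : Ideal B).jacobson = ⊥ :=
    (isJacobsonRing_iff_prime_eq.1 this) ⊥ Ideal.isPrime_bot
  have hv' : v ∉ (⊥ : Ideal B).jacobson := by rw [h]; simpa using hv
  rw [Ideal.jacobson, Ideal.mem_sInf] at hv'
  push Not at hv'
  obtain ⟨M, ⟨-, hM⟩, hvM⟩ := hv'
  obtain ⟨P, hP⟩ := exists_algHom_ker_eq (k := k) M hM
  exact ⟨P, fun h => hvM ((hP v).1 h)⟩

end Stepanov

section Stepanov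

variable {k : Type*} [Field k] {B : Type*} [CommRing B] [Algebra k[X] B] {D : ℕ}
  [Algebra k B] [IsScalarTower k k[X] B]

lemma linearIndependent_X_pow_smul {ι : Type*} [Fintype ι] {β : ι → B}
    (hβ : LinearIndependent k[X] β) (n : ℕ) :
    LinearIndependent k (fun I : Fin n × ι => (X ^ (I.1 : ℕ) : k[X]) • β I.2) := by
  have hX : LinearIndependent k (fun i : Fin n => (X ^ (i : ℕ) : k[X])) := by
    have h := (Polynomial.basisMonomials k).linearIndependent
    have h2 := h.comp (fun i : Fin n => (i : ℕ)) Fin.val_injective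
    convert h2 using 1
    ext1 i
    simp [Polynomial.X_pow_eq_monomial]
  exact linearIndependent_smul hX hβ

/-- Siegel's lemma over `k[X]`: too many functions of bounded degree are linearly dependent. -/
lemma exists_linear_relation (b : Basis (Fin D) k[X] B) {ι : Type*} [Fintype ι] (v : ι → B)
    {n : ℕ} (hv : ∀ i, CoordDegLE b n (v i)) (hn : D * (n + 1) < Fintype.card ι) :
    ∃ α : ι → k, ∑ i, α i • v i = 0 ∧ ∃ i, α i ≠ 0 := by
  let w : ι → (Fin D × Fin (n + 1) → k) := fun i je => (b.repr (v i) je.1).coeff je.2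
  have hw : ¬ LinearIndependent k w := by
    intro h
    have := h.fintype_card_le_finrank
    simp at this
    omega
  obtain ⟨α, h0, hne⟩ := Fintype.not_linearIndependent_iff.1 hw
  refine ⟨α, ?_, hne⟩
  apply b.repr.injective
  rw [map_zero]
  ext j e
  have hcoord : ∀ i, b.repr (α i • v i) j = C (α i) * b.repr (v i) j := by
    intro i
    rw [← IsScalarTower.algebraMap_smul k[X] (α i) (v i), map_smul]
    rfl
  simp only [map_sum, Finsupp.finsetSum_apply, hcoord, finsetSum_coeff, coeff_C_mul,
    Finsupp.zero_apply, coeff_zero]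
  by_cases he : e < n + 1
  · have := congrFun h0 (j, ⟨e, he⟩)
    simpa [w, Finset.sum_apply] using this
  · refine Finset.sum_eq_zero fun i _ => ?_
    rw [coeff_eq_zero_of_natDegree_lt ((hv i j).trans_lt (by omega)), mul_zero]

variable [IsAlgClosed k] (p : ℕ) [Fact p.Prime] [CharP k p] [IsDedekindDomain B]

include p in
/-- A combination of `q`-th powers with coefficients of small degree does not vanish. -/
lemma sum_mul_pow_ne_zero (b : Basis (Fin D) k[X] B) {c : ℕ}
    (hc : ∀ i j, CoordDegLE b c (b i * b j)) 
    {ι : Type*} [Fintype ι] {u : ι → B} (hu : LinearIndependent k u) {l : ℕ}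
    (hl : ∀ i, CoordDegLE b l (u i)) (s : ℕ) (hs : D * (l + c) < p ^ s) (V : ι → B)
    (hV : ∃ i, V i ≠ 0) : ∑ i, u i * V i ^ p ^ s ≠ 0 := by
  have : Module.Finite k[X] B := Module.Finite.of_basis b
  have : Algebra.FiniteType k B := Algebra.FiniteType.trans (S := k[X]) inferInstance inferInstance
  have : CharP B p := charP_of_injective_algebraMap (algebraMap k B).injective p
  intro h0
  obtain ⟨i₀, hi₀⟩ := hV
  obtain ⟨P, hP⟩ := exists_algHom_ne_zero (k := k) hi₀
  let M : Ideal B := RingHom.ker P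
  have hM' : M ≠ ⊤ := by
    rw [Ideal.ne_top_iff_one]
    simp [M, RingHom.mem_ker]
  set e : ι → k := fun i => P (V i) ^ p ^ s with he
  set w : B := ∑ i, e i • u i with hw
  have hw0 : w ≠ 0 := by
    intro h
    have := Fintype.linearIndependent_iff.1 hu e h i₀
    exact hP (pow_eq_zero_iff (pow_ne_zero s (Fact.out : p.Prime).ne_zero) |>.1 this)
  have hwM : w ∈ M ^ p ^ s := by
    have : w = - ∑ i, u i * (V i - algebraMap k B (P (V i))) ^ p ^ s := by
      simp only [sub_pow_char_pow, mul_sub, Finset.sum_sub_distrib, h0, zero_sub, neg_neg]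
      rw [hw]
      refine Finset.sum_congr rfl fun i _ => ?_
      rw [Algebra.smul_def, he, ← map_pow, mul_comm]
    rw [this]
    refine neg_mem (Ideal.sum_mem _ fun i _ => Ideal.mul_mem_left _ _ (Ideal.pow_mem_pow ?_ _))
    simp [M, RingHom.mem_ker]
  have hwl : CoordDegLE b l w := by
    refine CoordDegLE.sum _ fun i _ => ?_
    rw [← IsScalarTower.algebraMap_smul k[X] (e i) (u i)]
    have := CoordDegLE.smul (b := b) (m := 0) (f := algebraMap k k[X] (e i)) (by simp) (hl i)
    simpa using this
  have hM : M ≠ ⊥ := by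
    intro h
    have hX : (algebraMap k[X] B X) - algebraMap k B (P (algebraMap k[X] B X)) ∈ M := by
      simp [M, RingHom.mem_ker]
    rw [h, Ideal.mem_bot, IsScalarTower.algebraMap_apply k k[X] B, ← map_sub] at hX
    have hinj : Function.Injective (algebraMap k[X] B) := by
      have : Module.Free k[X] B := Module.Free.of_basis b
      exact FaithfulSMul.algebraMap_injective _ _
    rw [map_eq_zero_iff _ hinj] at hX
    exact X_sub_C_ne_zero _ hX
  have h1 := le_natDegree_norm_of_mem_pow b hw0 M hM hM' _ hwM
  have h2 := hwl.natDegree_norm hc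
  omega

lemma siegel_arith {D q l c : ℕ} (hD : 0 < D) (h1 : q ≤ D * (l + 2 * c + 1)) (h2 : l ≤ q)
    (h3 : 4 * c * D + 2 * D + 20 ≤ q) :
    q * (l + c + c) + (l + (10 * c + 9) + c) + c + 1 < (l + (10 * c + 9)) * D * (l + 1) := by
  have e1 : q + D * (8 * c + 8) ≤ (l + (10 * c + 9)) * D := by nlinarith
  have e2 : q ≤ 2 * (D * (l + 1)) := by nlinarith
  have e3 : (q + D * (8 * c + 8)) * (l + 1) ≤ (l + (10 * c + 9)) * D * (l + 1) :=
    Nat.mul_le_mul_right _ e1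
  have e4 : (4 * c + 4) * q ≤ (4 * c + 4) * (2 * (D * (l + 1))) := Nat.mul_le_mul_left _ e2
  have e5 : c * 20 ≤ c * q := Nat.mul_le_mul_left _ (by omega)
  nlinarith

set_option maxHeartbeats 1000000 in
/-- Stepanov's bound for the number of points on which the `Q`-power map acts through `σ`. -/
theorem stepanov_bound (b : Basis (Fin D) k[X] B) (β : Fin D → B)
    (hβ : LinearIndependent k[X] β) (σ : B →ₐ[k[X]] B) :
    ∃ C : ℕ, ∀ s : ℕ, 0 < s → ∀ S : Set (B →ₐ[k] k),
      (∀ P ∈ S, P (algebraMap k[X] B X) ^ (p ^ s) ^ 2 = P (algebraMap k[X] B X) ∧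
        ∀ j, P (β j) ^ (p ^ s) ^ 2 = P (σ (β j))) →
      S.Finite ∧ S.ncard ≤ (p ^ s) ^ 2 + C * p ^ s := by
  have hp : 2 ≤ p := (Fact.out : p.Prime).two_le
  have hfin : Module.Finite k[X] B := Module.Finite.of_basis b
  have hfree : Module.Free k[X] B := Module.Free.of_basis b
  have : CharP B p := charP_of_injective_algebraMap (algebraMap k B).injective p
  have hD : 0 < D := by
    rcases Nat.eq_zero_or_pos D with h | h
    · subst h
      have : Subsingleton B := b.repr.toEquiv.subsingleton
      exact absurd this (not_subsingleton B)
    · exact h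
  obtain ⟨c₁, hc₁⟩ := exists_coordDegLE b (fun ij : Fin D × Fin D => b ij.1 * b ij.2)
  obtain ⟨c₂, hc₂⟩ := exists_coordDegLE b b
  obtain ⟨c₃, hc₃⟩ := exists_coordDegLE b β
  obtain ⟨c₄, hc₄⟩ := exists_coordDegLE b (fun j => σ (β j))
  set c := c₁ + c₂ + c₃ + c₄ with hcdef
  have hc : ∀ i j, CoordDegLE b c (b i * b j) := fun i j => (hc₁ (i, j)).mono (by omega)
  have hcb : ∀ i, CoordDegLE b c (b i) := fun i => (hc₂ i).mono (by omega)
  have hcβ : ∀ i, CoordDegLE b c (β i) := fun i => (hc₃ i).mono (by omega)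
  have hcσ : ∀ i, CoordDegLE b c (σ (β i)) := fun i => (hc₄ i).mono (by omega)
  obtain ⟨M, hM⟩ : ∃ M, M = 10 * c + 9 := ⟨_, rfl⟩
  obtain ⟨q₀, hq₀⟩ : ∃ q₀, q₀ = 4 * c * D + 2 * D + 20 := ⟨_, rfl⟩
  refine ⟨D * q₀ + (D * M + 6 * c * D + D), fun s hs S hS => ?_⟩
  obtain ⟨q, hq⟩ : ∃ q, q = p ^ s := ⟨_, rfl⟩
  rw [← hq] at hS ⊢
  have hq1 : 1 < q := hq ▸ Nat.one_lt_pow hs.ne' (by omega)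
  rcases lt_or_ge q q₀ with hlt | hge
  · set g : k[X] := X ^ q ^ 2 - X with hg
    have hgd : g.natDegree = q ^ 2 :=
      FiniteField.X_pow_card_sub_X_natDegree_eq k (by nlinarith)
    have hg0 : g ≠ 0 := FiniteField.X_pow_card_sub_X_ne_zero k (by nlinarith)
    have hf0 : algebraMap k[X] B g ≠ 0 := by
      rwa [Ne, map_eq_zero_iff _ (FaithfulSMul.algebraMap_injective _ _)]
    obtain ⟨h1, h2⟩ := ncard_zeros_le b hf0 S (fun P hP => by
      simp [hg, (hS P hP).1])
    refine ⟨h1, h2.trans ?_⟩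
    rw [Algebra.norm_algebraMap_of_basis b, natDegree_pow, hgd, Fintype.card_fin]
    have : D * q ^ 2 ≤ D * q₀ * q := by nlinarith [Nat.mul_le_mul_left (D * q) hlt.le]
    nlinarith [Nat.zero_le ((D * M + 6 * c * D + D) * q), Nat.zero_le (q ^ 2)]
  · obtain ⟨l, hl⟩ : ∃ l, l = (q - 1) / D - 2 * c := ⟨_, rfl⟩
    have hdiv1 : D * ((q - 1) / D) ≤ q - 1 := Nat.mul_div_le _ _
    have hdiv2 : q - 1 < D * ((q - 1) / D + 1) := Nat.lt_mul_div_succ _ hD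
    have hdge : 2 * c ≤ (q - 1) / D := by
      rw [Nat.le_div_iff_mul_le hD]
      have : 2 * c * D ≤ 4 * c * D := by nlinarith
      omega
    have hlc : (q - 1) / D = l + 2 * c := by omega
    rw [hlc] at hdiv1 hdiv2
    have hd1 : D * (l + 2 * c) < q := by omega
    have hd2 : q ≤ D * (l + 2 * c + 1) := by omega
    obtain ⟨m, hm⟩ : ∃ m, m = l + M := ⟨_, rfl⟩
    obtain ⟨n, hn⟩ : ∃ n, n = q * (l + c + c) + (m + c) + c := ⟨_, rfl⟩
    let I := (Fin m × Fin D) × (Fin (l + 1) × Fin D)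
    let v : I → B := fun I => ((X ^ (I.2.1 : ℕ) : k[X]) • b I.2.2) ^ q *
      ((X ^ (I.1.1 : ℕ) : k[X]) • σ (β I.1.2))
    have hv : ∀ i, CoordDegLE b n (v i) := by
      intro i
      rw [hn]
      refine CoordDegLE.mul hc (CoordDegLE.pow hc (n := l + c) ?_ (by omega)) ?_
      · refine CoordDegLE.smul ?_ (hcb _)
        rw [natDegree_X_pow]; omega
      · refine CoordDegLE.smul ?_ (hcσ _)
        rw [natDegree_X_pow]; omega
    have hcard : D * (n + 1) < Fintype.card I := by
      have : Fintype.card I = D * (m * D * (l + 1)) := by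
        simp only [I, Fintype.card_prod, Fintype.card_fin]; ring
      rw [this]
      refine Nat.mul_lt_mul_of_pos_left ?_ hD
      rw [hn, hm, hM]
      exact siegel_arith hD hd2 (by nlinarith) (by omega)
    obtain ⟨α, hα0, hαne⟩ := exists_linear_relation b v hv hcard
    have hroot : ∀ i, ∃ e : k, e ^ q ^ 2 = α i := fun i =>
      IsAlgClosed.exists_pow_nat_eq _ (by positivity)
    choose e he using hroot
    let u : Fin (l + 1) × Fin D → B := fun T => (X ^ (T.1 : ℕ) : k[X]) • b T.2
    let V : Fin (l + 1) × Fin D → B := fun T =>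
      ∑ J : Fin m × Fin D, e (J, T) • ((X ^ (J.1 : ℕ) : k[X]) • β J.2)
    have hu : ∀ T, CoordDegLE b (l + c) (u T) := fun T => by
      refine CoordDegLE.smul ?_ (hcb _)
      rw [natDegree_X_pow]; omega
    have hVd : ∀ T, CoordDegLE b (m + c) (V T) := fun T => by
      refine CoordDegLE.sum _ fun J _ => ?_
      rw [← IsScalarTower.algebraMap_smul k[X], smul_smul]
      refine CoordDegLE.smul ?_ (hcβ _)
      refine (natDegree_C_mul_le _ _).trans ?_
      rw [natDegree_X_pow]; omega
    have hF0 : ∑ T, u T * V T ^ q ≠ 0 := by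
      simp only [hq]
      refine sum_mul_pow_ne_zero p b hc (linearIndependent_X_pow_smul b.linearIndependent _) hu
        s (by rw [← hq, add_assoc, ← two_mul]; exact hd1) V ?_
      by_contra! hV
      obtain ⟨i, hi⟩ := hαne
      have := Fintype.linearIndependent_iff.1 (linearIndependent_X_pow_smul (k := k) hβ m)
        (fun J => e (J, i.2)) (hV i.2) i.1
      apply hi
      rw [← he]
      simp only [Prod.mk.eta] at this
      rw [this, zero_pow (by positivity)]
    have hFS : ∀ P ∈ S, P (∑ T, u T * V T ^ q) = 0 := by
      intro P hP
      obtain ⟨hPX, hPβ⟩ := hS P hP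
      rw [← pow_eq_zero_iff (n := q) (by omega)]
      have key : ∀ T, P (u T * V T ^ q) ^ q = ∑ J, P (α (J, T) • v (J, T)) := by
        intro T
        have hVT : P (V T) ^ q ^ 2 = ∑ J : Fin m × Fin D, α (J, T) *
            (P (algebraMap k[X] B X) ^ (J.1 : ℕ) * P (σ (β J.2))) := by
          simp only [V, map_sum]
          rw [show q ^ 2 = p ^ (s * 2) by rw [hq, pow_mul], sum_pow_char_pow]
          refine Finset.sum_congr rfl fun J _ => ?_
          rw [show p ^ (s * 2) = q ^ 2 by rw [hq, pow_mul]]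
          rw [map_smul, smul_eq_mul, mul_pow, he, Algebra.smul_def, map_mul, mul_pow, hPβ, map_pow,
            map_pow, ← pow_mul, mul_comm (J.1 : ℕ), pow_mul, hPX]
        rw [map_mul, map_pow, mul_pow, ← pow_mul, ← sq, hVT, Finset.mul_sum]
        refine Finset.sum_congr rfl fun J _ => ?_
        rw [map_smul P, smul_eq_mul]
        simp only [v, u]
        rw [map_mul P (_ ^ q), map_pow P, Algebra.smul_def (X ^ (J.1 : ℕ) : k[X]),
            map_mul P, map_pow,
          map_pow]
        ring
      rw [map_sum, hq, sum_pow_char_pow, ← hq]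
      simp only [key]
      rw [← map_zero P, ← hα0, map_sum, Fintype.sum_prod_type_right (f := fun i => P (α i • v i))]
    obtain ⟨h1, h2⟩ := ncard_zeros_le b hF0 S hFS
    refine ⟨h1, h2.trans ?_⟩
    have hFd : CoordDegLE b ((l + c) + q * (m + c + c) + c) (∑ T, u T * V T ^ q) :=
      CoordDegLE.sum _ fun T _ => (hu T).mul hc ((hVd T).pow hc (by omega))
    refine (hFd.natDegree_norm hc).trans ?_
    have e1 : D * l ≤ q := by nlinarith
    have e2 : D * (q * (m + c + c)) ≤ q ^ 2 + q * (D * M) + 2 * c * D * q := by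
      rw [hm]; nlinarith [Nat.mul_le_mul_left q e1]
    have e3 : D * (4 * c) ≤ 4 * c * D * q := by nlinarith [Nat.zero_le (c * D)]
    have e4 : D * l ≤ D * q₀ * q := by
      have : 1 ≤ D * q₀ := Nat.mul_pos hD (by omega)
      nlinarith
    nlinarith

end Stepanov

section FixedPoints

variable {k : Type*} [Field k]

/-- The points of `k` fixed by the `Q`-th power map. -/
noncomputable def fixedPts (k : Type*) [Field k] [DecidableEq k] (Q : ℕ) : Finset k :=
  (X ^ Q - X : k[X]).roots.toFinset

lemma mem_fixedPts [DecidableEq k] {Q : ℕ} (hQ : 1 < Q) {x : k} :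
    x ∈ fixedPts k Q ↔ x ^ Q = x := by
  rw [fixedPts, Multiset.mem_toFinset, mem_roots (FiniteField.X_pow_card_sub_X_ne_zero k hQ)]
  simp [sub_eq_zero]

lemma card_fixedPts [DecidableEq k] [IsAlgClosed k] (p : ℕ) [CharP k p] {Q : ℕ} (hQ : 1 < Q)
    (hpQ : p ∣ Q) : (fixedPts k Q).card = Q := by
  have hsep : (X ^ Q - X : k[X]).Separable := galois_poly_separable p Q hpQ
  rw [fixedPts, Multiset.toFinset_card_of_nodup (Polynomial.nodup_roots hsep),
    ← (IsAlgClosed.splits (X ^ Q - X : k[X])).natDegree_eq_card_roots,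
    FiniteField.X_pow_card_sub_X_natDegree_eq k hQ]

lemma pow_pow_eq_of_dvd {M : Type*} [Monoid M] {a : M} {p n m : ℕ} (h : a ^ p ^ n = a)
    (hnm : n ∣ m) : a ^ p ^ m = a := by
  obtain ⟨c, rfl⟩ := hnm
  induction c with
  | zero => simp
  | succ c ih => rw [mul_add, mul_one, pow_add, pow_mul, ih, h]

/-- Finitely many elements algebraic over `𝔽_p` are fixed by a common power of Frobenius. -/
lemma exists_pow_fixed (p : ℕ) [Fact p.Prime] [Algebra (ZMod p) k]
    [Algebra.IsAlgebraic (ZMod p) k] (A : Finset k) :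
    ∃ r₀, 0 < r₀ ∧ ∀ r, r₀ ∣ r → ∀ a ∈ A, a ^ p ^ r = a := by
  classical
  have key : ∀ a : k, ∃ n, 0 < n ∧ a ^ p ^ n = a := by
    intro a
    have hint : IsIntegral (ZMod p) a := Algebra.IsIntegral.isIntegral a
    have : FiniteDimensional (ZMod p) (IntermediateField.adjoin (ZMod p) {a}) :=
      IntermediateField.adjoin.finiteDimensional hint
    have : Finite (IntermediateField.adjoin (ZMod p) {a}) := Module.finite_of_finite (ZMod p)
    let _ := Fintype.ofFinite (IntermediateField.adjoin (ZMod p) {a})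
    refine ⟨finrank (ZMod p) (IntermediateField.adjoin (ZMod p) {a}), finrank_pos, ?_⟩
    have h := FiniteField.pow_card (IntermediateField.AdjoinSimple.gen (ZMod p) a)
    rw [Module.card_eq_pow_finrank (K := ZMod p), ZMod.card] at h
    have h2 := congrArg (algebraMap (IntermediateField.adjoin (ZMod p) {a}) k) h
    rwa [map_pow, IntermediateField.AdjoinSimple.algebraMap_gen] at h2
  choose n hn0 hn using key
  exact ⟨∏ a ∈ A, n a, Finset.prod_pos fun a _ => hn0 a, fun r hr a ha =>
    pow_pow_eq_of_dvd (hn a) ((Finset.dvd_prod_of_mem n ha).trans hr)⟩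

lemma exists_pow_fixed_coeff (p : ℕ) [Fact p.Prime] [Algebra (ZMod p) k]
    [Algebra.IsAlgebraic (ZMod p) k] {ι : Type*} [Finite ι] (R : ι → k[X][X]) :
    ∃ r₀, 0 < r₀ ∧ ∀ r, r₀ ∣ r → ∀ t i j, ((R t).coeff i).coeff j ^ p ^ r =
        ((R t).coeff i).coeff j := by
  classical
  have := Fintype.ofFinite ι
  obtain ⟨r₀, h0, h⟩ := exists_pow_fixed p
    (Finset.univ.biUnion fun t => (R t).coeffs.biUnion fun c => c.coeffs)
  refine ⟨r₀, h0, fun r hr t i j => ?_⟩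
  have hp : 0 < p := (Fact.out : p.Prime).pos
  rcases eq_or_ne (((R t).coeff i).coeff j) 0 with h1 | h1
  · rw [h1, zero_pow (pow_pos hp _).ne']
  · refine h r hr _ ?_
    have h2 : (R t).coeff i ≠ 0 := by rintro h; simp [h] at h1
    simp only [Finset.mem_biUnion, Finset.mem_univ, true_and]
    exact ⟨t, _, coeff_mem_coeffs h2, coeff_mem_coeffs h1⟩

/-- Evaluation of a bivariate polynomial with Frobenius-fixed coefficients commutes with
Frobenius. -/
lemma eval₂_pow_of_fixed (p : ℕ) [Fact p.Prime] [CharP k p] {r : ℕ} {R : k[X][X]}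
    (hR : ∀ i j, (R.coeff i).coeff j ^ p ^ r = (R.coeff i).coeff j) {x : k}
    (hx : x ^ p ^ r = x) (t : k) :
    (eval₂ (evalRingHom x) t R) ^ p ^ r = eval₂ (evalRingHom x) (t ^ p ^ r) R := by
  have h := hom_eval₂ R (evalRingHom x) (iterateFrobenius k p r) t
  rw [iterateFrobenius_def, iterateFrobenius_def] at h
  rw [h, eval₂_eq_sum, eval₂_eq_sum, Polynomial.sum, Polynomial.sum]
  refine Finset.sum_congr rfl fun i _ => ?_
  congr 1
  rw [RingHom.comp_apply, coe_evalRingHom, iterateFrobenius_def, eval_eq_sum, Polynomial.sum,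
    sum_pow_char_pow]
  refine Finset.sum_congr rfl fun j _ => ?_
  rw [mul_pow, hR, ← pow_mul, mul_comm j, pow_mul, hx]

end FixedPoints

section Galois

variable {k : Type*} [Field k] {B : Type*} [CommRing B] [Algebra k[X] B] [Algebra k B]
  [IsScalarTower k k[X] B]

lemma algHom_algebraMap (P : B →ₐ[k] k) (a : k[X]) :
    P (algebraMap k[X] B a) = eval (P (algebraMap k[X] B X)) a := by
  have h : (P.comp (IsScalarTower.toAlgHom k k[X] B)) = aeval (P (algebraMap k[X] B X)) := by
    ext; simp
  have h2 := DFunLike.congr_fun h a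
  simpa [coe_aeval_eq_eval] using h2

lemma algHom_aeval (P : B →ₐ[k] k) (y : B) (R : k[X][X]) :
    P (aeval y R) = eval₂ (evalRingHom (P (algebraMap k[X] B X))) (P y) R := by
  rw [aeval_def]
  refine (hom_eval₂ R (algebraMap k[X] B) (P : B →+* k) y).trans ?_
  congr 1
  exact RingHom.ext fun a => algHom_algebraMap P a

variable {G : Type*} [Group G] [Fintype G] [MulSemiringAction G B] [SMulCommClass G k[X] B]

omit [Algebra k B] [IsScalarTower k k[X] B] [Fintype G] in
lemma smul_aeval (σ : G) (y : B) (R : k[X][X]) : σ • aeval y R = aeval (σ • y) R :=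
  (aeval_algHom_apply (MulSemiringAction.toAlgHom k[X] B σ) y R).symm

omit [Algebra k B] [IsScalarTower k k[X] B] [Fintype G] in
lemma smul_algebraMap' (σ : G) (a : k[X]) : σ • algebraMap k[X] B a = algebraMap k[X] B a :=
  (MulSemiringAction.toAlgHom k[X] B σ).commutes a

omit [Algebra k B] [IsScalarTower k k[X] B] [Fintype G] [SMulCommClass G k[X] B] in
lemma exists_map_eq_of_invariant [Algebra.IsInvariant k[X] B G] (R : B[X])
    (hR : ∀ σ : G, ∀ i, σ • R.coeff i = R.coeff i) :
    ∃ R₀ : k[X][X], R₀.map (algebraMap k[X] B) = R := by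
  have h : ∀ i, ∃ a, algebraMap k[X] B a = R.coeff i := fun i =>
    Algebra.IsInvariant.isInvariant (G := G) _ fun σ => hR σ i
  rw [← mem_lifts]
  rw [lifts_iff_coeff_lifts]
  exact fun i => h i

/-- Some element has pairwise distinct conjugates. -/
lemma exists_primitive [IsDomain B] [Infinite k] [FaithfulSMul G B] :
    ∃ ξ : B, ∀ σ τ : G, σ • ξ = τ • ξ → σ = τ := by
  classical
  let W : G → Subspace k B := fun σ =>
    { carrier := {x | σ • x = x}
      add_mem' := fun {a b} ha hb => by
        simp only [Set.mem_ofPred_eq] at *; rw [smul_add, ha, hb]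
      zero_mem' := smul_zero σ
      smul_mem' := fun c x hx => by
        simp only [Set.mem_ofPred_eq] at *
        rw [← algebraMap_smul k[X] c x, smul_comm, hx] }
  have hW : ⊤ ∉ (Finset.univ.erase (1 : G)).image W := by
    simp only [Finset.mem_image, Finset.mem_erase, Finset.mem_univ, and_true, not_exists, not_and]
    intro σ hσ h
    refine hσ (FaithfulSMul.eq_of_smul_eq_smul (α := B) fun x => ?_)
    have : x ∈ W σ := by rw [h]; trivial
    rw [one_smul]; exact this
  have h := Subspace.biUnion_ne_univ_of_top_notMem hW
  obtain ⟨ξ, hξ⟩ := (Set.ne_univ_iff_exists_notMem _).1 h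
  refine ⟨ξ, fun σ τ hστ => ?_⟩
  by_contra hne
  refine hξ (Set.mem_biUnion (x := W (τ⁻¹ * σ)) ?_ ?_)
  · refine Finset.mem_coe.2 (Finset.mem_image_of_mem _ ?_)
    simp only [Finset.mem_erase, Finset.mem_univ, and_true, ne_eq, inv_mul_eq_one]
    exact fun h => hne h.symm
  · change (τ⁻¹ * σ) • ξ = ξ
    rw [mul_smul, hστ, inv_smul_smul]

omit [Algebra k B] [IsScalarTower k k[X] B] [SMulCommClass G k[X] B] in
open Classical in
/-- Lagrange-type interpolation through the conjugates of `ξ`. -/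
lemma exists_lagrange [Algebra.IsInvariant k[X] B G] (ξ ω : B) :
    ∃ R : k[X][X], ∀ σ : G, aeval (σ • ξ) R =
      σ • ω * ∏ τ ∈ Finset.univ.erase σ, (σ • ξ - τ • ξ) := by
  obtain ⟨R, hR⟩ := exists_map_eq_of_invariant (k := k) (G := G)
    (∑ σ : G, C (σ • ω) * ∏ τ ∈ Finset.univ.erase σ, (X - C (τ • ξ))) (by
      intro ρ i
      have hmap : ∀ F : B[X], ρ • F.coeff i =
          (F.map (MulSemiringAction.toRingHom G B ρ)).coeff i := fun F => by
        rw [coeff_map]; rfl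
      rw [hmap]
      congr 1
      rw [Polynomial.map_sum]
      refine Fintype.sum_equiv (Equiv.mulLeft ρ) _ _ fun σ => ?_
      rw [Polynomial.map_mul, Polynomial.map_prod, map_C]
      congr 1
      · simp [mul_smul]
      · refine Finset.prod_bij (fun τ _ => ρ * τ) ?_ ?_ ?_ ?_
        · intro τ hτ; simpa using hτ
        · intro a _ b _ h; simpa using h
        · intro b hb
          refine ⟨ρ⁻¹ * b, ?_, by simp⟩
          simp only [Finset.mem_erase, Finset.mem_univ, and_true, Equiv.coe_mulLeft] at hb ⊢
          rintro rfl; simp at hb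
        · intro τ _; simp [mul_smul])
  refine ⟨R, fun σ => ?_⟩
  rw [aeval_def, ← eval_map, hR, eval_finsetSum, Finset.sum_eq_single σ]
  · simp [eval_mul, eval_prod]
  · intro b _ hb
    rw [eval_mul, eval_prod, Finset.prod_eq_zero (i := σ), mul_zero]
    · simpa using hb.symm
    · simp
  · simp

omit [Algebra k B] [IsScalarTower k k[X] B] [SMulCommClass G k[X] B] in
open Classical in
/-- The characteristic polynomial of `ξ` under the group. -/
lemma exists_galois_charpoly [Algebra.IsInvariant k[X] B G] (ξ : B) :
    ∃ R : k[X][X], R.map (algebraMap k[X] B) = ∏ σ : G, (X - C (σ • ξ)) := by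
  refine exists_map_eq_of_invariant (k := k) (G := G) _ fun ρ i => ?_
  have hmap : ∀ F : B[X], ρ • F.coeff i =
      (F.map (MulSemiringAction.toRingHom G B ρ)).coeff i := fun F => by
    rw [coeff_map]; rfl
  rw [hmap, Polynomial.map_prod]
  congr 1
  exact Fintype.prod_equiv (Equiv.mulLeft ρ) _ _ fun σ => by simp [mul_smul]


/-- The points outside a finite bad set carry a Frobenius element, and their fibres are regular
`G`-orbits. -/
lemma exists_frobenius [IsDomain B] [FaithfulSMul G B] [Algebra.IsInvariant k[X] B G]
    [Infinite k] (p : ℕ) [Fact p.Prime] [CharP k p] [Algebra (ZMod p) k]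
    [Algebra.IsAlgebraic (ZMod p) k] [Algebra.IsIntegral k[X] B]
    {ι : Type*} [Finite ι] (ω : ι → B) (Z₁ : Finset k) :
    ∃ r₀, 0 < r₀ ∧ ∃ Z : Finset k, Z₁ ⊆ Z ∧ ∃ ξ : B,
      (∀ P : B →ₐ[k] k, P (algebraMap k[X] B X) ∉ Z → ∀ σ τ : G, P (σ • ξ) = P (τ • ξ) → σ = τ) ∧
      ∀ r, r₀ ∣ r → ∀ P : B →ₐ[k] k, P (algebraMap k[X] B X) ∉ Z →
        P (algebraMap k[X] B X) ^ p ^ r = P (algebraMap k[X] B X) →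
        ∃ σ : G, ∀ i, P (ω i) ^ p ^ r = P (σ • ω i) := by
  classical
  obtain ⟨ξ, hξ⟩ := exists_primitive (k := k) (B := B) (G := G)
  choose A hA using exists_lagrange (k := k) (G := G) ξ
  obtain ⟨Ξ, hΞ⟩ := exists_galois_charpoly (k := k) (G := G) ξ
  obtain ⟨r₀, hr₀, hfix⟩ := exists_pow_fixed_coeff (k := k) p
    (fun t : Option (Option ι) => t.elim Ξ fun u => u.elim (A 1) fun i => A (ω i))
  have hfixΞ := fun r hr => hfix r hr none
  have hfix1 := fun r hr => hfix r hr (some none)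
  have hfixω := fun r hr i => hfix r hr (some (some i))
  simp only [Option.elim] at hfixΞ hfix1 hfixω
  obtain ⟨d, hd⟩ : ∃ d : k[X], algebraMap k[X] B d = ∏ σ : G, aeval (σ • ξ) (A 1) := by
    refine Algebra.IsInvariant.isInvariant (G := G) _ fun ρ => ?_
    rw [Finset.smul_prod']
    refine Fintype.prod_equiv (Equiv.mulLeft ρ) _ _ fun σ => ?_
    rw [smul_aeval, Equiv.coe_mulLeft, mul_smul]
  have hd0 : d ≠ 0 := by
    rintro rfl
    rw [map_zero, eq_comm, Finset.prod_eq_zero_iff] at hd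
    obtain ⟨σ, _, h⟩ := hd
    rw [hA, smul_one, one_mul, Finset.prod_eq_zero_iff] at h
    obtain ⟨τ, hτ, h⟩ := h
    exact (Finset.mem_erase.1 hτ).1 (hξ _ _ (sub_eq_zero.1 h)).symm
  have hne : ∀ P : B →ₐ[k] k, P (algebraMap k[X] B X) ∉ Z₁ ∪ d.roots.toFinset →
      ∀ σ : G, P (aeval (σ • ξ) (A 1)) ≠ 0 := by
    intro P hP σ h
    refine hP (Finset.mem_union_right _ ?_)
    rw [Multiset.mem_toFinset, mem_roots hd0, IsRoot, ← algHom_algebraMap P, hd, map_prod]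
    exact Finset.prod_eq_zero (Finset.mem_univ σ) h
  refine ⟨r₀, hr₀, Z₁ ∪ d.roots.toFinset, Finset.subset_union_left, ξ, ?_, ?_⟩
  · intro P hP σ τ h
    by_contra hστ
    refine hne P hP σ ?_
    rw [hA, map_mul, map_prod, Finset.prod_eq_zero (i := τ), mul_zero]
    · simpa using fun h => hστ h.symm
    · rw [map_sub, h, sub_self]
  · intro r hr P hP hx
    have hpow : ∀ R : k[X][X], (∀ i j, (R.coeff i).coeff j ^ p ^ r = (R.coeff i).coeff j) →
        ∀ σ : G, P ξ ^ p ^ r = P (σ • ξ) →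
        P (aeval ξ R) ^ p ^ r = P (aeval (σ • ξ) R) := by
      intro R hR σ hσ
      rw [algHom_aeval, algHom_aeval, eval₂_pow_of_fixed p hR hx, hσ]
    obtain ⟨σ, hσ⟩ : ∃ σ : G, P ξ ^ p ^ r = P (σ • ξ) := by
      have h0 : aeval ξ Ξ = 0 := by
        rw [aeval_def, ← eval_map, hΞ, eval_prod]
        exact Finset.prod_eq_zero (Finset.mem_univ 1) (by simp)
      have h1 : eval₂ (evalRingHom (P (algebraMap k[X] B X))) (P ξ ^ p ^ r) Ξ = 0 := by
        rw [← eval₂_pow_of_fixed p (hfixΞ r hr) hx, ← algHom_aeval, h0, map_zero,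
          zero_pow (pow_pos (Fact.out : p.Prime).pos _).ne']
      have h2 : evalRingHom (P (algebraMap k[X] B X)) = (P : B →+* k).comp (algebraMap k[X] B) :=
        RingHom.ext fun a => (algHom_algebraMap P a).symm
      rw [h2, ← eval₂_map, hΞ, eval₂_finsetProd, Finset.prod_eq_zero_iff] at h1
      obtain ⟨σ, _, h⟩ := h1
      refine ⟨σ, ?_⟩
      simpa [sub_eq_zero] using h
    refine ⟨σ, fun i => ?_⟩
    have e1 := hpow _ (hfix1 r hr) σ hσ
    have e2 := hpow _ (hfixω r hr i) σ hσ
    have e3 : ∀ (ρ : G) (w : B), aeval (ρ • ξ) (A w) = ρ • w * aeval (ρ • ξ) (A 1) := by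
      intro ρ w; rw [hA, hA, smul_one, one_mul]
    have e4 := e3 1 (ω i)
    rw [one_smul, one_smul] at e4
    rw [e4, e3, map_mul, map_mul, mul_pow, e1] at e2
    exact mul_right_cancel₀ (hne P hP σ) e2

end Galois

section Chebotarev

variable {k : Type*} [Field k] [IsAlgClosed k] [DecidableEq k] {B : Type*} [CommRing B]
  [IsDedekindDomain B] [Algebra k[X] B] [Algebra k B] [IsScalarTower k k[X] B]
  {G : Type*} [Group G] [Fintype G] [MulSemiringAction G B] [SMulCommClass G k[X] B]
  [FaithfulSMul G B] [Algebra.IsInvariant k[X] B G]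

omit [DecidableEq k] [IsDedekindDomain B] in
lemma exists_algHom_over [IsDomain B] [Module.Finite k[X] B] [FaithfulSMul k[X] B] (x : k) :
    ∃ P : B →ₐ[k] k, P (algebraMap k[X] B X) = x := by
  have : Algebra.FiniteType k k[X] := inferInstance
  have : Algebra.FiniteType k[X] B := inferInstance
  have : Algebra.FiniteType k B := Algebra.FiniteType.trans (S := k[X]) ‹_› ‹_›
  have hmax : (Ideal.span {(X - C x : k[X])}).IsMaximal :=
    PrincipalIdealRing.isMaximal_of_irreducible (irreducible_X_sub_C x)
  obtain ⟨M, hM, hcomap⟩ := Ideal.exists_ideal_over_maximal_of_isIntegral (S := B)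
    (Ideal.span {(X - C x : k[X])}) (by
      rw [(RingHom.injective_iff_ker_eq_bot _).1 (FaithfulSMul.algebraMap_injective k[X] B)]
      exact bot_le)
  obtain ⟨P, hP⟩ := exists_algHom_ker_eq (k := k) M hM
  refine ⟨P, ?_⟩
  have h : (X - C x : k[X]) ∈ Ideal.comap (algebraMap k[X] B) M := by
    rw [hcomap]; exact Ideal.mem_span_singleton_self _
  rw [Ideal.mem_comap, ← hP, algHom_algebraMap] at h
  simpa [sub_eq_zero] using h

lemma norm_sum_le_of_sum_eq_zero {G : Type*} [Fintype G] (c : G → ℂ) (hc : ∑ σ, c σ = 0)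
    (N : G → ℝ) {M L e : ℝ} (hN : ∀ σ, N σ ≤ M + e) (hL : Fintype.card G * M ≤ ∑ σ, N σ + L)
    {A : ℝ} (hA : ∀ σ, ‖c σ‖ ≤ A) (hA0 : 0 ≤ A) :
    ‖∑ σ, c σ * (N σ : ℂ)‖ ≤ A * (Fintype.card G * e + L) := by
  have h1 : ∑ σ, c σ * (N σ : ℂ) = ∑ σ, c σ * ((N σ - (M + e) : ℝ) : ℂ) := by
    have : ∑ σ, c σ * ((N σ - (M + e) : ℝ) : ℂ) =
        ∑ σ, c σ * (N σ : ℂ) - (∑ σ, c σ) * ((M + e : ℝ) : ℂ) := by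
      rw [Finset.sum_mul, ← Finset.sum_sub_distrib]
      refine Finset.sum_congr rfl fun σ _ => ?_
      push_cast; ring
    rw [this, hc]; simp
  rw [h1]
  refine (norm_sum_le _ _).trans ?_
  have h2 : ∀ σ, ‖c σ * ((N σ - (M + e) : ℝ) : ℂ)‖ ≤ A * ((M + e) - N σ) := by
    intro σ
    rw [norm_mul, Complex.norm_real, Real.norm_eq_abs, abs_of_nonpos (by linarith [hN σ])]
    have := hN σ
    nlinarith [hA σ]
  refine (Finset.sum_le_sum fun σ _ => h2 σ).trans ?_
  rw [← Finset.mul_sum]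
  refine mul_le_mul_of_nonneg_left ?_ hA0
  rw [Finset.sum_sub_distrib, Finset.sum_const, Finset.card_univ, nsmul_eq_mul]
  linarith

/-- Equidistribution of Frobenius elements with square-root error term. -/
theorem chebotarev_bound (p : ℕ) [Fact p.Prime] [CharP k p] [Algebra (ZMod p) k]
    [Algebra.IsAlgebraic (ZMod p) k] {D : ℕ} (b : Basis (Fin D) k[X] B)
    {ι : Type*} [Finite ι] (ω : ι → B) (Z₁ : Finset k) (c : G → ℂ) (hc : ∑ σ, c σ = 0) :
    ∃ r₀, 0 < r₀ ∧ ∃ Z : Finset k, Z₁ ⊆ Z ∧ ∃ C : ℝ, ∀ s, 0 < s → r₀ ∣ s → ∀ g : k → ℂ,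
      (∀ P : B →ₐ[k] k, ∀ σ : G, P (algebraMap k[X] B X) ∉ Z →
        P (algebraMap k[X] B X) ^ (p ^ s) ^ 2 = P (algebraMap k[X] B X) →
        (∀ i, P (ω i) ^ (p ^ s) ^ 2 = P (σ • ω i)) → g (P (algebraMap k[X] B X)) = c σ) →
      ‖∑ x ∈ fixedPts k ((p ^ s) ^ 2) \ Z, g x‖ ≤ C * p ^ s := by
  classical
  have hp : p.Prime := Fact.out
  have hfin : Module.Finite k[X] B := Module.Finite.of_basis b
  have hfree : Module.Free k[X] B := Module.Free.of_basis b
  have : Infinite k := IsAlgClosed.instInfinite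
  obtain ⟨r₀, hr₀, Z, hZ, ξ, hξ, hFr⟩ := exists_frobenius (k := k) (B := B) (G := G) p
    (Sum.elim ω b) Z₁
  choose P₀ hP₀ using exists_algHom_over (k := k) (B := B)
  choose S hS using fun σ : G => stepanov_bound p b b b.linearIndependent
    (MulSemiringAction.toAlgHom k[X] B σ)
  obtain ⟨A, hA0, hA⟩ : ∃ A : ℝ, 0 ≤ A ∧ ∀ σ, ‖c σ‖ ≤ A :=
    ⟨∑ σ, ‖c σ‖, by positivity, fun σ =>
      Finset.single_le_sum (f := fun σ => ‖c σ‖) (fun _ _ => norm_nonneg _) (Finset.mem_univ σ)⟩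
  refine ⟨r₀, hr₀, Z, hZ, A * (Fintype.card G * (∑ σ, S σ : ℕ) + Fintype.card G * Z.card), ?_⟩
  intro s hs hrs g hg
  have hp1 : 1 < p ^ s := Nat.one_lt_pow hs.ne' hp.one_lt
  obtain ⟨Q, hQ⟩ : ∃ Q, Q = (p ^ s) ^ 2 := ⟨_, rfl⟩
  have hQ' : Q = p ^ (s * 2) := by rw [hQ, pow_mul]
  have hQ1 : 1 < Q := by rw [hQ]; exact Nat.one_lt_pow (by norm_num) hp1
  let ρ : G → B →ₐ[k] B := fun σ => (MulSemiringAction.toAlgHom k[X] B σ).restrictScalars k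
  let Pt : k × G → (B →ₐ[k] k) := fun y => (P₀ y.1).comp (ρ y.2)
  have hPt : ∀ y w, Pt y w = P₀ y.1 (y.2 • w) := fun y w => rfl
  have hPtX : ∀ y, Pt y (algebraMap k[X] B X) = y.1 := by
    intro y; rw [hPt, smul_algebraMap', hP₀]
  have hFr' : ∀ y : k × G, ∃ σ : G, y.1 ∈ fixedPts k Q \ Z →
      ∀ i, Pt y (Sum.elim ω b i) ^ Q = Pt y (σ • Sum.elim ω b i) := by
    intro y
    by_cases hy : y.1 ∈ fixedPts k Q \ Z
    · rw [Finset.mem_sdiff, mem_fixedPts hQ1] at hy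
      obtain ⟨σ, hσ⟩ := hFr (s * 2) (hrs.mul_right _) (Pt y) (by rw [hPtX]; exact hy.2)
        (by rw [hPtX, ← hQ']; exact hy.1)
      exact ⟨σ, fun _ i => by rw [hQ']; exact hσ i⟩
    · exact ⟨1, fun h => absurd h hy⟩
  choose Fr hFr using hFr'
  obtain ⟨Y, hY⟩ : ∃ Y, Y = (fixedPts k Q \ Z) ×ˢ (Finset.univ : Finset G) := ⟨_, rfl⟩
  have hinj : Set.InjOn Pt (Y : Set (k × G)) := by
    rintro ⟨x, σ⟩ hy ⟨x', τ⟩ - h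
    have e1 : x = x' := by
      have := DFunLike.congr_fun h (algebraMap k[X] B X)
      rwa [hPtX, hPtX] at this
    subst e1
    have e2 := DFunLike.congr_fun h ξ
    rw [hPt, hPt] at e2
    have hxZ : x ∉ Z := by
      rw [hY] at hy
      exact (Finset.mem_sdiff.1 (Finset.mem_product.1 (Finset.mem_coe.1 hy)).1).2
    rw [hξ (P₀ x) (by rw [hP₀]; exact hxZ) σ τ e2]
  have hN : ∀ σ : G, ((Y.filter fun y => Fr y = σ).card : ℝ) ≤
      Q + (∑ σ, S σ : ℕ) * (p : ℝ) ^ s := by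
    intro σ
    have h := (hS σ s hs (Pt '' (Y.filter fun y => Fr y = σ : Finset (k × G))) (by
      rintro _ ⟨y, hy, rfl⟩
      rw [Finset.mem_coe, Finset.mem_filter, hY, Finset.mem_product] at hy
      have hy1 := hy.1.1
      refine ⟨?_, fun j => ?_⟩
      · rw [hPtX, ← hQ]
        exact (mem_fixedPts hQ1).1 (Finset.mem_sdiff.1 hy1).1
      · have := hFr y hy1 (Sum.inr j)
        rw [hy.2] at this
        rw [← hQ]; exact this)).2
    rw [Set.InjOn.ncard_image (hinj.mono (by
      intro y hy; exact Finset.mem_coe.2 (Finset.mem_filter.1 (Finset.mem_coe.1 hy)).1)),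
      Set.ncard_coe_finset, ← hQ] at h
    have h2 : S σ ≤ ∑ σ, S σ := Finset.single_le_sum (fun _ _ => Nat.zero_le _) (Finset.mem_univ σ)
    have h3 : (Y.filter fun y => Fr y = σ).card ≤ Q + (∑ σ, S σ) * p ^ s :=
      h.trans (Nat.add_le_add_left (Nat.mul_le_mul_right _ h2) _)
    exact_mod_cast h3
  have hsum : ∑ y ∈ Y, c (Fr y) = ∑ σ, c σ * (((Y.filter fun y => Fr y = σ).card : ℝ) : ℂ) := by
    rw [← Finset.sum_fiberwise_of_maps_to (g := Fr) (t := Finset.univ)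
        (fun _ _ => Finset.mem_univ _)]
    refine Finset.sum_congr rfl fun σ _ => ?_
    rw [Finset.sum_congr rfl (g := fun _ => c σ) (fun y hy => by rw [(Finset.mem_filter.1 hy).2]),
      Finset.sum_const, nsmul_eq_mul, mul_comm]
    simp
  have hgsum : ∑ y ∈ Y, c (Fr y) = Fintype.card G * ∑ x ∈ fixedPts k Q \ Z, g x := by
    rw [hY, Finset.sum_product, Finset.mul_sum]
    refine Finset.sum_congr rfl fun x hx => ?_
    rw [Finset.sum_congr rfl (g := fun _ => g x), Finset.sum_const, Finset.card_univ, nsmul_eq_mul]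
    intro σ _
    have hx' := Finset.mem_sdiff.1 hx
    have := hg (Pt (x, σ)) (Fr (x, σ)) (by rw [hPtX]; exact hx'.2)
      (by rw [hPtX, ← hQ]; exact (mem_fixedPts hQ1).1 hx'.1)
      (fun i => by rw [← hQ]; exact hFr (x, σ) hx (Sum.inl i))
    rw [hPtX] at this
    exact this.symm
  have hcard : (Fintype.card G : ℝ) * Q ≤
      ∑ σ, ((Y.filter fun y => Fr y = σ).card : ℝ) + Fintype.card G * Z.card := by
    have e1 : ∑ σ, (Y.filter fun y => Fr y = σ).card = Y.card :=
      (Finset.card_eq_sum_card_fiberwise (fun _ _ => Finset.mem_univ _)).symm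
    have e2 : Y.card = (fixedPts k Q \ Z).card * Fintype.card G := by
      rw [hY, Finset.card_product, Finset.card_univ]
    have e3 : Q ≤ (fixedPts k Q \ Z).card + Z.card := by
      have := Finset.le_card_sdiff Z (fixedPts k Q)
      rw [card_fixedPts p hQ1 (by rw [hQ']; exact dvd_pow_self p (by omega))] at this
      omega
    have e4 : Fintype.card G * Q ≤ ∑ σ, (Y.filter fun y => Fr y = σ).card + Fintype.card G *
        Z.card := by
      rw [e1, e2]; nlinarith
    exact_mod_cast e4
  have key := norm_sum_le_of_sum_eq_zero c hc _ hN hcard hA hA0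
  rw [← hsum, hgsum, norm_mul, Complex.norm_natCast, hQ] at key
  have hG1 : (1 : ℝ) ≤ Fintype.card G := by exact_mod_cast Fintype.card_pos
  have hps : (1 : ℝ) ≤ (p : ℝ) ^ s := by exact_mod_cast hp1.le
  refine (le_mul_of_one_le_left (norm_nonneg _) hG1).trans (key.trans ?_)
  rw [mul_assoc]
  refine mul_le_mul_of_nonneg_left ?_ hA0
  have : (0 : ℝ) ≤ Fintype.card G * Z.card := by positivity
  nlinarith

end Chebotarev

section ChebotarevGalois

variable {k : Type*} [Field k] [IsAlgClosed k] [DecidableEq k]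

/-- Equidistribution of Frobenius elements in a Galois extension of the rational function field. -/
theorem chebotarev_galois (p : ℕ) [Fact p.Prime] [CharP k p] [Algebra (ZMod p) k]
    [Algebra.IsAlgebraic (ZMod p) k] (K L : Type*) [Field K] [Field L] [Algebra k[X] K]
    [IsFractionRing k[X] K] [Algebra K L] [Algebra k[X] L] [IsScalarTower k[X] K L] [Algebra k L]
    [IsScalarTower k k[X] L] [FiniteDimensional K L] [IsGalois K L]
    {ι : Type*} [Finite ι] (ω : ι → L) (hω : ∀ i, IsIntegral k[X] (ω i)) (Z₁ : Finset k)
    (c : Gal(L/K) → ℂ) (hc : ∑ σ, c σ = 0) :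
    ∃ r₀, 0 < r₀ ∧ ∃ Z : Finset k, Z₁ ⊆ Z ∧ ∃ C : ℝ, ∀ s, 0 < s → r₀ ∣ s → ∀ g : k → ℂ,
      (∀ P : integralClosure k[X] L →ₐ[k] k, ∀ σ : Gal(L/K), P (algebraMap k[X] _ X) ∉ Z →
        P (algebraMap k[X] _ X) ^ (p ^ s) ^ 2 = P (algebraMap k[X] _ X) →
        (∀ i, P ⟨ω i, hω i⟩ ^ (p ^ s) ^ 2 = P ⟨σ (ω i), (hω i).map (σ.restrictScalars k[X])⟩) →
          g (P (algebraMap k[X] _ X)) = c σ) →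
      ‖∑ x ∈ fixedPts k ((p ^ s) ^ 2) \ Z, g x‖ ≤ C * p ^ s := by
  let B := integralClosure k[X] L
  have hdom : IsDedekindDomain B := integralClosure.isDedekindDomain k[X] K L
  have hfin : Module.Finite k[X] B := IsIntegralClosure.finite k[X] K L B
  have hinj : Function.Injective (algebraMap k[X] L) := by
    rw [IsScalarTower.algebraMap_eq k[X] K L]
    exact (algebraMap K L).injective.comp (IsFractionRing.injective k[X] K)
  have : FaithfulSMul k[X] L := (faithfulSMul_iff_algebraMap_injective _ _).2 hinj
  have : Module.IsTorsionFree k[X] L := inferInstance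
  have hfree : Module.Free k[X] B := IsIntegralClosure.module_free k[X] K L B
  have hfrac : IsFractionRing B L := IsIntegralClosure.isFractionRing_of_finite_extension k[X] K L B
  let _ : MulSemiringAction Gal(L/K) B := IsIntegralClosure.MulSemiringAction k[X] K L B
  have hsmul : ∀ (σ : Gal(L/K)) (x : B), ((σ • x : B) : L) = σ (x : L) := fun σ x =>
    algebraMap_galRestrict_apply k[X] σ x
  have hcomm : SMulCommClass Gal(L/K) k[X] B := ⟨fun σ a x => by
    exact map_smul (galRestrict k[X] K L B σ) a x⟩
  have hinv : Algebra.IsInvariant k[X] B Gal(L/K) := Algebra.isInvariant_of_isGalois k[X] K L B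
  have hfaith : FaithfulSMul Gal(L/K) B := ⟨fun {σ τ} h => by
    ext x
    obtain ⟨a, b, hb, rfl⟩ := IsFractionRing.div_surjective (A := B) x
    have e : ∀ y : B, σ (y : L) = τ (y : L) := fun y => by rw [← hsmul, ← hsmul, h]
    rw [map_div₀, map_div₀]
    exact congrArg₂ (· / ·) (e a) (e b)⟩
  obtain ⟨r₀, h0, Z, hZ, C, h⟩ := chebotarev_bound p (B := B) (G := Gal(L/K))
    (Module.finBasis k[X] B) (fun i => ⟨ω i, hω i⟩) Z₁ c hc
  refine ⟨r₀, h0, Z, hZ, C, fun s hs hrs g hg => h s hs hrs g fun P σ hP hx hPω => ?_⟩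
  refine hg P σ hP hx fun i => (hPω i).trans ?_
  congr 1
  exact Subtype.ext (hsmul σ _)

end ChebotarevGalois

section Frobenius

/-- The product of the first `r` Frobenius conjugates. -/
def frobNorm {k : Type*} [CommRing k] (p r : ℕ) (t : k) : k := ∏ i ∈ Finset.range r, t ^ p ^ i

/-- The sum of the first `r` Frobenius conjugates. -/
def frobTrace {k : Type*} [CommRing k] (p r : ℕ) (t : k) : k := ∑ i ∈ Finset.range r, t ^ p ^ i

lemma mul_frobNorm {k : Type*} [CommRing k] {p : ℕ} (hp : 1 ≤ p) {w t : k} (h : w ^ (p - 1) = t)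
    (r : ℕ) : w * frobNorm p r t = w ^ p ^ r := by
  induction r with
  | zero => simp [frobNorm]
  | succ r ih =>
    rw [frobNorm, Finset.prod_range_succ, ← mul_assoc, ← frobNorm, ih, ← h, ← pow_mul, ← pow_add]
    congr 1
    obtain ⟨q, rfl⟩ := Nat.exists_eq_add_of_le hp
    rw [Nat.add_sub_cancel_left, pow_succ]; ring

lemma add_frobTrace {k : Type*} [CommRing k] {p : ℕ} [Fact p.Prime] [CharP k p] {z t : k}
    (h : z ^ p = z + t) (r : ℕ) : z ^ p ^ r = z + frobTrace p r t := by
  induction r with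
  | zero => simp [frobTrace]
  | succ r ih =>
    rw [frobTrace, Finset.sum_range_succ, ← add_assoc, ← frobTrace, ← ih, pow_succ', pow_mul, h,
      add_pow_char_pow]

/-- Transport of a function on `𝔽_p` to the image of `𝔽_p` in `k`. -/
noncomputable def liftFn {p : ℕ} (k : Type*) [Field k] [Algebra (ZMod p) k] (χ : ZMod p → ℂ)
    (a : k) : ℂ := χ (Function.invFun (algebraMap (ZMod p) k) a)

lemma liftFn_algebraMap {p : ℕ} [Fact p.Prime] {k : Type*} [Field k] [Algebra (ZMod p) k]
    (χ : ZMod p → ℂ) (u : ZMod p) : liftFn k χ (algebraMap (ZMod p) k u) = χ u := by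
  rw [liftFn, Function.leftInverse_invFun (algebraMap (ZMod p) k).injective u]

lemma norm_liftFn_le {p : ℕ} {k : Type*} [Field k] [Algebra (ZMod p) k] {χ : ZMod p → ℂ} {A : ℝ}
    (hχ : ∀ u, ‖χ u‖ ≤ A) (a : k) : ‖liftFn k χ a‖ ≤ A := hχ _

lemma exists_zmod_of_pow_eq {p : ℕ} [Fact p.Prime] {F : Type*} [Field F] (ι : ZMod p →+* F)
    {a : F} (ha : a ^ p = a) : ∃ u, ι u = a := by
  have : CharP F p := charP_of_injective_ringHom ι.injective p
  have h := (Subfield.mem_bot_iff_pow_eq_self (F := F) (p := p)).2 ha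
  rw [← ZMod.fieldRange_castHom_eq_bot p] at h
  obtain ⟨u, hu⟩ := h
  exact ⟨u, by rw [← hu]; exact RingHom.congr_fun (RingHom.ext_zmod _ _) u⟩

lemma norm_mulChar_le_one {p : ℕ} [Fact p.Prime] (χ : MulChar (ZMod p) ℂ) (u : ZMod p) :
    ‖χ u‖ ≤ 1 := by
  by_cases h : IsUnit u
  · obtain ⟨v, rfl⟩ := h
    refine (Complex.norm_eq_one_of_pow_eq_one (n := Fintype.card (ZMod p)ˣ) ?_
        Fintype.card_ne_zero).le
    rw [← map_pow, ← Units.val_pow_eq_pow_val, pow_card_eq_one, Units.val_one, map_one]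
  · rw [MulChar.map_nonunit χ h, norm_zero]; exact zero_le_one

lemma norm_addChar_eq_one {p : ℕ} [Fact p.Prime] (ψ : AddChar (ZMod p) ℂ) (u : ZMod p) :
    ‖ψ u‖ = 1 := by
  refine Complex.norm_eq_one_of_pow_eq_one (n := p) ?_ (Fact.out : p.Prime).ne_zero
  rw [← AddChar.map_nsmul_eq_pow]; simp

lemma addChar_pow_char {p : ℕ} [Fact p.Prime] (ψ : AddChar (ZMod p) ℂ) (u : ZMod p) :
    ψ u ^ p = 1 := by
  rw [← AddChar.map_nsmul_eq_pow]; simp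

end Frobenius

section Extension

lemma isGalois_splittingField_mul {K : Type*} [Field K] {Φ₁ Φ₂ : K[X]} (h₁ : Φ₁.Separable)
    (h₂ : Φ₂.Separable) : IsGalois K (Φ₁ * Φ₂).SplittingField := by
  have hne : Φ₁ * Φ₂ ≠ 0 := mul_ne_zero h₁.ne_zero h₂.ne_zero
  have hsep : Algebra.IsSeparable K (Φ₁ * Φ₂).SplittingField := by
    have h : Algebra.IsSeparable K
        (IntermediateField.adjoin K ((Φ₁ * Φ₂).rootSet (Φ₁ * Φ₂).SplittingField)) := by
      rw [IntermediateField.isSeparable_adjoin_iff_isSeparable]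
      intro x hx
      rw [mem_rootSet, map_mul, mul_eq_zero] at hx
      rcases hx.2 with h | h
      · exact h₁.of_dvd (minpoly.dvd K x h)
      · exact h₂.of_dvd (minpoly.dvd K x h)
    have htop : IntermediateField.adjoin K ((Φ₁ * Φ₂).rootSet (Φ₁ * Φ₂).SplittingField) = ⊤ := by
      have := IsSplittingField.adjoin_rootSet (Φ₁ * Φ₂).SplittingField (Φ₁ * Φ₂)
      rw [← IntermediateField.toSubalgebra_inj, IntermediateField.top_toSubalgebra, ← this]
      refine IntermediateField.adjoin_toSubalgebra_of_isAlgebraic fun x hx => ?_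
      exact Algebra.IsAlgebraic.isAlgebraic x
    rw [htop] at h
    exact AlgEquiv.Algebra.isSeparable IntermediateField.topEquiv
  have : Normal K (Φ₁ * Φ₂).SplittingField := Normal.of_isSplittingField (Φ₁ * Φ₂)
  exact { }

lemma separable_artinSchreier {K : Type*} [Field K] (p : ℕ) [Fact p.Prime] [CharP K p] (a : K) :
    (X ^ p - X - C a : K[X]).Separable := by
  have h : derivative (X ^ p - X - C a : K[X]) = -1 := by
    simp [derivative_X_pow]
  rw [separable_def, h]
  exact isCoprime_one_right.neg_right

end Extension

section SplittingField

lemma norm_sum_le_add_card {k : Type*} [DecidableEq k] (S Z : Finset k) (g : k → ℂ) {A : ℝ}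
    (hA : 0 ≤ A) (hg : ∀ x, ‖g x‖ ≤ A) : ‖∑ x ∈ S, g x‖ ≤ ‖∑ x ∈ S \ Z, g x‖ + Z.card * A := by
  rw [← Finset.sum_inter_add_sum_sdiff S Z, add_comm]
  refine (norm_add_le _ _).trans (add_le_add_right ?_ _)
  refine (norm_sum_le_of_le _ fun x _ => hg x).trans ?_
  rw [Finset.sum_const, nsmul_eq_mul]
  gcongr
  exact Finset.inter_subset_right

/-- The compositum of the splitting fields of two separable polynomials is a Galois extension. -/
lemma forall_of_galois.{u} {k : Type u} [Field k] {Φ₁ Φ₂ : (RatFunc k)[X]}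
    (h₁ : Φ₁.Separable) (h₂ : Φ₂.Separable) {R : Prop}
    (h : ∀ (L : Type u) [Field L] [Algebra (RatFunc k) L] [Algebra k[X] L]
      [IsScalarTower k[X] (RatFunc k) L] [FiniteDimensional (RatFunc k) L]
      [IsGalois (RatFunc k) L] [Algebra k L] [IsScalarTower k k[X] L],
      (Φ₁.map (algebraMap (RatFunc k) L)).Splits → (Φ₂.map (algebraMap (RatFunc k) L)).Splits → R) :
    R := by
  have hgal := isGalois_splittingField_mul h₁ h₂
  have htower : IsScalarTower k k[X] (Φ₁ * Φ₂).SplittingField := IsScalarTower.of_algebraMap_eq' (by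
    rw [IsScalarTower.algebraMap_eq k (RatFunc k), IsScalarTower.algebraMap_eq k[X] (RatFunc k),
      RingHom.comp_assoc, ← IsScalarTower.algebraMap_eq k k[X] (RatFunc k)])
  have hsplit : ((Φ₁ * Φ₂).map (algebraMap (RatFunc k) (Φ₁ * Φ₂).SplittingField)).Splits :=
    SplittingField.splits _
  rw [Polynomial.map_mul] at hsplit
  have hinj := (algebraMap (RatFunc k) (Φ₁ * Φ₂).SplittingField).injective
  have hs := (splits_mul ((Polynomial.map_ne_zero_iff hinj).2 h₁.ne_zero)
    ((Polynomial.map_ne_zero_iff hinj).2 h₂.ne_zero)).1 hsplit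
  exact h _ hs.1 hs.2

lemma exists_artinSchreier_root {k : Type*} [Field k] {p : ℕ} (hp : 1 < p) {L : Type*} [Field L]
    [Algebra (RatFunc k) L] [Algebra k[X] L] [IsScalarTower k[X] (RatFunc k) L]
    (h : ((X ^ p - X - C (algebraMap k[X] (RatFunc k) X)).map (algebraMap (RatFunc k) L)).Splits) :
    ∃ z : L, z ^ p = z + algebraMap k[X] L X := by
  obtain ⟨z, hz⟩ := h.exists_eval_eq_zero (by
    have h0 : (X ^ p - X : (RatFunc k)[X]).degree = p := by
      rw [degree_eq_natDegree (FiniteField.X_pow_card_sub_X_ne_zero _ hp),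
        FiniteField.X_pow_card_sub_X_natDegree_eq _ hp]
    have h1 : 0 < (X ^ p - X : (RatFunc k)[X]).degree := by rw [h0]; exact_mod_cast by omega
    rw [degree_map, degree_sub_C h1]; exact h1.ne')
  refine ⟨z, ?_⟩
  simp only [Polynomial.map_sub, Polynomial.map_pow, map_X, map_C, eval_sub, eval_pow, eval_X,
    eval_C, ← IsScalarTower.algebraMap_apply] at hz
  linear_combination hz

end SplittingField

section Kummer

variable {k : Type*} [Field k] [IsAlgClosed k] [DecidableEq k]

omit [IsAlgClosed k] [DecidableEq k] in
lemma sum_mulChar_eq_zero_of_kummer {p : ℕ} [Fact p.Prime] {K L : Type*} [Field K] [Field L]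
    [Algebra k[X] K] [IsFractionRing k[X] K] [Algebra K L] [Algebra k[X] L]
    [IsScalarTower k[X] K L] [FiniteDimensional K L] [IsGalois K L]
    (ι : ZMod p →+* L) {f : k[X]} (hf : f.Separable) (hdeg : f.natDegree ≠ 0) {y : L}
    (hy : y ^ (p - 1) = algebraMap k[X] L f) (χ : MulChar (ZMod p) ℂ) (hχ : χ ≠ 1)
    (ψ : AddChar (ZMod p) ℂ) (a b : Gal(L/K) → ZMod p) (z : L)
    (ha : ∀ σ, σ y = ι (a σ) * y) (hb : ∀ σ, σ z = z + ι (b σ)) :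
    ∑ σ, χ (a σ) * ψ (b σ) = 0 := by
  have hp : p.Prime := Fact.out
  have hinj : Function.Injective (algebraMap k[X] L) := by
    rw [IsScalarTower.algebraMap_eq k[X] K L]
    exact (algebraMap K L).injective.comp (IsFractionRing.injective k[X] K)
  have hf0 : f ≠ 0 := by rintro rfl; simp at hdeg
  have hy0 : y ≠ 0 := by
    rintro rfl
    rw [zero_pow (Nat.sub_ne_zero_of_lt hp.one_lt), eq_comm, map_eq_zero_iff _ hinj] at hy
    exact hf0 hy
  have hσι : ∀ (σ : Gal(L/K)) u, σ (ι u) = ι u := fun σ u =>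
    RingHom.congr_fun (RingHom.ext_zmod ((σ : L →+* L).comp ι) ι) u
  have ha1 : a 1 = 1 := by
    have h := ha 1
    rw [AlgEquiv.one_apply] at h
    refine ι.injective (mul_right_cancel₀ hy0 ?_)
    rw [← h, map_one, one_mul]
  have hamul : ∀ σ τ, a (σ * τ) = a σ * a τ := by
    intro σ τ
    refine ι.injective (mul_right_cancel₀ hy0 ?_)
    rw [← ha, AlgEquiv.mul_apply, ha τ, map_mul, hσι, ha σ, map_mul]; ring
  have hb1 : b 1 = 0 := by
    have h := hb 1
    rw [AlgEquiv.one_apply] at h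
    refine ι.injective ?_
    rw [map_zero]; linear_combination -h
  have hbadd : ∀ σ τ, b (σ * τ) = b σ + b τ := by
    intro σ τ
    refine ι.injective ?_
    have h := hb (σ * τ)
    rw [AlgEquiv.mul_apply, hb τ, map_add, hσι, hb σ] at h
    rw [map_add]; linear_combination -h
  have ha0 : ∀ σ, a σ ≠ 0 := by
    intro σ h
    have := hamul σ σ⁻¹
    rw [mul_inv_cancel, ha1, h, zero_mul] at this
    exact one_ne_zero this
  let c : Gal(L/K) →* ℂ :=
    { toFun := fun σ => χ (a σ) * ψ (b σ)
      map_one' := by rw [ha1, hb1, map_one, AddChar.map_zero_eq_one, one_mul]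
      map_mul' := fun σ τ => by rw [hamul, hbadd, map_mul, AddChar.map_add_eq_mul]; ring }
  refine sum_hom_units_eq_zero c fun hc => ?_
  have hχa : ∀ σ, χ (a σ) = 1 := by
    intro σ
    have h : χ (a σ) * ψ (b σ) = 1 := DFunLike.congr_fun hc σ
    have h2 := congrArg (· ^ p) h
    simp only [mul_pow, addChar_pow_char, mul_one, one_pow] at h2
    rwa [← map_pow, ZMod.pow_card] at h2
  obtain ⟨H, hH⟩ : ∃ H : Subgroup (ZMod p)ˣ, H = χ.toUnitHom.ker := ⟨_, rfl⟩
  have hHtop : H ≠ ⊤ := by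
    intro h
    obtain ⟨u, hu⟩ := MulChar.ne_one_iff.1 hχ
    have : u ∈ H := h ▸ Subgroup.mem_top u
    rw [hH, MonoidHom.mem_ker] at this
    exact hu (by rw [← MulChar.coe_toUnitHom, this, Units.val_one])
  have hcardG : Nat.card (ZMod p)ˣ = p - 1 := by
    rw [Nat.card_eq_fintype_card, ZMod.card_units_eq_totient, Nat.totient_prime hp]
  obtain ⟨m, hm⟩ : Nat.card H ∣ p - 1 := hcardG ▸ Subgroup.card_subgroup_dvd_card H
  have hm1 : m ≠ 1 := by
    rintro rfl
    rw [mul_one] at hm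
    exact hHtop (Subgroup.eq_top_of_card_eq H (by rw [hcardG, ← hm]))
  have hm0 : m ≠ 0 := by
    rintro rfl
    have := hp.two_le
    omega
  have hah : ∀ σ, a σ ^ Nat.card H = 1 := by
    intro σ
    have hmem : Units.mk0 (a σ) (ha0 σ) ∈ H := by
      rw [hH, MonoidHom.mem_ker]
      ext
      rw [MulChar.coe_toUnitHom, Units.val_mk0, hχa, Units.val_one]
    have h := pow_card_eq_one' (x := (⟨_, hmem⟩ : H))
    have h2 := congrArg (fun x : H => ((x : (ZMod p)ˣ) : ZMod p)) h
    simpa only [SubmonoidClass.coe_pow, Units.val_pow_eq_pow_val, Units.val_mk0,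
      OneMemClass.coe_one, Units.val_one] using h2
  obtain ⟨u, hu⟩ : ∃ u : K, algebraMap K L u = y ^ Nat.card H := by
    have := (IsGalois.mem_bot_iff_fixed (F := K) (y ^ Nat.card H)).2 fun σ => by
      rw [map_pow, ha, mul_pow, ← map_pow, hah, map_one, one_mul]
    exact IntermediateField.mem_bot.1 this
  have hum : u ^ m = algebraMap k[X] K f := by
    refine (algebraMap K L).injective ?_
    rw [map_pow, hu, ← pow_mul, ← hm, hy, ← IsScalarTower.algebraMap_apply]
  have huint : IsIntegral k[X] u := by
    refine IsIntegral.of_pow (Nat.pos_of_ne_zero hm0) ?_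
    rw [hum]; exact isIntegral_algebraMap
  obtain ⟨v, rfl⟩ := IsIntegrallyClosed.isIntegral_iff.1 huint
  rw [← map_pow] at hum
  have hv : v ^ m = f := IsFractionRing.injective k[X] K hum
  have hvv : v * v ∣ f := by
    rw [← hv, ← sq]; exact pow_dvd_pow v (by omega)
  have hvu : IsUnit v := hf.squarefree v hvv
  exact hdeg (natDegree_eq_zero_of_isUnit (hv ▸ hvu.pow m))

omit [IsAlgClosed k] [DecidableEq k] in
lemma isIntegral_artinSchreier {L : Type*} [Field L] [Algebra k[X] L] {p : ℕ} (hp : 1 < p) {z : L}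
    (hz : z ^ p = z + algebraMap k[X] L X) : IsIntegral k[X] z := by
  refine ⟨X ^ p - (X + C X), monic_X_pow_sub ?_, ?_⟩
  · refine (degree_add_le _ _).trans_lt (max_lt ?_
        (degree_C_le.trans_lt (by exact_mod_cast by omega)))
    rw [degree_X]; exact_mod_cast hp
  · rw [← aeval_def]; simp [hz]

lemma mixed_sum_bound_aux (p : ℕ) [Fact p.Prime] [CharP k p] [Algebra (ZMod p) k]
    [Algebra.IsAlgebraic (ZMod p) k] {K L : Type*} [Field K] [Field L]
    [Algebra k[X] K] [IsFractionRing k[X] K] [Algebra K L] [Algebra k[X] L]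
    [IsScalarTower k[X] K L] [FiniteDimensional K L] [IsGalois K L] [Algebra k L]
    [IsScalarTower k k[X] L] {f : k[X]} (hf : f.Separable) (hdeg : f.natDegree ≠ 0)
    {y z : L} (hy : y ^ (p - 1) = algebraMap k[X] L f) (hz : z ^ p = z + algebraMap k[X] L X)
    (χ : MulChar (ZMod p) ℂ) (hχ : χ ≠ 1) (ψ : AddChar (ZMod p) ℂ) :
    ∃ r₀, 0 < r₀ ∧ ∃ C : ℝ, ∀ s, 0 < s → r₀ ∣ s →
      ‖∑ x ∈ fixedPts k ((p ^ s) ^ 2), liftFn k χ (frobNorm p (s * 2) (eval x f)) *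
        liftFn k ψ (frobTrace p (s * 2) x)‖ ≤ C * p ^ s := by
  have hp : p.Prime := Fact.out
  have hp1 : p - 1 ≠ 0 := Nat.sub_ne_zero_of_lt hp.one_lt
  have hpp : p - 1 + 1 = p := Nat.sub_add_cancel hp.one_le
  have hf0 : f ≠ 0 := by rintro rfl; simp at hdeg
  have hyint : IsIntegral k[X] y :=
    IsIntegral.of_pow (Nat.pos_of_ne_zero hp1) (hy ▸ isIntegral_algebraMap)
  have hzint : IsIntegral k[X] z := isIntegral_artinSchreier hp.one_lt hz
  let ι : ZMod p →+* L := (algebraMap k L).comp (algebraMap (ZMod p) k)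
  have : CharP L p := charP_of_injective_algebraMap (algebraMap k L).injective p
  have hinj : Function.Injective (algebraMap k[X] L) := by
    rw [IsScalarTower.algebraMap_eq k[X] K L]
    exact (algebraMap K L).injective.comp (IsFractionRing.injective k[X] K)
  have hy0 : y ≠ 0 := by
    rintro rfl
    rw [zero_pow hp1, eq_comm, map_eq_zero_iff _ hinj] at hy
    exact hf0 hy
  have hσ : ∀ (σ : Gal(L/K)) (q : k[X]), σ (algebraMap k[X] L q) = algebraMap k[X] L q :=
    fun σ q => (σ.restrictScalars k[X]).commutes q
  have ha : ∀ σ : Gal(L/K), ∃ u : ZMod p, σ y = ι u * y := by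
    intro σ
    obtain ⟨u, hu⟩ := exists_zmod_of_pow_eq ι (a := σ y / y) (by
      have h1 : (σ y / y) ^ (p - 1) = 1 := by
        rw [div_pow, ← map_pow, hy, hσ, ← hy, div_self (pow_ne_zero _ hy0)]
      rw [← hpp, pow_succ, h1, one_mul])
    exact ⟨u, by rw [hu, div_mul_cancel₀ _ hy0]⟩
  have hb : ∀ σ : Gal(L/K), ∃ u : ZMod p, σ z = z + ι u := by
    intro σ
    obtain ⟨u, hu⟩ := exists_zmod_of_pow_eq ι (a := σ z - z) (by
      rw [sub_pow_char, ← map_pow, hz, map_add, hσ]; ring)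
    exact ⟨u, by rw [hu]; ring⟩
  choose a ha using ha
  choose b hb using hb
  have hc := sum_mulChar_eq_zero_of_kummer ι hf hdeg hy χ hχ ψ a b z ha hb
  obtain ⟨r₀, hr₀, Z, hZ, C, h⟩ := chebotarev_galois p K L ![y, z]
    (by intro i; fin_cases i; exacts [hyint, hzint]) f.roots.toFinset _ hc
  refine ⟨r₀, hr₀, C + Z.card, fun s hs hrs => ?_⟩
  obtain ⟨g, hg⟩ : ∃ g : k → ℂ, g = fun x => liftFn k χ (frobNorm p (s * 2) (eval x f)) *
        liftFn k ψ (frobTrace p (s * 2) x) := ⟨_, rfl⟩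
  have hg1 : ∀ x, ‖g x‖ ≤ 1 := by
    intro x
    rw [hg, norm_mul]
    exact mul_le_one₀ (norm_liftFn_le (norm_mulChar_le_one χ) _) (norm_nonneg _)
      (norm_liftFn_le (fun u => (norm_addChar_eq_one ψ u).le) _)
  have hmain := h s hs hrs g (by
    intro P σ hPZ hPX hPω
    have hPy : P ⟨y, hyint⟩ ^ (p ^ s) ^ 2 = P ⟨σ y, _⟩ := hPω 0
    have hPz : P ⟨z, hzint⟩ ^ (p ^ s) ^ 2 = P ⟨σ z, _⟩ := hPω 1
    have hQ : (p ^ s) ^ 2 = p ^ (s * 2) := (pow_mul _ _ _).symm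
    have hPι : ∀ u, P (algebraMap k _ (algebraMap (ZMod p) k u)) = algebraMap (ZMod p) k u :=
      fun u => P.commutes _
    have hy1 : P ⟨y, hyint⟩ ^ (p - 1) = eval (P (algebraMap k[X] _ X)) f := by
      rw [← algHom_algebraMap P, ← map_pow]
      exact congrArg P (Subtype.ext hy)
    have hz1 : P ⟨z, hzint⟩ ^ p = P ⟨z, hzint⟩ + P (algebraMap k[X] _ X) := by
      rw [← map_add, ← map_pow]
      exact congrArg P (Subtype.ext hz)
    have hPy0 : P ⟨y, hyint⟩ ≠ 0 := by
      intro h0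
      rw [h0, zero_pow hp1] at hy1
      refine hPZ (hZ ?_)
      rw [Multiset.mem_toFinset, mem_roots hf0]
      exact hy1.symm
    have e1 : frobNorm p (s * 2) (eval (P (algebraMap k[X] _ X)) f) =
        algebraMap (ZMod p) k (a σ) := by
      refine mul_left_cancel₀ hPy0 ?_
      rw [mul_frobNorm hp.one_le hy1, ← hQ, hPy, ← hPι, ← map_mul]
      exact congrArg P (Subtype.ext ((ha σ).trans (mul_comm _ _)))
    have e2 : frobTrace p (s * 2) (P (algebraMap k[X] _ X)) = algebraMap (ZMod p) k (b σ) := by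
      refine add_left_cancel (a := P ⟨z, hzint⟩) ?_
      rw [← add_frobTrace hz1, ← hQ, hPz, ← hPι, ← map_add]
      exact congrArg P (Subtype.ext (hb σ))
    rw [hg]
    simp only [e1, e2, liftFn_algebraMap])
  have hle := norm_sum_le_add_card (fixedPts k ((p ^ s) ^ 2)) Z g zero_le_one hg1
  have hps : (1 : ℝ) ≤ (p : ℝ) ^ s := one_le_pow₀ (by exact_mod_cast hp.one_le)
  simp only [hg] at hle hmain
  nlinarith [Nat.cast_nonneg (α := ℝ) Z.card]

/-- Square-root cancellation over large extensions for mixed character sums. -/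
theorem mixed_sum_bound (p : ℕ) [Fact p.Prime] [CharP k p] [Algebra (ZMod p) k]
    [Algebra.IsAlgebraic (ZMod p) k] {f : k[X]} (hf : f.Separable) (hdeg : f.natDegree ≠ 0)
    (χ : MulChar (ZMod p) ℂ) (hχ : χ ≠ 1) (ψ : AddChar (ZMod p) ℂ) :
    ∃ r₀, 0 < r₀ ∧ ∃ C : ℝ, ∀ s, 0 < s → r₀ ∣ s →
      ‖∑ x ∈ fixedPts k ((p ^ s) ^ 2), liftFn k χ (frobNorm p (s * 2) (eval x f)) *
        liftFn k ψ (frobTrace p (s * 2) x)‖ ≤ C * p ^ s := by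
  have hp : p.Prime := Fact.out
  have hf0 : f ≠ 0 := by rintro rfl; simp at hdeg
  have hp1 : p - 1 ≠ 0 := Nat.sub_ne_zero_of_lt hp.one_lt
  have hsep₁ : (X ^ (p - 1) - C (algebraMap k[X] (RatFunc k) f)).Separable := by
    refine separable_X_pow_sub_C _ ?_ ?_
    · have : CharP (RatFunc k) p := charP_of_injective_algebraMap
          (algebraMap k (RatFunc k)).injective p
      rw [Nat.cast_sub hp.one_le, CharP.cast_eq_zero]; simp
    · rw [ne_eq, map_eq_zero_iff _ (IsFractionRing.injective k[X] (RatFunc k))]; exact hf0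
  have : CharP (RatFunc k) p := charP_of_injective_algebraMap (algebraMap k (RatFunc k)).injective p
  refine forall_of_galois hsep₁ (separable_artinSchreier p (algebraMap k[X] (RatFunc k) X)) ?_
  intro L _ _ _ _ _ _ _ _ hs₁ hs₂
  obtain ⟨z, hz⟩ := exists_artinSchreier_root hp.one_lt hs₂
  obtain ⟨y, hy⟩ := hs₁.exists_eval_eq_zero (by
    rw [degree_map, degree_X_pow_sub_C (Nat.pos_of_ne_zero hp1)]; exact_mod_cast hp1)
  simp only [Polynomial.map_sub, Polynomial.map_pow, map_X, map_C, eval_sub, eval_pow, eval_X,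
    eval_C, ← IsScalarTower.algebraMap_apply k[X] (RatFunc k) L] at hy
  exact mixed_sum_bound_aux p (K := RatFunc k) hf hdeg (sub_eq_zero.1 hy) hz χ hχ ψ

end Kummer

section ArtinSchreier

variable {k : Type*} [Field k]

lemma not_isFixed_artinSchreier {p : ℕ} (hp : 1 < p) {K L : Type*} [Field K] [Field L]
    [Algebra k[X] K] [IsFractionRing k[X] K] [Algebra K L] [Algebra k[X] L]
    [IsScalarTower k[X] K L] [FiniteDimensional K L] [IsGalois K L] {z : L}
    (hz : z ^ p = z + algebraMap k[X] L X) : ∃ σ : Gal(L/K), σ z ≠ z := by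
  by_contra! h
  obtain ⟨u, hu⟩ := IntermediateField.mem_bot.1 ((IsGalois.mem_bot_iff_fixed (F := K) z).2 h)
  have hzint : IsIntegral k[X] z := isIntegral_artinSchreier hp hz
  rw [← hu] at hzint
  have huint : IsIntegral k[X] u :=
    (isIntegral_algHom_iff (IsScalarTower.toAlgHom k[X] K L) (algebraMap K L).injective).1 hzint
  obtain ⟨v, rfl⟩ := IsIntegrallyClosed.isIntegral_iff.1 huint
  have hv : v ^ p = v + X := by
    refine IsFractionRing.injective k[X] K ((algebraMap K L).injective ?_)
    rw [map_pow, map_pow, hu, hz, map_add, map_add, hu, ← IsScalarTower.algebraMap_apply]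
  have h1 : v.natDegree ≠ 0 := by
    intro h0
    obtain ⟨c, rfl⟩ := natDegree_eq_zero.1 h0
    have := congrArg (fun q => q.coeff 1) hv
    rw [← C_pow, coeff_C_of_ne_zero one_ne_zero, coeff_add, coeff_C_of_ne_zero one_ne_zero,
        coeff_X_one,
      zero_add] at this
    exact zero_ne_one this
  have h2 := congrArg natDegree hv
  rw [natDegree_pow] at h2
  have h3 : (v + X).natDegree ≤ v.natDegree :=
    (natDegree_add_le _ _).trans (max_le le_rfl (by rw [natDegree_X]; omega))
  nlinarith [Nat.pos_of_ne_zero h1]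

lemma artinSchreier_iterate {p : ℕ} [Fact p.Prime] {L : Type*} [Field L] (ι : ZMod p →+* L)
    {G : Type*} [Group G] [MulSemiringAction G L] (hι : ∀ (σ : G) u, σ • ι u = ι u) {z : L}
    {σ : G} {u : ZMod p} (h : σ • z = z + ι u) (n : ℕ) : σ ^ n • z = z + ι (n * u) := by
  induction n with
  | zero => simp
  | succ n ih =>
    rw [pow_succ', mul_smul, ih, smul_add, hι, h, add_assoc, ← map_add]
    congr 2
    push_cast
    ring

lemma exists_artinSchreier_ne_of_fixes {p : ℕ} [Fact p.Prime] {K L : Type*} [Field K] [Field L]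
    [Algebra k[X] K] [IsFractionRing k[X] K] [Algebra K L] [Algebra k[X] L]
    [IsScalarTower k[X] K L] [FiniteDimensional K L] [IsGalois K L]
    (ι : ZMod p →+* L) {z : L} (hz : z ^ p = z + algebraMap k[X] L X) (b : Gal(L/K) → ZMod p)
    (hb : ∀ σ, σ z = z + ι (b σ)) {w : L} (hw : (minpoly K w).natDegree < p) :
    ∃ σ : Gal(L/K), σ w = w ∧ b σ ≠ 0 := by
  by_contra! h
  have hp : p.Prime := Fact.out
  classical
  have hσι : ∀ (σ : Gal(L/K)) u, σ (ι u) = ι u := fun σ u =>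
    RingHom.congr_fun (RingHom.ext_zmod ((σ : L →+* L).comp ι) ι) u
  have hmem : z ∈ IntermediateField.adjoin K {w} := by
    rw [← IsGalois.fixedField_fixingSubgroup (IntermediateField.adjoin K {w})]
    intro σ
    have h1 : σ.1 w = w := σ.2 ⟨w, IntermediateField.mem_adjoin_simple_self K w⟩
    change σ.1 z = z
    rw [hb, h _ h1, map_zero, add_zero]
  have hle : (minpoly K z).natDegree < p := by
    have hfin : finrank K (IntermediateField.adjoin K {w}) = (minpoly K w).natDegree :=
      IntermediateField.adjoin.finrank (Algebra.IsIntegral.isIntegral w)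
    have h1 := minpoly.natDegree_le (A := K) (⟨z, hmem⟩ : IntermediateField.adjoin K {w})
    have h2 : minpoly K (⟨z, hmem⟩ : IntermediateField.adjoin K {w}) = minpoly K z :=
      (minpoly.algebraMap_eq (B' := L) (algebraMap (IntermediateField.adjoin K {w}) L).injective
        ⟨z, hmem⟩).symm
    rw [h2, hfin] at h1
    omega
  obtain ⟨σ, hσ⟩ := not_isFixed_artinSchreier (K := K) hp.one_lt hz
  have hbσ : b σ ≠ 0 := by
    intro h0
    exact hσ (by rw [hb, h0, map_zero, add_zero])
  have hsub : (Finset.univ.image fun u : ZMod p => z + ι u) ⊆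
      ((minpoly K z).aroots L).toFinset := by
    intro y hy
    obtain ⟨u, -, rfl⟩ := Finset.mem_image.1 hy
    rw [Multiset.mem_toFinset, mem_aroots]
    refine ⟨minpoly.ne_zero (Algebra.IsIntegral.isIntegral z), ?_⟩
    obtain ⟨n, hn⟩ := ZMod.natCast_zmod_surjective (u / b σ)
    have h1 := artinSchreier_iterate ι (G := Gal(L/K)) hσι (hb σ) n
    rw [hn, div_mul_cancel₀ _ hbσ] at h1
    rw [← h1, AlgEquiv.smul_def, aeval_algHom_apply, minpoly.aeval, map_zero]
  have h1 := (Finset.card_le_card hsub).trans (Multiset.toFinset_card_le _)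
  rw [Finset.card_image_of_injective _ (fun u v huv => ι.injective (add_left_cancel huv)),
    Finset.card_univ, ZMod.card] at h1
  have h2 := (card_roots' ((minpoly K z).map (algebraMap K L))).trans natDegree_map_le
  rw [aroots_def] at h1
  omega

lemma sum_addChar_eq_zero_of_artinSchreier {p : ℕ} [Fact p.Prime] {K L : Type*} [Field K] [Field L]
    [Algebra k[X] K] [IsFractionRing k[X] K] [Algebra K L] [Algebra k[X] L]
    [IsScalarTower k[X] K L] [FiniteDimensional K L] [IsGalois K L] [DecidableEq L]
    (ι : ZMod p →+* L) {z : L} (hz : z ^ p = z + algebraMap k[X] L X) (b : Gal(L/K) → ZMod p)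
    (hb : ∀ σ, σ z = z + ι (b σ)) {w : L} (hw : (minpoly K w).natDegree < p)
    {ψ : AddChar (ZMod p) ℂ} (hψ : ψ ≠ 1) :
    ∑ σ : Gal(L/K), (if σ w = w then ψ (b σ) else 0) = 0 := by
  have hσι : ∀ (σ : Gal(L/K)) u, σ (ι u) = ι u := fun σ u =>
    RingHom.congr_fun (RingHom.ext_zmod ((σ : L →+* L).comp ι) ι) u
  have hbadd : ∀ σ τ, b (σ * τ) = b σ + b τ := by
    intro σ τ
    refine ι.injective ?_
    have h := hb (σ * τ)
    rw [AlgEquiv.mul_apply, hb τ, map_add, hσι, hb σ] at h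
    rw [map_add]; linear_combination -h
  obtain ⟨σ, hσw, hσ⟩ := exists_artinSchreier_ne_of_fixes ι hz b hb hw
  obtain ⟨u, hu⟩ := AddChar.ne_one_iff.1 hψ
  obtain ⟨n, hn⟩ := ZMod.natCast_zmod_surjective (u / b σ)
  have hτw : (σ ^ n) w = w := by
    clear hn
    induction n with
    | zero => simp
    | succ n ih => rw [pow_succ, AlgEquiv.mul_apply, hσw, ih]
  have hτ : b (σ ^ n) = u := by
    have h1 : (σ ^ n) z = _ := artinSchreier_iterate ι (G := Gal(L/K)) hσι (hb σ) n
    rw [hn, div_mul_cancel₀ _ hσ, hb] at h1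
    exact ι.injective (add_left_cancel h1)
  obtain ⟨S, hS⟩ : ∃ S, S = ∑ σ : Gal(L/K), (if σ w = w then ψ (b σ) else 0) := ⟨_, rfl⟩
  have h2 : S = ψ u * S := by
    conv_lhs => rw [hS]
    rw [← Equiv.sum_comp (Equiv.mulLeft (σ ^ n)), hS, Finset.mul_sum]
    refine Finset.sum_congr rfl fun τ _ => ?_
    rw [Equiv.coe_mulLeft, AlgEquiv.mul_apply, hbadd, hτ, AddChar.map_add_eq_mul]
    have : (σ ^ n) (τ w) = w ↔ τ w = w :=
      ⟨fun h => (σ ^ n).injective (h.trans hτw.symm), fun h => by rw [h, hτw]⟩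
    simp only [this, mul_ite, mul_zero]
  rw [← hS]
  by_contra h0
  exact hu (mul_right_cancel₀ h0 (by rw [one_mul, ← h2]))

end ArtinSchreier

section Curve

variable {k : Type*} [Field k] [IsAlgClosed k] [DecidableEq k]

omit [IsAlgClosed k] in
lemma card_filter_le_natDegree {F : k[X][X]} (hF : F.Monic) (S : Finset k) (x : k) :
    (S.filter fun y => eval y (F.map (evalRingHom x)) = 0).card ≤ F.natDegree := by
  have hm := hF.map (evalRingHom x)
  refine le_trans ?_ ((card_roots' (F.map (evalRingHom x))).trans natDegree_map_le)
  refine le_trans (Finset.card_le_card fun y hy => ?_) (Multiset.toFinset_card_le _)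
  rw [Multiset.mem_toFinset, mem_roots hm.ne_zero]
  exact (Finset.mem_filter.1 hy).2

omit [IsAlgClosed k] [DecidableEq k] in
lemma map_eq_prod_of_algHom {L : Type*} [Field L] [Algebra k[X] L] [Algebra k L]
    [IsScalarTower k k[X] L] {F : k[X][X]} {ι : Type*} [Fintype ι] {ω : ι → L}
    (hω : ∀ i, IsIntegral k[X] (ω i)) (hprod : F.map (algebraMap k[X] L) = ∏ i, (X - C (ω i)))
    (P : integralClosure k[X] L →ₐ[k] k) :
    F.map (evalRingHom (P (algebraMap k[X] _ X))) = ∏ i, (X - C (P ⟨ω i, hω i⟩)) := by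
  have h1 : F.map (algebraMap k[X] (integralClosure k[X] L)) = ∏ i, (X - C ⟨ω i, hω i⟩) := by
    refine map_injective (algebraMap (integralClosure k[X] L) L) Subtype.val_injective ?_
    rw [map_map, ← IsScalarTower.algebraMap_eq, hprod, Polynomial.map_prod]
    simp only [Polynomial.map_sub, map_X, map_C]
    rfl
  have h2 := congrArg (Polynomial.map (P : integralClosure k[X] L →+* k)) h1
  rw [map_map, Polynomial.map_prod] at h2
  simp only [Polynomial.map_sub, map_X, map_C] at h2
  rw [show (evalRingHom (P (algebraMap k[X] _ X)) : k[X] →+* k) =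
    (P : integralClosure k[X] L →+* k).comp (algebraMap k[X] _) from
      RingHom.ext fun q => (algHom_algebraMap P q).symm]
  exact h2

lemma curve_sum_bound_aux (p : ℕ) [Fact p.Prime] [CharP k p] [Algebra (ZMod p) k]
    [Algebra.IsAlgebraic (ZMod p) k] {K L : Type*} [Field K] [Field L]
    [Algebra k[X] K] [IsFractionRing k[X] K] [Algebra K L] [Algebra k[X] L]
    [IsScalarTower k[X] K L] [FiniteDimensional K L] [IsGalois K L] [Algebra k L]
    [IsScalarTower k k[X] L] {F : k[X][X]} (hF : F.Monic) (hdeg : F.natDegree < p)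
    {u v : k[X][X]} {r : k[X]} (hr : r ≠ 0) (huv : u * F + v * derivative F = C r)
    {ι : Type*} [Fintype ι] {ω : ι → L} (hprod : F.map (algebraMap k[X] L) = ∏ i, (X - C (ω i)))
    {z : L} (hz : z ^ p = z + algebraMap k[X] L X)
    {ψ : AddChar (ZMod p) ℂ} (hψ : ψ ≠ 1) :
    ∃ r₀, 0 < r₀ ∧ ∃ C : ℝ, ∀ s, 0 < s → r₀ ∣ s →
      ‖∑ x ∈ fixedPts k ((p ^ s) ^ 2), (((fixedPts k ((p ^ s) ^ 2)).filter
          fun y => eval y (F.map (evalRingHom x)) = 0).card : ℂ) *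
        liftFn k ψ (frobTrace p (s * 2) x)‖ ≤ C * p ^ s := by
  classical
  have hp : p.Prime := Fact.out
  have hω : ∀ i, IsIntegral k[X] (ω i) := fun i => ⟨F, hF, by
    rw [← eval_map, hprod, eval_prod]
    exact Finset.prod_eq_zero (Finset.mem_univ i) (by simp)⟩
  have hωdeg : ∀ i, (minpoly K (ω i)).natDegree < p := fun i => by
    refine (Nat.lt_of_le_of_lt ?_ hdeg)
    have h1 : aeval (ω i) (F.map (algebraMap k[X] K)) = 0 := by
      rw [aeval_map_algebraMap, aeval_def, ← eval_map, hprod, eval_prod]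
      exact Finset.prod_eq_zero (Finset.mem_univ i) (by simp)
    exact (natDegree_le_natDegree (minpoly.min K _ (hF.map _) h1)).trans natDegree_map_le
  have hzint : IsIntegral k[X] z := isIntegral_artinSchreier hp.one_lt hz
  let ι' : ZMod p →+* L := (algebraMap k L).comp (algebraMap (ZMod p) k)
  have : CharP L p := charP_of_injective_algebraMap (algebraMap k L).injective p
  have hσ : ∀ (σ : Gal(L/K)) (q : k[X]), σ (algebraMap k[X] L q) = algebraMap k[X] L q :=
    fun σ q => (σ.restrictScalars k[X]).commutes q
  have hb : ∀ σ : Gal(L/K), ∃ u : ZMod p, σ z = z + ι' u := by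
    intro σ
    obtain ⟨u, hu⟩ := exists_zmod_of_pow_eq ι' (a := σ z - z) (by
      rw [sub_pow_char, ← map_pow, hz, map_add, hσ]; ring)
    exact ⟨u, by rw [hu]; ring⟩
  choose b hb using hb
  have hc : ∑ σ : Gal(L/K), ((Finset.univ.filter fun i => σ (ω i) = ω i).card : ℂ) * ψ (b σ)
      = 0 := by
    simp_rw [Finset.card_filter, Nat.cast_sum, Finset.sum_mul]
    rw [Finset.sum_comm]
    refine Finset.sum_eq_zero fun i _ => ?_
    rw [← sum_addChar_eq_zero_of_artinSchreier ι' hz b hb (hωdeg i) hψ]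
    refine Finset.sum_congr rfl fun σ _ => ?_
    split_ifs <;> simp
  obtain ⟨r₀, hr₀, Z, hZ, C, h⟩ := chebotarev_galois p K L (fun o : Option ι => o.elim z ω)
    (by rintro (_ | i); exacts [hzint, hω i]) r.roots.toFinset _ hc
  refine ⟨r₀, hr₀, C + Z.card * F.natDegree, fun s hs hrs => ?_⟩
  obtain ⟨g, hg⟩ : ∃ g : k → ℂ, g = fun x => (((fixedPts k ((p ^ s) ^ 2)).filter
          fun y => eval y (F.map (evalRingHom x)) = 0).card : ℂ) *
        liftFn k ψ (frobTrace p (s * 2) x) := ⟨_, rfl⟩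
  have hg1 : ∀ x, ‖g x‖ ≤ F.natDegree := by
    intro x
    rw [hg, norm_mul, ← mul_one (F.natDegree : ℝ)]
    refine mul_le_mul ?_ (norm_liftFn_le (fun u => (norm_addChar_eq_one ψ u).le) _) (norm_nonneg _)
      (Nat.cast_nonneg _)
    rw [Complex.norm_natCast]
    exact_mod_cast card_filter_le_natDegree hF _ x
  have hmain := h s hs hrs g (by
    intro P σ hPZ hPX hPω
    have hPz : P ⟨z, hzint⟩ ^ (p ^ s) ^ 2 = P ⟨σ z, _⟩ := hPω none
    have hPi : ∀ i, P ⟨ω i, hω i⟩ ^ (p ^ s) ^ 2 = P ⟨σ (ω i), _⟩ := fun i => hPω (some i)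
    have hQ : (p ^ s) ^ 2 = p ^ (s * 2) := (pow_mul _ _ _).symm
    have hQ1 : 1 < (p ^ s) ^ 2 := by
      rw [hQ]; exact Nat.one_lt_pow (by omega) hp.one_lt
    have hPι : ∀ u, P (algebraMap k _ (algebraMap (ZMod p) k u)) = algebraMap (ZMod p) k u :=
      fun u => P.commutes _
    have hz1 : P ⟨z, hzint⟩ ^ p = P ⟨z, hzint⟩ + P (algebraMap k[X] _ X) := by
      rw [← map_add, ← map_pow]
      exact congrArg P (Subtype.ext hz)
    have e2 : frobTrace p (s * 2) (P (algebraMap k[X] _ X)) = algebraMap (ZMod p) k (b σ) := by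
      refine add_left_cancel (a := P ⟨z, hzint⟩) ?_
      rw [← add_frobTrace hz1, ← hQ, hPz, ← hPι, ← map_add]
      exact congrArg P (Subtype.ext (hb σ))
    have hr0 : eval (P (algebraMap k[X] _ X)) r ≠ 0 := by
      intro h0
      refine hPZ (hZ ?_)
      rw [Multiset.mem_toFinset, mem_roots hr]
      exact h0
    have hfac := map_eq_prod_of_algHom hω hprod P
    obtain ⟨x, hx⟩ : ∃ x, x = P (algebraMap k[X] _ X) := ⟨_, rfl⟩
    rw [← hx] at hr0 hfac e2 ⊢
    have hsepx : (F.map (evalRingHom x)).Separable := by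
      have h1 := congrArg (Polynomial.map (evalRingHom x)) huv
      rw [Polynomial.map_add, Polynomial.map_mul, Polynomial.map_mul, ← derivative_map, map_C] at h1
      refine ⟨Polynomial.C (eval x r)⁻¹ * u.map (evalRingHom x),
        Polynomial.C (eval x r)⁻¹ * v.map (evalRingHom x), ?_⟩
      rw [mul_assoc, mul_assoc, ← mul_add, h1, ← C_mul, coe_evalRingHom, inv_mul_cancel₀ hr0, C_1]
    have hinjω : Function.Injective fun i => P ⟨ω i, hω i⟩ := by
      rw [hfac] at hsepx
      exact separable_prod_X_sub_C_iff.1 hsepx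
    have hcard : ((fixedPts k ((p ^ s) ^ 2)).filter
          fun y => eval y (F.map (evalRingHom x)) = 0).card =
        (Finset.univ.filter fun i => σ (ω i) = ω i).card := by
      rw [← Finset.card_image_of_injective _ hinjω]
      congr 1
      ext y
      rw [Finset.mem_filter, mem_fixedPts hQ1, hfac, eval_prod, Finset.prod_eq_zero_iff]
      simp only [Finset.mem_univ, true_and, eval_sub, eval_X, eval_C, sub_eq_zero,
        Finset.mem_image, Finset.mem_filter]
      have key : ∀ i, σ (ω i) = ω i ↔ P ⟨ω i, hω i⟩ ^ (p ^ s) ^ 2 = P ⟨ω i, hω i⟩ := by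
        intro i
        rw [hPi]
        constructor
        · intro h; congr 1; exact Subtype.ext h
        · intro h
          have hroot : (F.map (algebraMap k[X] L)).eval (σ (ω i)) = 0 := by
            have h1 : (F.map (algebraMap k[X] L)).eval (ω i) = 0 := by
              rw [hprod, eval_prod]
              exact Finset.prod_eq_zero (Finset.mem_univ i) (by simp)
            have h2 := congrArg σ h1
            rw [eval_map_algebraMap, map_zero] at h2
            rw [eval_map_algebraMap, ← h2]
            exact aeval_algHom_apply (σ.restrictScalars k[X]) (ω i) F
          rw [hprod, eval_prod, Finset.prod_eq_zero_iff] at hroot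
          obtain ⟨j, -, hj⟩ := hroot
          rw [eval_sub, eval_X, eval_C, sub_eq_zero] at hj
          have h3 : P ⟨ω j, hω j⟩ = P ⟨ω i, hω i⟩ := by
            rw [← h]; congr 1; exact Subtype.ext hj.symm
          rw [hj, hinjω h3]
      constructor
      · rintro ⟨h1, i, hi⟩
        exact ⟨i, (key i).2 (by rw [← hi, h1]), hi.symm⟩
      · rintro ⟨i, hi, rfl⟩
        exact ⟨(key i).1 hi, i, rfl⟩
    rw [hg]
    simp only [hcard, e2, liftFn_algebraMap])
  have hle := norm_sum_le_add_card (fixedPts k ((p ^ s) ^ 2)) Z g (Nat.cast_nonneg _) hg1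
  have hps : (1 : ℝ) ≤ (p : ℝ) ^ s := one_le_pow₀ (by exact_mod_cast hp.one_le)
  simp only [hg] at hle hmain
  have hnn : (0 : ℝ) ≤ Z.card * F.natDegree := by positivity
  nlinarith

/-- Square-root cancellation over large extensions for additive characters along a curve. -/
theorem curve_sum_bound (p : ℕ) [Fact p.Prime] [CharP k p] [Algebra (ZMod p) k]
    [Algebra.IsAlgebraic (ZMod p) k] {F : k[X][X]} (hF : F.Monic) (hdeg : F.natDegree < p)
    {u v : k[X][X]} {r : k[X]} (hr : r ≠ 0) (huv : u * F + v * derivative F = C r)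
    {ψ : AddChar (ZMod p) ℂ} (hψ : ψ ≠ 1) :
    ∃ r₀, 0 < r₀ ∧ ∃ C : ℝ, ∀ s, 0 < s → r₀ ∣ s →
      ‖∑ x ∈ fixedPts k ((p ^ s) ^ 2), (((fixedPts k ((p ^ s) ^ 2)).filter
          fun y => eval y (F.map (evalRingHom x)) = 0).card : ℂ) *
        liftFn k ψ (frobTrace p (s * 2) x)‖ ≤ C * p ^ s := by
  have hp : p.Prime := Fact.out
  have : CharP (RatFunc k) p := charP_of_injective_algebraMap (algebraMap k (RatFunc k)).injective p
  have hsep : (F.map (algebraMap k[X] (RatFunc k))).Separable := by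
    have h1 := congrArg (Polynomial.map (algebraMap k[X] (RatFunc k))) huv
    rw [Polynomial.map_add, Polynomial.map_mul, Polynomial.map_mul, ← derivative_map, map_C] at h1
    have hr0 : algebraMap k[X] (RatFunc k) r ≠ 0 := by
      rwa [ne_eq, map_eq_zero_iff _ (IsFractionRing.injective k[X] (RatFunc k))]
    refine ⟨C (algebraMap k[X] (RatFunc k) r)⁻¹ * u.map (algebraMap k[X] (RatFunc k)),
      C (algebraMap k[X] (RatFunc k) r)⁻¹ * v.map (algebraMap k[X] (RatFunc k)), ?_⟩
    rw [mul_assoc, mul_assoc, ← mul_add, h1, ← C_mul, inv_mul_cancel₀ hr0, C_1]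
  refine forall_of_galois hsep (separable_artinSchreier p (algebraMap k[X] (RatFunc k) X)) ?_
  intro L _ _ _ _ _ _ _ _ hs₁ hs₂
  obtain ⟨z, hz⟩ := exists_artinSchreier_root hp.one_lt hs₂
  rw [map_map, ← IsScalarTower.algebraMap_eq] at hs₁
  have hprod : F.map (algebraMap k[X] L) =
      ∏ i : Fin (F.map (algebraMap k[X] L)).roots.toList.length,
        (X - C ((F.map (algebraMap k[X] L)).roots.toList.get i)) := by
    conv_lhs => rw [hs₁.eq_prod_roots_of_monic (hF.map _)]
    refine Eq.trans ?_ (Fin.prod_univ_fun_getElem _ fun w => X - C w).symm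
    conv_lhs => rw [← Multiset.coe_toList (F.map (algebraMap k[X] L)).roots, Multiset.map_coe,
      Multiset.prod_coe]
  exact curve_sum_bound_aux p (K := RatFunc k) hF hdeg hr huv hprod hz hψ

end Curve

end

section

open Polynomial

section PowerSums

lemma exists_pow_near_one {ι : Type*} [Fintype ι] (u : ι → ℂ) (hu : ∀ i, ‖u i‖ = 1) (N : ℕ) :
    ∃ m, N ≤ m ∧ ∀ i, ‖u i ^ m - 1‖ < 1 / 2 := by
  obtain ⟨a, -, φ, hφ, hlim⟩ := tendsto_subseq_of_bounded (x := fun m : ℕ => u ^ m)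
    (s := Metric.closedBall (0 : ι → ℂ) 1) Metric.isBounded_closedBall (by
      intro m
      rw [mem_closedBall_zero_iff, pi_norm_le_iff_of_nonneg zero_le_one]
      intro i
      rw [Pi.pow_apply, norm_pow, hu, one_pow])
  obtain ⟨M, hM⟩ := Metric.cauchySeq_iff.1 hlim.cauchySeq (1 / 2) (by norm_num)
  have hlt : φ M + N ≤ φ (M + N) := by
    clear hM
    induction N with
    | zero => simp
    | succ N ih =>
      have := hφ (show M + N < M + (N + 1) by omega)
      omega
  refine ⟨φ (M + N) - φ M, by omega, fun i => ?_⟩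
  have h1 := hM (M + N) (by omega) M le_rfl
  rw [dist_eq_norm, pi_norm_lt_iff (by norm_num)] at h1
  have h2 := h1 i
  simp only [Function.comp_apply, Pi.sub_apply, Pi.pow_apply] at h2
  have h3 : u i ^ φ (M + N) - u i ^ φ M = u i ^ φ M * (u i ^ (φ (M + N) - φ M) - 1) := by
    rw [mul_sub, ← pow_add, mul_one]; congr 2; omega
  rwa [h3, norm_mul, norm_pow, hu, one_pow, one_mul] at h2

lemma norm_le_of_powerSums {ι : Type*} [Fintype ι] (w : ι → ℂ) {B C : ℝ} (hB : 0 < B)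
    (h : ∀ m, 0 < m → ‖∑ i, w i ^ m‖ ≤ C * B ^ m) (i : ι) : ‖w i‖ ≤ B := by
  by_contra! hlt
  have hw0 : ‖w i‖ ≠ 0 := (hB.trans hlt).ne'
  obtain ⟨u, hu⟩ : ∃ u : ι → ℂ, ∀ j, ‖u j‖ = 1 ∧ w j = ‖w j‖ * u j := by
    refine ⟨fun j => if w j = 0 then 1 else w j / ‖w j‖, fun j => ?_⟩
    by_cases hj : w j = 0
    · simp [hj]
    · have : (‖w j‖ : ℂ) ≠ 0 := by exact_mod_cast norm_ne_zero_iff.2 hj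
      simp only [hj, if_false]
      refine ⟨?_, by field_simp⟩
      rw [norm_div, Complex.norm_real, norm_norm, div_self (norm_ne_zero_iff.2 hj)]
  have hx : 1 < ‖w i‖ / B := (one_lt_div hB).2 hlt
  obtain ⟨N, hN⟩ := pow_unbounded_of_one_lt (2 * C) hx
  obtain ⟨m, hm, hnear⟩ := exists_pow_near_one u (fun j => (hu j).1) (N + 1)
  have h1 : 2 * C < (‖w i‖ / B) ^ m := hN.trans_le (pow_le_pow_right₀ hx.le (by omega))
  have hre : ∀ j, ‖w j‖ ^ m / 2 ≤ (w j ^ m).re := by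
    intro j
    have e : w j ^ m = ((‖w j‖ ^ m : ℝ) : ℂ) * u j ^ m := by
      conv_lhs => rw [(hu j).2, mul_pow]
      push_cast; rfl
    rw [e, Complex.re_ofReal_mul]
    have h2 := (Complex.abs_re_le_norm _).trans_lt (hnear j)
    rw [Complex.sub_re, Complex.one_re, abs_lt] at h2
    have h3 : 0 ≤ ‖w j‖ ^ m := by positivity
    nlinarith
  have h4 : ‖w i‖ ^ m / 2 ≤ ‖∑ j, w j ^ m‖ := by
    refine le_trans ?_ (Complex.re_le_norm _)
    rw [Complex.re_sum]
    refine (hre i).trans (Finset.single_le_sum (f := fun j => (w j ^ m).re) (fun j _ => ?_)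
      (Finset.mem_univ i))
    exact le_trans (by positivity) (hre j)
  have h5 := h4.trans (h m (by omega))
  rw [div_pow, lt_div_iff₀ (by positivity)] at h1
  linarith

lemma exists_esymm_eq {D : ℕ} (c : ℕ → ℂ) (h0 : c 0 = 1) (hD : ∀ n, D < n → c n = 0) :
    ∃ w : Fin D → ℂ, ∀ n, c n = (-1) ^ n * MvPolynomial.aeval w
        (MvPolynomial.esymm (Fin D) ℂ n) := by
  obtain ⟨R, hR⟩ : ∃ R : ℂ[X], R = ∑ n ∈ Finset.range (D + 1), C (c n) * X ^ (D - n) := ⟨_, rfl⟩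
  have hcoeff : ∀ n ≤ D, R.coeff (D - n) = c n := by
    intro n hn
    rw [hR, finsetSum_coeff, Finset.sum_eq_single n]
    · simp
    · intro m hm hmn
      rw [Finset.mem_range] at hm
      rw [coeff_C_mul, coeff_X_pow, if_neg (by omega), mul_zero]
    · intro h
      rw [Finset.mem_range] at h
      omega
  have hdeg : R.natDegree ≤ D := by
    rw [hR]
    refine natDegree_sum_le_of_forall_le _ _ fun n _ => ?_
    exact (natDegree_C_mul_X_pow_le _ _).trans (Nat.sub_le _ _)
  have hmon : R.Monic := monic_of_natDegree_le_of_coeff_eq_one D hdeg (by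
    have := hcoeff 0 (Nat.zero_le _)
    rwa [Nat.sub_zero, h0] at this)
  have hdeg' : R.natDegree = D := natDegree_eq_of_le_of_coeff_ne_zero hdeg (by
    have := hcoeff 0 (Nat.zero_le _)
    rw [Nat.sub_zero, h0] at this
    rw [this]; exact one_ne_zero)
  have hcard : Multiset.card R.roots = D := by
    rw [← hdeg']; exact splits_iff_card_roots.1 (IsAlgClosed.splits R)
  have hlen : R.roots.toList.length = D := by rw [Multiset.length_toList, hcard]
  refine ⟨fun i => R.roots.toList.get (i.cast hlen.symm), fun n => ?_⟩
  rw [MvPolynomial.aeval_esymm_eq_multiset_esymm]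
  have hms : (Finset.univ : Finset (Fin D)).val.map
      (fun i => R.roots.toList.get (i.cast hlen.symm)) = R.roots := by
    conv_rhs => rw [← Multiset.coe_toList R.roots, ← List.ofFn_get R.roots.toList]
    rw [Fin.univ_val_map, List.ofFn_congr hlen]
  rw [hms]
  by_cases hn : n ≤ D
  · have h1 := coeff_eq_esymm_roots_of_card (p := R) (hcard.trans hdeg'.symm) (k := D - n)
      (by omega)
    rw [hcoeff n hn, hmon.leadingCoeff, one_mul, hdeg', Nat.sub_sub_self hn] at h1
    exact h1
  · rw [hD n (by omega), Multiset.esymm, Multiset.powersetCard_eq_empty _ (by omega)]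
    simp

/-- If the power sums attached to a polynomial by the Newton identities are bounded by `C * A ^ r`
for all `r` in an arithmetic progression, then the first one is bounded by `D * A`. -/
theorem norm_le_of_newton {D : ℕ} {c S : ℕ → ℂ} (h0 : c 0 = 1) (hD : ∀ n, D < n → c n = 0)
    (hnewton : ∀ n, n * c n = ∑ r ∈ Finset.range n, c r * S (n - r)) {A C : ℝ} (hA : 0 < A)
    {r₀ : ℕ} (hr₀ : 0 < r₀) (hS : ∀ r, 0 < r → r₀ ∣ r → ‖S r‖ ≤ C * A ^ r) :
    ‖S 1‖ ≤ D * A := by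
  obtain ⟨w, hw⟩ := exists_esymm_eq c h0 hD
  have hsum : ∀ n, 0 < n → S n = -∑ i, w i ^ n := by
    intro n
    induction n using Nat.strong_induction_on with
    | _ n ih =>
      intro hn
      have h1 := congrArg (MvPolynomial.aeval w) (MvPolynomial.mul_esymm_eq_sum (Fin D) ℂ n)
      simp only [map_mul, map_natCast, map_pow, map_neg, map_one, map_sum, MvPolynomial.psum,
        MvPolynomial.aeval_X] at h1
      have h2 : (n : ℂ) * c n = ∑ r ∈ Finset.range n, c r * -∑ i, w i ^ (n - r) := by
        have h3 : (n : ℂ) * c n = (-1) ^ n * (n * MvPolynomial.aeval w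
            (MvPolynomial.esymm (Fin D) ℂ n)) := by
          rw [hw]; ring
        rw [h3, h1, ← mul_assoc, ← pow_add, Finset.sum_filter,
          Finset.Nat.sum_antidiagonal_eq_sum_range_succ_mk, Finset.sum_range_succ]
        rw [if_neg (lt_irrefl _), add_zero, Odd.neg_one_pow ⟨n, by ring⟩, Finset.mul_sum]
        refine Finset.sum_congr rfl fun r hr => ?_
        rw [if_pos (Finset.mem_range.1 hr), hw]
        ring
      rw [hnewton] at h2
      obtain ⟨m, rfl⟩ : ∃ m, n = m + 1 := ⟨n - 1, by omega⟩
      rw [Finset.sum_range_succ', Finset.sum_range_succ', h0, one_mul, one_mul] at h2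
      have h4 : ∑ r ∈ Finset.range m, c (r + 1) * S (m + 1 - (r + 1)) =
          ∑ r ∈ Finset.range m, c (r + 1) * -∑ i, w i ^ (m + 1 - (r + 1)) := by
        refine Finset.sum_congr rfl fun r hr => ?_
        rw [Finset.mem_range] at hr
        rw [ih (m + 1 - (r + 1)) (by omega) (by omega)]
      rw [h4] at h2
      exact add_left_cancel h2
  have hb : ∀ i, ‖w i‖ ≤ A := by
    intro i
    have h1 := norm_le_of_powerSums (fun i => w i ^ r₀) (B := A ^ r₀) (C := C) (by positivity)
      (fun m hm => by
        have h2 := hS (r₀ * m) (by positivity) (dvd_mul_right _ _)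
        rw [hsum _ (by positivity), norm_neg] at h2
        simpa only [← pow_mul] using h2) i
    rw [norm_pow] at h1
    exact le_of_pow_le_pow_left₀ hr₀.ne' hA.le h1
  rw [hsum 1 one_pos, norm_neg]
  refine (norm_sum_le_of_le _ (fun i _ => (by rw [pow_one]; exact hb i : ‖w i ^ 1‖ ≤ A))).trans ?_
  simp

end PowerSums

end

section

open Polynomial UniqueFactorizationMonoid

section Newton

variable {O : Type*} [CommRing O] [IsDedekindDomain O] {deg : Ideal O → ℕ} {lam : Ideal O → ℂ}

lemma deg_multiset_prod (hdeg : ∀ I J : Ideal O, I ≠ ⊥ → J ≠ ⊥ → deg (I * J) = deg I + deg J)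
    (s : Multiset (Ideal O)) (hs : ∀ I ∈ s, I ≠ ⊥) : deg s.prod = (s.map deg).sum := by
  have h1 : deg 1 = 0 := by
    have h := hdeg 1 1 one_ne_zero one_ne_zero
    rw [one_mul] at h
    omega
  induction s using Multiset.induction with
  | empty => simpa using h1
  | cons I s ih =>
    have hs' : ∀ J ∈ s, J ≠ ⊥ := fun J hJ => hs J (Multiset.mem_cons_of_mem hJ)
    rw [Multiset.prod_cons, hdeg I _ (hs I (Multiset.mem_cons_self I s)), ih hs', Multiset.map_cons,
      Multiset.sum_cons]
    exact Multiset.prod_ne_zero fun h => hs' _ h rfl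

lemma deg_pow (hdeg : ∀ I J : Ideal O, I ≠ ⊥ → J ≠ ⊥ → deg (I * J) = deg I + deg J)
    {P : Ideal O} (hP : P ≠ ⊥) (j : ℕ) : deg (P ^ j) = j * deg P := by
  have := deg_multiset_prod hdeg (Multiset.replicate j P)
    fun I hI => by rwa [Multiset.eq_of_mem_replicate hI]
  simpa using this

/-- The prime ideals of degree dividing `m`, where `T i` is the set of ideals of degree `i`. -/
noncomputable def primesOfDegDvd (deg : Ideal O → ℕ) (T : ℕ → Finset (Ideal O)) (m : ℕ) :
    Finset (Ideal O) := by
  classical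
  exact ((Finset.range (m + 1)).biUnion T).filter fun P => P.IsPrime ∧ deg P ∣ m

omit [IsDedekindDomain O] in
lemma mem_primesOfDegDvd {T : ℕ → Finset (Ideal O)} (hT : ∀ n I, I ∈ T n ↔ I ≠ ⊥ ∧ deg I = n)
    {m : ℕ} (hm : 0 < m) (P : Ideal O) :
    P ∈ primesOfDegDvd deg T m ↔ P ≠ ⊥ ∧ P.IsPrime ∧ deg P ∣ m := by
  classical
  rw [primesOfDegDvd, Finset.mem_filter, Finset.mem_biUnion]
  constructor
  · rintro ⟨⟨i, -, hi⟩, h1, h2⟩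
    exact ⟨((hT _ _).1 hi).1, h1, h2⟩
  · rintro ⟨h0, h1, h2⟩
    exact ⟨⟨deg P, Finset.mem_range.2 (Nat.lt_succ_of_le (Nat.le_of_dvd hm h2)),
      (hT _ _).2 ⟨h0, rfl⟩⟩, h1, h2⟩

lemma deg_eq_sum_primes (hdeg : ∀ I J : Ideal O, I ≠ ⊥ → J ≠ ⊥ → deg (I * J) = deg I + deg J)
    (hpos : ∀ P : Ideal O, P ≠ ⊥ → P.IsPrime → 0 < deg P) {n : ℕ} (Q : Finset (Ideal O))
    (hQ : ∀ P, P ∈ Q ↔ P ≠ ⊥ ∧ P.IsPrime ∧ deg P ≤ n) {I : Ideal O} (hI : I ≠ ⊥)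
    (hn : deg I ≤ n) [∀ I J : Ideal O, Decidable (I ∣ J)] :
    deg I = ∑ P ∈ Q, ((Finset.Icc 1 n).filter fun j => P ^ j ∣ I).card * deg P := by
  classical
  have hmem : ∀ P ∈ normalizedFactors I, P ≠ ⊥ ∧ P.IsPrime := fun P hP =>
    ⟨(prime_of_normalized_factor P hP).ne_zero,
      Ideal.isPrime_of_prime (prime_of_normalized_factor P hP)⟩
  have hprod : (normalizedFactors I).prod = I := associated_iff_eq.1 (prod_normalizedFactors hI)
  have h1 := deg_multiset_prod hdeg (normalizedFactors I) (fun P hP => (hmem P hP).1)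
  rw [hprod, Finset.sum_multiset_map_count] at h1
  have hsub : (normalizedFactors I).toFinset ⊆ Q := by
    intro P hP
    have hP' := Multiset.mem_toFinset.1 hP
    refine (hQ P).2 ⟨(hmem P hP').1, (hmem P hP').2, le_trans ?_ hn⟩
    rw [h1]
    refine le_trans ?_ (Finset.single_le_sum (f := fun P => (normalizedFactors I).count P • deg P)
      (fun _ _ => Nat.zero_le _) hP)
    exact Nat.le_mul_of_pos_left _ (Multiset.count_pos.2 hP')
  rw [Finset.sum_subset hsub (fun P _ hP => by
    rw [Multiset.count_eq_zero_of_notMem (fun h => hP (Multiset.mem_toFinset.2 h)),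
        zero_smul])] at h1
  rw [h1]
  refine Finset.sum_congr rfl fun P hP => ?_
  obtain ⟨hP0, hPp, -⟩ := (hQ P).1 hP
  have hirr : Irreducible P := (Ideal.prime_of_isPrime hP0 hPp).irreducible
  rw [smul_eq_mul]
  congr 1
  have hdvd : ∀ j, P ^ j ∣ I ↔ j ≤ (normalizedFactors I).count P := by
    intro j
    rw [pow_dvd_iff_le_emultiplicity, emultiplicity_eq_count_normalizedFactors hirr hI,
      normalize_eq, Nat.cast_le]
  have hle : (normalizedFactors I).count P ≤ n := by
    refine le_trans ?_ hn
    rw [h1]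
    refine le_trans ?_ (Finset.single_le_sum (f := fun P => (normalizedFactors I).count P • deg P)
      (fun _ _ => Nat.zero_le _) hP)
    exact Nat.le_mul_of_pos_right _ (hpos P hP0 hPp)
  have : ((Finset.Icc 1 n).filter fun j => P ^ j ∣ I) =
      Finset.Icc 1 ((normalizedFactors I).count P) := by
    ext j
    rw [Finset.mem_filter, Finset.mem_Icc, Finset.mem_Icc, hdvd]
    omega
  rw [this, Nat.card_Icc, Nat.add_sub_cancel]

lemma sum_filter_pow_dvd
    (hdeg : ∀ I J : Ideal O, I ≠ ⊥ → J ≠ ⊥ → deg (I * J) = deg I + deg J)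
    (hlam : ∀ I J : Ideal O, I ≠ ⊥ → J ≠ ⊥ → lam (I * J) = lam I * lam J)
    {T : ℕ → Finset (Ideal O)} (hT : ∀ n I, I ∈ T n ↔ I ≠ ⊥ ∧ deg I = n)
    {A : Ideal O} (hA : A ≠ ⊥) (n : ℕ) [∀ I J : Ideal O, Decidable (I ∣ J)] :
    ∑ I ∈ (T n).filter (fun I => A ∣ I), lam I =
      if deg A ≤ n then lam A * ∑ J ∈ T (n - deg A), lam J else 0 := by
  classical
  split_ifs with h
  · rw [Finset.mul_sum]
    symm
    refine Finset.sum_bij (fun J _ => A * J) ?_ ?_ ?_ ?_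
    · intro J hJ
      obtain ⟨h0, h1⟩ := (hT _ _).1 hJ
      refine Finset.mem_filter.2 ⟨(hT _ _).2 ⟨mul_ne_zero hA h0, ?_⟩, dvd_mul_right _ _⟩
      rw [hdeg A J hA h0, h1]; omega
    · intro J _ J' _ h
      exact mul_left_cancel₀ hA h
    · intro I hI
      obtain ⟨hI, J, rfl⟩ := Finset.mem_filter.1 hI
      obtain ⟨h0, h1⟩ := (hT _ _).1 hI
      have hJ : J ≠ ⊥ := right_ne_zero_of_mul h0
      refine ⟨J, (hT _ _).2 ⟨hJ, ?_⟩, rfl⟩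
      rw [hdeg A J hA hJ] at h1; omega
    · intro J hJ
      rw [hlam A J hA ((hT _ _).1 hJ).1]
  · refine Finset.sum_eq_zero fun I hI => ?_
    obtain ⟨hI, J, rfl⟩ := Finset.mem_filter.1 hI
    obtain ⟨h0, h1⟩ := (hT _ _).1 hI
    rw [hdeg A J hA (right_ne_zero_of_mul h0)] at h1
    omega

lemma sum_Icc_mul_le {M : Type*} [AddCommMonoid M] {d : ℕ} (hd : 0 < d) (n : ℕ) (f : ℕ → ℕ → M) :
    ∑ j ∈ Finset.Icc 1 n, (if j * d ≤ n then f (n - j * d) j else 0) =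
      ∑ r ∈ Finset.range n, if d ∣ n - r then f r ((n - r) / d) else 0 := by
  rw [← Finset.sum_filter, ← Finset.sum_filter]
  refine Finset.sum_bij' (fun j _ => n - j * d) (fun r _ => (n - r) / d) ?_ ?_ ?_ ?_ ?_
  · intro j hj
    simp only [Finset.mem_filter, Finset.mem_Icc, Finset.mem_range] at hj ⊢
    have : 0 < j * d := by apply Nat.mul_pos <;> omega
    refine ⟨by omega, ?_⟩
    rw [Nat.sub_sub_self hj.2]
    exact dvd_mul_left _ _
  · intro r hr
    simp only [Finset.mem_filter, Finset.mem_Icc, Finset.mem_range] at hr ⊢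
    rw [Nat.div_mul_cancel hr.2]
    refine ⟨⟨Nat.div_pos (Nat.le_of_dvd (by omega) hr.2) hd, ?_⟩, by omega⟩
    exact (Nat.div_le_self _ _).trans (by omega)
  · intro j hj
    simp only [Finset.mem_filter, Finset.mem_Icc] at hj
    rw [Nat.sub_sub_self hj.2, Nat.mul_div_cancel _ hd]
  · intro r hr
    simp only [Finset.mem_filter, Finset.mem_range] at hr
    rw [Nat.div_mul_cancel hr.2]; omega
  · intro j hj
    simp only [Finset.mem_filter, Finset.mem_Icc] at hj
    rw [Nat.sub_sub_self hj.2, Nat.mul_div_cancel _ hd]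

/-- The Newton identities between the coefficients of an `L`-series over the ideals of a Dedekind
domain and the associated sums over prime ideals. -/
theorem newton_ideals (hdeg : ∀ I J : Ideal O, I ≠ ⊥ → J ≠ ⊥ → deg (I * J) = deg I + deg J)
    (hpos : ∀ P : Ideal O, P ≠ ⊥ → P.IsPrime → 0 < deg P)
    (hlam1 : lam 1 = 1)
    (hlam : ∀ I J : Ideal O, I ≠ ⊥ → J ≠ ⊥ → lam (I * J) = lam I * lam J)
    {T : ℕ → Finset (Ideal O)} (hT : ∀ n I, I ∈ T n ↔ I ≠ ⊥ ∧ deg I = n) (n : ℕ) :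
    n * ∑ I ∈ T n, lam I = ∑ r ∈ Finset.range n, (∑ I ∈ T r, lam I) *
      ∑ P ∈ primesOfDegDvd deg T (n - r), deg P * lam P ^ ((n - r) / deg P) := by
  classical
  have hlampow : ∀ (P : Ideal O), P ≠ ⊥ → ∀ j, lam (P ^ j) = lam P ^ j := by
    intro P hP j
    induction j with
    | zero => rw [pow_zero, pow_zero, hlam1]
    | succ j ih => rw [pow_succ, hlam _ _ (pow_ne_zero j hP) hP, ih, pow_succ]
  obtain ⟨Q, hQdef⟩ : ∃ Q : Finset (Ideal O),
    Q = ((Finset.range (n + 1)).biUnion T).filter fun P => P.IsPrime := ⟨_, rfl⟩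
  have hQ : ∀ P, P ∈ Q ↔ P ≠ ⊥ ∧ P.IsPrime ∧ deg P ≤ n := by
    intro P
    rw [hQdef, Finset.mem_filter, Finset.mem_biUnion]
    constructor
    · rintro ⟨⟨i, hi, hi'⟩, h1⟩
      obtain ⟨h2, h3⟩ := (hT _ _).1 hi'
      exact ⟨h2, h1, by rw [h3]; exact Nat.lt_succ_iff.1 (Finset.mem_range.1 hi)⟩
    · rintro ⟨h0, h1, h2⟩
      exact ⟨⟨deg P, Finset.mem_range.2 (Nat.lt_succ_of_le h2), (hT _ _).2 ⟨h0, rfl⟩⟩, h1⟩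
  have hL : n * ∑ I ∈ T n, lam I = ∑ P ∈ Q, deg P * ∑ j ∈ Finset.Icc 1 n,
      (if j * deg P ≤ n then lam P ^ j * ∑ J ∈ T (n - j * deg P), lam J else 0) := by
    rw [Finset.mul_sum]
    have h1 : ∀ I ∈ T n, n * lam I =
        ∑ P ∈ Q, deg P * ∑ j ∈ Finset.Icc 1 n, if P ^ j ∣ I then lam I else 0 := by
      intro I hI
      obtain ⟨h2, h3⟩ := (hT _ _).1 hI
      have h4 := deg_eq_sum_primes hdeg hpos Q hQ h2 h3.le
      rw [h3] at h4
      conv_lhs => rw [h4]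
      rw [Nat.cast_sum, Finset.sum_mul]
      refine Finset.sum_congr rfl fun P _ => ?_
      rw [← Finset.sum_filter, Finset.sum_const, nsmul_eq_mul]
      push_cast; ring
    rw [Finset.sum_congr rfl h1, Finset.sum_comm]
    refine Finset.sum_congr rfl fun P hP => ?_
    have hP0 := ((hQ P).1 hP).1
    rw [← Finset.mul_sum, Finset.sum_comm]
    congr 1
    refine Finset.sum_congr rfl fun j _ => ?_
    rw [← Finset.sum_filter, sum_filter_pow_dvd hdeg hlam hT (pow_ne_zero j hP0), hlampow P hP0,
      deg_pow hdeg hP0]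
  rw [hL]
  have hR : ∀ r ∈ Finset.range n,
      ∑ P ∈ primesOfDegDvd deg T (n - r), deg P * lam P ^ ((n - r) / deg P) =
      ∑ P ∈ Q, if deg P ∣ n - r then (deg P * lam P ^ ((n - r) / deg P) : ℂ) else 0 := by
    intro r hr
    rw [Finset.mem_range] at hr
    rw [← Finset.sum_filter]
    refine Finset.sum_congr ?_ fun _ _ => rfl
    ext P
    rw [mem_primesOfDegDvd hT (by omega), Finset.mem_filter, hQ]
    constructor
    · rintro ⟨h1, h2, h3⟩
      exact ⟨⟨h1, h2, (Nat.le_of_dvd (by omega) h3).trans (Nat.sub_le _ _)⟩, h3⟩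
    · rintro ⟨⟨h1, h2, -⟩, h3⟩
      exact ⟨h1, h2, h3⟩
  have hR2 : ∑ r ∈ Finset.range n, (∑ I ∈ T r, lam I) *
      ∑ P ∈ primesOfDegDvd deg T (n - r), deg P * lam P ^ ((n - r) / deg P) =
      ∑ P ∈ Q, ∑ r ∈ Finset.range n, (∑ I ∈ T r, lam I) *
        (if deg P ∣ n - r then (deg P * lam P ^ ((n - r) / deg P) : ℂ) else 0) := by
    rw [Finset.sum_comm]
    refine Finset.sum_congr rfl fun r hr => ?_
    rw [hR r hr, Finset.mul_sum]
  rw [hR2]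
  refine Finset.sum_congr rfl fun P hP => ?_
  obtain ⟨hP0, hPp, -⟩ := (hQ P).1 hP
  rw [sum_Icc_mul_le (hpos P hP0 hPp) n (fun r j => lam P ^ j * ∑ J ∈ T r, lam J), Finset.mul_sum]
  refine Finset.sum_congr rfl fun r _ => ?_
  split_ifs <;> ring

end Newton

end

section

open Polynomial Module

section FrobPoly

variable {p : ℕ} [Fact p.Prime] {k : Type*} [Field k] [Algebra (ZMod p) k]

/-- The power of the minimal polynomial over `𝔽_p` of a point fixed by `x ↦ x ^ p ^ r` that has
degree `r`. -/
noncomputable def frobPoly (p : ℕ) [Fact p.Prime] {k : Type*} [Field k] [Algebra (ZMod p) k]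
    (r : ℕ) (x : k) : (ZMod p)[X] := minpoly (ZMod p) x ^ (r / (minpoly (ZMod p) x).natDegree)

lemma isIntegral_of_pow_eq {r : ℕ} (hr : 0 < r) {x : k} (hx : x ^ p ^ r = x) :
    IsIntegral (ZMod p) x := by
  have h1 : 1 < p ^ r := Nat.one_lt_pow hr.ne' (Fact.out : p.Prime).one_lt
  exact ⟨X ^ p ^ r - X, monic_X_pow_sub (by rw [degree_X]; exact_mod_cast h1), by simp [hx]⟩

lemma monic_frobPoly {r : ℕ} (hr : 0 < r) {x : k} (hx : x ^ p ^ r = x) :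
    (frobPoly p r x).Monic := (minpoly.monic (isIntegral_of_pow_eq hr hx)).pow _

lemma map_frobPoly {r : ℕ} (hr : 0 < r) {x : k} (hx : x ^ p ^ r = x) :
    (frobPoly p r x).map (algebraMap (ZMod p) k) = ∏ j ∈ Finset.range r, (X - C (x ^ p ^ j)) ∧
      (minpoly (ZMod p) x).natDegree ∣ r := by
  have : CharP k p := charP_of_injective_algebraMap (algebraMap (ZMod p) k).injective p
  have hint := isIntegral_of_pow_eq hr hx
  obtain ⟨g, hg⟩ : ∃ g : k[X], g = ∏ j ∈ Finset.range r, (X - C (x ^ p ^ j)) := ⟨_, rfl⟩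
  have hgm : g.Monic := hg ▸ monic_prod_of_monic _ _ fun j _ => monic_X_sub_C _
  have hgdeg : g.natDegree = r := by
    rw [hg, natDegree_prod_of_monic _ _ fun j _ => monic_X_sub_C _]
    simp only [natDegree_X_sub_C, Finset.sum_const, Finset.card_range, smul_eq_mul, mul_one]
  have hfrob : g.map (frobenius k p) = g := by
    rw [hg, Polynomial.map_prod]
    simp only [Polynomial.map_sub, map_X, map_C, frobenius_def, ← pow_mul, ← pow_succ]
    obtain ⟨m, rfl⟩ : ∃ m, r = m + 1 := ⟨r - 1, by omega⟩
    rw [Finset.prod_range_succ, hx, Finset.prod_range_succ' _ m, pow_zero, pow_one]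
  obtain ⟨G, hG⟩ : ∃ G : (ZMod p)[X], G.map (algebraMap (ZMod p) k) = g := by
    have h : g ∈ lifts (algebraMap (ZMod p) k) := by
      rw [lifts_iff_coeff_lifts]
      intro n
      obtain ⟨u, hu⟩ := exists_zmod_of_pow_eq (algebraMap (ZMod p) k) (a := g.coeff n) (by
        conv_rhs => rw [← hfrob, coeff_map, frobenius_def])
      exact ⟨u, hu⟩
    exact (mem_lifts _).1 h
  have hGm : G.Monic := by
    have := hgm
    rw [← hG] at this
    exact monic_of_injective (algebraMap (ZMod p) k).injective this
  have hμ := minpoly.monic hint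
  have hroot : ∀ j, aeval (x ^ p ^ j) (minpoly (ZMod p) x) = 0 := by
    intro j
    induction j with
    | zero => rw [pow_zero, pow_one, minpoly.aeval]
    | succ j ih =>
      rw [pow_succ, pow_mul]
      have h := ZMod.expand_card (minpoly (ZMod p) x)
      have h2 := congrArg (aeval (x ^ p ^ j)) h
      rw [expand_aeval, map_pow, ih, zero_pow (Fact.out : p.Prime).ne_zero] at h2
      exact h2
  have hdvd : G ∣ minpoly (ZMod p) x ^ r := by
    rw [← map_dvd_map' (algebraMap (ZMod p) k), hG, hg, Polynomial.map_pow]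
    conv_rhs => rw [← Finset.card_range r, ← Finset.prod_const]
    refine Finset.prod_dvd_prod_of_dvd _ _ fun j _ => ?_
    rw [dvd_iff_isRoot, IsRoot.def, eval_map_algebraMap, hroot j]
  obtain ⟨i, -, hi⟩ := (dvd_prime_pow (minpoly.irreducible hint).prime r).1 hdvd
  have hGi : G = minpoly (ZMod p) x ^ i := eq_of_monic_of_associated hGm (hμ.pow i) hi
  have hdeg : i * (minpoly (ZMod p) x).natDegree = r := by
    rw [← natDegree_pow, ← hGi, ← hgdeg, ← hG, natDegree_map]
  have hpos : 0 < (minpoly (ZMod p) x).natDegree := minpoly.natDegree_pos hint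
  rw [frobPoly, ← hg, ← hG, hGi]
  have : r / (minpoly (ZMod p) x).natDegree = i := by
    rw [← hdeg, Nat.mul_div_cancel _ hpos]
  rw [this]
  exact ⟨rfl, ⟨i, by rw [mul_comm, hdeg]⟩⟩

lemma frobPoly_one (u : ZMod p) : frobPoly p 1 (algebraMap (ZMod p) k u) = X - C u := by
  rw [frobPoly, minpoly.eq_X_sub_C, natDegree_X_sub_C, Nat.div_one, pow_one]

end FrobPoly

section NormGen

variable {F : Type*} [Field F] {O : Type*} [CommRing O] [IsDedekindDomain O] [Algebra F[X] O]
  [Module.Finite F[X] O] [IsTorsionFree F[X] O]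

/-- The monic generator of the relative norm of an ideal. -/
noncomputable def normGen (F : Type*) [Field F] {O : Type*} [CommRing O] [IsDedekindDomain O]
    [Algebra F[X] O] [Module.Finite F[X] O] [IsTorsionFree F[X] O] (I : Ideal O) : F[X] := by
  classical
  exact normalize (Submodule.IsPrincipal.generator (Ideal.relNorm F[X] I))

lemma span_normGen (I : Ideal O) : Ideal.span {normGen F I} = Ideal.relNorm F[X] I := by
  classical
  rw [normGen, Ideal.span_singleton_eq_span_singleton.2 (normalize_associated _)]
  exact Ideal.span_singleton_generator _

lemma monic_normGen {I : Ideal O} (hI : I ≠ ⊥) : (normGen F I).Monic := by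
  classical
  refine monic_normalize fun h => hI ?_
  rw [← Ideal.relNorm_eq_bot_iff (R := F[X]), ← Ideal.span_singleton_generator
      (Ideal.relNorm F[X] I),
    h, Ideal.span_singleton_eq_bot]

lemma normGen_eq {I : Ideal O} {g : F[X]} (hg : g.Monic) (h : Ideal.relNorm F[X] I =
    Ideal.span {g}) :
    normGen F I = g := by
  have hI : I ≠ ⊥ := by
    rintro rfl
    rw [Ideal.relNorm_bot, eq_comm, Ideal.span_singleton_eq_bot] at h
    exact hg.ne_zero h
  refine eq_of_monic_of_associated (monic_normGen hI) hg ?_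
  rw [← Ideal.span_singleton_eq_span_singleton, span_normGen, h]

lemma normGen_one : normGen F (1 : Ideal O) = 1 :=
  normGen_eq monic_one (by rw [map_one, Ideal.span_singleton_one, Ideal.one_eq_top])

lemma normGen_mul {I J : Ideal O} (hI : I ≠ ⊥) (hJ : J ≠ ⊥) :
    normGen F (I * J) = normGen F I * normGen F J :=
  normGen_eq ((monic_normGen hI).mul (monic_normGen hJ)) (by
    rw [map_mul, ← span_normGen, ← span_normGen, Ideal.span_singleton_mul_span_singleton])

lemma finite_natDegree_normGen_eq [Finite F] (n : ℕ) :
    {I : Ideal O | I ≠ ⊥ ∧ (normGen F I).natDegree = n}.Finite := by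
  have h1 : {g : F[X] | g ≠ 0 ∧ g.natDegree = n}.Finite := by
    refine Set.Finite.subset (s := (degreeLT F (n + 1) : Set F[X])) ?_ ?_
    · have : Finite (degreeLT F (n + 1)) := Finite.of_equiv _ (degreeLTEquiv F (n + 1)).toEquiv.symm
      exact Set.toFinite _
    · rintro g ⟨-, hg⟩
      rw [SetLike.mem_coe, mem_degreeLT]
      exact degree_le_natDegree.trans_lt (by rw [hg]; exact_mod_cast Nat.lt_succ_self n)
  have h2 := h1.biUnion (t := fun g => {I : Ideal O | Ideal.span {algebraMap F[X] O g} ≤ I}) (by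
    rintro g ⟨hg, -⟩
    have := UniqueFactorizationMonoid.fintypeSubtypeDvd (Ideal.span {algebraMap F[X] O g}) (by
      rw [Ne, Ideal.zero_eq_bot, Ideal.span_singleton_eq_bot, FaithfulSMul.algebraMap_eq_zero_iff]
      exact hg)
    have h3 : {I : Ideal O | I ∣ Ideal.span {algebraMap F[X] O g}}.Finite :=
      Set.finite_coe_iff.1 (@Finite.of_fintype _ this)
    exact h3.subset fun I hI => Ideal.dvd_iff_le.2 hI)
  refine h2.subset ?_
  rintro I ⟨hI, hn⟩
  rw [Set.mem_iUnion₂]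
  refine ⟨normGen F I, ⟨(monic_normGen hI).ne_zero, hn⟩, ?_⟩
  have h4 := Ideal.relNorm_le_comap F[X] I
  rw [← span_normGen, Ideal.span_singleton_le_iff_mem, Ideal.mem_comap] at h4
  exact (Ideal.span_singleton_le_iff_mem _).2 h4

lemma finite_classGroup [Finite F] : Finite (ClassGroup O) := by
  classical
  have := Fintype.ofFinite F
  have : Module.Free F[X] O := inferInstance
  obtain b := Module.Free.chooseBasis F[X] O
  have hb : DecidableEq (Module.Free.ChooseBasisIndex F[X] O) := Classical.decEq _
  have h := ClassGroup.fintypeOfAdmissibleOfAlgebraic b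
    (Polynomial.cardPowDegreeIsAdmissible : AbsoluteValue.IsAdmissible
      (Polynomial.cardPowDegree : AbsoluteValue F[X] ℤ))
  exact @Finite.of_fintype _ h

variable [Algebra F O] [IsScalarTower F F[X] O]

lemma natDegree_normGen_eq_finrank [Finite F] {P : Ideal O} (hP : P ≠ ⊥) [P.IsPrime] :
    (normGen F P).natDegree = finrank F (O ⧸ P) := by
  have := finite_classGroup (F := F) (O := O)
  obtain ⟨h, hh⟩ : ∃ h, h = Nat.card (ClassGroup O) := ⟨_, rfl⟩
  have hh0 : 0 < h := hh ▸ Nat.card_pos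
  have h1 : ClassGroup.mk0 (⟨P ^ h, mem_nonZeroDivisors_iff_ne_zero.2 (pow_ne_zero h hP)⟩ :
      nonZeroDivisors (Ideal O)) = 1 := by
    have : (⟨P ^ h, mem_nonZeroDivisors_iff_ne_zero.2 (pow_ne_zero h hP)⟩ :
      nonZeroDivisors (Ideal O)) = ⟨P, mem_nonZeroDivisors_iff_ne_zero.2 hP⟩ ^ h := rfl
    rw [this, map_pow, hh, pow_card_eq_one']
  rw [ClassGroup.mk0_eq_one_iff] at h1
  obtain ⟨⟨a, ha⟩⟩ := h1
  change P ^ h = Ideal.span {a} at ha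
  have ha0 : a ≠ 0 := by
    rintro rfl
    exact pow_ne_zero h hP (by rw [ha]; simp)
  have h2 : (normGen F (P ^ h)).natDegree = (Algebra.norm F[X] a).natDegree := by
    have h3 := span_normGen (F := F) (P ^ h)
    rw [ha, Ideal.relNorm_singleton, Algebra.intNorm_eq_norm, ← ha,
      Ideal.span_singleton_eq_span_singleton] at h3
    exact natDegree_eq_of_degree_eq (degree_eq_degree_of_associated h3)
  have h4 : normGen F (P ^ h) = normGen F P ^ h := by
    clear hh h2 ha
    induction h with
    | zero => rw [pow_zero, pow_zero, normGen_one]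
    | succ h ih =>
      rcases Nat.eq_zero_or_pos h with rfl | h0
      · simp
      · rw [pow_succ, normGen_mul (pow_ne_zero h hP) hP, ih h0, pow_succ]
  have hfin : ∀ I : Ideal O, I ≠ ⊥ → Module.Finite F (O ⧸ I) := fun I hI =>
    finite_quotient_of_ne_bot (Module.finBasis F[X] O) hI
  have h5 : finrank F (O ⧸ P ^ h) = h * finrank F (O ⧸ P) := by
    have h6 := cardQuot_pow_of_prime hP (i := h)
    have := hfin P hP
    have := hfin _ (pow_ne_zero h hP)
    rw [Submodule.cardQuot_apply, Submodule.cardQuot_apply] at h6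
    have e1 : Nat.card (O ⧸ P ^ h) = Nat.card F ^ finrank F (O ⧸ P ^ h) :=
      Module.natCard_eq_pow_finrank
    have e2 : Nat.card (O ⧸ P) = Nat.card F ^ finrank F (O ⧸ P) := Module.natCard_eq_pow_finrank
    have h7 := e1.symm.trans (h6.trans (congrArg (· ^ h) e2))
    simp only [← pow_mul] at h7
    rw [Nat.pow_right_injective Finite.one_lt_card h7, mul_comm]
  rw [ha, finrank_quotient_span_eq_natDegree_norm (Module.Free.chooseBasis F[X] O) ha0, ← h2, h4,
    natDegree_pow] at h5
  exact Nat.eq_of_mul_eq_mul_left hh0 h5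

end NormGen

section Homs

variable {p : ℕ} [Fact p.Prime] {k : Type*} [Field k] [IsAlgClosed k] [Algebra (ZMod p) k]
  {O : Type*} [CommRing O] [IsDedekindDomain O] [Algebra (ZMod p)[X] O]
  [Module.Finite (ZMod p)[X] O] [IsTorsionFree (ZMod p)[X] O] [Algebra (ZMod p) O]
  [IsScalarTower (ZMod p) (ZMod p)[X] O]

omit [IsAlgClosed k] [IsScalarTower (ZMod p) (ZMod p)[X] O] in
lemma ker_ne_bot_of_fixed {r : ℕ} (hr : 0 < r) {φ : O →ₐ[ZMod p] k} (hφ : ∀ x, φ x ^ p ^ r = φ x) :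
    RingHom.ker φ ≠ ⊥ := by
  intro h
  have h1 : algebraMap (ZMod p)[X] O (X ^ p ^ r - X) ∈ RingHom.ker φ := by
    rw [RingHom.mem_ker, map_sub, map_pow, map_sub, map_pow, hφ, sub_self]
  rw [h, Ideal.mem_bot, FaithfulSMul.algebraMap_eq_zero_iff] at h1
  exact FiniteField.X_pow_card_sub_X_ne_zero (ZMod p)
    (Nat.one_lt_pow hr.ne' (Fact.out : p.Prime).one_lt) h1

omit [IsAlgClosed k] in
lemma finrank_dvd_iff_fixed {P : Ideal O} (hP : P ≠ ⊥) {φ : O →ₐ[ZMod p] k}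
    (hφ : RingHom.ker φ = P) (r : ℕ) :
    finrank (ZMod p) (O ⧸ P) ∣ r ↔ ∀ x, φ x ^ p ^ r = φ x := by
  have hPp : P.IsPrime := hφ ▸ RingHom.ker_isPrime φ
  have hPm : P.IsMaximal := hPp.isMaximal hP
  let : Field (O ⧸ P) := Ideal.Quotient.field P
  have : Module.Finite (ZMod p) (O ⧸ P) :=
    finite_quotient_of_ne_bot (Module.finBasis (ZMod p)[X] O) hP
  have : Finite (O ⧸ P) := Module.finite_of_finite (ZMod p)
  have h1 : (∀ x, φ x ^ p ^ r = φ x) ↔ FiniteField.frobeniusAlgHom (ZMod p) (O ⧸ P) ^ r = 1 := by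
    rw [DFunLike.ext_iff]
    have h2 : ∀ (r : ℕ) (y : O ⧸ P), (FiniteField.frobeniusAlgHom (ZMod p) (O ⧸ P) ^ r) y =
        y ^ p ^ r := by
      intro r y
      induction r generalizing y with
      | zero => simp
      | succ r ih =>
        rw [pow_succ, AlgHom.mul_apply, ih, FiniteField.frobeniusAlgHom_apply, ZMod.card, ← pow_mul,
          ← pow_succ']
    constructor
    · intro h y
      obtain ⟨x, rfl⟩ := Ideal.Quotient.mk_surjective y
      rw [h2, AlgHom.one_apply, ← map_pow, Ideal.Quotient.eq, ← hφ, RingHom.mem_ker,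
          map_sub, map_pow,
        h x, sub_self]
    · intro h x
      have h3 := h (Ideal.Quotient.mk P x)
      rw [h2, AlgHom.one_apply, ← map_pow, Ideal.Quotient.eq, ← hφ, RingHom.mem_ker,
          map_sub, map_pow,
        sub_eq_zero] at h3
      exact h3
  rw [h1, ← FiniteField.orderOf_frobeniusAlgHom (ZMod p) (O ⧸ P), orderOf_dvd_iff_pow_eq_one]

lemma natCard_hom_ker_eq {P : Ideal O} (hP : P ≠ ⊥) [P.IsPrime] :
    Nat.card {φ : O →ₐ[ZMod p] k // RingHom.ker φ = P} = finrank (ZMod p) (O ⧸ P) := by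
  have hPm : P.IsMaximal := (inferInstance : P.IsPrime).isMaximal hP
  let : Field (O ⧸ P) := Ideal.Quotient.field P
  have : Module.Finite (ZMod p) (O ⧸ P) :=
    finite_quotient_of_ne_bot (Module.finBasis (ZMod p)[X] O) hP
  have h := AlgHom.natCard_of_splits (ZMod p) (O ⧸ P) k fun x => IsAlgClosed.splits _
  rw [← h]
  refine Nat.card_congr ⟨fun φ => Ideal.Quotient.liftₐ P φ.1 fun a ha => by
      rwa [← φ.2, RingHom.mem_ker] at ha,
    fun ψ => ⟨ψ.comp (Ideal.Quotient.mkₐ (ZMod p) P), ?_⟩, fun φ => ?_, fun ψ => ?_⟩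
  · ext x
    rw [RingHom.mem_ker, AlgHom.comp_apply, Ideal.Quotient.mkₐ_eq_mk, map_eq_zero,
      Ideal.Quotient.eq_zero_iff_mem]
  · ext x; rfl
  · refine AlgHom.ext fun x => ?_
    obtain ⟨x, rfl⟩ := Ideal.Quotient.mk_surjective x
    rfl

omit [IsAlgClosed k] [IsDedekindDomain O] [IsTorsionFree (ZMod p)[X] O] in
variable (p k O) in
lemma finite_fixed_homs {r : ℕ} (hr : 0 < r) :
    {φ : O →ₐ[ZMod p] k | ∀ x, φ x ^ p ^ r = φ x}.Finite := by
  classical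
  have hft : Algebra.FiniteType (ZMod p) O :=
    Algebra.FiniteType.trans (inferInstance : Algebra.FiniteType (ZMod p) (ZMod p)[X])
      (inferInstance : Algebra.FiniteType (ZMod p)[X] O)
  obtain ⟨s, hs⟩ := hft
  have hQ := Nat.one_lt_pow hr.ne' (Fact.out : p.Prime).one_lt
  have hfin : (Set.pi Set.univ fun _ : s => (fixedPts k (p ^ r) : Set k)).Finite :=
    Set.Finite.pi fun _ => Finset.finite_toSet _
  refine Set.Finite.of_finite_image (f := fun φ (a : s) => φ a) (hfin.subset ?_) ?_
  · rintro _ ⟨φ, hφ, rfl⟩ a -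
    exact (mem_fixedPts hQ).2 (hφ a)
  · intro φ _ φ' _ h
    refine AlgHom.ext_of_adjoin_eq_top hs fun x hx => ?_
    exact congrFun h ⟨x, hx⟩

omit [IsAlgClosed k] in
lemma frobPoly_eq_normGen_pow {r : ℕ} (hr : 0 < r) {φ : O →ₐ[ZMod p] k}
    (hφ : ∀ x, φ x ^ p ^ r = φ x) :
    frobPoly p r (φ (algebraMap (ZMod p)[X] O X)) =
      normGen (ZMod p) (RingHom.ker φ) ^ (r / (normGen (ZMod p) (RingHom.ker φ)).natDegree) := by
  obtain ⟨x₀, hx₀⟩ : ∃ x₀, x₀ = φ (algebraMap (ZMod p)[X] O X) := ⟨_, rfl⟩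
  have hfix : x₀ ^ p ^ r = x₀ := hx₀ ▸ hφ _
  have hint := isIntegral_of_pow_eq hr hfix
  have hP := ker_ne_bot_of_fixed hr hφ
  have hPp : (RingHom.ker φ).IsPrime := RingHom.ker_isPrime φ
  have hunder : (RingHom.ker φ).under (ZMod p)[X] = Ideal.span {minpoly (ZMod p) x₀} := by
    ext g
    rw [Ideal.mem_comap, RingHom.mem_ker, Ideal.mem_span_singleton, minpoly.dvd_iff, hx₀]
    have : φ (algebraMap (ZMod p)[X] O g) = aeval (φ (algebraMap (ZMod p)[X] O X)) g := by
      have h2 : (φ.comp (IsScalarTower.toAlgHom (ZMod p) (ZMod p)[X] O)) =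
          aeval (φ (algebraMap (ZMod p)[X] O X)) := by
        ext; simp
      exact DFunLike.congr_fun h2 g
    rw [this]
  obtain ⟨s, hs⟩ := Ideal.exists_relNorm_eq_pow_of_isPrime (RingHom.ker φ)
    ((RingHom.ker φ).under (ZMod p)[X])
  rw [hunder, Ideal.span_singleton_pow] at hs
  have hN := normGen_eq ((minpoly.monic hint).pow s) hs
  have hd : (normGen (ZMod p) (RingHom.ker φ)).natDegree ∣ r := by
    rw [natDegree_normGen_eq_finrank hP]
    exact (finrank_dvd_iff_fixed hP rfl r).2 hφ
  rw [← hx₀, frobPoly]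
  have hμ : 0 < (minpoly (ZMod p) x₀).natDegree := minpoly.natDegree_pos hint
  rw [hN] at hd ⊢
  rw [natDegree_pow] at hd ⊢
  rw [← pow_mul]
  obtain ⟨t, ht⟩ := hd
  congr 1
  have hs0 : 0 < s := by
    rcases Nat.eq_zero_or_pos s with rfl | h
    · rw [zero_mul, zero_mul] at ht; omega
    · exact h
  rw [ht, Nat.mul_div_cancel_left _ (Nat.mul_pos hs0 hμ), mul_assoc, mul_comm s, mul_assoc,
    Nat.mul_div_cancel_left _ hμ, mul_comm]

lemma sum_fixed_homs {lam : (ZMod p)[X] → ℂ} (hlam1 : lam 1 = 1)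
    (hlam : ∀ g h : (ZMod p)[X], g.Monic → h.Monic → lam (g * h) = lam g * lam h)
    {T : ℕ → Finset (Ideal O)}
    (hT : ∀ n I, I ∈ T n ↔ I ≠ ⊥ ∧ (normGen (ZMod p) I).natDegree = n) {r : ℕ} (hr : 0 < r)
    {H : Finset (O →ₐ[ZMod p] k)} (hH : ∀ φ, φ ∈ H ↔ ∀ x, φ x ^ p ^ r = φ x) :
    ∑ φ ∈ H, lam (frobPoly p r (φ (algebraMap (ZMod p)[X] O X))) =
      ∑ P ∈ primesOfDegDvd (fun I : Ideal O => (normGen (ZMod p) I).natDegree) T r,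
        ((normGen (ZMod p) P).natDegree : ℂ) *
          lam (normGen (ZMod p) P) ^ (r / (normGen (ZMod p) P).natDegree) := by
  classical
  have hpow : ∀ g : (ZMod p)[X], g.Monic → ∀ n, lam (g ^ n) = lam g ^ n := by
    intro g hg n
    induction n with
    | zero => rw [pow_zero, pow_zero, hlam1]
    | succ n ih => rw [pow_succ, hlam _ _ (hg.pow n) hg, ih, pow_succ]
  rw [← Finset.sum_fiberwise_of_maps_to (t := primesOfDegDvd _ T r)
    (g := fun φ : O →ₐ[ZMod p] k => RingHom.ker φ)]
  · refine Finset.sum_congr rfl fun P hP => ?_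
    rw [mem_primesOfDegDvd hT hr] at hP
    obtain ⟨hP0, hPp, hPd⟩ := hP
    rw [natDegree_normGen_eq_finrank hP0] at hPd ⊢
    rw [Finset.sum_congr rfl (g := fun _ => lam (normGen (ZMod p) P)
        ^ (r / finrank (ZMod p) (O ⧸ P)))]
    · rw [Finset.sum_const, nsmul_eq_mul, ← natCard_hom_ker_eq (k := k) hP0]
      rw [Nat.subtype_card (H.filter fun φ => RingHom.ker φ = P)]
      intro φ
      rw [Finset.mem_filter, and_iff_right_iff_imp, hH]
      intro h
      exact (finrank_dvd_iff_fixed hP0 h r).1 hPd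
    · intro φ hφ
      obtain ⟨h1, h2⟩ := Finset.mem_filter.1 hφ
      rw [frobPoly_eq_normGen_pow hr ((hH φ).1 h1), h2, hpow _ (monic_normGen hP0),
        natDegree_normGen_eq_finrank hP0]
  · intro φ hφ
    have hφ' := (hH φ).1 hφ
    have hP := ker_ne_bot_of_fixed hr hφ'
    have hPp : (RingHom.ker φ).IsPrime := RingHom.ker_isPrime φ
    rw [mem_primesOfDegDvd hT hr]
    refine ⟨hP, hPp, ?_⟩
    rw [natDegree_normGen_eq_finrank hP]
    exact (finrank_dvd_iff_fixed hP rfl r).2 hφ'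

variable (k) in
/-- Square root cancellation from a bound in a divisible set of extensions together with the
vanishing of the coefficients of large degree of the associated `L`-series. -/
theorem norm_sum_fixed_homs_le {lam : (ZMod p)[X] → ℂ} (hlam1 : lam 1 = 1)
    (hlam : ∀ g h : (ZMod p)[X], g.Monic → h.Monic → lam (g * h) = lam g * lam h) {D : ℕ}
    (hD : ∀ n, D < n → ∀ T : Finset (Ideal O),
      (∀ I, I ∈ T ↔ I ≠ ⊥ ∧ (normGen (ZMod p) I).natDegree = n) →
      ∑ I ∈ T, lam (normGen (ZMod p) I) = 0)
    {A C : ℝ} (hA : 0 < A) {r₀ : ℕ} (hr₀ : 0 < r₀)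
    (hS : ∀ r, 0 < r → r₀ ∣ r → ∀ H : Finset (O →ₐ[ZMod p] k),
      (∀ φ, φ ∈ H ↔ ∀ x, φ x ^ p ^ r = φ x) →
      ‖∑ φ ∈ H, lam (frobPoly p r (φ (algebraMap (ZMod p)[X] O X)))‖ ≤ C * A ^ r)
    {H : Finset (O →ₐ[ZMod p] k)} (hH : ∀ φ, φ ∈ H ↔ ∀ x, φ x ^ p = φ x) :
    ‖∑ φ ∈ H, lam (frobPoly p 1 (φ (algebraMap (ZMod p)[X] O X)))‖ ≤ D * A := by
  obtain ⟨T, hT'⟩ : ∃ T : ℕ → Finset (Ideal O), ∀ n,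
      (T n : Set (Ideal O)) = {I | I ≠ ⊥ ∧ (normGen (ZMod p) I).natDegree = n} :=
    ⟨fun n => (finite_natDegree_normGen_eq n).toFinset, fun n => Set.Finite.coe_toFinset _⟩
  have hT : ∀ n I, I ∈ T n ↔ I ≠ ⊥ ∧ (normGen (ZMod p) I).natDegree = n := by
    intro n I
    rw [← Finset.mem_coe, hT' n, Set.mem_ofPred_eq]
  obtain ⟨deg, hdeg⟩ : ∃ deg : Ideal O → ℕ, deg = fun I => (normGen (ZMod p) I).natDegree :=
    ⟨_, rfl⟩
  have hnewton := newton_ideals (deg := deg) (lam := fun I => lam (normGen (ZMod p) I)) (T := T)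
    (fun I J hI hJ => by
      rw [hdeg]
      change (normGen (ZMod p) (I * J)).natDegree = _
      rw [normGen_mul hI hJ, (monic_normGen hI).natDegree_mul (monic_normGen hJ)])
    (fun P hP hPp => by
      rw [hdeg]
      change 0 < (normGen (ZMod p) P).natDegree
      rw [natDegree_normGen_eq_finrank hP]
      have : Module.Finite (ZMod p) (O ⧸ P) :=
        finite_quotient_of_ne_bot (Module.finBasis (ZMod p)[X] O) hP
      have : Nontrivial (O ⧸ P) := Ideal.Quotient.nontrivial_iff.2 hPp.ne_top
      exact finrank_pos)
    (by rw [normGen_one, hlam1])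
    (fun I J hI hJ => by rw [normGen_mul hI hJ, hlam _ _ (monic_normGen hI) (monic_normGen hJ)])
    (fun n I => by rw [hT, hdeg])
  have hS' : ∀ r, 0 < r → ∀ H : Finset (O →ₐ[ZMod p] k), (∀ φ, φ ∈ H ↔ ∀ x, φ x ^ p ^ r = φ x) →
      ∑ φ ∈ H, lam (frobPoly p r (φ (algebraMap (ZMod p)[X] O X))) =
      ∑ P ∈ primesOfDegDvd deg T r, (deg P : ℂ) * lam (normGen (ZMod p) P) ^ (r / deg P) := by
    intro r hr H hH
    rw [hdeg]
    exact sum_fixed_homs hlam1 hlam hT hr hH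
  rw [hS' 1 one_pos H (by simpa using hH)]
  refine norm_le_of_newton (c := fun n => ∑ I ∈ T n, lam (normGen (ZMod p) I))
    (S := fun r => ∑ P ∈ primesOfDegDvd deg T r,
      (deg P : ℂ) * lam (normGen (ZMod p) P) ^ (r / deg P)) ?_
    (fun n hn => hD n hn (T n) (hT n)) hnewton hA (C := C) hr₀ ?_
  · have h0 : T 0 = {1} := by
      ext I
      rw [hT, Finset.mem_singleton]
      constructor
      · rintro ⟨hI, h⟩
        have h1 : normGen (ZMod p) I = 1 := (monic_normGen hI).natDegree_eq_zero.1 h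
        have h2 := Ideal.relNorm_le_comap (ZMod p)[X] I
        rw [← span_normGen, h1, Ideal.span_singleton_one, top_le_iff, Ideal.comap_eq_top_iff] at h2
        rw [h2, Ideal.one_eq_top]
      · rintro rfl
        exact ⟨one_ne_zero, by rw [normGen_one, natDegree_one]⟩
    change ∑ I ∈ T 0, lam (normGen (ZMod p) I) = 1
    rw [h0, Finset.sum_singleton, normGen_one, hlam1]
  · intro r hr hrr
    have hf := finite_fixed_homs p k O hr
    have hH' : ∀ φ, φ ∈ hf.toFinset ↔ ∀ x, φ x ^ p ^ r = φ x := by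
      intro φ
      rw [Set.Finite.mem_toFinset, Set.mem_ofPred_eq]
    have := hS r hr hrr hf.toFinset hH'
    rwa [hS' r hr _ hH'] at this

end Homs

lemma aeval_pow_char_pow {p : ℕ} [Fact p.Prime] {B : Type*} [CommRing B] [Algebra (ZMod p) B]
    (x : B) (g : (ZMod p)[X]) (r : ℕ) : aeval x g ^ p ^ r = aeval (x ^ p ^ r) g := by
  induction r generalizing x with
  | zero => simp
  | succ r ih =>
    rw [pow_succ', pow_mul, pow_mul, ← ih (x ^ p), ← expand_aeval, ZMod.expand_card, map_pow]

lemma sum_eq_zero_of_injOn {α : Type*} {M : Finset α} {f : α → ℂ} {σ : α → α}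
    (hσ : ∀ a ∈ M, σ a ∈ M) (hinj : Set.InjOn σ M) {c : ℂ} (hc : c ≠ 1)
    (hf : ∀ a ∈ M, f (σ a) = c * f a) : ∑ a ∈ M, f a = 0 := by
  have h1 : ∑ a ∈ M, f (σ a) = ∑ a ∈ M, f a :=
    Finset.sum_bij (fun a _ => σ a) hσ (fun a ha b hb h => hinj ha hb h)
      (fun b hb => by
        obtain ⟨a, ha, h⟩ := Finset.surjOn_of_injOn_of_card_le σ hσ hinj le_rfl hb
        exact ⟨a, ha, h⟩) (fun _ _ => rfl)
  rw [Finset.sum_congr rfl hf, ← Finset.mul_sum] at h1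
  have h2 : (c - 1) * ∑ a ∈ M, f a = 0 := by rw [sub_mul, h1, one_mul, sub_self]
  exact (mul_eq_zero.1 h2).resolve_left (sub_ne_zero.2 hc)

section W1

variable {p : ℕ} [Fact p.Prime]

lemma normGen_span_self {F : Type*} [Field F] {g : F[X]} (hg : g.Monic) :
    normGen F (Ideal.span {g} : Ideal F[X]) = g :=
  normGen_eq hg (by rw [Ideal.relNorm_singleton, Algebra.intNorm_eq_norm]; simp)

/-- The coefficient weight attached to a multiplicative character of the values at `-1, …, -d` and
an additive character of the second coefficient. -/
noncomputable def shiftWeight (d : ℕ) (χ : MulChar (ZMod p) ℂ) (ψ : AddChar (ZMod p) ℂ)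
    (g : (ZMod p)[X]) : ℂ :=
  χ (∏ i ∈ Finset.Icc 1 d, eval (-(i : ZMod p)) g) * ψ (-g.nextCoeff)

lemma shiftWeight_mul (d : ℕ) (χ : MulChar (ZMod p) ℂ) (ψ : AddChar (ZMod p) ℂ)
    {g h : (ZMod p)[X]} (hg : g.Monic) (hh : h.Monic) :
    shiftWeight d χ ψ (g * h) = shiftWeight d χ ψ g * shiftWeight d χ ψ h := by
  simp only [shiftWeight, eval_mul, Finset.prod_mul_distrib, map_mul, Monic.nextCoeff_mul hg hh,
    neg_add, AddChar.map_add_eq_mul]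
  ring

lemma natCast_ne_of_lt {d : ℕ} (hdp : d < p) {i j : ℕ} (hi : i ≤ d) (hj : j ≤ d) (hij : i ≠ j) :
    (i : ZMod p) ≠ j := by
  intro h
  rw [ZMod.natCast_eq_natCast_iff', Nat.mod_eq_of_lt (by omega), Nat.mod_eq_of_lt (by omega)] at h
  exact hij h

lemma exists_shift_poly {d : ℕ} (hd : 1 ≤ d) (hdp : d < p) :
    ∃ l : (ZMod p)[X], l.natDegree < d ∧ eval (-1) l = 1 ∧
      ∀ i ∈ Finset.Icc 2 d, eval (-(i : ZMod p)) l = 0 := by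
  obtain ⟨m, hm⟩ : ∃ m : (ZMod p)[X], m = ∏ i ∈ Finset.Icc 2 d, (X + C (i : ZMod p)) := ⟨_, rfl⟩
  have h1 : eval (-1) m ≠ 0 := by
    rw [hm, eval_prod, Finset.prod_ne_zero_iff]
    intro i hi
    rw [Finset.mem_Icc] at hi
    simp only [eval_add, eval_X, eval_C]
    intro h
    refine natCast_ne_of_lt hdp hi.2 hd (by omega) ?_
    rw [Nat.cast_one]
    linear_combination h
  refine ⟨C (eval (-1) m)⁻¹ * m, ?_, ?_, ?_⟩
  · refine (natDegree_C_mul_le _ _).trans_lt ?_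
    rw [hm, natDegree_prod_of_monic _ _ fun i _ => monic_X_add_C _]
    simp only [natDegree_X_add_C, Finset.sum_const, Nat.card_Icc, smul_eq_mul, mul_one]
    omega
  · rw [eval_mul, eval_C, inv_mul_cancel₀ h1]
  · intro i hi
    have : eval (-(i : ZMod p)) m = 0 := by
      rw [hm, eval_prod, Finset.prod_eq_zero hi]
      simp
    rw [eval_mul, this, mul_zero]

lemma sum_shiftWeight_eq_zero {d : ℕ} (hd : 1 ≤ d) (hdp : d < p) {χ : MulChar (ZMod p) ℂ}
    (hχ : χ ≠ 1) (ψ : AddChar (ZMod p) ℂ) {n : ℕ} (hn : d < n) {M : Finset (ZMod p)[X]}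
    (hM : ∀ g, g ∈ M ↔ g.Monic ∧ g.natDegree = n) : ∑ g ∈ M, shiftWeight d χ ψ g = 0 := by
  obtain ⟨l, hl, hl1, hl0⟩ := exists_shift_poly hd hdp
  obtain ⟨u, hu, hu0⟩ : ∃ u : ZMod p, χ u ≠ 1 ∧ u ≠ 0 := by
    obtain ⟨u, hu⟩ := MulChar.ne_one_iff.1 hχ
    exact ⟨u, hu, u.ne_zero⟩
  have hdeg : ∀ (g : (ZMod p)[X]) (c : ZMod p), g.natDegree =
      n → (C c * l).natDegree + 1 < g.natDegree := by
    intro g c hg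
    have := natDegree_C_mul_le c l
    omega
  have h1 : ∀ g, eval (-1) (g + C ((u - 1) * eval (-1) g) * l) = u * eval (-1) g := by
    intro g
    rw [eval_add, eval_mul, eval_C, hl1]; ring
  refine sum_eq_zero_of_injOn (σ := fun g => g + C ((u - 1) * eval (-1) g) * l) ?_ ?_ hu ?_
  · intro g hg
    rw [hM] at hg ⊢
    have h2 := hdeg g ((u - 1) * eval (-1) g) hg.2
    refine ⟨hg.1.add_of_left (degree_lt_degree (by omega)), ?_⟩
    rw [natDegree_add_eq_left_of_natDegree_lt (by omega), hg.2]
  · intro g _ g' _ h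
    have h2 := congrArg (eval (-1)) h
    simp only [h1] at h2
    have h3 := mul_left_cancel₀ hu0 h2
    simp only [h3] at h
    exact add_right_cancel h
  · intro g hg
    rw [hM] at hg
    have h2 := hdeg g ((u - 1) * eval (-1) g) hg.2
    have h3 : (g + C ((u - 1) * eval (-1) g) * l).nextCoeff = g.nextCoeff := by
      rw [nextCoeff, nextCoeff, natDegree_add_eq_left_of_natDegree_lt (by omega),
        if_neg (by omega), if_neg (by omega), coeff_add,
        coeff_eq_zero_of_natDegree_lt (p := C ((u - 1) * eval (-1) g) * l) (by omega), add_zero]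
    rw [shiftWeight, shiftWeight, h3, ← mul_assoc]
    congr 1
    rw [← map_mul]
    congr 1
    have hIcc : Finset.Icc 1 d = insert 1 (Finset.Icc 2 d) := by
      ext i
      simp only [Finset.mem_insert, Finset.mem_Icc]
      omega
    rw [hIcc, Finset.prod_insert (by simp), Finset.prod_insert (by simp), Nat.cast_one, h1,
        mul_assoc]
    congr 2
    refine Finset.prod_congr rfl fun i hi => ?_
    rw [eval_add, eval_mul, hl0 i hi, mul_zero, add_zero]

/-- The sum of the weights over the points of `A¹` fixed by Frobenius. -/
lemma shiftWeight_frobPoly {k : Type*} [Field k] [Algebra (ZMod p) k] (d : ℕ)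
    (χ : MulChar (ZMod p) ℂ) (ψ : AddChar (ZMod p) ℂ) {r : ℕ} (hr : 0 < r) {x : k}
    (hx : x ^ p ^ r = x) :
    shiftWeight d χ ψ (frobPoly p r x) =
      liftFn k χ (((-1) ^ r) ^ d * frobNorm p r (∏ i ∈ Finset.Icc 1 d, (x + (i : k)))) *
        liftFn k ψ (frobTrace p r x) := by
  have hmap := (map_frobPoly hr hx).1
  have hmon := monic_frobPoly hr hx
  have : CharP k p := charP_of_injective_algebraMap (algebraMap (ZMod p) k).injective p
  have h1 : algebraMap (ZMod p) k (∏ i ∈ Finset.Icc 1 d, eval (-(i : ZMod p)) (frobPoly p r x)) =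
      ((-1) ^ r) ^ d * frobNorm p r (∏ i ∈ Finset.Icc 1 d, (x + (i : k))) := by
    have h2 : ∀ i : ℕ, algebraMap (ZMod p) k (eval (-(i : ZMod p)) (frobPoly p r x)) =
        (-1) ^ r * ∏ j ∈ Finset.range r, (x + (i : k)) ^ p ^ j := by
      intro i
      rw [← eval_map_apply, hmap, eval_prod]
      conv_rhs => rw [← Finset.card_range r, ← Finset.prod_const, Finset.card_range,
        ← Finset.prod_mul_distrib]
      refine Finset.prod_congr rfl fun j _ => ?_
      rw [add_pow_char_pow, eval_sub, eval_X, eval_C, map_neg, map_natCast]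
      have : (i : k) ^ p ^ j = i := by
        have h3 : ((i : ZMod p)) ^ p ^ j = i := ZMod.pow_card_pow _
        have h4 := congrArg (algebraMap (ZMod p) k) h3
        rwa [map_pow, map_natCast] at h4
      rw [this]; ring
    rw [map_prod, Finset.prod_congr rfl fun i _ => h2 i, Finset.prod_mul_distrib, Finset.prod_const,
      Nat.card_Icc, Nat.add_sub_cancel, frobNorm, Finset.prod_comm]
    congr 1
    exact Finset.prod_congr rfl fun j _ => Finset.prod_pow _ _ _
  have h2 : algebraMap (ZMod p) k (-(frobPoly p r x).nextCoeff) = frobTrace p r x := by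
    rw [map_neg, ← nextCoeff_map (algebraMap (ZMod p) k).injective, hmap,
      prod_X_sub_C_nextCoeff, neg_neg, frobTrace]
  rw [shiftWeight, ← h1, ← h2, liftFn_algebraMap, liftFn_algebraMap]

lemma separable_prod_X_add_natCast {k : Type*} [Field k] [Algebra (ZMod p) k] {d : ℕ}
    (hdp : d < p) : (∏ i ∈ Finset.Icc 1 d, (X + C (i : k))).Separable := by
  refine separable_prod' (fun i hi j hj hij => ?_) fun i _ => ?_
  · rw [← sub_neg_eq_add, ← sub_neg_eq_add X, ← C_neg, ← C_neg]
    refine isCoprime_X_sub_C_of_isUnit_sub (IsUnit.mk0 _ ?_)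
    rw [Finset.mem_Icc] at hi hj
    have h := natCast_ne_of_lt hdp hi.2 hj.2 hij
    intro h2
    apply h
    apply (algebraMap (ZMod p) k).injective
    rw [map_natCast, map_natCast]
    linear_combination -h2
  · have := separable_X_sub_C (x := -(i : k))
    rwa [C_neg, sub_neg_eq_add] at this

/-- The homomorphisms from `𝔽_p[X]` fixed by Frobenius are the evaluations at fixed points. -/
lemma sum_polynomial_homs {k : Type*} [Field k] [DecidableEq k] [Algebra (ZMod p) k] {r : ℕ}
    (hr : 0 < r) {H : Finset ((ZMod p)[X] →ₐ[ZMod p] k)}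
    (hH : ∀ φ, φ ∈ H ↔ ∀ x, φ x ^ p ^ r = φ x) (f : k → ℂ) :
    ∑ φ ∈ H, f (φ X) = ∑ x ∈ fixedPts k (p ^ r), f x := by
  have hQ := Nat.one_lt_pow hr.ne' (Fact.out : p.Prime).one_lt
  refine Finset.sum_bij (fun φ _ => φ X) (fun φ hφ => (mem_fixedPts hQ).2 ((hH φ).1 hφ X))
    (fun φ _ φ' _ h => Polynomial.algHom_ext h) (fun x hx => ?_) (fun _ _ => rfl)
  rw [mem_fixedPts hQ] at hx
  refine ⟨aeval x, (hH _).2 fun g => ?_, aeval_X x⟩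
  rw [aeval_pow_char_pow, hx]

lemma sum_ideals_shiftWeight_eq_zero {d : ℕ} (hd : 1 ≤ d) (hdp : d < p) {χ : MulChar (ZMod p) ℂ}
    (hχ : χ ≠ 1) (ψ : AddChar (ZMod p) ℂ) {n : ℕ} (hn : d < n) (T : Finset (Ideal (ZMod p)[X]))
    (hT : ∀ I, I ∈ T ↔ I ≠ ⊥ ∧ (normGen (ZMod p) I).natDegree = n) :
    ∑ I ∈ T, shiftWeight d χ ψ (normGen (ZMod p) I) = 0 := by
  classical
  have hinj : Set.InjOn (fun I : Ideal (ZMod p)[X] => normGen (ZMod p) I) T := by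
    intro I _ J _ h
    have h1 := span_normGen (F := ZMod p) I
    have h2 := span_normGen (F := ZMod p) J
    simp only at h
    have h3 : ∀ I : Ideal (ZMod p)[X], Ideal.relNorm (ZMod p)[X] I = I := by
      intro I
      have := Ideal.relNorm_algebraMap (R := (ZMod p)[X]) (ZMod p)[X] I
      rwa [finrank_self, pow_one, Algebra.algebraMap_self, Ideal.map_id] at this
    rw [h3] at h1 h2
    rw [← h1, ← h2, h]
  rw [← Finset.sum_image (f := shiftWeight d χ ψ) hinj]
  refine sum_shiftWeight_eq_zero hd hdp hχ ψ hn fun g => ?_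
  rw [Finset.mem_image]
  constructor
  · rintro ⟨I, hI, rfl⟩
    rw [hT] at hI
    exact ⟨monic_normGen hI.1, hI.2⟩
  · rintro ⟨h1, h2⟩
    refine ⟨Ideal.span {g}, (hT _).2 ⟨?_, ?_⟩, normGen_span_self h1⟩
    · rw [Ne, Ideal.span_singleton_eq_bot]
      exact h1.ne_zero
    · rw [normGen_span_self h1, h2]

lemma sum_fixedPts_shiftWeight (k : Type*) [Field k] [DecidableEq k] [Algebra (ZMod p) k] {d : ℕ}
    (χ : MulChar (ZMod p) ℂ) (ψ : AddChar (ZMod p) ℂ) :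
    ∑ x ∈ fixedPts k (p ^ 1), shiftWeight d χ ψ (frobPoly p 1 x) =
      χ ((-1) ^ d) * ∑ x : ZMod p, χ (∏ i ∈ Finset.Icc 1 d, (x + (i : ZMod p))) * ψ x := by
  have hp1 : 1 < p ^ 1 := by rw [pow_one]; exact (Fact.out : p.Prime).one_lt
  rw [Finset.mul_sum]
  symm
  refine Finset.sum_bij (fun u _ => algebraMap (ZMod p) k u) ?_ ?_ ?_ ?_
  · intro u _
    rw [mem_fixedPts hp1, ← map_pow, pow_one, ZMod.pow_card]
  · exact fun u _ v _ h => (algebraMap (ZMod p) _).injective h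
  · intro x hx
    rw [mem_fixedPts hp1, pow_one] at hx
    obtain ⟨u, hu⟩ := exists_zmod_of_pow_eq (algebraMap (ZMod p) _) hx
    exact ⟨u, Finset.mem_univ _, hu⟩
  · intro u _
    rw [frobPoly_one, shiftWeight, nextCoeff_X_sub_C, neg_neg, ← mul_assoc, ← map_mul]
    congr 2
    simp only [eval_sub, eval_X, eval_C]
    have h : ((-1 : ZMod p)) ^ d = ∏ i ∈ Finset.Icc 1 d, (-1) := by
      rw [Finset.prod_const, Nat.card_Icc, Nat.add_sub_cancel]
    rw [h, ← Finset.prod_mul_distrib]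
    exact Finset.prod_congr rfl fun i _ => by ring

lemma norm_sum_mulChar_shift_le_aux (k : Type*) [Field k] [IsAlgClosed k] [DecidableEq k]
    [CharP k p] [Algebra (ZMod p) k] [Algebra.IsAlgebraic (ZMod p) k] {d : ℕ} (hd : 1 ≤ d)
    (hdp : d < p) {χ : MulChar (ZMod p) ℂ} (hχ : χ ≠ 1) (ψ : AddChar (ZMod p) ℂ) :
    ‖∑ x : ZMod p, χ (∏ i ∈ Finset.Icc 1 d, (x + (i : ZMod p))) * ψ x‖ ≤ d * √p := by
  have hp0 : 0 < p := (Fact.out : p.Prime).pos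
  obtain ⟨r₀, hr₀, C₀, hC₀⟩ := mixed_sum_bound (k := k) p
    (f := ∏ i ∈ Finset.Icc 1 d, (X + C (i : k))) (separable_prod_X_add_natCast hdp) (by
      rw [natDegree_prod_of_monic _ _ fun i _ => monic_X_add_C _]
      simp only [natDegree_X_add_C, Finset.sum_const, Nat.card_Icc, smul_eq_mul, mul_one]
      omega) χ hχ ψ
  have hf := finite_fixed_homs p k (ZMod p)[X] one_pos
  obtain ⟨H, hH⟩ : ∃ H : Finset ((ZMod p)[X] →ₐ[ZMod p] k),
      ∀ φ, φ ∈ H ↔ ∀ x, φ x ^ p ^ 1 = φ x :=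
    ⟨hf.toFinset, fun φ => by rw [Set.Finite.mem_toFinset, Set.mem_ofPred_eq]⟩
  have hS : ∀ r, 0 < r → r₀ * 2 ∣ r → ∀ H : Finset ((ZMod p)[X] →ₐ[ZMod p] k),
      (∀ φ, φ ∈ H ↔ ∀ x, φ x ^ p ^ r = φ x) →
      ‖∑ φ ∈ H, shiftWeight d χ ψ (frobPoly p r (φ (algebraMap (ZMod p)[X] (ZMod p)[X] X)))‖ ≤
        C₀ * √p ^ r := by
    rintro r hr ⟨t, rfl⟩ H hH
    have ht : 0 < r₀ * t := Nat.mul_pos hr₀ (Nat.pos_of_ne_zero (by rintro rfl; simp at hr))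
    have hrt : r₀ * 2 * t = r₀ * t * 2 := by ring
    rw [hrt] at hr hH ⊢
    have h1 := hC₀ (r₀ * t) ht (dvd_mul_right _ _)
    simp only [Algebra.algebraMap_self, RingHom.id_apply]
    rw [sum_polynomial_homs hr hH (fun x => shiftWeight d χ ψ (frobPoly p (r₀ * t * 2) x))]
    have hsq : (√p) ^ (r₀ * t * 2) = (p : ℝ) ^ (r₀ * t) := by
      rw [mul_comm, pow_mul, Real.sq_sqrt (Nat.cast_nonneg p)]
    rw [hsq]
    rw [← pow_mul] at h1
    refine le_of_eq_of_le ?_ h1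
    congr 1
    refine Finset.sum_congr rfl fun x hx => ?_
    rw [mem_fixedPts (Nat.one_lt_pow hr.ne' (Fact.out : p.Prime).one_lt)] at hx
    rw [shiftWeight_frobPoly d χ ψ hr hx, mul_comm (r₀ * t) 2, pow_mul, neg_one_sq, one_pow,
      one_pow, one_mul, eval_prod]
    simp only [eval_add, eval_X, eval_C]
  have hmain := norm_sum_fixed_homs_le k (O := (ZMod p)[X])
    (lam := shiftWeight d χ ψ) (by simp [shiftWeight, nextCoeff])
    (fun g h => shiftWeight_mul d χ ψ) (D := d)
    (fun n hn T hT => sum_ideals_shiftWeight_eq_zero hd hdp hχ ψ hn T hT)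
    (Real.sqrt_pos.2 (by exact_mod_cast hp0)) (r₀ := r₀ * 2) (by omega) hS (H := H)
    (by simpa using hH)
  simp only [Algebra.algebraMap_self, RingHom.id_apply] at hmain
  rw [sum_polynomial_homs one_pos hH (fun x => shiftWeight d χ ψ (frobPoly p 1 x)),
    sum_fixedPts_shiftWeight, norm_mul] at hmain
  have hone : ‖χ ((-1) ^ d)‖ = 1 := by
    refine Complex.norm_eq_one_of_pow_eq_one (n := 2) ?_ two_ne_zero
    rw [← map_pow, ← pow_mul, mul_comm, pow_mul, neg_one_sq, one_pow, map_one]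
  rwa [hone, one_mul] at hmain

/-- Weil's bound for mixed character sums of a product of consecutive shifts. -/
theorem norm_sum_mulChar_shift_le {d : ℕ} (hd : 1 ≤ d) (hdp : d < p) {χ : MulChar (ZMod p) ℂ}
    (hχ : χ ≠ 1) (ψ : AddChar (ZMod p) ℂ) :
    ‖∑ x : ZMod p, χ (∏ i ∈ Finset.Icc 1 d, (x + (i : ZMod p))) * ψ x‖ ≤ d * √p := by
  classical
  have : CharP (AlgebraicClosure (ZMod p)) p :=
    charP_of_injective_algebraMap (algebraMap (ZMod p) _).injective p
  exact norm_sum_mulChar_shift_le_aux (AlgebraicClosure (ZMod p)) hd hdp hχ ψ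

end W1

section AtInfinity

variable {F : Type*} [Field F]

/-- The rational functions that are regular at infinity. -/
noncomputable def inftyRing (F : Type*) [Field F] : Subring (RatFunc F) where
  carrier := {f | f.intDegree ≤ 0}
  mul_mem' {f g} hf hg := by
    rcases eq_or_ne f 0 with rfl | hf0
    · simp
    rcases eq_or_ne g 0 with rfl | hg0
    · simp
    simp only [Set.mem_ofPred_eq] at *
    rw [RatFunc.intDegree_mul hf0 hg0]
    omega
  one_mem' := by simp
  add_mem' {f g} hf hg := by
    simp only [Set.mem_ofPred_eq] at *
    rcases eq_or_ne g 0 with rfl | hg0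
    · simpa
    rcases eq_or_ne (f + g) 0 with h | h
    · simp [h]
    · exact (RatFunc.intDegree_add_le hg0 h).trans (max_le hf hg)
  zero_mem' := by simp
  neg_mem' {f} hf := by simpa using hf

lemma mem_inftyRing {f : RatFunc F} : f ∈ inftyRing F ↔ f.intDegree ≤ 0 := Iff.rfl

/-- The uniformiser at infinity. -/
noncomputable def tInf (F : Type*) [Field F] : RatFunc F := RatFunc.X⁻¹

lemma tInf_ne_zero : tInf F ≠ 0 := inv_ne_zero RatFunc.X_ne_zero

lemma intDegree_tInf_pow (n : ℕ) : (tInf F ^ n).intDegree = -n := by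
  induction n with
  | zero => simp
  | succ n ih =>
    rw [pow_succ, RatFunc.intDegree_mul (pow_ne_zero _ tInf_ne_zero) tInf_ne_zero, ih, tInf,
      RatFunc.intDegree_inv, RatFunc.intDegree_X]
    push_cast; ring

lemma tInf_pow_mul_mem_iff {f : RatFunc F} (hf : f ≠ 0) (n : ℕ) :
    tInf F ^ n * f ∈ inftyRing F ↔ f.intDegree ≤ n := by
  rw [mem_inftyRing, RatFunc.intDegree_mul (pow_ne_zero _ tInf_ne_zero) hf, intDegree_tInf_pow]
  omega

lemma tInf_mem : tInf F ∈ inftyRing F := by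
  have := intDegree_tInf_pow (F := F) 1
  rw [pow_one] at this
  rw [mem_inftyRing, this]; simp

lemma tInf_pow_mem (n : ℕ) : tInf F ^ n ∈ inftyRing F := pow_mem tInf_mem n

lemma tInf_pow_mul_polynomial_mem {n : ℕ} {g : F[X]} (hg : g.natDegree ≤ n) :
    tInf F ^ n * algebraMap F[X] (RatFunc F) g ∈ inftyRing F := by
  rcases eq_or_ne g 0 with rfl | hg0
  · simp
  rw [tInf_pow_mul_mem_iff (by simpa using hg0), RatFunc.intDegree_polynomial]
  exact_mod_cast hg

lemma natDegree_le_of_tInf_pow_mul_mem {n : ℕ} {g : F[X]}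
    (h : tInf F ^ n * algebraMap F[X] (RatFunc F) g ∈ inftyRing F) : g.natDegree ≤ n := by
  rcases eq_or_ne g 0 with rfl | hg0
  · simp
  rw [tInf_pow_mul_mem_iff (by simpa using hg0), RatFunc.intDegree_polynomial] at h
  exact_mod_cast h

lemma exists_tInf_pow_mul_mem (f : RatFunc F) : ∃ n, tInf F ^ n * f ∈ inftyRing F := by
  rcases eq_or_ne f 0 with rfl | hf
  · exact ⟨0, by simp⟩
  exact ⟨f.intDegree.toNat, (tInf_pow_mul_mem_iff hf _).2 (Int.self_le_toNat _)⟩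

lemma tInf_pow_mul_mem_of_le {f : RatFunc F} {m n : ℕ} (hmn : m ≤ n)
    (h : tInf F ^ m * f ∈ inftyRing F) : tInf F ^ n * f ∈ inftyRing F := by
  obtain ⟨c, rfl⟩ := Nat.exists_eq_add_of_le hmn
  rw [pow_add, mul_comm (tInf F ^ m), mul_assoc]
  exact mul_mem (tInf_pow_mem _) h

/-- Polynomial plus a remainder vanishing at infinity. -/
lemma exists_polynomial_add_tInf_mul (f : RatFunc F) :
    ∃ g : F[X], ∃ r ∈ inftyRing F, f = algebraMap F[X] (RatFunc F) g + tInf F * r := by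
  have hd : algebraMap F[X] (RatFunc F) f.denom ≠ 0 := by simpa using f.denom_ne_zero
  have h1 : f = algebraMap F[X] (RatFunc F) (f.num / f.denom) +
      algebraMap F[X] (RatFunc F) (f.num % f.denom) / algebraMap F[X] (RatFunc F) f.denom := by
    rw [eq_comm, ← mul_right_inj' hd, mul_add, mul_div_cancel₀ _ hd, ← map_mul, ← map_add,
      EuclideanDomain.div_add_mod]
    have h0 := RatFunc.num_div_denom f
    rw [div_eq_iff hd] at h0
    rw [h0, mul_comm]
  rcases eq_or_ne (f.num % f.denom) 0 with h0 | h0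
  · refine ⟨f.num / f.denom, 0, zero_mem _, ?_⟩
    rw [h0] at h1
    simpa using h1
  refine ⟨f.num / f.denom, RatFunc.X * (algebraMap F[X] (RatFunc F) (f.num % f.denom) /
    algebraMap F[X] (RatFunc F) f.denom), ?_, ?_⟩
  · have h2 : algebraMap F[X] (RatFunc F) (f.num % f.denom) ≠ 0 := by simpa using h0
    rw [mem_inftyRing, RatFunc.intDegree_mul RatFunc.X_ne_zero (div_ne_zero h2 hd),
      RatFunc.intDegree_div h2 hd, RatFunc.intDegree_X, RatFunc.intDegree_polynomial,
      RatFunc.intDegree_polynomial]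
    have h3 := natDegree_lt_natDegree h0 (degree_mod_lt f.num f.denom_ne_zero)
    omega
  · rw [← mul_assoc, tInf, inv_mul_cancel₀ RatFunc.X_ne_zero, one_mul]
    exact h1

lemma one_add_tInf_mul_inv_mem {r : RatFunc F} (hr : r ∈ inftyRing F) :
    1 + tInf F * r ≠ 0 ∧ (1 + tInf F * r)⁻¹ ∈ inftyRing F := by
  have key : ∀ s : RatFunc F, s.intDegree < 0 → 1 + tInf F * r ≠ s := by
    intro s hs h
    have hr' : (tInf F * r) = 0 ∨ (tInf F * r).intDegree < 0 := by
      rcases eq_or_ne r 0 with rfl | hr0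
      · simp
      right
      have := intDegree_tInf_pow (F := F) 1
      rw [pow_one] at this
      rw [RatFunc.intDegree_mul tInf_ne_zero hr0, this]
      have := mem_inftyRing.1 hr
      push_cast; omega
    have h1 : (1 : RatFunc F) = s + -(tInf F * r) := by rw [← h]; ring
    rcases hr' with h0 | h0
    · rw [h0, neg_zero, add_zero] at h1
      rw [← h1] at hs
      simp at hs
    · have h2 := RatFunc.intDegree_add_le (x := s) (y := -(tInf F * r))
        (neg_ne_zero.2 (by rintro h; simp [h] at h0)) (by rw [← h1]; exact one_ne_zero)
      rw [← h1, RatFunc.intDegree_neg, RatFunc.intDegree_one] at h2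
      rcases le_max_iff.1 h2 with h3 | h3 <;> omega
  constructor
  · intro h
    have := key (tInf F ^ 1) (by rw [intDegree_tInf_pow]; simp)
    rcases eq_or_ne r 0 with rfl | hr0
    · simp at h
    have h1 : tInf F * r = -1 := by linear_combination h
    have h2 := congrArg RatFunc.intDegree h1
    have h3 := intDegree_tInf_pow (F := F) 1
    rw [pow_one] at h3
    rw [RatFunc.intDegree_mul tInf_ne_zero hr0, RatFunc.intDegree_neg, RatFunc.intDegree_one,
      h3] at h2
    have := mem_inftyRing.1 hr
    push_cast at h2; omega
  · rw [mem_inftyRing, RatFunc.intDegree_inv]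
    by_contra h
    exact key _ (by omega) rfl

/-- Multiplication by a one-unit at infinity does not change the degree and the leading coefficient
of a polynomial, and shifts the second coefficient. -/
lemma coeff_of_eq_mul_one_add {g g' : F[X]} (hg : 1 ≤ g.natDegree) {e : ℕ} {r : RatFunc F}
    (hr : r ∈ inftyRing F)
    (h : algebraMap F[X] (RatFunc F) g' =
      algebraMap F[X] (RatFunc F) g * (1 + e * tInf F + tInf F ^ 2 * r)) :
    g'.natDegree = g.natDegree ∧ g'.leadingCoeff = g.leadingCoeff ∧
      g'.nextCoeff = g.nextCoeff + e * g.leadingCoeff := by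
  obtain ⟨m, hm⟩ : ∃ m, g.natDegree = m + 1 := ⟨g.natDegree - 1, by omega⟩
  obtain ⟨q, hq⟩ : ∃ q : F[X], q = X ^ 2 * g' - (X ^ 2 + C (e : F) * X) * g := ⟨_, rfl⟩
  have hq1 : algebraMap F[X] (RatFunc F) q = algebraMap F[X] (RatFunc F) g * r := by
    rw [hq]
    simp only [map_sub, map_mul, map_add, map_pow, RatFunc.algebraMap_X, h,
      map_natCast]
    have hX : (RatFunc.X : RatFunc F) * tInf F = 1 := mul_inv_cancel₀ RatFunc.X_ne_zero
    linear_combination (algebraMap F[X] (RatFunc F) g * (e * RatFunc.X + r *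
      (RatFunc.X * tInf F + 1))) * hX
  have hqd : q.natDegree ≤ m + 1 := by
    refine natDegree_le_of_tInf_pow_mul_mem ?_
    rw [hq1, ← mul_assoc]
    exact mul_mem (tInf_pow_mul_polynomial_mem hm.le) hr
  have hc : ∀ i, m < i → g'.coeff i = g.coeff i + e * g.coeff (i + 1) := by
    intro i hi
    have h1 : q.coeff (i + 2) = 0 := coeff_eq_zero_of_natDegree_lt (by omega)
    rw [hq, add_mul, coeff_sub, coeff_add, coeff_X_pow_mul, coeff_X_pow_mul, mul_assoc, coeff_C_mul,
      coeff_X_mul] at h1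
    linear_combination h1
  have hc' : g'.coeff m = g.coeff m + e * g.coeff (m + 1) := by
    have h1 : q.coeff (m + 2) = 0 := coeff_eq_zero_of_natDegree_lt (by omega)
    rw [hq, add_mul, coeff_sub, coeff_add, coeff_X_pow_mul, coeff_X_pow_mul, mul_assoc, coeff_C_mul,
      coeff_X_mul] at h1
    linear_combination h1
  have h2 : g'.coeff (m + 1) = g.coeff (m + 1) := by
    rw [hc _ (by omega), coeff_eq_zero_of_natDegree_lt (n := m + 1 + 1) (by omega)]; ring
  have h3 : g.coeff (m + 1) ≠ 0 := by
    rw [← hm]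
    exact leadingCoeff_ne_zero.2 (by rintro rfl; simp at hm)
  have h4 : g'.natDegree = m + 1 := by
    refine le_antisymm (natDegree_le_iff_coeff_eq_zero.2 fun i hi => ?_)
      (le_natDegree_of_ne_zero (by rwa [h2]))
    rw [hc _ (by omega), coeff_eq_zero_of_natDegree_lt (n := i) (by omega),
      coeff_eq_zero_of_natDegree_lt (n := i + 1) (by omega)]; ring
  refine ⟨h4.trans hm.symm, ?_, ?_⟩
  · rw [leadingCoeff, leadingCoeff, h4, hm, h2]
  · rw [nextCoeff, nextCoeff, leadingCoeff, h4, hm, if_neg (by omega), if_neg (by omega),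
      Nat.add_sub_cancel, hc']

variable {L ι : Type*} [Field L] [Algebra (RatFunc F) L] [Fintype ι] [DecidableEq ι]

/-- The elements whose multiplication matrix is regular at infinity. -/
noncomputable def inftyOrder (b : Basis ι (RatFunc F) L) : Subring L :=
  ((inftyRing F).subtype.mapMatrix (m := ι)).range.comap (Algebra.leftMulMatrix b).toRingHom

lemma mem_inftyOrder {b : Basis ι (RatFunc F) L} {a : L} :
    a ∈ inftyOrder b ↔ ∃ M : Matrix ι ι (inftyRing F),
      (inftyRing F).subtype.mapMatrix M = Algebra.leftMulMatrix b a := Iff.rfl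

lemma mem_inftyOrder_iff {b : Basis ι (RatFunc F) L} {a : L} :
    a ∈ inftyOrder b ↔ ∀ i j, b.repr (a * b j) i ∈ inftyRing F := by
  rw [mem_inftyOrder]
  constructor
  · rintro ⟨M, hM⟩ i j
    rw [← Algebra.leftMulMatrix_eq_repr_mul, ← hM]
    exact (M i j).2
  · intro h
    refine ⟨Matrix.of fun i j => ⟨_, h i j⟩, ?_⟩
    ext i j
    simp [Algebra.leftMulMatrix_eq_repr_mul]

lemma algebraMap_mem_inftyOrder (b : Basis ι (RatFunc F) L) {f : RatFunc F}
    (hf : f ∈ inftyRing F) : algebraMap (RatFunc F) L f ∈ inftyOrder b := by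
  rw [mem_inftyOrder_iff]
  intro i j
  rw [← Algebra.smul_def, map_smul, b.repr_self, Finsupp.smul_apply, Finsupp.single_apply]
  split_ifs
  · simpa
  · simp

/-- The uniformiser at infinity in an extension. -/
noncomputable abbrev tExt (F L : Type*) [Field F] [Field L] [Algebra (RatFunc F) L] : L :=
  algebraMap (RatFunc F) L (tInf F)

lemma tExt_ne_zero : tExt F L ≠ 0 := by
  simpa using tInf_ne_zero

lemma tExt_pow_mem (b : Basis ι (RatFunc F) L) (n : ℕ) : tExt F L ^ n ∈ inftyOrder b := by
  rw [← map_pow]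
  exact algebraMap_mem_inftyOrder b (tInf_pow_mem n)

lemma norm_mem_inftyRing {b : Basis ι (RatFunc F) L} {a : L} (ha : a ∈ inftyOrder b) :
    Algebra.norm (RatFunc F) a ∈ inftyRing F := by
  obtain ⟨M, hM⟩ := mem_inftyOrder.1 ha
  rw [Algebra.norm_eq_matrix_det b, ← hM, ← RingHom.map_det]
  exact (Matrix.det M).2

lemma exists_norm_one_add_tExt_mul {b : Basis ι (RatFunc F) L} {a : L} (ha : a ∈ inftyOrder b) :
    ∃ r ∈ inftyRing F, Algebra.norm (RatFunc F) (1 + tExt F L * a) =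
      1 + tInf F * Algebra.trace (RatFunc F) L a + tInf F ^ 2 * r := by
  obtain ⟨M, hM⟩ := mem_inftyOrder.1 ha
  obtain ⟨s, hs⟩ : ∃ s : inftyRing F, s = ⟨tInf F, tInf_mem⟩ := ⟨_, rfl⟩
  obtain ⟨r, hr⟩ : ∃ r, Matrix.det (1 + s • M) = 1 + M.trace * s + r * s ^ 2 :=
    ⟨_, Matrix.det_one_add_smul s M⟩
  refine ⟨r, r.2, ?_⟩
  have h1 : Algebra.leftMulMatrix b (1 + tExt F L * a) =
      (inftyRing F).subtype.mapMatrix (1 + s • M) := by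
    rw [map_add, map_one, map_add, map_one, ← Algebra.smul_def, map_smul, ← hM]
    congr 1
    ext i j
    simp [hs]
  have h2 : Algebra.trace (RatFunc F) L a = (inftyRing F).subtype M.trace := by
    rw [Algebra.trace_eq_matrix_trace b, ← hM]
    simp [Matrix.trace]
  rw [Algebra.norm_eq_matrix_det b, h1, ← RingHom.map_det, hr, h2, hs]
  simp
  ring

lemma exists_inv_one_add_tExt_mul {b : Basis ι (RatFunc F) L} {a : L} (ha : a ∈ inftyOrder b) :
    ∃ a' ∈ inftyOrder b, (1 + tExt F L * a) * (1 + tExt F L * a') = 1 := by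
  obtain ⟨M, hM⟩ := mem_inftyOrder.1 ha
  obtain ⟨s, hs⟩ : ∃ s : inftyRing F, s = ⟨tInf F, tInf_mem⟩ := ⟨_, rfl⟩
  obtain ⟨r, hr⟩ : ∃ r, Matrix.det (1 + s • M) = 1 + M.trace * s + r * s ^ 2 :=
    ⟨_, Matrix.det_one_add_smul s M⟩
  have h1 : Algebra.leftMulMatrix b (1 + tExt F L * a) =
      (inftyRing F).subtype.mapMatrix (1 + s • M) := by
    rw [map_add, map_one, map_add, map_one, ← Algebra.smul_def, map_smul, ← hM]
    congr 1
    ext i j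
    simp [hs]
  have hu : IsUnit (Matrix.det (1 + s • M)) := by
    obtain ⟨h2, h3⟩ := one_add_tInf_mul_inv_mem (F := F) (M.trace + r * s).2
    refine IsUnit.of_mul_eq_one ⟨_, h3⟩ ?_
    apply Subtype.ext
    rw [hr]
    simp only [Subring.coe_mul, Subring.coe_add, Subring.coe_one, Subring.coe_pow, hs] at h2 ⊢
    rw [mul_inv_eq_one₀ h2]
    ring
  have h4 : (1 + tExt F L * a) ≠ 0 := by
    intro h
    rw [h, map_zero] at h1
    have h5 := congrArg Matrix.det h1
    rw [← RingHom.map_det] at h5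
    rcases isEmpty_or_nonempty ι with hι | hι
    · have := b.index_nonempty
      exact hι.elim this.some
    rw [Matrix.det_zero] at h5
    exact hu.ne_zero (Subtype.coe_injective (by simpa using h5.symm))
  have h6 : (1 + tExt F L * a)⁻¹ ∈ inftyOrder b := by
    refine mem_inftyOrder.2 ⟨(1 + s • M)⁻¹, ?_⟩
    have h7 : (inftyRing F).subtype.mapMatrix ((1 + s • M)⁻¹) *
        (inftyRing F).subtype.mapMatrix (1 + s • M) = 1 := by
      rw [← map_mul, Matrix.nonsing_inv_mul _ hu, map_one]
    have h8 : (inftyRing F).subtype.mapMatrix (1 + s • M) *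
        Algebra.leftMulMatrix b ((1 + tExt F L * a)⁻¹) = 1 := by
      rw [← h1, ← map_mul, mul_inv_cancel₀ h4, map_one]
    exact left_inv_eq_right_inv h7 h8
  refine ⟨-(a * (1 + tExt F L * a)⁻¹), neg_mem (mul_mem ha h6), ?_⟩
  have h9 := mul_inv_cancel₀ h4
  linear_combination -(tExt F L * a) * h9

lemma exists_norm_one_add_tExt {b : Basis ι (RatFunc F) L} {a : L} (ha : a ∈ inftyOrder b) :
    ∃ r ∈ inftyRing F, Algebra.norm (RatFunc F) (1 + tExt F L + tExt F L ^ 2 * a) =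
      1 + (Fintype.card ι : ℕ) * tInf F + tInf F ^ 2 * r := by
  have h1 : 1 + tExt F L * a ∈ inftyOrder b :=
    add_mem (one_mem _) (mul_mem (by simpa using tExt_pow_mem b 1) ha)
  obtain ⟨r, hr, h2⟩ := exists_norm_one_add_tExt_mul h1
  obtain ⟨M, hM⟩ := mem_inftyOrder.1 ha
  have h3 : Algebra.trace (RatFunc F) L a = (inftyRing F).subtype M.trace := by
    rw [Algebra.trace_eq_matrix_trace b, ← hM]
    simp [Matrix.trace]
  refine ⟨r + M.trace, add_mem hr M.trace.2, ?_⟩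
  have h4 : 1 + tExt F L + tExt F L ^ 2 * a = 1 + tExt F L * (1 + tExt F L * a) := by ring
  have h5 : Algebra.trace (RatFunc F) L (1 : L) = (Fintype.card ι : ℕ) := by
    rw [← map_one (algebraMap (RatFunc F) L), Algebra.trace_algebraMap_of_basis b]
    simp
  rw [h4, h2, map_add, ← Algebra.smul_def, map_smul, h3, h5, smul_eq_mul]
  simp only [Subring.coe_subtype]
  ring

end AtInfinity

section CardQuot

lemma cardQuot_mul_of_infinite {S : Type*} [CommRing S] [IsDedekindDomain S] [Infinite S]
    (I J : Ideal S) :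
    Submodule.cardQuot (I * J) = Submodule.cardQuot I * Submodule.cardQuot J :=
  UniqueFactorizationMonoid.multiplicative_of_coprime Submodule.cardQuot I J
    (Submodule.cardQuot_bot _ _) (fun {I J} hI => by simp [Ideal.isUnit_iff.mp hI, Ideal.mul_top])
    (fun {I} i hI =>
      have : Ideal.IsPrime I := Ideal.isPrime_of_prime hI
      cardQuot_pow_of_prime hI.ne_zero)
    fun {I J} hIJ => cardQuot_mul_of_coprime <| Ideal.isCoprime_iff_sup_eq.mpr
      (Ideal.isUnit_iff.mp
        (hIJ (Ideal.dvd_iff_le.mpr le_sup_left) (Ideal.dvd_iff_le.mpr le_sup_right)))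

variable {F : Type*} [Field F] [Finite F] {O : Type*} [CommRing O] [IsDedekindDomain O]
  [Algebra F[X] O] [Module.Finite F[X] O] [IsTorsionFree F[X] O] [Algebra F O]
  [IsScalarTower F F[X] O]

lemma natCard_quotient_eq {I : Ideal O} (hI : I ≠ ⊥) :
    Nat.card (O ⧸ I) = Nat.card F ^ (normGen F I).natDegree := by
  have hinf : Infinite O :=
    Infinite.of_injective _ (FaithfulSMul.algebraMap_injective F[X] O)
  rw [← Submodule.cardQuot_apply]
  induction I using UniqueFactorizationMonoid.induction_on_prime with
  | h₁ => exact absurd rfl hI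
  | h₂ I h =>
    rw [Ideal.isUnit_iff.1 h, Submodule.cardQuot_top, ← Ideal.one_eq_top, normGen_one]
    simp
  | h₃ I P hI0 hP ih =>
    have hPp : P.IsPrime := Ideal.isPrime_of_prime hP
    rw [cardQuot_mul_of_infinite, ih hI0, normGen_mul hP.ne_zero hI0,
      (monic_normGen hP.ne_zero).natDegree_mul (monic_normGen hI0), pow_add,
      natDegree_normGen_eq_finrank hP.ne_zero, Submodule.cardQuot_apply]
    congr 1
    have : Module.Finite F (O ⧸ P) :=
      finite_quotient_of_ne_bot (Module.finBasis F[X] O) hP.ne_zero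
    exact Module.natCard_eq_pow_finrank

end CardQuot

section Weighted

variable {F : Type*} [Field F] {L : Type*} [Field L] [Algebra (RatFunc F) L] {e : ℕ}

/-- The basis consists of the powers of `y t ^ w`, and this element is regular at infinity. -/
structure IsWeighted (b : Basis (Fin e) (RatFunc F) L) (y : L) (w : ℕ) : Prop where
  basis_eq : ∀ j : Fin e, b j = (y * tExt F L ^ w) ^ (j : ℕ)
  mem : y * tExt F L ^ w ∈ inftyOrder b

variable {b : Basis (Fin e) (RatFunc F) L} {y : L} {w : ℕ}

lemma IsWeighted.basis_mem (h : IsWeighted b y w) (j : Fin e) : b j ∈ inftyOrder b := by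
  rw [h.basis_eq]; exact pow_mem h.mem _

lemma IsWeighted.exists_pow_mul_mem (h : IsWeighted b y w) (z : L) :
    ∃ m, tExt F L ^ m * z ∈ inftyOrder b := by
  choose n hn using fun j => exists_tInf_pow_mul_mem (b.repr z j)
  refine ⟨∑ j, n j, ?_⟩
  rw [← b.sum_repr z, Finset.mul_sum]
  refine sum_mem fun j _ => ?_
  rw [Algebra.smul_def, ← mul_assoc, ← map_pow, ← map_mul]
  exact mul_mem (algebraMap_mem_inftyOrder b (tInf_pow_mul_mem_of_le
    (Finset.single_le_sum (fun _ _ => Nat.zero_le _) (Finset.mem_univ j)) (hn j))) (h.basis_mem j)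

variable [Algebra F[X] L] [IsScalarTower F[X] (RatFunc F) L]

lemma tExt_pow_mul_polynomial_mem (b : Basis (Fin e) (RatFunc F) L) {n : ℕ} {g : F[X]}
    (hg : g.natDegree ≤ n) : tExt F L ^ n * algebraMap F[X] L g ∈ inftyOrder b := by
  rw [IsScalarTower.algebraMap_apply F[X] (RatFunc F) L, ← map_pow, ← map_mul]
  exact algebraMap_mem_inftyOrder b (tInf_pow_mul_polynomial_mem hg)

lemma IsWeighted.pow_mul_mem (h : IsWeighted b y w) {m j : ℕ} {g : F[X]}
    (hg : g.natDegree + w * j ≤ m) :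
    tExt F L ^ m * (algebraMap F[X] L g * y ^ j) ∈ inftyOrder b := by
  obtain ⟨c, rfl⟩ := Nat.exists_eq_add_of_le hg
  have h1 : tExt F L ^ (g.natDegree + w * j + c) * (algebraMap F[X] L g * y ^ j) =
      tExt F L ^ c * (tExt F L ^ g.natDegree * algebraMap F[X] L g) *
        (y * tExt F L ^ w) ^ j := by ring
  rw [h1]
  exact mul_mem (mul_mem (tExt_pow_mem b c) (tExt_pow_mul_polynomial_mem b le_rfl))
    (pow_mem h.mem j)

lemma IsWeighted.eq_zero_of_sum_eq_zero (h : IsWeighted b y w) {g : Fin e → F[X]}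
    (hg : ∑ j, algebraMap F[X] L (g j) * y ^ (j : ℕ) = 0) : g = 0 := by
  have h1 : ∑ j, (algebraMap F[X] (RatFunc F) (g j) * ((tInf F)⁻¹ ^ w) ^ (j : ℕ)) • b j = 0 := by
    rw [← hg]
    refine Finset.sum_congr rfl fun j _ => ?_
    have ht := tExt_ne_zero (F := F) (L := L)
    rw [h.basis_eq, Algebra.smul_def, map_mul, ← IsScalarTower.algebraMap_apply, mul_assoc, map_pow,
      map_pow, map_inv₀, ← mul_pow, inv_pow, mul_comm y, inv_mul_cancel_left₀ (pow_ne_zero w ht)]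
  have h2 := Fintype.linearIndependent_iff.1 b.linearIndependent _ h1
  ext1 j
  have h3 := h2 j
  rw [mul_eq_zero] at h3
  rcases h3 with h3 | h3
  · simpa using h3
  · exact absurd h3 (pow_ne_zero _ (pow_ne_zero _ (inv_ne_zero tInf_ne_zero)))

variable {O : Type*} [CommRing O] [Algebra F[X] O] [Algebra O L] [IsScalarTower F[X] O L]

/-- Strong approximation: an element is integral up to a bounded error at infinity. -/
lemma IsWeighted.exists_add {y : O} (h : IsWeighted b (algebraMap O L y) w) (z : L) :
    ∃ o : O, ∃ a ∈ inftyOrder b,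
      tExt F L ^ (w * (e - 1)) * z = tExt F L ^ (w * (e - 1)) * algebraMap O L o + tExt F L
          * a := by
  have ht := tExt_ne_zero (F := F) (L := L)
  choose g r hr hgr using fun j : Fin e =>
    exists_polynomial_add_tInf_mul (b.repr z j * (tInf F ^ w) ^ (j : ℕ))
  refine ⟨∑ j, algebraMap F[X] O (g j) * y ^ (j : ℕ),
    ∑ j, algebraMap (RatFunc F) L (r j) * tExt F L ^ (w * (e - 1 - j)) * b j,
    sum_mem fun j _ => mul_mem (mul_mem (algebraMap_mem_inftyOrder b (hr j)) (tExt_pow_mem b _))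
      (h.basis_mem j), ?_⟩
  conv_lhs => rw [← b.sum_repr z]
  rw [map_sum, Finset.mul_sum, Finset.mul_sum, Finset.mul_sum, ← Finset.sum_add_distrib]
  refine Finset.sum_congr rfl fun j _ => ?_
  have h1 := congrArg (algebraMap (RatFunc F) L) (hgr j)
  rw [map_mul, map_add, map_mul, map_pow, map_pow, ← IsScalarTower.algebraMap_apply] at h1
  have h2 : w * (e - 1) = w * (e - 1 - j) + w * j := by
    rw [← mul_add]; congr 1; have := j.2; omega
  rw [Algebra.smul_def, h.basis_eq, map_mul, map_pow, ← IsScalarTower.algebraMap_apply, h2, pow_add,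
    pow_mul _ w j, mul_pow]
  linear_combination (tExt F L ^ (w * (e - 1 - j)) * algebraMap O L y ^ (j : ℕ) *
    (tExt F L ^ w) ^ (j : ℕ)) * h1

variable [IsDedekindDomain O] [Module.Finite F[X] O] [IsTorsionFree F[X] O] [IsFractionRing O L]

lemma algebraMap_norm_eq (b : Basis (Fin e) (RatFunc F) L) (h : O) :
    algebraMap F[X] (RatFunc F) (Algebra.norm F[X] h) =
      Algebra.norm (RatFunc F) (algebraMap O L h) := by
  have := Module.Finite.of_basis b
  rw [← Algebra.intNorm_eq_norm, Algebra.algebraMap_intNorm (L := L)]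

lemma norm_ne_zero_of_ne_zero {h : O} (hh : h ≠ 0) : Algebra.norm F[X] h ≠ 0 := by
  rwa [Ne, Algebra.norm_eq_zero_iff]

lemma natDegree_norm_le (b : Basis (Fin e) (RatFunc F) L) {h : O} {m : ℕ}
    (hm : tExt F L ^ m * algebraMap O L h ∈ inftyOrder b) :
    (Algebra.norm F[X] h).natDegree ≤ e * m := by
  have h1 := norm_mem_inftyRing hm
  rw [map_mul, ← map_pow, Algebra.norm_algebraMap_of_basis b, ← algebraMap_norm_eq b,
    Fintype.card_fin, ← pow_mul, mul_comm] at h1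
  exact natDegree_le_of_tInf_pow_mul_mem (by rwa [mul_comm e m, mul_comm])

lemma eq_zero_of_eq_tExt_mul (b : Basis (Fin e) (RatFunc F) L) (he : 1 ≤ e) {h : O} {a : L}
    (ha : a ∈ inftyOrder b) (hh : algebraMap O L h = tExt F L * a) : h = 0 := by
  by_contra h0
  have h1 := algebraMap_norm_eq b h
  rw [hh, map_mul, Algebra.norm_algebraMap_of_basis b, Fintype.card_fin] at h1
  have h2 : algebraMap F[X] (RatFunc F) (Algebra.norm F[X] h) ≠ 0 := by
    simpa using norm_ne_zero_of_ne_zero (F := F) h0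
  have h3 : Algebra.norm (RatFunc F) a ≠ 0 := by
    intro h4
    rw [h4, mul_zero] at h1
    exact h2 h1
  have h4 := congrArg RatFunc.intDegree h1
  rw [RatFunc.intDegree_polynomial, RatFunc.intDegree_mul (pow_ne_zero _ tInf_ne_zero) h3,
    intDegree_tInf_pow] at h4
  have := mem_inftyRing.1 (norm_mem_inftyRing ha)
  omega

lemma finite_integral_bounded [Finite F] (b : Basis (Fin e) (RatFunc F) L) (he : 1 ≤ e) (m : ℕ) :
    {h : O | tExt F L ^ m * algebraMap O L h ∈ inftyOrder b}.Finite := by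
  choose g r hr hgr using exists_polynomial_add_tInf_mul (F := F)
  let φ : O → Fin e → Fin e → F[X] := fun h i j => g (b.repr (algebraMap O L h * b j) i)
  have hfin : (Set.univ.pi fun _ : Fin e => Set.univ.pi fun _ : Fin e =>
      {q : F[X] | q.natDegree ≤ m}).Finite := by
    refine Set.Finite.pi fun _ => Set.Finite.pi fun _ => ?_
    refine Set.Finite.subset (s := (degreeLT F (m + 1) : Set F[X])) ?_ ?_
    · have : Finite (degreeLT F (m + 1)) := Finite.of_equiv _ (degreeLTEquiv F (m + 1)).toEquiv.symm
      exact Set.toFinite _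
    · intro q hq
      rw [SetLike.mem_coe, mem_degreeLT]
      exact degree_le_natDegree.trans_lt (by exact_mod_cast Nat.lt_succ_of_le hq)
  refine Set.Finite.of_injOn (f := φ) ?_ ?_ hfin
  · intro h hh
    simp only [Set.mem_pi, Set.mem_univ, true_implies, Set.mem_ofPred_eq]
    intro i j
    refine natDegree_le_of_tInf_pow_mul_mem ?_
    have h1 := mem_inftyOrder_iff.1 hh i j
    rw [mul_assoc, ← map_pow, ← Algebra.smul_def, map_smul, Finsupp.smul_apply, smul_eq_mul,
      hgr (b.repr _ i), mul_add] at h1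
    have h2 := sub_mem h1 (mul_mem (tInf_pow_mem m) (mul_mem tInf_mem
      (hr (b.repr (algebraMap O L h * b j) i))))
    rwa [add_sub_cancel_right] at h2
  · intro h _ h' _ heq
    rw [← sub_eq_zero]
    have ht := tExt_ne_zero (F := F) (L := L)
    refine eq_zero_of_eq_tExt_mul b he (a := (tExt F L)⁻¹ * algebraMap O L (h - h')) ?_
      (by rw [mul_inv_cancel_left₀ ht])
    rw [mem_inftyOrder_iff]
    intro i j
    have h1 : g (b.repr (algebraMap O L h * b j) i) = g (b.repr (algebraMap O L h' * b j) i) :=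
      congrFun (congrFun heq i) j
    have h2 : b.repr (algebraMap O L (h - h') * b j) i = tInf F *
        (r (b.repr (algebraMap O L h * b j) i) - r (b.repr (algebraMap O L h' * b j) i)) := by
      rw [map_sub, sub_mul, map_sub, Finsupp.sub_apply]
      conv_lhs => rw [hgr (b.repr (algebraMap O L h * b j) i),
        hgr (b.repr (algebraMap O L h' * b j) i), h1]
      ring
    rw [mul_assoc, ← map_inv₀, ← Algebra.smul_def, map_smul, Finsupp.smul_apply, smul_eq_mul, h2,
      inv_mul_cancel_left₀ tInf_ne_zero]
    exact sub_mem (hr _) (hr _)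

lemma normGen_span_singleton {h : O} (hh : h ≠ 0) :
    normGen F (Ideal.span {h}) =
      C (Algebra.norm F[X] h).leadingCoeff⁻¹ * Algebra.norm F[X] h := by
  have h0 := norm_ne_zero_of_ne_zero (F := F) hh
  refine normGen_eq (by rw [mul_comm]; exact monic_mul_leadingCoeff_inv h0) ?_
  rw [Ideal.relNorm_singleton, Algebra.intNorm_eq_norm, eq_comm,
    Ideal.span_singleton_eq_span_singleton]
  exact associated_unit_mul_left _ _
    (isUnit_C.2 (inv_ne_zero (leadingCoeff_ne_zero.2 h0)).isUnit)

lemma natDegree_normGen_span {h : O} (hh : h ≠ 0) :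
    (normGen F (Ideal.span {h})).natDegree = (Algebra.norm F[X] h).natDegree := by
  rw [normGen_span_singleton hh, natDegree_C_mul
    (inv_ne_zero (leadingCoeff_ne_zero.2 (norm_ne_zero_of_ne_zero hh)))]

lemma nextCoeff_normGen_span_of_eq (b : Basis (Fin e) (RatFunc F) L) {h h' : O}
    (h0 : h ≠ 0) (h0' : h' ≠ 0) {a : L} (ha : a ∈ inftyOrder b)
    (heq : algebraMap O L h' = algebraMap O L h * (1 + tExt F L + tExt F L ^ 2 * a))
    (hd : 1 ≤ (normGen F (Ideal.span {h})).natDegree) :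
    (normGen F (Ideal.span {h'})).natDegree = (normGen F (Ideal.span {h})).natDegree ∧
    (normGen F (Ideal.span {h'})).nextCoeff = (normGen F (Ideal.span {h})).nextCoeff + e := by
  obtain ⟨r, hr, h1⟩ := exists_norm_one_add_tExt ha
  rw [natDegree_normGen_span h0] at hd
  have h2 := coeff_of_eq_mul_one_add (g := Algebra.norm F[X] h) (g' := Algebra.norm F[X] h') hd
    (e := e) hr (by
      rw [algebraMap_norm_eq b, heq, map_mul, h1, algebraMap_norm_eq b, Fintype.card_fin])
  have h3 : (Algebra.norm F[X] h).leadingCoeff ≠ 0 :=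
    leadingCoeff_ne_zero.2 (norm_ne_zero_of_ne_zero h0)
  refine ⟨by rw [natDegree_normGen_span h0, natDegree_normGen_span h0', h2.1], ?_⟩
  have h4 : ∀ (c : F) (_ : c ≠ 0) (g : F[X]), (C c * g).nextCoeff = c * g.nextCoeff := by
    intro c hc g
    rw [nextCoeff, nextCoeff, natDegree_C_mul hc]
    split_ifs
    · simp
    · rw [coeff_C_mul]
  rw [normGen_span_singleton h0, normGen_span_singleton h0', h2.2.1, h4 _ (inv_ne_zero h3),
    h4 _ (inv_ne_zero h3), h2.2.2]
  field_simp

end Weighted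

lemma finite_quotient_ideal (F : Type*) [Field F] [Finite F] {O : Type*} [CommRing O]
    [IsDedekindDomain O] [Algebra F[X] O] [Module.Finite F[X] O] [IsTorsionFree F[X] O]
    [Algebra F O] [IsScalarTower F F[X] O] {I : Ideal O} (hI : I ≠ ⊥) : Finite (O ⧸ I) :=
  Nat.finite_of_card_ne_zero (by
    rw [natCard_quotient_eq (F := F) hI]; exact pow_ne_zero _ Nat.card_pos.ne')

section Vanishing

variable {F : Type*} [Field F] {L : Type*} [Field L] [Algebra (RatFunc F) L] {e : ℕ}
  {b : Basis (Fin e) (RatFunc F) L} {w : ℕ}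
  [Algebra F[X] L] [IsScalarTower F[X] (RatFunc F) L]
  {O : Type*} [CommRing O] [Algebra F[X] O] [Algebra O L] [IsScalarTower F[X] O L]
  [IsDedekindDomain O] [Module.Finite F[X] O] [IsTorsionFree F[X] O] [IsFractionRing O L]

lemma inv_tExt_pow_mul_mem (b : Basis (Fin e) (RatFunc F) L) {g : F[X]} (hg : g.Monic) :
    (tExt F L ^ g.natDegree * algebraMap F[X] L g)⁻¹ ∈ inftyOrder b := by
  rw [IsScalarTower.algebraMap_apply F[X] (RatFunc F) L, ← map_pow, ← map_mul, ← map_inv₀]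
  refine algebraMap_mem_inftyOrder b ?_
  have hg0 : algebraMap F[X] (RatFunc F) g ≠ 0 := by simpa using hg.ne_zero
  have ht := pow_ne_zero g.natDegree (tInf_ne_zero (F := F))
  rw [mem_inftyRing, RatFunc.intDegree_inv, RatFunc.intDegree_mul ht hg0, intDegree_tInf_pow,
    RatFunc.intDegree_polynomial]
  simp

variable [Finite F] [Algebra F O] [IsScalarTower F F[X] O]

omit [IsScalarTower F[X] (RatFunc F) L] [IsScalarTower F[X] O L] [Finite F]
  [Algebra F O] [IsScalarTower F F[X] O] [Algebra F[X] L] in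
lemma algebraMap_normGen_mem (I : Ideal O) :
    algebraMap F[X] O (normGen F I) ∈ I := by
  have h1 := Ideal.relNorm_le_comap F[X] I
  rw [← span_normGen (F := F) I] at h1
  exact h1 (Ideal.mem_span_singleton_self _)

omit [Algebra F[X] L] [IsScalarTower F[X] (RatFunc F) L] [IsScalarTower F[X] O L]
  [IsFractionRing O L] [Algebra O L] in
lemma exists_integral_combination_mem {y : O} {I : Ideal O} (hI : I ≠ ⊥) {S : ℕ}
    (hS : (normGen F I).natDegree < e * S) :
    ∃ g : Fin e → F[X], g ≠ 0 ∧ (∀ j, g j ∈ degreeLT F S) ∧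
      ∑ j, algebraMap F[X] O (g j) * y ^ (j : ℕ) ∈ I := by
  have hfin := finite_quotient_ideal F hI
  have : Finite (degreeLT F S) := Finite.of_equiv _ (degreeLTEquiv F S).toEquiv.symm
  let φ : (Fin e → degreeLT F S) → O ⧸ I := fun g =>
    Ideal.Quotient.mk I (∑ j, algebraMap F[X] O (g j) * y ^ (j : ℕ))
  have hcard : Nat.card (O ⧸ I) < Nat.card (Fin e → degreeLT F S) := by
    rw [natCard_quotient_eq (F := F) hI, Nat.card_fun, Nat.card_congr (degreeLTEquiv F S).toEquiv,
      Nat.card_fun, Nat.card_fin, Nat.card_fin, ← pow_mul, mul_comm S]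
    exact Nat.pow_lt_pow_right Finite.one_lt_card hS
  have hni : ¬ Function.Injective φ := fun hinj =>
    absurd (Nat.card_le_card_of_injective φ hinj) (not_le.2 hcard)
  rw [Function.Injective] at hni
  push Not at hni
  obtain ⟨g, g', hgg, hne⟩ := hni
  refine ⟨fun j => (g j : F[X]) - g' j, ?_, fun j => sub_mem (g j).2 (g' j).2, ?_⟩
  · intro h0
    refine hne (funext fun j => Subtype.ext ?_)
    exact sub_eq_zero.1 (congrFun h0 j)
  · have h1 := Ideal.Quotient.eq.1 hgg
    rw [← Finset.sum_sub_distrib] at h1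
    simpa only [map_sub, sub_mul] using h1

lemma IsWeighted.exists_multiplier {y : O} (h : IsWeighted b (algebraMap O L y) w) (he : 1 ≤ e)
    {I : Ideal O} (hI : I ≠ ⊥) (hn : 2 * w * e * (e - 1) < (normGen F I).natDegree) :
    ∃ a ∈ inftyOrder b, ∀ z ∈ I, ∃ o : O,
      algebraMap O L o = (tExt F L + tExt F L ^ 2 * a) * algebraMap O L z := by
  have ht := tExt_ne_zero (F := F) (L := L)
  obtain ⟨g, hgdef⟩ : ∃ g, g = normGen F I := ⟨_, rfl⟩
  have hg : g.Monic := hgdef ▸ monic_normGen hI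
  have hgO : algebraMap F[X] O g ≠ 0 := by
    simpa using hg.ne_zero
  obtain ⟨I', hI'⟩ := Ideal.dvd_span_singleton.2 (hgdef ▸ algebraMap_normGen_mem (F := F) I)
  have hI'0 : I' ≠ ⊥ := by
    rintro rfl
    rw [Ideal.mul_bot, Ideal.span_singleton_eq_bot] at hI'
    exact hgO hI'
  have hdeg : (normGen F I').natDegree + g.natDegree = e * g.natDegree := by
    have h1 := natDegree_normGen_span (F := F) hgO
    rw [hI', normGen_mul hI hI'0, (monic_normGen hI).natDegree_mul (monic_normGen hI'0),
      ← hgdef] at h1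
    rw [add_comm, h1]
    have h2 := algebraMap_norm_eq b (algebraMap F[X] O g)
    rw [← IsScalarTower.algebraMap_apply, IsScalarTower.algebraMap_apply F[X] (RatFunc F) L,
      Algebra.norm_algebraMap_of_basis b, Fintype.card_fin, ← map_pow] at h2
    rw [FaithfulSMul.algebraMap_injective F[X] (RatFunc F) h2, natDegree_pow]
  rw [← hgdef] at hn
  obtain ⟨S, hS⟩ : ∃ S, g.natDegree = S + 1 + 2 * (w * (e - 1)) := by
    refine ⟨g.natDegree - 1 - 2 * (w * (e - 1)), ?_⟩
    have : 2 * (w * (e - 1)) ≤ 2 * w * e * (e - 1) := by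
      calc 2 * (w * (e - 1)) = 2 * w * 1 * (e - 1) := by ring
        _ ≤ _ := by gcongr
    omega
  have hlt : (normGen F I').natDegree < e * (S + 1) := by
    have h1 : e * g.natDegree = e * (S + 1) + 2 * w * e * (e - 1) := by rw [hS]; ring
    omega
  obtain ⟨c, hc0, hc, hcI⟩ := exists_integral_combination_mem (y := y) hI'0 hlt
  obtain ⟨β, hβ⟩ : ∃ β, β = ∑ j, algebraMap F[X] O (c j) * y ^ (j : ℕ) := ⟨_, rfl⟩
  rw [← hβ] at hcI
  have hβL : algebraMap O L β = ∑ j, algebraMap F[X] L (c j) * algebraMap O L y ^ (j : ℕ) := by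
    rw [hβ, map_sum]
    simp only [map_mul, map_pow, ← IsScalarTower.algebraMap_apply]
  have hβ0 : algebraMap O L β ≠ 0 := fun h0 => hc0 (h.eq_zero_of_sum_eq_zero (hβL ▸ h0))
  have hβA : tExt F L ^ (S + w * (e - 1)) * algebraMap O L β ∈ inftyOrder b := by
    rw [hβL, Finset.mul_sum]
    refine sum_mem fun j _ => h.pow_mul_mem ?_
    have h1 : (c j).natDegree ≤ S := by
      by_cases h0 : c j = 0
      · simp [h0]
      · exact Nat.lt_succ_iff.1 ((natDegree_lt_iff_degree_lt h0).2 (mem_degreeLT.1 (hc j)))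
    have h2 : w * (j : ℕ) ≤ w * (e - 1) := Nat.mul_le_mul_left _ (by have := j.2; omega)
    omega
  have hu := inv_tExt_pow_mul_mem b hg
  obtain ⟨gL, hgL⟩ : ∃ gL, gL = algebraMap F[X] L g := ⟨_, rfl⟩
  have hgL0 : gL ≠ 0 := by
    rw [hgL, IsScalarTower.algebraMap_apply F[X] O L]
    simpa using hg.ne_zero
  rw [← hgL] at hu
  obtain ⟨ε, hε⟩ : ∃ ε, ε = algebraMap O L β / gL := ⟨_, rfl⟩
  have hε0 : ε ≠ 0 := hε ▸ div_ne_zero hβ0 hgL0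
  obtain ⟨a₀, ha₀, hεa⟩ : ∃ a₀ ∈ inftyOrder b, ε = tExt F L ^ (w * (e - 1)) * tExt F L * a₀ := by
    refine ⟨_, mul_mem hu hβA, ?_⟩
    rw [hε, hS]
    field_simp
    ring
  obtain ⟨o, a, ha, hoa⟩ := h.exists_add (tExt F L / ε)
  have hεo : ε * algebraMap O L o = tExt F L + tExt F L ^ 2 * -(a₀ * a) := by
    have h1 : tExt F L ^ (w * (e - 1)) ≠ 0 := pow_ne_zero _ ht
    refine mul_left_cancel₀ h1 ?_
    have h2 : tExt F L ^ (w * (e - 1)) * tExt F L =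
        ε * (tExt F L ^ (w * (e - 1)) * algebraMap O L o + tExt F L * a) := by
      rw [← hoa]; field_simp
    linear_combination -h2 - (tExt F L * a) * hεa
  refine ⟨-(a₀ * a), neg_mem (mul_mem ha₀ ha), fun z hz => ?_⟩
  have h1 : β * z ∈ Ideal.span {algebraMap F[X] O g} := by
    rw [hI', mul_comm I]; exact Ideal.mul_mem_mul hcI hz
  obtain ⟨o', ho'⟩ := Ideal.mem_span_singleton'.1 h1
  refine ⟨o * o', ?_⟩
  have h2 := congrArg (algebraMap O L) ho'
  rw [map_mul, map_mul, ← IsScalarTower.algebraMap_apply, ← hgL] at h2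
  rw [← hεo, map_mul, hε]
  field_simp
  linear_combination algebraMap O L o * h2

omit [Algebra F[X] L] [IsScalarTower F[X] (RatFunc F) L] [IsScalarTower F[X] O L]
  [IsTorsionFree F[X] O] [IsFractionRing O L] [Finite F] [IsScalarTower F F[X] O] [Algebra F O]
  [Algebra F[X] O] [IsDedekindDomain O] [Module.Finite F[X] O] in
lemma tExt_pow_mul_mem_of_le {b : Basis (Fin e) (RatFunc F) L} {m n : ℕ} (hmn : m ≤ n) {z : L}
    (hz : tExt F L ^ m * z ∈ inftyOrder b) : tExt F L ^ n * z ∈ inftyOrder b := by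
  obtain ⟨c, rfl⟩ := Nat.exists_eq_add_of_le' hmn
  rw [pow_add, mul_assoc]
  exact mul_mem (tExt_pow_mem b c) hz

lemma IsWeighted.exists_finset_card {y : O} (h : IsWeighted b (algebraMap O L y) w) (he : 1 ≤ e)
    {n : ℕ} {T : Finset (Ideal O)} (hT : ∀ I ∈ T, I ≠ ⊥ ∧ (normGen F I).natDegree = n) :
    ∃ (M : ℕ) (W : Finset O) (c : ℕ), (∀ x, x ∈ W ↔ x ≠ 0 ∧
      tExt F L ^ M * algebraMap O L x ∈ inftyOrder b) ∧ c ≠ 0 ∧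
      ∀ I ∈ T, ∀ S : Finset O, (∀ x, x ∈ S ↔ x ∈ W ∧ x ∈ I) → S.card = c := by
  classical
  choose m hm using fun x : O => h.exists_pow_mul_mem (algebraMap O L x)
  have hB : ∀ I : Ideal O, ∃ B : ℕ, I ≠ ⊥ →
      (∀ q : O ⧸ I, ∃ x, Ideal.Quotient.mk I x = q ∧ m x ≤ B) ∧ ∃ x ∈ I, x ≠ 0 ∧ m x ≤ B := by
    intro I
    by_cases hI : I = ⊥
    · exact ⟨0, fun h => absurd hI h⟩
    · have hfin := finite_quotient_ideal F hI
      choose r hr using Ideal.Quotient.mk_surjective (I := I)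
      obtain ⟨B, hB⟩ := (Set.finite_range fun q : O ⧸ I => m (r q)).bddAbove
      obtain ⟨z, hz, hz0⟩ := Submodule.exists_mem_ne_zero_of_ne_bot hI
      refine ⟨max B (m z), fun _ => ⟨fun q => ⟨r q, hr q, ?_⟩, z, hz, hz0, le_max_right _ _⟩⟩
      exact (hB ⟨q, rfl⟩).trans (le_max_left _ _)
  choose B hB using hB
  obtain ⟨M, hM⟩ : ∃ M, M = T.sup B := ⟨_, rfl⟩
  obtain ⟨W₀, hW₀⟩ : ∃ W₀ : AddSubgroup O, ∀ x, x ∈ W₀ ↔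
      tExt F L ^ M * algebraMap O L x ∈ inftyOrder b :=
    ⟨(inftyOrder b).toAddSubgroup.comap ((AddMonoidHom.mulLeft (tExt F L ^ M)).comp
      (algebraMap O L).toAddMonoidHom), fun x => Iff.rfl⟩
  have hfin : (W₀ : Set O).Finite :=
    (finite_integral_bounded b he M).subset fun x hx => (hW₀ x).1 hx
  have hfin' : Finite W₀ := hfin
  obtain ⟨W, hW⟩ : ∃ W : Finset O, ∀ x, x ∈ W ↔ x ≠ 0 ∧ x ∈ W₀ := by
    refine ⟨hfin.toFinset.erase 0, fun x => ?_⟩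
    rw [Finset.mem_erase, Set.Finite.mem_toFinset, SetLike.mem_coe]
  have hcard : ∀ I ∈ T, ∀ S : Finset O, (∀ x, x ∈ S ↔ x ∈ W ∧ x ∈ I) →
      (S.card + 1) * Nat.card F ^ n = Nat.card W₀ ∧ S.card ≠ 0 := by
    intro I hI S hS
    obtain ⟨hI0, hn⟩ := hT I hI
    obtain ⟨h1, z, hz, hz0, hzB⟩ := hB I hI0
    have hle : B I ≤ M := hM ▸ Finset.le_sup hI
    refine ⟨?_, ?_⟩
    · let f : W₀ →+ O ⧸ I := (Ideal.Quotient.mk I).toAddMonoidHom.comp W₀.subtype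
      have hf : Function.Surjective f := fun q => by
        obtain ⟨x, hx, hxB⟩ := h1 q
        exact ⟨⟨x, (hW₀ x).2 (tExt_pow_mul_mem_of_le (hxB.trans hle) (hm x))⟩, hx⟩
      have h2 : Nat.card f.ker = S.card + 1 := by
        have h0 : (0 : O) ∉ S := fun h0 => ((hW 0).1 ((hS 0).1 h0).1).1 rfl
        have hmem : ∀ x : O, x ∈ insert 0 S ↔ x ∈ W₀ ∧ x ∈ I := fun x => by
          rw [Finset.mem_insert, hS, hW]
          constructor
          · rintro (rfl | h3)
            · exact ⟨zero_mem _, zero_mem _⟩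
            · exact ⟨h3.1.2, h3.2⟩
          · intro h3
            by_cases hx : x = 0
            · exact Or.inl hx
            · exact Or.inr ⟨⟨hx, h3.1⟩, h3.2⟩
        rw [← Finset.card_insert_of_notMem h0, ← Fintype.card_coe, ← Nat.card_eq_fintype_card]
        refine Nat.card_congr
          ⟨fun x => ⟨x.1.1, (hmem _).2 ⟨x.1.2, Ideal.Quotient.eq_zero_iff_mem.1 x.2⟩⟩,
          fun x => ⟨⟨x.1, ((hmem _).1 x.2).1⟩, Ideal.Quotient.eq_zero_iff_mem.2
            ((hmem _).1 x.2).2⟩, fun _ => rfl, fun _ => rfl⟩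
      rw [← AddSubgroup.card_mul_index f.ker, AddSubgroup.index_ker, h2,
        AddMonoidHom.range_eq_top.2 hf, AddSubgroup.card_top, natCard_quotient_eq (F := F) hI0, hn]
    · refine Finset.card_ne_zero_of_mem ((hS z).2 ⟨(hW z).2 ⟨hz0, (hW₀ z).2 ?_⟩, hz⟩)
      exact tExt_pow_mul_mem_of_le (hzB.trans hle) (hm z)
  by_cases hT0 : T = ∅
  · exact ⟨M, W, 1, fun x => by rw [hW, hW₀], one_ne_zero, by simp [hT0]⟩
  · obtain ⟨I, hI⟩ := Finset.nonempty_iff_ne_empty.2 hT0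
    refine ⟨M, W, (W.filter (· ∈ I)).card, fun x => by rw [hW, hW₀], ?_, ?_⟩
    · exact (hcard I hI _ fun x => Finset.mem_filter).2
    · intro J hJ S hS
      have h1 := (hcard I hI (W.filter (· ∈ I)) fun x => Finset.mem_filter).1
      have h2 := (hcard J hJ S hS).1
      rw [← h1] at h2
      exact Nat.succ_injective
        (Nat.eq_of_mul_eq_mul_right (pow_pos Nat.card_pos n) h2)

/-- The class of an element modulo the principal units at infinity. -/
def inftyClass (b : Basis (Fin e) (RatFunc F) L) (z : L) : Set L :=
  {z' | ∃ a ∈ inftyOrder b, z' = z * (1 + tExt F L * a)}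

omit [Algebra F[X] L] [IsScalarTower F[X] (RatFunc F) L] [Finite F] in
lemma self_mem_inftyClass (b : Basis (Fin e) (RatFunc F) L) (z : L) : z ∈ inftyClass b z :=
  ⟨0, zero_mem _, by ring⟩

omit [Algebra F[X] L] [IsScalarTower F[X] (RatFunc F) L] [Finite F] in
lemma inftyClass_mul (b : Basis (Fin e) (RatFunc F) L) (z : L) {a : L} (ha : a ∈ inftyOrder b) :
    inftyClass b (z * (1 + tExt F L * a)) = inftyClass b z := by
  have ht : tExt F L ∈ inftyOrder b := by simpa using tExt_pow_mem b 1
  obtain ⟨a', ha', haa⟩ := exists_inv_one_add_tExt_mul ha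
  ext z'
  constructor
  · rintro ⟨c, hc, rfl⟩
    exact ⟨a + c + tExt F L * a * c, add_mem (add_mem ha hc) (mul_mem (mul_mem ht ha) hc), by ring⟩
  · rintro ⟨c, hc, rfl⟩
    refine ⟨a' + c + tExt F L * a' * c, add_mem (add_mem ha' hc) (mul_mem (mul_mem ht ha') hc), ?_⟩
    linear_combination -z * (1 + tExt F L * c) * haa

lemma IsWeighted.exists_shift {y : O} (h : IsWeighted b (algebraMap O L y) w) (he : 1 ≤ e)
    {n : ℕ} (hn : 2 * w * e * (e - 1) < n) :
    ∃ δ : Ideal O → Set L → O, ∀ (I J : Ideal O) (x : O), I ≠ ⊥ → (normGen F I).natDegree = n →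
      Ideal.span {x} = I * J → δ J (inftyClass b (algebraMap O L x)) ∈ J ∧
      ∃ a ∈ inftyOrder b, algebraMap O L (δ J (inftyClass b (algebraMap O L x))) =
        algebraMap O L x * (tExt F L + tExt F L ^ 2 * a) := by
  have ht : tExt F L ∈ inftyOrder b := by simpa using tExt_pow_mem b 1
  have key : ∀ (J : Ideal O) (c : Set L), ∃ d : O, ∀ (I : Ideal O) (x : O), I ≠ ⊥ →
      (normGen F I).natDegree = n → Ideal.span {x} = I * J →
      inftyClass b (algebraMap O L x) = c → d ∈ J ∧
      ∃ a ∈ inftyOrder b, algebraMap O L d =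
        algebraMap O L x * (tExt F L + tExt F L ^ 2 * a) := by
    intro J c
    by_cases hex : ∃ (I : Ideal O) (x : O), I ≠ ⊥ ∧ (normGen F I).natDegree = n ∧
        Ideal.span {x} = I * J ∧ inftyClass b (algebraMap O L x) = c
    · obtain ⟨I, ρ, hI, hIn, hρ, hc⟩ := hex
      obtain ⟨a, ha, hmul⟩ := h.exists_multiplier he hI (hIn ▸ hn)
      have h1 : ∀ z ∈ I * J, ∃ o ∈ J,
          algebraMap O L o = (tExt F L + tExt F L ^ 2 * a) * algebraMap O L z := by
        intro z hz
        refine Submodule.mul_induction_on hz ?_ ?_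
        · intro i hi j hj
          obtain ⟨o, ho⟩ := hmul i hi
          exact ⟨o * j, Ideal.mul_mem_left _ _ hj, by rw [map_mul, map_mul, ho, mul_assoc]⟩
        · rintro z z' ⟨o, ho, h2⟩ ⟨o', ho', h3⟩
          exact ⟨o + o', add_mem ho ho', by rw [map_add, map_add, h2, h3, mul_add]⟩
      obtain ⟨d, hd, hdρ⟩ := h1 ρ (hρ ▸ Ideal.mem_span_singleton_self ρ)
      refine ⟨d, fun I' x _ _ _ hx => ⟨hd, ?_⟩⟩
      obtain ⟨a₁, ha₁, hρx⟩ : algebraMap O L ρ ∈ inftyClass b (algebraMap O L x) := by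
        rw [hx, ← hc]; exact self_mem_inftyClass b _
      refine ⟨a + a₁ + tExt F L * a₁ * a,
        add_mem (add_mem ha ha₁) (mul_mem (mul_mem ht ha₁) ha), ?_⟩
      rw [hdρ, hρx]
      ring
    · exact ⟨0, fun I x hI hIn hx hc => absurd ⟨I, x, hI, hIn, hx, hc⟩ hex⟩
  choose δ hδ using key
  exact ⟨δ, fun I J x hI hIn hx => hδ J _ I x hI hIn hx rfl⟩

set_option maxHeartbeats 400000 in
/-- Vanishing of the coefficients of large degree of the `L`-series attached to the second
coefficient of the norm. -/
theorem IsWeighted.sum_addChar_nextCoeff_eq_zero {y : O}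
    (h : IsWeighted b (algebraMap O L y) w) (he : 1 ≤ e) {ψ : AddChar F ℂ}
    (hψ : ψ (-(e : F)) ≠ 1) {n : ℕ} (hn : 2 * w * e * (e - 1) < n) {T : Finset (Ideal O)}
    (hT : ∀ I, I ∈ T ↔ I ≠ ⊥ ∧ (normGen F I).natDegree = n) :
    ∑ I ∈ T, ψ (-(normGen F I).nextCoeff) = 0 := by
  classical
  have ht := tExt_ne_zero (F := F) (L := L)
  have htA : tExt F L ∈ inftyOrder b := by simpa using tExt_pow_mem b 1
  obtain ⟨M, W, c, hW, hc, hcard⟩ := h.exists_finset_card he (fun I hI => (hT I).1 hI)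
  obtain ⟨δ, hδ⟩ := h.exists_shift he hn
  have hcof : ∀ (I : Ideal O) (x : O), ∃ J : Ideal O, x ∈ I → Ideal.span {x} = I * J := by
    intro I x
    by_cases hx : x ∈ I
    · obtain ⟨J, hJ⟩ := Ideal.dvd_span_singleton.2 hx
      exact ⟨J, fun _ => hJ⟩
    · exact ⟨⊥, fun h => absurd h hx⟩
  choose cof hcof using hcof
  obtain ⟨E, hE⟩ : ∃ E : Finset (Ideal O × O), ∀ z, z ∈ E ↔ z.1 ∈ T ∧ z.2 ∈ W ∧ z.2 ∈ z.1 :=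
    ⟨(T ×ˢ W).filter fun z => z.2 ∈ z.1, fun z => by
      rw [Finset.mem_filter, Finset.mem_product, and_assoc]⟩
  have hsum : ∑ z ∈ E, ψ (-(normGen F z.1).nextCoeff) =
      c * ∑ I ∈ T, ψ (-(normGen F I).nextCoeff) := by
    rw [← Finset.sum_fiberwise_of_maps_to (g := Prod.fst) (fun z hz => ((hE z).1 hz).1),
      Finset.mul_sum]
    refine Finset.sum_congr rfl fun I hI => ?_
    rw [Finset.sum_congr rfl (g := fun _ => ψ (-(normGen F I).nextCoeff))
      (fun z hz => by rw [(Finset.mem_filter.1 hz).2]), Finset.sum_const, nsmul_eq_mul]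
    congr 2
    rw [← hcard I hI ((E.filter fun z => z.1 = I).image Prod.snd), Finset.card_image_of_injOn]
    · intro z hz z' hz' hzz
      exact Prod.ext ((Finset.mem_filter.1 hz).2.trans (Finset.mem_filter.1 hz').2.symm) hzz
    · intro x
      rw [Finset.mem_image]
      constructor
      · rintro ⟨z, hz, rfl⟩
        obtain ⟨hz1, rfl⟩ := Finset.mem_filter.1 hz
        exact ((hE z).1 hz1).2
      · intro hx
        exact ⟨(I, x), Finset.mem_filter.2 ⟨(hE _).2 ⟨hI, hx⟩, rfl⟩, rfl⟩
  -- the new element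
  obtain ⟨ν, hν⟩ : ∃ ν : Ideal O × O → O, ∀ z, ν z = z.2 +
      δ (cof z.1 z.2) (inftyClass b (algebraMap O L z.2)) := ⟨_, fun _ => rfl⟩
  obtain ⟨σ, hσ⟩ : ∃ σ : Ideal O × O → Ideal O × O, ∀ z, σ z =
      (cof (cof z.1 z.2) (ν z), ν z) := ⟨_, fun _ => rfl⟩
  have hprop : ∀ z ∈ E, Ideal.span {z.2} = z.1 * cof z.1 z.2 ∧
      Ideal.span {ν z} = (σ z).1 * cof z.1 z.2 ∧ cof z.1 z.2 ≠ ⊥ ∧ ν z ≠ 0 ∧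
      ∃ a ∈ inftyOrder b, algebraMap O L (ν z) =
        algebraMap O L z.2 * (1 + tExt F L + tExt F L ^ 2 * a) := by
    intro z hz
    obtain ⟨hzT, hzW, hzI⟩ := (hE z).1 hz
    have h1 := hcof z.1 z.2 hzI
    have hz0 := ((hW _).1 hzW).1
    obtain ⟨h2, a, ha, h3⟩ := hδ _ _ _ ((hT _).1 hzT).1 ((hT _).1 hzT).2 h1
    have hJ : cof z.1 z.2 ≠ ⊥ := by
      intro h0
      rw [h0, Ideal.mul_bot, Ideal.span_singleton_eq_bot] at h1
      exact hz0 h1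
    have hmem : ν z ∈ cof z.1 z.2 := by
      rw [hν]
      refine add_mem ?_ h2
      have h4 : z.2 ∈ z.1 * cof z.1 z.2 := by
        rw [← h1]; exact Ideal.mem_span_singleton_self _
      exact Ideal.mul_le_right (I := z.1) (J := cof z.1 z.2) h4
    have heq : algebraMap O L (ν z) =
        algebraMap O L z.2 * (1 + tExt F L + tExt F L ^ 2 * a) := by
      rw [hν, map_add, h3]; ring
    refine ⟨h1, ?_, hJ, ?_, a, ha, heq⟩
    · have h5 : (σ z).1 = cof (cof z.1 z.2) (ν z) := by rw [hσ]
      rw [h5, mul_comm _ (cof z.1 z.2)]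
      exact hcof (cof z.1 z.2) (ν z) hmem
    · intro h0
      obtain ⟨a', -, haa⟩ := exists_inv_one_add_tExt_mul (b := b) (a := 1 + tExt F L * a)
        (add_mem (one_mem _) (mul_mem htA ha))
      rw [h0, map_zero, eq_comm, mul_eq_zero] at heq
      rcases heq with h4 | h4
      · exact hz0 (by simpa using h4)
      · have h5 : 1 + tExt F L * (1 + tExt F L * a) = 0 := by linear_combination h4
        rw [h5, zero_mul] at haa
        exact zero_ne_one haa
  have hdeg : ∀ z ∈ E, (σ z).1 ≠ ⊥ ∧ (normGen F (σ z).1).natDegree = n ∧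
      (normGen F (σ z).1).nextCoeff = (normGen F z.1).nextCoeff + e := by
    intro z hz
    obtain ⟨hzT, hzW, hzI⟩ := (hE z).1 hz
    obtain ⟨h1, h2, hJ, hν0, a, ha, h3⟩ := hprop z hz
    have hI' : (σ z).1 ≠ ⊥ := by
      intro h0
      rw [h0, Ideal.bot_mul, Ideal.span_singleton_eq_bot] at h2
      exact hν0 h2
    obtain ⟨hI, hIn⟩ := (hT _).1 hzT
    have h4 := normGen_mul (F := F) hI hJ
    have h5 := normGen_mul (F := F) hI' hJ
    rw [← h1] at h4
    rw [← h2] at h5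
    have h6 := nextCoeff_normGen_span_of_eq b ((hW _).1 hzW).1 hν0 ha h3 (by
      rw [h4, (monic_normGen hI).natDegree_mul (monic_normGen hJ), hIn]; omega)
    rw [h4, h5, (monic_normGen hI).natDegree_mul (monic_normGen hJ),
      (monic_normGen hI').natDegree_mul (monic_normGen hJ),
      (monic_normGen hI).nextCoeff_mul (monic_normGen hJ),
      (monic_normGen hI').nextCoeff_mul (monic_normGen hJ)] at h6
    exact ⟨hI', by omega, by linear_combination h6.2⟩
  have hclass : ∀ z ∈ E, inftyClass b (algebraMap O L (ν z)) =
      inftyClass b (algebraMap O L z.2) := by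
    intro z hz
    obtain ⟨-, -, -, -, a, ha, h3⟩ := hprop z hz
    rw [h3, show 1 + tExt F L + tExt F L ^ 2 * a = 1 + tExt F L * (1 + tExt F L * a) by ring]
    exact inftyClass_mul b _ (add_mem (one_mem _) (mul_mem htA ha))
  have hzero : ∑ z ∈ E, ψ (-(normGen F z.1).nextCoeff) = 0 := by
    refine sum_eq_zero_of_injOn (σ := σ) (c := ψ (-(e : F))) ?_ ?_ hψ ?_
    · intro z hz
      obtain ⟨hzT, hzW, hzI⟩ := (hE z).1 hz
      obtain ⟨h1, h2, hJ, hν0, a, ha, h3⟩ := hprop z hz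
      obtain ⟨h4, h5, -⟩ := hdeg z hz
      have h6 : (σ z).2 = ν z := by rw [hσ]
      rw [hE, hT, h6, hW, h3, ← mul_assoc]
      refine ⟨⟨h4, h5⟩, ⟨hν0, mul_mem ((hW _).1 hzW).2 ?_⟩, ?_⟩
      · exact add_mem (add_mem (one_mem _) htA) (mul_mem (tExt_pow_mem b 2) ha)
      · have h7 : ν z ∈ (σ z).1 * cof z.1 z.2 := by
          rw [← h2]; exact Ideal.mem_span_singleton_self _
        exact Ideal.mul_le_left (I := (σ z).1) (J := cof z.1 z.2) h7
    · intro z hz z' hz' hzz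
      obtain ⟨h1, h2, hJ, hν0, -⟩ := hprop z hz
      obtain ⟨h1', h2', hJ', -, -⟩ := hprop z' hz'
      have h3 : ν z = ν z' := by
        have := congrArg Prod.snd hzz
        rwa [hσ, hσ] at this
      have hne := (hdeg z hz).1
      rw [← hzz, ← h3, h2] at h2'
      have h4 := mul_left_cancel₀ hne h2'
      have h5 : z.2 = z'.2 := by
        have h6 := h3
        rw [hν, hν, ← hclass z hz, ← hclass z' hz', h3, h4] at h6
        exact add_right_cancel h6
      refine Prod.ext ?_ h5
      have h7 : Ideal.span {z.2} = Ideal.span {z'.2} := by rw [h5]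
      rw [h1, h1', h4] at h7
      exact mul_right_cancel₀ hJ' h7
    · intro z hz
      rw [(hdeg z hz).2.2, ← AddChar.map_add_eq_mul]
      congr 1
      ring
  rw [hzero] at hsum
  exact (mul_eq_zero.1 hsum.symm).resolve_left (by exact_mod_cast hc)

end Vanishing

section Conductor

variable {F : Type*} [Field F] {L : Type*} [Field L] [Algebra (RatFunc F) L] {e : ℕ}
  {b : Basis (Fin e) (RatFunc F) L} {w : ℕ}
  [Algebra F[X] L] [IsScalarTower F[X] (RatFunc F) L]
  {O : Type*} [CommRing O] [Algebra F[X] O] [Algebra O L] [IsScalarTower F[X] O L]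

lemma IsWeighted.dvd_of_aeval_eq_zero {y : O} (h : IsWeighted b (algebraMap O L y) w)
    {P : F[X][X]} (hP : P.Monic) (hPe : P.natDegree = e) (hPy : aeval y P = 0) (he : 1 ≤ e)
    {c : F[X][X]} (hc : aeval y c = 0) : P ∣ c := by
  rw [← modByMonic_eq_zero_iff_dvd hP]
  obtain ⟨r, hr⟩ : ∃ r, r = c %ₘ P := ⟨_, rfl⟩
  have hdeg : r.natDegree < e := by
    rw [hr, ← hPe]; exact natDegree_modByMonic_lt c hP (by rintro rfl; simp at hPe; omega)
  have hry : aeval y r = 0 := by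
    have h1 := modByMonic_add_div c P
    have h2 := congrArg (aeval y) h1
    rwa [map_add, map_mul, hPy, zero_mul, add_zero, hc, ← hr] at h2
  rw [← hr]
  have h3 : ∑ j : Fin e, algebraMap F[X] L (r.coeff j) * algebraMap O L y ^ (j : ℕ) = 0 := by
    have h4 := congrArg (algebraMap O L) hry
    rw [aeval_eq_sum_range' hdeg, map_zero, map_sum, Finset.sum_range] at h4
    rw [← h4]
    refine Finset.sum_congr rfl fun j _ => ?_
    rw [Algebra.smul_def, map_mul, map_pow, ← IsScalarTower.algebraMap_apply]
  have h5 := h.eq_zero_of_sum_eq_zero (g := fun j => r.coeff j) h3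
  ext1 j
  by_cases hj : j < e
  · exact congrFun h5 ⟨j, hj⟩
  · rw [coeff_eq_zero_of_natDegree_lt (by omega), coeff_zero]

lemma IsWeighted.pow_mul_aeval_mem {y : O} (h : IsWeighted b (algebraMap O L y) w)
    {c : F[X][X]} {m : ℕ} (hc : ∀ j, c.coeff j ≠ 0 → (c.coeff j).natDegree + w * j ≤ m) :
    tExt F L ^ m * algebraMap O L (aeval y c) ∈ inftyOrder b := by
  rw [aeval_eq_sum_range, map_sum, Finset.mul_sum]
  refine sum_mem fun j _ => ?_
  rw [Algebra.smul_def, map_mul, map_pow, ← IsScalarTower.algebraMap_apply]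
  by_cases h0 : c.coeff j = 0
  · rw [h0, map_zero, zero_mul, mul_zero]; exact zero_mem _
  · exact h.pow_mul_mem (hc j h0)

lemma IsWeighted.aeval_derivative_ne_zero {y : O} (h : IsWeighted b (algebraMap O L y) w)
    {P : F[X][X]} (hP : P.Monic) (hPe : P.natDegree = e) (hPy : aeval y P = 0) (he : (e : F) ≠ 0) :
    aeval y (derivative P) ≠ 0 := by
  intro h0
  have he1 : 1 ≤ e := Nat.one_le_iff_ne_zero.2 (by rintro rfl; simp at he)
  have h1 := h.dvd_of_aeval_eq_zero hP hPe hPy he1 h0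
  have h2 : derivative P ≠ 0 := by
    intro h3
    have h4 := congrArg (fun q : F[X][X] => q.coeff (e - 1)) h3
    simp only [coeff_derivative, coeff_zero] at h4
    have h5 : P.coeff (e - 1 + 1) = 1 := by
      rw [Nat.sub_add_cancel he1, ← hPe]; exact hP
    rw [h5, one_mul, ← Nat.cast_add_one, Nat.sub_add_cancel he1, ← C_eq_natCast, C_eq_zero] at h4
    exact he h4
  have h3 := natDegree_le_of_dvd h1 h2
  have h4 := natDegree_derivative_lt (p := P) (by omega)
  omega

variable [IsDedekindDomain O] [Module.Finite F[X] O] [IsTorsionFree F[X] O] [IsFractionRing O L]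

lemma IsWeighted.natDegree_normGen_derivative_le {y : O} (h : IsWeighted b (algebraMap O L y) w)
    {P : F[X][X]} (hP : P.Monic) (hPe : P.natDegree = e) (hPy : aeval y P = 0) (he : (e : F) ≠ 0)
    (hPw : ∀ j, P.coeff j ≠ 0 → (P.coeff j).natDegree + w * j ≤ w * e) :
    (normGen F (Ideal.span {aeval y (derivative P)})).natDegree ≤ w * e * (e - 1) := by
  have he1 : 1 ≤ e := Nat.one_le_iff_ne_zero.2 (by rintro rfl; simp at he)
  rw [natDegree_normGen_span (h.aeval_derivative_ne_zero hP hPe hPy he)]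
  refine (natDegree_norm_le b (m := w * (e - 1)) (h.pow_mul_aeval_mem fun j hj => ?_)).trans
    (le_of_eq (by ring))
  have h1 : P.coeff (j + 1) ≠ 0 := by
    rw [coeff_derivative] at hj; exact left_ne_zero_of_mul hj
  have h2 := hPw _ h1
  have h3 : (coeff (derivative P) j).natDegree ≤ (P.coeff (j + 1)).natDegree := by
    rw [coeff_derivative, ← Nat.cast_add_one, ← C_eq_natCast]
    exact natDegree_mul_C_le _ _
  obtain ⟨e', rfl⟩ := Nat.exists_eq_add_of_le' he1
  rw [Nat.add_sub_cancel]
  rw [mul_add, mul_add] at h2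
  omega

lemma IsWeighted.exists_aeval_eq_normGen_mul [Algebra.IsSeparable (RatFunc F) L] {y : O}
    (h : IsWeighted b (algebraMap O L y) w)
    {P : F[X][X]} (hP : P.Monic) (hPe : P.natDegree = e) (hPy : aeval y P = 0) (he : (e : F) ≠ 0)
    (B : PowerBasis (RatFunc F) L) (hB : B.gen = algebraMap O L y)
    (hmin : minpoly (RatFunc F) B.gen = P.map (algebraMap F[X] (RatFunc F))) (o : O) :
    ∃ c : F[X][X], aeval y c =
      algebraMap F[X] O (normGen F (Ideal.span {aeval y (derivative P)})) * o := by
  have hd := h.aeval_derivative_ne_zero hP hPe hPy he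
  have := Module.Finite.of_basis b
  have hint : ∀ x : O, IsIntegral F[X] (algebraMap O L x) := fun x =>
    (Algebra.IsIntegral.isIntegral (R := F[X]) x).map (IsScalarTower.toAlgHom F[X] O L)
  have h1 := Algebra.discr_mul_isIntegral_mem_adjoin (R := F[X]) (RatFunc F) (B := B)
    (hB ▸ hint y) (hint o)
  have h2 : aeval B.gen (derivative (minpoly (RatFunc F) B.gen)) =
      algebraMap O L (aeval y (derivative P)) := by
    rw [hmin, hB, derivative_map, aeval_map_algebraMap, aeval_algebraMap_apply]
  rw [Algebra.discr_powerBasis_eq_norm, h2, ← algebraMap_norm_eq b, hB,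
    Algebra.adjoin_singleton_eq_range_aeval] at h1
  obtain ⟨c, hc⟩ := h1
  obtain ⟨N, hN⟩ : ∃ N, N = Algebra.norm F[X] (aeval y (derivative P)) := ⟨_, rfl⟩
  obtain ⟨s, hs⟩ : ∃ s : F[X], s = (-1) ^ (finrank (RatFunc F) L * (finrank (RatFunc F) L - 1) / 2)
      := ⟨_, rfl⟩
  have hss : s * s = 1 := by rw [hs, ← mul_pow]; simp
  refine ⟨C (s * C N.leadingCoeff⁻¹) * c, IsFractionRing.injective O L ?_⟩
  rw [normGen_span_singleton hd, ← hN, map_mul, aeval_C, map_mul, map_mul, ← aeval_algebraMap_apply]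
  have h3 : aeval (algebraMap O L y) c =
      algebraMap O L (algebraMap F[X] O (s * N)) * algebraMap O L o := by
    refine hc.trans ?_
    rw [← IsScalarTower.algebraMap_apply, IsScalarTower.algebraMap_apply F[X] (RatFunc F) L,
      ← Algebra.smul_def, map_mul, hs, map_pow, map_neg, map_one, hN]
  have h4 : (s * C N.leadingCoeff⁻¹) * (s * N) = C N.leadingCoeff⁻¹ * N := by
    linear_combination C N.leadingCoeff⁻¹ * N * hss
  have h5 := congrArg (fun z => algebraMap O L (algebraMap F[X] O z)) h4
  rw [h3]
  simp only [map_mul] at h5 ⊢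
  linear_combination algebraMap O L o * h5

lemma IsWeighted.exists_bezout [Algebra.IsSeparable (RatFunc F) L] {y : O}
    (h : IsWeighted b (algebraMap O L y) w)
    {P : F[X][X]} (hP : P.Monic) (hPe : P.natDegree = e) (hPy : aeval y P = 0) (he : (e : F) ≠ 0)
    (B : PowerBasis (RatFunc F) L) (hB : B.gen = algebraMap O L y)
    (hmin : minpoly (RatFunc F) B.gen = P.map (algebraMap F[X] (RatFunc F))) :
    ∃ u v : F[X][X], u * P + v * derivative P =
      C (normGen F (Ideal.span {aeval y (derivative P)}) ^ 2) := by
  obtain ⟨g, hg⟩ : ∃ g, g = normGen F (Ideal.span {aeval y (derivative P)}) := ⟨_, rfl⟩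
  have he1 : 1 ≤ e := Nat.one_le_iff_ne_zero.2 (by rintro rfl; simp at he)
  have h1 : algebraMap F[X] O g ∈ Ideal.span {aeval y (derivative P)} :=
    hg ▸ algebraMap_normGen_mem _
  obtain ⟨z, hz⟩ := Ideal.mem_span_singleton'.1 h1
  obtain ⟨c, hc⟩ := h.exists_aeval_eq_normGen_mul hP hPe hPy he B hB hmin z
  rw [← hg] at hc ⊢
  have h2 : aeval y (C (g ^ 2) - c * derivative P) = 0 := by
    rw [map_sub, aeval_C, map_mul, hc, map_pow]
    linear_combination -algebraMap F[X] O g * hz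
  obtain ⟨u, hu⟩ := h.dvd_of_aeval_eq_zero hP hPe hPy he1 h2
  exact ⟨u, c, by linear_combination -hu⟩

end Conductor

section Points

/-- Evaluation of a bivariate polynomial at a point over an extension. -/
noncomputable def evalXY {F k : Type*} [Field F] [Field k] [Algebra F k] (z : k × k) :
    F[X][X] →+* k :=
  eval₂RingHom (eval₂RingHom (algebraMap F k) z.1) z.2

variable {F k : Type*} [Field F] [Field k] [Algebra F k]

lemma evalXY_C (z : k × k) (g : F[X]) : evalXY z (C g) = aeval z.1 g := by
  simp only [evalXY, coe_eval₂RingHom, eval₂_C]; rfl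

lemma evalXY_X (z : k × k) : evalXY z (X : F[X][X]) = z.2 := by
  simp [evalXY]

lemma evalXY_eq_eval_map (z : k × k) (P : F[X][X]) :
    evalXY z P = eval z.2 ((P.map (mapRingHom (algebraMap F k))).map (evalRingHom z.1)) := by
  rw [evalXY, coe_eval₂RingHom, map_map, eval_map]
  congr 1
  ext <;> simp

lemma evalXY_eq_eval (z : F × F) (P : F[X][X]) :
    evalXY z P = eval z.2 (P.map (evalRingHom z.1)) := by
  rw [evalXY, coe_eval₂RingHom, eval_map]; rfl

lemma evalXY_algebraMap (z : F × F) (P : F[X][X]) :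
    evalXY (algebraMap F k z.1, algebraMap F k z.2) P = algebraMap F k (evalXY z P) := by
  have h : (evalXY (algebraMap F k z.1, algebraMap F k z.2) : F[X][X] →+* k) =
      (algebraMap F k).comp (evalXY z) := by
    refine Polynomial.ringHom_ext' (Polynomial.ringHom_ext' ?_ ?_) ?_
    · ext; simp [evalXY]
    · simp [evalXY]
    · simp [evalXY]
  rw [h]; rfl

lemma evalXY_pow_char {p : ℕ} [Fact p.Prime] {k : Type*} [Field k] [Algebra (ZMod p) k] {r : ℕ}
    {z : k × k} (h1 : z.1 ^ p ^ r = z.1) (h2 : z.2 ^ p ^ r = z.2) (c : (ZMod p)[X][X]) :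
    evalXY z c ^ p ^ r = evalXY z c := by
  have : CharP k p := charP_of_injective_algebraMap (algebraMap (ZMod p) k).injective p
  have h : (iterateFrobenius k p r).comp (evalXY z : (ZMod p)[X][X] →+* k) = evalXY z := by
    refine Polynomial.ringHom_ext' (Polynomial.ringHom_ext' (Subsingleton.elim _ _) ?_) ?_
    · simpa [evalXY, iterateFrobenius_def] using h1
    · simpa [evalXY, iterateFrobenius_def] using h2
  exact congrArg (fun f => f c) h

/-- The points of a plane curve with coordinates fixed by the `Q`-power map. -/
noncomputable def curvePts (k : Type*) [Field k] [DecidableEq k] [Algebra F k] (P : F[X][X])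
    (Q : ℕ) :
    Finset (k × k) :=
  (fixedPts k Q ×ˢ fixedPts k Q).filter fun z => evalXY z P = 0

lemma mem_curvePts [DecidableEq k] {P : F[X][X]} {Q : ℕ} (hQ : 1 < Q) {z : k × k} :
    z ∈ curvePts k P Q ↔ z.1 ^ Q = z.1 ∧ z.2 ^ Q = z.2 ∧ evalXY z P = 0 := by
  rw [curvePts, Finset.mem_filter, Finset.mem_product, mem_fixedPts hQ, mem_fixedPts hQ, and_assoc]

/-- A monic curve has few points above the zeros of a polynomial. -/
lemma card_points_above_le {P : F[X][X]} (hP : P.Monic) {g : F[X]} (hg : g ≠ 0)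
    (S : Finset (k × k)) (hS : ∀ z ∈ S, evalXY z P = 0 ∧ aeval z.1 g = 0) :
    S.card ≤ P.natDegree * g.natDegree := by
  classical
  have hQm : ∀ x : k, ((P.map (mapRingHom (algebraMap F k))).map (evalRingHom x)).Monic :=
    fun x => (hP.map _).map _
  have hsub : S ⊆ (g.map (algebraMap F k)).roots.toFinset.biUnion fun x =>
      (((P.map (mapRingHom (algebraMap F k))).map (evalRingHom x)).roots.toFinset).image
        fun y => (x, y) := by
    intro z hz
    obtain ⟨h1, h2⟩ := hS z hz
    simp only [Finset.mem_biUnion, Finset.mem_image, Multiset.mem_toFinset]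
    refine ⟨z.1, ?_, z.2, ?_, rfl⟩
    · rw [mem_roots ((Polynomial.map_ne_zero_iff (algebraMap F k).injective).2 hg), IsRoot.def,
        eval_map_algebraMap, h2]
    · rw [mem_roots (hQm _).ne_zero, IsRoot.def, ← evalXY_eq_eval_map, h1]
  refine (Finset.card_le_card hsub).trans ?_
  refine (Finset.card_biUnion_le_card_mul _ _ P.natDegree fun x _ => ?_).trans ?_
  · refine Finset.card_image_le.trans ((Multiset.toFinset_card_le _).trans
        ((card_roots' _).trans ?_))
    rw [(hP.map _).natDegree_map, hP.natDegree_map]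
  · rw [mul_comm]
    refine Nat.mul_le_mul_left _ ((Multiset.toFinset_card_le _).trans ((card_roots' _).trans ?_))
    exact natDegree_map_le

variable {O : Type*} [CommRing O] [IsDomain O] [Algebra F[X] O] [Algebra F O]
    [IsScalarTower F F[X] O]

omit [IsDomain O] in
lemma algHom_aeval_eq_evalXY (φ : O →ₐ[F] k) (y : O) (c : F[X][X]) :
    φ (aeval y c) = evalXY (φ (algebraMap F[X] O X), φ y) c := by
  have h : (φ : O →+* k).comp (aeval y : F[X][X] →ₐ[F[X]] O).toRingHom =
      evalXY (φ (algebraMap F[X] O X), φ y) := by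
    refine Polynomial.ringHom_ext' (Polynomial.ringHom_ext' ?_ ?_) ?_
    · ext a
      have h1 : algebraMap F[X] O (C a) = algebraMap F O a :=
        (IsScalarTower.algebraMap_apply F F[X] O a).symm
      simp [evalXY, h1]
    · simp [evalXY]
    · simp [evalXY]
  exact congrArg (fun f => f c) h

omit [IsDomain O] in
lemma algHom_algebraMap_eq_aeval (φ : O →ₐ[F] k) (g : F[X]) :
    φ (algebraMap F[X] O g) = aeval (φ (algebraMap F[X] O X)) g := by
  rw [← evalXY_C (φ (algebraMap F[X] O X), φ 0), ← algHom_aeval_eq_evalXY, aeval_C]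

lemma card_homs_killing_le [Module.Finite F[X] O] [Module.IsTorsionFree F[X] O] {a : O} (ha : a ≠ 0)
    (S : Finset (O →ₐ[F] k)) (hS : ∀ φ ∈ S, φ a = 0) :
    S.card ≤ (Algebra.norm F[X] a).natDegree := by
  have hfree : Module.Free F[X] O := inferInstance
  have := finite_quotient_span (Module.finBasis F[X] O) ha
  rw [← finrank_quotient_span_eq_natDegree_norm (Module.finBasis F[X] O) ha]
  have hfin : Finite ((O ⧸ Ideal.span {a}) →ₐ[F] k) := inferInstance
  let f : S → ((O ⧸ Ideal.span {a}) →ₐ[F] k) := fun φ =>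
    Ideal.Quotient.liftₐ _ φ.1 (by
      intro x hx
      obtain ⟨c, rfl⟩ := Ideal.mem_span_singleton'.1 hx
      rw [map_mul, hS _ φ.2, mul_zero])
  have hf : Function.Injective f := fun φ φ' h => Subtype.ext (AlgHom.ext fun x =>
    congrArg (fun g => g (Ideal.Quotient.mk _ x)) h)
  rw [← Fintype.card_coe, ← Nat.card_eq_fintype_card]
  exact (Nat.card_le_card_of_injective f hf).trans (card_algHom_le_finrank F _ k)

variable {y : O} {P : F[X][X]} {g : F[X]}

omit [IsDomain O] in
/-- Away from the conductor, points of the plane model lift to the normalisation. -/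
lemma exists_algHom_of_point (hker : ∀ c : F[X][X], aeval y c = 0 → P ∣ c)
    (hg : ∀ o : O, ∃ c : F[X][X], aeval y c = algebraMap F[X] O g * o) {z : k × k}
    (hz : evalXY z P = 0) (hgz : aeval z.1 g ≠ 0) :
    ∃ φ : O →ₐ[F] k, φ (algebraMap F[X] O X) = z.1 ∧ φ y = z.2 := by
  choose c hc using hg
  have hev : ∀ c c' : F[X][X], aeval y c = aeval y c' → evalXY z c = evalXY z c' := by
    intro c c' h
    obtain ⟨u, hu⟩ := hker (c - c') (by rw [map_sub, h, sub_self])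
    rw [← sub_eq_zero, ← map_sub, hu, map_mul, hz, zero_mul]
  have hmul : ∀ a b, evalXY z (c (a * b)) * aeval z.1 g = evalXY z (c a) * evalXY z (c b) := by
    intro a b
    rw [← evalXY_C z g, ← map_mul, ← map_mul]
    refine hev _ _ ?_
    rw [map_mul, map_mul, aeval_C, hc, hc, hc]
    ring
  have hadd : ∀ a b, evalXY z (c (a + b)) = evalXY z (c a) + evalXY z (c b) := by
    intro a b
    rw [← map_add]
    refine hev _ _ ?_
    rw [map_add, hc, hc, hc, mul_add]
  have haev : ∀ d : F[X][X], evalXY z (c (aeval y d)) = aeval z.1 g * evalXY z d := by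
    intro d
    rw [← evalXY_C z g, ← map_mul]
    refine hev _ _ ?_
    rw [map_mul, aeval_C, hc]
  have h1 : evalXY z (c 1) = aeval z.1 g := by simpa using haev 1
  have h0 : evalXY z (c 0) = 0 := by simpa using haev 0
  refine ⟨⟨⟨⟨⟨fun o => evalXY z (c o) / aeval z.1 g, ?_⟩, ?_⟩, ?_, ?_⟩, ?_⟩, ?_, ?_⟩
  · rw [h1, div_self hgz]
  · intro a b
    change evalXY z (c _) / aeval z.1 g =
      evalXY z (c _) / aeval z.1 g * (evalXY z (c _) / aeval z.1 g)
    rw [div_mul_div_comm, ← hmul, mul_div_mul_right _ _ hgz]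
  · change evalXY z (c _) / aeval z.1 g = _
    rw [h0, zero_div]
  · intro a b
    change evalXY z (c _) / aeval z.1 g =
      evalXY z (c _) / aeval z.1 g + evalXY z (c _) / aeval z.1 g
    rw [hadd, add_div]
  · intro a
    change evalXY z (c _) / aeval z.1 g = _
    have h := haev (C (C a))
    rw [aeval_C, evalXY_C, aeval_C, ← Polynomial.algebraMap_eq (R := F),
      ← IsScalarTower.algebraMap_apply F F[X] O] at h
    rw [h, mul_div_cancel_left₀ _ hgz]
  · change evalXY z (c _) / aeval z.1 g = _
    have h := haev (C X)
    rw [aeval_C, evalXY_C, aeval_X] at h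
    rw [h, mul_div_cancel_left₀ _ hgz]
  · change evalXY z (c _) / aeval z.1 g = _
    have h := haev X
    rw [aeval_X, evalXY_X] at h
    rw [h, mul_div_cancel_left₀ _ hgz]

omit [IsDomain O] in
lemma algHom_eq_of_point (hg : ∀ o : O, ∃ c : F[X][X], aeval y c = algebraMap F[X] O g * o)
    {φ φ' : O →ₐ[F] k} (hX : φ (algebraMap F[X] O X) = φ' (algebraMap F[X] O X)) (hy : φ y = φ' y)
    (hgφ : aeval (φ (algebraMap F[X] O X)) g ≠ 0) : φ = φ' := by
  ext o
  obtain ⟨c, hc⟩ := hg o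
  have h1 := algHom_aeval_eq_evalXY φ y c
  have h2 := algHom_aeval_eq_evalXY φ' y c
  rw [hc, map_mul, algHom_algebraMap_eq_aeval] at h1 h2
  rw [← hX, ← hy, ← h1] at h2
  exact (mul_left_cancel₀ hgφ h2).symm

/-- A bound for the number of points common to two curves. -/
lemma card_common_points_le [Module.Finite F[X] O] [Module.IsTorsionFree F[X] O] (hP : P.Monic)
    (hker : ∀ c : F[X][X], aeval y c = 0 → P ∣ c) (hg0 : g ≠ 0)
    (hg : ∀ o : O, ∃ c : F[X][X], aeval y c = algebraMap F[X] O g * o) {R : F[X][X]}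
    (hR : aeval y R ≠ 0) (S : Finset (k × k))
    (hS : ∀ z ∈ S, evalXY z P = 0 ∧ evalXY z R = 0) :
    S.card ≤ (Algebra.norm F[X] (aeval y R)).natDegree + P.natDegree * g.natDegree := by
  classical
  rw [← Finset.card_filter_add_card_filter_not (s := S) (fun z => aeval z.1 g ≠ 0)]
  refine Nat.add_le_add ?_ (card_points_above_le hP hg0 _ fun z hz => ?_)
  · have key : ∀ z : {z // z ∈ S.filter fun z => aeval z.1 g ≠ 0}, ∃ φ : O →ₐ[F] k,
        φ (algebraMap F[X] O X) = z.1.1 ∧ φ y = z.1.2 := fun z => by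
      obtain ⟨h1, h2⟩ := Finset.mem_filter.1 z.2
      exact exists_algHom_of_point hker hg (hS z h1).1 h2
    choose φ hφ using key
    rw [← Finset.card_attach, ← Finset.card_image_of_injective (f := φ) _ fun z z' h =>
      Subtype.ext (Prod.ext (by rw [← (hφ z).1, ← (hφ z').1, h])
        (by rw [← (hφ z).2, ← (hφ z').2, h]))]
    refine card_homs_killing_le hR _ fun ψ hψ => ?_
    obtain ⟨z, hz, rfl⟩ := Finset.mem_image.1 hψ
    rw [algHom_aeval_eq_evalXY, (hφ z).1, (hφ z).2]
    exact (hS z (Finset.mem_filter.1 z.2).1).2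
  · rw [Finset.mem_filter, not_not] at hz
    exact ⟨(hS z hz.1).1, hz.2⟩

lemma norm_sum_sub_sum_le {α β : Type*} (S : Finset α) (T : Finset β) (f : α → ℂ) (h : β → ℂ)
    (pS : α → Prop) (pT : β → Prop) [DecidablePred pS] [DecidablePred pT]
    (hf : ∀ a, ‖f a‖ ≤ 1) (hh : ∀ a, ‖h a‖ ≤ 1)
    (heq : ∑ a ∈ S.filter pS, f a = ∑ a ∈ T.filter pT, h a) {m n : ℕ}
    (hm : (S.filter fun a => ¬pS a).card ≤ m) (hn : (T.filter fun a => ¬pT a).card ≤ n) :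
    ‖∑ a ∈ S, f a - ∑ a ∈ T, h a‖ ≤ m + n := by
  rw [← Finset.sum_filter_add_sum_filter_not S pS, ← Finset.sum_filter_add_sum_filter_not T pT, heq,
    add_sub_add_left_eq_sub]
  have h1 : ‖∑ a ∈ S.filter fun a => ¬pS a, f a‖ ≤ m := by
    refine (norm_sum_le_of_le _ fun a _ => hf a).trans ?_
    rw [Finset.sum_const, nsmul_eq_mul, mul_one]; exact_mod_cast hm
  have h2 : ‖∑ a ∈ T.filter fun a => ¬pT a, h a‖ ≤ n := by
    refine (norm_sum_le_of_le _ fun a _ => hh a).trans ?_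
    rw [Finset.sum_const, nsmul_eq_mul, mul_one]; exact_mod_cast hn
  exact (norm_sub_le _ _).trans (add_le_add h1 h2)

/-- Comparison of sums over the places of the normalisation and over the points of a plane model. -/
lemma norm_sum_homs_sub_sum_points_le {p : ℕ} [Fact p.Prime] {k : Type*} [Field k] [DecidableEq k]
    [Algebra (ZMod p) k] {O : Type*} [CommRing O] [IsDomain O] [Algebra (ZMod p)[X] O]
    [Algebra (ZMod p) O] [IsScalarTower (ZMod p) (ZMod p)[X] O]
    [Module.Finite (ZMod p)[X] O] [Module.IsTorsionFree (ZMod p)[X] O]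
    {y : O} {P : (ZMod p)[X][X]} {g : (ZMod p)[X]} (hP : P.Monic)
    (hPy : aeval y P = 0) (hker : ∀ c : (ZMod p)[X][X], aeval y c = 0 → P ∣ c) (hg0 : g ≠ 0)
    (hg : ∀ o : O, ∃ c : (ZMod p)[X][X], aeval y c = algebraMap (ZMod p)[X] O g * o) {r : ℕ}
    (hr : 0 < r) {H : Finset (O →ₐ[ZMod p] k)} (hH : ∀ φ, φ ∈ H ↔ ∀ x, φ x ^ p ^ r = φ x)
    {G : k → ℂ} (hG : ∀ x, ‖G x‖ ≤ 1) :
    ‖∑ φ ∈ H, G (φ (algebraMap (ZMod p)[X] O X)) - ∑ z ∈ curvePts k P (p ^ r), G z.1‖ ≤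
      (Algebra.norm (ZMod p)[X] (algebraMap (ZMod p)[X] O g)).natDegree +
        (P.natDegree * g.natDegree : ℕ) := by
  classical
  have hQ := Nat.one_lt_pow hr.ne' (Fact.out : p.Prime).one_lt
  refine norm_sum_sub_sum_le H (curvePts k P (p ^ r)) _ _
    (fun φ => aeval (φ (algebraMap (ZMod p)[X] O X)) g ≠ 0) (fun z => aeval z.1 g ≠ 0)
    (fun _ => hG _) (fun _ => hG _) ?_ ?_ ?_
  · refine Finset.sum_bij (fun φ _ => (φ (algebraMap (ZMod p)[X] O X), φ y)) ?_ ?_ ?_ fun _ _ => rfl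
    · intro φ hφ
      rw [Finset.mem_filter, hH] at hφ
      rw [Finset.mem_filter, mem_curvePts hQ]
      exact ⟨⟨hφ.1 _, hφ.1 _, by rw [← algHom_aeval_eq_evalXY, hPy, map_zero]⟩, hφ.2⟩
    · intro φ hφ φ' hφ' h
      exact algHom_eq_of_point hg (congrArg Prod.fst h) (congrArg Prod.snd h)
        (Finset.mem_filter.1 hφ).2
    · intro z hz
      rw [Finset.mem_filter, mem_curvePts hQ] at hz
      obtain ⟨⟨h1, h2, h3⟩, h4⟩ := hz
      obtain ⟨φ, hφX, hφy⟩ := exists_algHom_of_point hker hg h3 h4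
      refine ⟨φ, ?_, Prod.ext hφX hφy⟩
      rw [Finset.mem_filter, hH, hφX]
      refine ⟨fun x => ?_, h4⟩
      obtain ⟨c, hc⟩ := hg x
      have h5 := algHom_aeval_eq_evalXY φ y c
      rw [hc, map_mul, algHom_algebraMap_eq_aeval, hφX, hφy] at h5
      have h6 : (aeval z.1 g : k) ^ p ^ r = aeval z.1 g := by
        have := evalXY_pow_char h1 h2 (C g)
        rwa [evalXY_C] at this
      have h7 := evalXY_pow_char h1 h2 c
      rw [← h5, mul_pow, h6] at h7
      exact mul_left_cancel₀ h4 h7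
  · refine card_homs_killing_le ?_ _ fun φ hφ => ?_
    · rwa [Ne, FaithfulSMul.algebraMap_eq_zero_iff]
    · rw [Finset.mem_filter, not_not] at hφ
      rw [algHom_algebraMap_eq_aeval, hφ.2]
  · refine card_points_above_le hP hg0 _ fun z hz => ?_
    rw [Finset.mem_filter, mem_curvePts hQ, not_not] at hz
    exact ⟨hz.1.2.2, hz.2⟩

end Points

section IrreducibleCurve

lemma nextCoeff_prod_X_sub_C {R ι : Type*} [CommRing R] [Nontrivial R] (s : Finset ι) (f : ι → R) :
    (∏ i ∈ s, (X - C (f i))).nextCoeff = -∑ i ∈ s, f i :=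
  prod_X_sub_C_nextCoeff f

variable {p : ℕ} [Fact p.Prime]

lemma addChar_nextCoeff_frobPoly {k : Type*} [Field k] [Algebra (ZMod p) k] (ψ : AddChar (ZMod p) ℂ)
    {r : ℕ} (hr : 0 < r) {x : k} (hx : x ^ p ^ r = x) :
    ψ (-(frobPoly p r x).nextCoeff) = liftFn k ψ (frobTrace p r x) := by
  have h : algebraMap (ZMod p) k (-(frobPoly p r x).nextCoeff) = frobTrace p r x := by
    rw [map_neg, ← nextCoeff_map (algebraMap (ZMod p) k).injective, (map_frobPoly hr hx).1,
      nextCoeff_prod_X_sub_C, neg_neg, frobTrace]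
  rw [← h, liftFn_algebraMap]

lemma sum_curvePts {k : Type*} [Field k] [DecidableEq k] [Algebra (ZMod p) k] (P : (ZMod p)[X][X])
    (Q : ℕ) (f : k → ℂ) :
    ∑ z ∈ curvePts k P Q, f z.1 = ∑ x ∈ fixedPts k Q, (((fixedPts k Q).filter fun y =>
      eval y ((P.map (mapRingHom (algebraMap (ZMod p) k))).map (evalRingHom x)) = 0).card : ℂ) *
        f x := by
  rw [curvePts, Finset.sum_filter, Finset.sum_product]
  refine Finset.sum_congr rfl fun x _ => ?_
  rw [← Finset.sum_filter]
  refine (Finset.sum_const (f x)).trans ?_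
  rw [nsmul_eq_mul]
  simp only [evalXY_eq_eval_map]

/-- The points of a plane curve over a finite prime field. -/
noncomputable def ratPts (P : (ZMod p)[X][X]) : Finset (ZMod p × ZMod p) :=
  Finset.univ.filter fun z => eval z.2 (P.map (evalRingHom z.1)) = 0

lemma mem_ratPts {P : (ZMod p)[X][X]} {z : ZMod p × ZMod p} : z ∈ ratPts P ↔ evalXY z P = 0 := by
  simp [ratPts, evalXY_eq_eval]

lemma sum_curvePts_one {k : Type*} [Field k] [DecidableEq k] [Algebra (ZMod p) k]
    (P : (ZMod p)[X][X]) (f : k → ℂ) :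
    ∑ z ∈ curvePts k P (p ^ 1), f z.1 = ∑ z ∈ ratPts P, f (algebraMap (ZMod p) k z.1) := by
  have hQ := Nat.one_lt_pow one_ne_zero (Fact.out : p.Prime).one_lt
  have hi := (algebraMap (ZMod p) k).injective
  symm
  refine Finset.sum_bij (fun z _ => (algebraMap (ZMod p) k z.1, algebraMap (ZMod p) k z.2)) ?_ ?_ ?_
    fun _ _ => rfl
  · intro z hz
    rw [mem_curvePts hQ, pow_one, ← map_pow, ← map_pow, ZMod.pow_card, ZMod.pow_card]
    exact ⟨rfl, rfl, by rw [evalXY_algebraMap, mem_ratPts.1 hz, map_zero]⟩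
  · intro z _ z' _ h
    exact Prod.ext (hi (congrArg Prod.fst h)) (hi (congrArg Prod.snd h))
  · intro z hz
    rw [mem_curvePts hQ, pow_one] at hz
    obtain ⟨u, hu⟩ := exists_zmod_of_pow_eq (algebraMap (ZMod p) k) hz.1
    obtain ⟨v, hv⟩ := exists_zmod_of_pow_eq (algebraMap (ZMod p) k) hz.2.1
    have hz' : z = (algebraMap (ZMod p) k (u, v).1, algebraMap (ZMod p) k (u, v).2) :=
      Prod.ext hu.symm hv.symm
    refine ⟨(u, v), mem_ratPts.2 (hi ?_), hz'.symm⟩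
    rw [← evalXY_algebraMap, ← hz', map_zero]
    exact hz.2.2

variable {L : Type*} [Field L] [Algebra (RatFunc (ZMod p)) L] {e : ℕ}
  {b : Basis (Fin e) (RatFunc (ZMod p)) L} {w : ℕ}
  [Algebra (ZMod p)[X] L] [IsScalarTower (ZMod p)[X] (RatFunc (ZMod p)) L]
  {O : Type*} [CommRing O] [IsDedekindDomain O] [Algebra (ZMod p)[X] O] [Algebra O L]
  [IsScalarTower (ZMod p)[X] O L] [Module.Finite (ZMod p)[X] O]
  [Module.IsTorsionFree (ZMod p)[X] O] [IsFractionRing O L]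
  [Algebra (ZMod p) O] [IsScalarTower (ZMod p) (ZMod p)[X] O]

omit [Algebra (ZMod p) O] [IsScalarTower (ZMod p) (ZMod p)[X] O] in
lemma natDegree_norm_algebraMap (b : Basis (Fin e) (RatFunc (ZMod p)) L) (g : (ZMod p)[X]) :
    (Algebra.norm (ZMod p)[X] (algebraMap (ZMod p)[X] O g)).natDegree = e * g.natDegree := by
  have h : Algebra.norm (ZMod p)[X] (algebraMap (ZMod p)[X] O g) = g ^ e := by
    apply IsFractionRing.injective (ZMod p)[X] (RatFunc (ZMod p))
    rw [algebraMap_norm_eq b, ← IsScalarTower.algebraMap_apply,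
      IsScalarTower.algebraMap_apply (ZMod p)[X] (RatFunc (ZMod p)) L,
      Algebra.norm_algebraMap_of_basis b, Fintype.card_fin, map_pow]
  rw [h, natDegree_pow]

lemma addChar_ne_one_of_ne_zero {ψ : AddChar (ZMod p) ℂ} (hψ : ψ ≠ 1) {u : ZMod p}
    (hu : u ≠ 0) : ψ u ≠ 1 := by
  intro h
  refine hψ (AddChar.ext _ _ fun x => ?_)
  have h1 : x = (x / u).val • u := by
    rw [nsmul_eq_mul, ZMod.natCast_zmod_val, div_mul_cancel₀ _ hu]
  rw [h1, AddChar.map_nsmul_eq_pow, h, one_pow, AddChar.one_apply]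

lemma natCast_ne_zero_of_lt {e : ℕ} (he : 1 ≤ e) (hep : e < p) : (e : ZMod p) ≠ 0 := by
  rw [Ne, ZMod.natCast_eq_zero_iff]
  exact fun h => absurd (Nat.le_of_dvd he h) (by omega)

lemma IsWeighted.norm_sum_ratPts_le_aux (k : Type*) [Field k] [IsAlgClosed k] [DecidableEq k]
    [Algebra (ZMod p) k] [Algebra.IsAlgebraic (ZMod p) k]
    [Algebra.IsSeparable (RatFunc (ZMod p)) L] {y : O}
    (h : IsWeighted b (algebraMap O L y) w)
    {P : (ZMod p)[X][X]} (hP : P.Monic) (hPe : P.natDegree = e) (hPy : aeval y P = 0)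
    (he : 1 ≤ e) (hep : e < p)
    (hPw : ∀ j, P.coeff j ≠ 0 → (P.coeff j).natDegree + w * j ≤ w * e)
    (B : PowerBasis (RatFunc (ZMod p)) L) (hB : B.gen = algebraMap O L y)
    (hmin : minpoly (RatFunc (ZMod p)) B.gen =
      P.map (algebraMap (ZMod p)[X] (RatFunc (ZMod p))))
    {ψ : AddChar (ZMod p) ℂ} (hψ : ψ ≠ 1) :
    ‖∑ z ∈ ratPts P, ψ z.1‖ ≤
      ((2 * w * e * (e - 1) : ℕ) : ℝ) * √p + (2 * e * (w * e * (e - 1)) : ℕ) := by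
  have : CharP k p := charP_of_injective_algebraMap (algebraMap (ZMod p) k).injective p
  have hp : p.Prime := Fact.out
  have he0 := natCast_ne_zero_of_lt he hep
  obtain ⟨g, hg⟩ : ∃ g, g = normGen (ZMod p) (Ideal.span {aeval y (derivative P)}) := ⟨_, rfl⟩
  have hgdeg : g.natDegree ≤ w * e * (e - 1) := by
    rw [hg]; exact h.natDegree_normGen_derivative_le hP hPe hPy he0 hPw
  have hg0 : g ≠ 0 := by
    rw [hg]
    refine (monic_normGen ?_).ne_zero
    rw [Ne, Ideal.span_singleton_eq_bot]
    exact h.aeval_derivative_ne_zero hP hPe hPy he0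
  have hgo : ∀ o : O, ∃ c : (ZMod p)[X][X], aeval y c = algebraMap (ZMod p)[X] O g * o := by
    rw [hg]; exact h.exists_aeval_eq_normGen_mul hP hPe hPy he0 B hB hmin
  have hker : ∀ c : (ZMod p)[X][X], aeval y c = 0 → P ∣ c :=
    fun c hc => h.dvd_of_aeval_eq_zero hP hPe hPy he hc
  obtain ⟨u, v, huv⟩ := h.exists_bezout hP hPe hPy he0 B hB hmin
  rw [← hg] at huv
  have hcmp : ∀ r, 0 < r → ∀ H : Finset (O →ₐ[ZMod p] k), (∀ φ, φ ∈ H ↔ ∀ x, φ x ^ p ^ r = φ x) →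
      ‖∑ φ ∈ H, ψ (-(frobPoly p r (φ (algebraMap (ZMod p)[X] O X))).nextCoeff) -
        ∑ z ∈ curvePts k P (p ^ r), ψ (-(frobPoly p r z.1).nextCoeff)‖ ≤
          (2 * e * (w * e * (e - 1)) : ℕ) := by
    intro r hr H hH
    refine (norm_sum_homs_sub_sum_points_le (y := y) hP hPy hker hg0 hgo hr hH
      (G := fun x => ψ (-(frobPoly p r x).nextCoeff)) fun x =>
          (norm_addChar_eq_one ψ _).le).trans ?_
    rw [natDegree_norm_algebraMap b, hPe, ← Nat.cast_add, Nat.cast_le]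
    calc _ = 2 * e * g.natDegree := by ring
      _ ≤ _ := Nat.mul_le_mul_left _ hgdeg
  -- the square-root bound over large extensions
  obtain ⟨r₀, hr₀, C₁, hC₁⟩ := curve_sum_bound p
    (F := P.map (mapRingHom (algebraMap (ZMod p) k))) (hP.map _)
    (by rwa [hP.natDegree_map, hPe]) (u := u.map (mapRingHom (algebraMap (ZMod p) k)))
    (v := v.map (mapRingHom (algebraMap (ZMod p) k))) (r := (g ^ 2).map (algebraMap (ZMod p) k))
    ((Polynomial.map_ne_zero_iff (algebraMap (ZMod p) k).injective).2 (pow_ne_zero 2 hg0))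
    (by
      have := congrArg (Polynomial.map (mapRingHom (algebraMap (ZMod p) k))) huv
      rwa [Polynomial.map_add, Polynomial.map_mul, Polynomial.map_mul, ← derivative_map,
        map_C] at this) hψ
  have hfin := finite_fixed_homs p k O one_pos
  obtain ⟨H, hH⟩ : ∃ H : Finset (O →ₐ[ZMod p] k), ∀ φ, φ ∈ H ↔ ∀ x, φ x ^ p ^ 1 = φ x :=
    ⟨hfin.toFinset, fun φ => by rw [Set.Finite.mem_toFinset, Set.mem_ofPred_eq]⟩
  have hmain := norm_sum_fixed_homs_le (O := O) k (lam := fun g => ψ (-g.nextCoeff))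
    (D := 2 * w * e * (e - 1)) (A := √p) (C := |C₁| + (2 * e * (w * e * (e - 1)) : ℕ))
    (r₀ := 2 * r₀) (H := H) (by simp [nextCoeff])
    (fun g₁ g₂ h₁ h₂ => by
      rw [h₁.nextCoeff_mul h₂, neg_add, AddChar.map_add_eq_mul])
    (fun n hn T hT => by
      refine h.sum_addChar_nextCoeff_eq_zero he ?_ hn hT
      exact addChar_ne_one_of_ne_zero hψ (neg_ne_zero.2 he0))
          (Real.sqrt_pos.2 (by exact_mod_cast hp.pos)) (by omega)
    (fun r hr hrr H hH => by
      obtain ⟨s, rfl⟩ : ∃ s, r = s * 2 := by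
        obtain ⟨t, rfl⟩ := hrr; exact ⟨r₀ * t, by ring⟩
      have hs : 0 < s := by omega
      have hrs : r₀ ∣ s := by
        obtain ⟨t, ht⟩ := hrr; exact ⟨t, by nlinarith⟩
      have h1 := hcmp _ hr H hH
      have h2 := hC₁ s hs hrs
      have h3 : ∑ z ∈ curvePts k P (p ^ (s * 2)), ψ (-(frobPoly p (s * 2) z.1).nextCoeff) =
          ∑ z ∈ curvePts k P (p ^ (s * 2)), liftFn k ψ (frobTrace p (s * 2) z.1) := by
        refine Finset.sum_congr rfl fun z hz => addChar_nextCoeff_frobPoly ψ hr ?_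
        exact ((mem_curvePts (Nat.one_lt_pow hr.ne' hp.one_lt)).1 hz).1
      rw [sum_curvePts P _ fun x => liftFn k ψ (frobTrace p (s * 2) x), pow_mul] at h3
      rw [pow_mul, h3] at h1
      have hA : (√p : ℝ) ^ (s * 2) = (p : ℝ) ^ s := by
        rw [mul_comm, pow_mul, Real.sq_sqrt (Nat.cast_nonneg p)]
      have h4 : (1 : ℝ) ≤ (p : ℝ) ^ s := one_le_pow₀ (by exact_mod_cast hp.one_le)
      rw [hA]
      have h5 := norm_le_norm_add_norm_sub' (∑ φ ∈ H,
        ψ (-(frobPoly p (s * 2) (φ (algebraMap (ZMod p)[X] O X))).nextCoeff)) _ |>.trans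
        (add_le_add h2 h1)
      refine h5.trans ?_
      have h6 := mul_le_mul_of_nonneg_right (le_abs_self C₁) (zero_le_one.trans h4)
      have h7 := mul_le_mul_of_nonneg_left h4
        (Nat.cast_nonneg (α := ℝ) (2 * e * (w * e * (e - 1))))
      linarith)
    (by simpa using hH)
  have h1 := hcmp 1 one_pos H hH
  have h3 : ∑ z ∈ curvePts k P (p ^ 1), ψ (-(frobPoly p 1 z.1).nextCoeff) = ∑ z ∈ ratPts P,
      ψ z.1 := by
    rw [sum_curvePts_one P fun x => ψ (-(frobPoly p 1 x).nextCoeff)]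
    refine Finset.sum_congr rfl fun z _ => ?_
    rw [frobPoly_one, nextCoeff_X_sub_C, neg_neg]
  rw [h3, norm_sub_rev] at h1
  exact (norm_le_norm_add_norm_sub' _ _).trans (add_le_add hmain h1)

end IrreducibleCurve

section WeightedBasis

variable {F : Type*} [Field F] {L : Type*} [Field L] [Algebra (RatFunc F) L] {e w : ℕ}

/-- The powers of a generator, suitably rescaled, form a weighted basis. -/
lemma exists_isWeighted (B : PowerBasis (RatFunc F) L) {P : F[X][X]} (hP : P.Monic)
    (hPe : P.natDegree = e)
    (hmin : minpoly (RatFunc F) B.gen = P.map (algebraMap F[X] (RatFunc F)))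
    (hPw : ∀ j, P.coeff j ≠ 0 → (P.coeff j).natDegree + w * j ≤ w * e) :
    ∃ b : Basis (Fin e) (RatFunc F) L, IsWeighted b B.gen w := by
  have ht := tInf_ne_zero (F := F)
  have hdim : B.dim = e := by
    rw [← B.natDegree_minpoly, hmin, hP.natDegree_map, hPe]
  obtain ⟨b, hb⟩ : ∃ b : Basis (Fin e) (RatFunc F) L, ∀ j : Fin e,
      b j = (B.gen * tExt F L ^ w) ^ (j : ℕ) := by
    refine ⟨(B.basis.reindex (finCongr hdim)).isUnitSMul
      (w := fun j => (tInf F ^ w) ^ (j : ℕ)) fun j =>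
          (IsUnit.mk0 _ (pow_ne_zero _ (pow_ne_zero _ ht))),
      fun j => ?_⟩
    rw [Basis.isUnitSMul_apply, Basis.reindex_apply, B.basis_eq_pow, Algebra.smul_def, mul_pow,
      map_pow, map_pow, mul_comm]
    rfl
  refine ⟨b, hb, mem_inftyOrder_iff.2 fun i j => ?_⟩
  rw [hb j, ← pow_succ']
  by_cases hj : (j : ℕ) + 1 < e
  · rw [← hb ⟨j + 1, hj⟩, b.repr_self, Finsupp.single_apply]
    split_ifs
    · exact one_mem _
    · exact zero_mem _
  have hje : (j : ℕ) + 1 = e := by have := j.2; omega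
  have hroot : B.gen ^ e + ∑ i : Fin e, algebraMap (RatFunc F) L
      (algebraMap F[X] (RatFunc F) (P.coeff i)) * B.gen ^ (i : ℕ) = 0 := by
    have h1 := minpoly.aeval (RatFunc F) B.gen
    rw [hmin, aeval_eq_sum_range, hP.natDegree_map, hPe, Finset.sum_range_succ, Finset.sum_range,
      coeff_map, ← hPe, hP.coeff_natDegree, map_one, one_smul, hPe, add_comm] at h1
    simpa only [coeff_map, Algebra.smul_def] using h1
  have hexp : (B.gen * tExt F L ^ w) ^ ((j : ℕ) + 1) = ∑ i : Fin e,
      (-(tInf F ^ (w * (e - i)) * algebraMap F[X] (RatFunc F) (P.coeff i))) • b i := by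
    rw [hje, mul_pow, eq_neg_of_add_eq_zero_left hroot, neg_mul, Finset.sum_mul,
      ← Finset.sum_neg_distrib]
    refine Finset.sum_congr rfl fun i _ => ?_
    have h2 : w * e = w * (e - i) + w * i := by
      rw [← mul_add]; congr 1; have := i.2; omega
    rw [hb, Algebra.smul_def, map_neg, map_mul, map_pow, mul_pow, ← pow_mul, ← pow_mul, h2, pow_add]
    ring
  rw [hexp, b.repr_sum_self]
  refine neg_mem ?_
  by_cases hc : P.coeff i = 0
  · rw [hc, map_zero, mul_zero]; exact zero_mem _
  refine tInf_pow_mul_polynomial_mem ?_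
  have h3 := hPw i hc
  have h4 : w * e = w * (e - i) + w * i := by
    rw [← mul_add]; congr 1; have := i.2; omega
  omega

end WeightedBasis

section

variable {p : ℕ} [Fact p.Prime]

lemma irreducible_curve_bounds_aux (k : Type*) [Field k] [IsAlgClosed k] [DecidableEq k]
    [Algebra (ZMod p) k] [Algebra.IsAlgebraic (ZMod p) k]
    (L : Type*) [Field L] [Algebra (RatFunc (ZMod p)) L] [Algebra (ZMod p)[X] L]
    [IsScalarTower (ZMod p)[X] (RatFunc (ZMod p)) L] [Algebra (ZMod p) L]
    [IsScalarTower (ZMod p) (ZMod p)[X] L] {e w : ℕ}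
    {P : (ZMod p)[X][X]} (hP : P.Monic) (hPe : P.natDegree = e) (he : 1 ≤ e) (hep : e < p)
    (hPw : ∀ j, P.coeff j ≠ 0 → (P.coeff j).natDegree + w * j ≤ w * e)
    (B : PowerBasis (RatFunc (ZMod p)) L)
    (hmin : minpoly (RatFunc (ZMod p)) B.gen =
      P.map (algebraMap (ZMod p)[X] (RatFunc (ZMod p)))) :
    (∀ ψ : AddChar (ZMod p) ℂ, ψ ≠ 1 → ‖∑ z ∈ ratPts P, ψ z.1‖ ≤
      ((2 * w * e * (e - 1) : ℕ) : ℝ) * √p + (2 * e * (w * e * (e - 1)) : ℕ)) ∧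
    ∀ (R : (ZMod p)[X][X]) (m : ℕ),
      (∀ j, R.coeff j ≠ 0 → (R.coeff j).natDegree + w * j ≤ m) → ¬P ∣ R →
      (ratPts P ∩ ratPts R).card ≤ e * m + e * (w * e * (e - 1)) := by
  obtain ⟨b, hb⟩ := exists_isWeighted B hP hPe hmin hPw
  have hfd : FiniteDimensional (RatFunc (ZMod p)) L := B.finite
  have he0 := natCast_ne_zero_of_lt he hep
  have hirr : Irreducible (minpoly (RatFunc (ZMod p)) B.gen) :=
    minpoly.irreducible (Algebra.IsIntegral.isIntegral _)
  have hsepP : (minpoly (RatFunc (ZMod p)) B.gen).Separable := by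
    rw [separable_iff_derivative_ne_zero hirr, hmin]
    intro h
    have h1 := congrArg (fun q => q.coeff (e - 1)) h
    simp only [coeff_derivative, coeff_map, coeff_zero] at h1
    rw [Nat.sub_add_cancel he, ← hPe, hP.coeff_natDegree, hPe, map_one, one_mul] at h1
    have h2 : ((e - 1 : ℕ) : RatFunc (ZMod p)) + 1 = algebraMap (ZMod p) _ (e : ZMod p) := by
      rw [map_natCast, ← Nat.cast_add_one, Nat.sub_add_cancel he]
    rw [h2, map_eq_zero] at h1
    exact he0 h1
  have hsep : Algebra.IsSeparable (RatFunc (ZMod p)) L := by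
    refine ⟨fun x => mem_separableClosure_iff.1 ?_⟩
    have h1 : Algebra.adjoin (RatFunc (ZMod p)) {B.gen} ≤
        (separableClosure (RatFunc (ZMod p)) L).toSubalgebra := by
      rw [Algebra.adjoin_le_iff, Set.singleton_subset_iff]
      exact mem_separableClosure_iff.2 hsepP
    rw [B.adjoin_gen_eq_top] at h1
    exact h1 Algebra.mem_top
  let O := integralClosure (ZMod p)[X] L
  have hdom : IsDedekindDomain O := integralClosure.isDedekindDomain (ZMod p)[X]
      (RatFunc (ZMod p)) L
  have hfin : Module.Finite (ZMod p)[X] O :=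
    IsIntegralClosure.finite (ZMod p)[X] (RatFunc (ZMod p)) L O
  have hinj : Function.Injective (algebraMap (ZMod p)[X] L) := by
    rw [IsScalarTower.algebraMap_eq (ZMod p)[X] (RatFunc (ZMod p)) L]
    exact (algebraMap (RatFunc (ZMod p)) L).injective.comp (IsFractionRing.injective (ZMod p)[X] _)
  have : FaithfulSMul (ZMod p)[X] L := (faithfulSMul_iff_algebraMap_injective _ _).2 hinj
  have htf : Module.IsTorsionFree (ZMod p)[X] O := inferInstance
  have hfrac : IsFractionRing O L :=
    IsIntegralClosure.isFractionRing_of_finite_extension (ZMod p)[X] (RatFunc (ZMod p)) L O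
  have hPy' : aeval B.gen P = 0 := by
    have h1 := minpoly.aeval (RatFunc (ZMod p)) B.gen
    rwa [hmin, aeval_map_algebraMap] at h1
  obtain ⟨y, hy⟩ : ∃ y : O, algebraMap O L y = B.gen := ⟨⟨B.gen, P, hP, hPy'⟩, rfl⟩
  have hPy : aeval y P = 0 := by
    apply IsFractionRing.injective O L
    rw [← aeval_algebraMap_apply, hy, hPy', map_zero]
  rw [← hy] at hb
  refine ⟨fun ψ hψ => hb.norm_sum_ratPts_le_aux k hP hPe hPy he hep hPw B hy.symm hmin hψ,
    fun R m hR hPR => ?_⟩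
  obtain ⟨g, hg⟩ : ∃ g, g = normGen (ZMod p) (Ideal.span {aeval y (derivative P)}) := ⟨_, rfl⟩
  have hgdeg : g.natDegree ≤ w * e * (e - 1) := by
    rw [hg]; exact hb.natDegree_normGen_derivative_le hP hPe hPy he0 hPw
  have hg0 : g ≠ 0 := by
    rw [hg]
    refine (monic_normGen ?_).ne_zero
    rw [Ne, Ideal.span_singleton_eq_bot]
    exact hb.aeval_derivative_ne_zero hP hPe hPy he0
  have h1 := card_common_points_le (k := ZMod p) (y := y) hP
    (fun c hc => hb.dvd_of_aeval_eq_zero hP hPe hPy he hc) hg0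
    (by rw [hg]; exact hb.exists_aeval_eq_normGen_mul hP hPe hPy he0 B hy.symm hmin)
    (R := R) (fun h => hPR (hb.dvd_of_aeval_eq_zero hP hPe hPy he h)) (ratPts P ∩ ratPts R)
    (fun z hz => by
      rw [Finset.mem_inter, mem_ratPts, mem_ratPts] at hz; exact hz)
  refine h1.trans (Nat.add_le_add (natDegree_norm_le b (hb.pow_mul_aeval_mem hR)) ?_)
  rw [hPe]
  exact Nat.mul_le_mul_left _ hgdeg

/-- Point counts with additive weights, and intersection numbers, for an irreducible plane curve. -/
theorem irreducible_curve_bounds {e w : ℕ} {P : (ZMod p)[X][X]} (hP : P.Monic)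
    (hirr : Irreducible P) (hPe : P.natDegree = e) (hep : e < p)
    (hPw : ∀ j, P.coeff j ≠ 0 → (P.coeff j).natDegree + w * j ≤ w * e) :
    (∀ ψ : AddChar (ZMod p) ℂ, ψ ≠ 1 → ‖∑ z ∈ ratPts P, ψ z.1‖ ≤
      ((2 * w * e * (e - 1) : ℕ) : ℝ) * √p + (2 * e * (w * e * (e - 1)) : ℕ)) ∧
    ∀ (R : (ZMod p)[X][X]) (m : ℕ),
      (∀ j, R.coeff j ≠ 0 → (R.coeff j).natDegree + w * j ≤ m) → ¬P ∣ R →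
      (ratPts P ∩ ratPts R).card ≤ e * m + e * (w * e * (e - 1)) := by
  classical
  have he : 1 ≤ e := by
    rw [← hPe, Nat.one_le_iff_ne_zero]
    intro h
    exact hirr.not_isUnit (by rw [hP.natDegree_eq_zero.1 h]; exact isUnit_one)
  obtain ⟨q, hq⟩ : ∃ q, q = P.map (algebraMap (ZMod p)[X] (RatFunc (ZMod p))) := ⟨_, rfl⟩
  have hqm : q.Monic := hq ▸ hP.map _
  have : Fact (Irreducible q) :=
    ⟨hq ▸ (hP.irreducible_iff_irreducible_map_fraction_map (K := RatFunc (ZMod p))).1 hirr⟩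
  have htower : IsScalarTower (ZMod p) (ZMod p)[X] (AdjoinRoot q) :=
      IsScalarTower.of_algebraMap_eq' (by
    rw [IsScalarTower.algebraMap_eq (ZMod p) (RatFunc (ZMod p)),
      IsScalarTower.algebraMap_eq (ZMod p)[X] (RatFunc (ZMod p)),
      RingHom.comp_assoc, ← IsScalarTower.algebraMap_eq (ZMod p) (ZMod p)[X] (RatFunc (ZMod p))])
  exact irreducible_curve_bounds_aux (AlgebraicClosure (ZMod p)) (AdjoinRoot q) hP hPe he hep hPw
    (AdjoinRoot.powerBasis hqm.ne_zero) (by rw [AdjoinRoot.minpoly_powerBasis_gen_of_monic hqm, hq])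

end

section Weights

variable {F : Type*} [Field F]

/-- Bivariate polynomials graded by `deg X = 1`, `deg Y = w`. -/
noncomputable def gradeHom (F : Type*) [Field F] (w : ℕ) : F[X][X] →+* F[X][X][X] :=
  eval₂RingHom
    (eval₂RingHom
      ((C : F[X][X] →+* F[X][X][X]).comp ((C : F[X] →+* F[X][X]).comp (C : F →+* F[X])))
      (C (C X) * X : F[X][X][X]))
    (C X * X ^ w : F[X][X][X])

lemma gradeHom_monomial (w i j : ℕ) (a : F) :
    gradeHom F w (monomial j (monomial i a)) =
      monomial (i + w * j) (monomial j (monomial i a)) := by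
  simp only [gradeHom, coe_eval₂RingHom, eval₂_monomial, RingHom.comp_apply]
  rw [← C_mul_X_pow_eq_monomial, ← C_mul_X_pow_eq_monomial, ← C_mul_X_pow_eq_monomial]
  simp only [map_mul, map_pow]
  ring

lemma coeff_gradeHom (w : ℕ) (G : F[X][X]) (n j i : ℕ) :
    (((gradeHom F w G).coeff n).coeff j).coeff i = if i + w * j =
        n then (G.coeff j).coeff i else 0 := by
  induction G using Polynomial.induction_on' with
  | add P Q hP hQ =>
    rw [map_add, coeff_add, coeff_add, coeff_add, hP, hQ]
    split_ifs <;> simp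
  | monomial j' g =>
    induction g using Polynomial.induction_on' with
    | add P Q hP hQ =>
      rw [map_add, map_add, coeff_add, coeff_add, coeff_add, hP, hQ]
      split_ifs <;> simp
    | monomial i' a =>
      rw [gradeHom_monomial]
      simp only [coeff_monomial]
      by_cases h1 : j' = j
      · by_cases h2 : i' = i
        · subst h1 h2
          by_cases h3 : i' + w * j' = n <;> simp [h3]
        · subst h1
          split_ifs <;> simp [coeff_monomial, h2]
      · split_ifs <;> simp [coeff_monomial, h1]

lemma natDegree_gradeHom_le_iff {w m : ℕ} {G : F[X][X]} :
    (gradeHom F w G).natDegree ≤ m ↔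
      ∀ j, G.coeff j ≠ 0 → (G.coeff j).natDegree + w * j ≤ m := by
  constructor
  · intro h j hj
    by_contra! hlt
    have h1 := coeff_eq_zero_of_natDegree_lt (h.trans_lt hlt)
    have h2 := coeff_gradeHom w G ((G.coeff j).natDegree + w * j) j (G.coeff j).natDegree
    rw [h1, if_pos rfl, coeff_zero, coeff_zero] at h2
    exact hj (leadingCoeff_eq_zero.1 h2.symm)
  · intro h
    rw [natDegree_le_iff_coeff_eq_zero]
    intro n hn
    ext j i
    rw [coeff_gradeHom, coeff_zero, coeff_zero]
    split_ifs with hij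
    · by_contra hne
      have h1 := h j fun h0 => hne (by rw [h0, coeff_zero])
      have h2 := le_natDegree_of_ne_zero hne
      omega
    · rfl

lemma weights_of_mul {w : ℕ} {G H : F[X][X]} (hG : G.Monic) (hH : H.Monic)
    (hw : ∀ j, (G * H).coeff j ≠ 0 →
      ((G * H).coeff j).natDegree + w * j ≤ w * (G * H).natDegree) :
    ∀ j, G.coeff j ≠ 0 → (G.coeff j).natDegree + w * j ≤ w * G.natDegree := by
  have key : ∀ K : F[X][X], K.Monic → gradeHom F w K ≠ 0 ∧
      w * K.natDegree ≤ (gradeHom F w K).natDegree := by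
    intro K hK
    have h1 := natDegree_gradeHom_le_iff.1 (le_refl (gradeHom F w K).natDegree) K.natDegree
      (by rw [hK.coeff_natDegree]; exact one_ne_zero)
    refine ⟨fun h0 => ?_, by omega⟩
    have h2 := coeff_gradeHom w K (0 + w * K.natDegree) K.natDegree 0
    rw [h0, if_pos rfl, hK.coeff_natDegree] at h2
    simp at h2
  rw [← natDegree_gradeHom_le_iff, map_mul, natDegree_mul (key G hG).1 (key H hH).1,
    hG.natDegree_mul hH, mul_add] at hw
  rw [← natDegree_gradeHom_le_iff]
  have := (key H hH).2
  omega

lemma exists_monic_irreducible_factor {P : F[X][X]} (hP : P.Monic) (h1 : P ≠ 1) :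
    ∃ G H : F[X][X], G.Monic ∧ Irreducible G ∧ H.Monic ∧ P = G * H := by
  obtain ⟨q, hq, c, hc⟩ := WfDvdMonoid.exists_irreducible_factor
    (fun hu => h1 (hP.eq_one_of_isUnit hu)) hP.ne_zero
  have hlc : q.leadingCoeff * c.leadingCoeff = 1 := by rw [← leadingCoeff_mul, ← hc, hP]
  have hlc' : c.leadingCoeff * q.leadingCoeff = 1 := by rw [mul_comm, hlc]
  have hu : IsUnit (C c.leadingCoeff : F[X][X]) := (IsUnit.of_mul_eq_one _ hlc').map C
  have hGm : (C c.leadingCoeff * q).Monic := by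
    rw [Monic, leadingCoeff_mul, leadingCoeff_C, hlc']
  have hHm : (C q.leadingCoeff * c).Monic := by
    rw [Monic, leadingCoeff_mul, leadingCoeff_C, hlc]
  refine ⟨_, _, hGm, (irreducible_isUnit_mul hu).2 hq, hHm, ?_⟩
  have h2 : (C c.leadingCoeff * C q.leadingCoeff : F[X][X]) = 1 := by rw [← C_mul, hlc', C_1]
  rw [hc]
  linear_combination -(q * c) * h2

end Weights

section CurveBound

variable {p : ℕ} [Fact p.Prime]

lemma ratPts_mul (G H : (ZMod p)[X][X]) : ratPts (G * H) = ratPts G ∪ ratPts H := by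
  ext z
  rw [Finset.mem_union, mem_ratPts, mem_ratPts, mem_ratPts, map_mul, mul_eq_zero]

lemma curve_bound_arith {a c e W s : ℝ} (ha : 1 ≤ a) (hc : 0 ≤ c) (he : e = a + c) (hW : 0 ≤ W)
    (hs : 0 ≤ s) :
    (2 * W * a * (a - 1) * s + 2 * a * (W * a * (a - 1))) + (2 * W * c ^ 2 * s + 6 * W * c ^ 4) +
      (a * (W * c) + a * (W * a * (a - 1))) ≤ 2 * W * e ^ 2 * s + 6 * W * e ^ 4 := by
  subst he
  have h1 : a * (a - 1) + c ^ 2 ≤ (a + c) ^ 2 := by nlinarith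
  have h2 : 3 * (a ^ 2 * (a - 1)) + a * c ≤ 6 * (a + c) ^ 4 - 6 * c ^ 4 := by
    have ha2 : 1 ≤ a ^ 2 := one_le_pow₀ ha
    have e1 : a ^ 2 * (a - 1) ≤ a ^ 4 := by
      nlinarith [mul_nonneg (by linarith : (0:ℝ) ≤ a) (by linarith : (0:ℝ) ≤ a - 1), sq_nonneg a]
    have e2 : a * c ≤ a ^ 3 * c := by
      nlinarith [mul_nonneg (mul_nonneg (by linarith : (0:ℝ) ≤ a) hc)
        (by linarith : (0:ℝ) ≤ a ^ 2 - 1)]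
    have e3 : 0 ≤ a ^ 4 := by positivity
    have e4 : 0 ≤ a ^ 3 * c := by positivity
    have e5 : 0 ≤ a ^ 2 * c ^ 2 := by positivity
    have e6 : 0 ≤ a * c ^ 3 := by positivity
    nlinarith
  have h3 := mul_le_mul_of_nonneg_left h1 (mul_nonneg hW hs)
  have h4 := mul_le_mul_of_nonneg_left h2 hW
  nlinarith

/-- Additive character sums over the points of an arbitrary plane curve. -/
theorem norm_sum_ratPts_le {w : ℕ} {ψ : AddChar (ZMod p) ℂ} (hψ : ψ ≠ 1) {P : (ZMod p)[X][X]}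
    (hP : P.Monic) (hep : P.natDegree < p)
    (hPw : ∀ j, P.coeff j ≠ 0 → (P.coeff j).natDegree + w * j ≤ w * P.natDegree) :
    ‖∑ z ∈ ratPts P, ψ z.1‖ ≤
      2 * w * (P.natDegree : ℝ) ^ 2 * √p + 6 * w * (P.natDegree : ℝ) ^ 4 := by
  induction hn : P.natDegree using Nat.strong_induction_on generalizing P with
  | _ e ih =>
  by_cases h1 : P = 1
  · have : ratPts P = ∅ := by
      ext z; simp [mem_ratPts, h1]
    rw [this, Finset.sum_empty, norm_zero]
    positivity
  obtain ⟨G, H, hG, hirr, hH, rfl⟩ := exists_monic_irreducible_factor hP h1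
  have hdeg := hG.natDegree_mul hH
  have hG1 : 1 ≤ G.natDegree := by
    rw [Nat.one_le_iff_ne_zero]
    intro h
    exact hirr.not_isUnit (by rw [hG.natDegree_eq_zero.1 h]; exact isUnit_one)
  have hGw := weights_of_mul hG hH hPw
  have hHw := weights_of_mul hH hG (by rwa [mul_comm H G])
  have hind := ih H.natDegree (by omega) hH (by omega) hHw rfl
  have he : (e : ℝ) = G.natDegree + H.natDegree := by rw [← hn, hdeg]; push_cast; rfl
  rw [ratPts_mul]
  by_cases hdvd : G ∣ H
  · have hsub : ratPts G ∪ ratPts H = ratPts H := by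
      rw [Finset.union_eq_right]
      intro z hz
      obtain ⟨c, rfl⟩ := hdvd
      rw [mem_ratPts] at hz ⊢
      rw [map_mul, hz, zero_mul]
    rw [hsub]
    refine hind.trans ?_
    have : (H.natDegree : ℝ) ≤ e := by rw [he]; linarith [Nat.cast_nonneg (α := ℝ) G.natDegree]
    gcongr
  · obtain ⟨hs, hc⟩ := irreducible_curve_bounds hG hirr rfl (by omega) hGw
    have hs := hs ψ hψ
    have hc := hc H _ hHw hdvd
    have hui := Finset.sum_union_inter (s₁ := ratPts G) (s₂ := ratPts H) (f := fun z => ψ z.1)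
    rw [← eq_sub_iff_add_eq] at hui
    rw [hui]
    have hint : ‖∑ z ∈ ratPts G ∩ ratPts H, ψ z.1‖ ≤
        (G.natDegree * (w * H.natDegree) + G.natDegree * (w * G.natDegree * (G.natDegree - 1))
            : ℕ) := by
      refine (norm_sum_le_of_le _ fun z _ => (norm_addChar_eq_one ψ z.1).le).trans ?_
      rw [Finset.sum_const, nsmul_eq_mul, mul_one]
      exact_mod_cast hc
    refine (norm_sub_le _ _).trans ((add_le_add ((norm_add_le _ _).trans (add_le_add hs hind))
      hint).trans ?_)
    push_cast [Nat.cast_sub hG1]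
    exact curve_bound_arith (by exact_mod_cast hG1) (Nat.cast_nonneg _) he (Nat.cast_nonneg _)
      (Real.sqrt_nonneg _)

end CurveBound

section ShiftProd

variable {p : ℕ} [Fact p.Prime]

/-- The product `(x + 1) ⋯ (x + d)`. -/
def shiftProd (d : ℕ) (x : ZMod p) : ZMod p := ∏ i ∈ Finset.Icc 1 d, (x + (i : ZMod p))

lemma natDegree_gradeHom_C_C (w : ℕ) (a : ZMod p) :
    (gradeHom (ZMod p) w (C (C a))).natDegree = 0 := by
  simp [gradeHom]

lemma gradeHom_C_X (w : ℕ) : gradeHom (ZMod p) w (C X) = C (C X) * X := by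
  simp [gradeHom]

lemma gradeHom_X (w : ℕ) : gradeHom (ZMod p) w X = C X * X ^ w := by
  simp [gradeHom]

lemma natDegree_gradeHom_prod_le {w m d : ℕ} {G : (ZMod p)[X][X]}
    (hG : (gradeHom (ZMod p) w G).natDegree ≤ m) :
    (gradeHom (ZMod p) w (∏ i ∈ Finset.Icc 1 d, (G + C (C (i : ZMod p))))).natDegree ≤ d * m := by
  rw [map_prod]
  refine (natDegree_prod_le _ _).trans ((Finset.sum_le_card_nsmul _ _ m fun i _ => ?_).trans ?_)
  · rw [map_add]
    refine (natDegree_add_le _ _).trans (max_le hG ?_)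
    rw [natDegree_gradeHom_C_C]
    exact Nat.zero_le m
  · simp

lemma monic_prod_X_add (d : ℕ) :
    (∏ i ∈ Finset.Icc 1 d, (X + C (C (i : ZMod p))) : (ZMod p)[X][X]).Monic :=
  monic_prod_of_monic _ _ fun _ _ => monic_X_add_C _

lemma natDegree_prod_X_add (d : ℕ) :
    (∏ i ∈ Finset.Icc 1 d, (X + C (C (i : ZMod p))) : (ZMod p)[X][X]).natDegree = d := by
  rw [natDegree_prod_of_monic _ _ fun i _ => monic_X_add_C _]
  exact (Finset.sum_congr rfl fun i _ => natDegree_X_add_C _).trans (by simp)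

lemma evalXY_prod_add (d : ℕ) (z : ZMod p × ZMod p) (G : (ZMod p)[X][X]) :
    evalXY z (∏ i ∈ Finset.Icc 1 d, (G + C (C (i : ZMod p)))) = shiftProd d (evalXY z G) := by
  rw [map_prod, shiftProd]
  refine Finset.prod_congr rfl fun i _ => ?_
  rw [map_add, evalXY_C, aeval_C]
  rfl

lemma norm_sum_ratPts_prod_sub_le {ψ : AddChar (ZMod p) ℂ} (hψ : ψ ≠ 1) {w d e : ℕ} (hep : e < p)
    {G : (ZMod p)[X][X]} (hGd : (∏ i ∈ Finset.Icc 1 d, (G + C (C (i : ZMod p)))).natDegree < e)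
    (hGw : (gradeHom (ZMod p) w (∏ i ∈ Finset.Icc 1 d, (G + C (C (i : ZMod p))))).natDegree ≤
      w * e) :
    ‖∑ z : ZMod p × ZMod p with shiftProd e z.2 = shiftProd d (evalXY z G), ψ z.1‖ ≤
      2 * w * (e : ℝ) ^ 2 * √p + 6 * w * (e : ℝ) ^ 4 := by
  obtain ⟨B, hB⟩ : ∃ B : (ZMod p)[X][X], B = ∏ i ∈ Finset.Icc 1 d, (G + C (C (i : ZMod p))) :=
    ⟨_, rfl⟩
  obtain ⟨A, hA⟩ : ∃ A : (ZMod p)[X][X], A = ∏ i ∈ Finset.Icc 1 e, (X + C (C (i : ZMod p))) :=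
    ⟨_, rfl⟩
  have hAm : A.Monic := hA ▸ monic_prod_X_add e
  have hAd : A.natDegree = e := hA ▸ natDegree_prod_X_add e
  have hAw : (gradeHom (ZMod p) w A).natDegree ≤ w * e := by
    rw [hA, mul_comm]
    refine natDegree_gradeHom_prod_le ?_
    rw [gradeHom_X]
    exact natDegree_C_mul_X_pow_le _ _
  rw [← hB] at hGd hGw
  have hlt : B.degree < A.degree := degree_lt_degree (by rw [hAd]; exact hGd)
  have hPm : (A - B).Monic := hAm.sub_of_left hlt
  have hPd : (A - B).natDegree = e := by
    rw [natDegree_sub_eq_left_of_natDegree_lt (by rw [hAd]; exact hGd), hAd]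
  have hmem : (Finset.univ.filter fun z : ZMod p × ZMod p =>
      shiftProd e z.2 = shiftProd d (evalXY z G)) = ratPts (A - B) := by
    ext z
    rw [mem_ratPts, map_sub, hA, hB, evalXY_prod_add, evalXY_prod_add, evalXY_X, sub_eq_zero]
    simp
  rw [hmem]
  have := norm_sum_ratPts_le (w := w) hψ hPm (by omega) (by
    rw [← natDegree_gradeHom_le_iff, hPd, map_sub]
    exact (natDegree_sub_le _ _).trans (max_le hAw hGw))
  rwa [hPd] at this

lemma norm_sum_shiftProd_eq_le_of_left {ψ : AddChar (ZMod p) ℂ} (hψ : ψ ≠ 1) {d e : ℕ}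
    (hde : d < e) (hep : e < p) {α : ZMod p} (hα : α ≠ 0) (β : ZMod p) :
    ‖∑ z : ZMod p × ZMod p with shiftProd d z.1 = shiftProd e z.2, ψ (α * z.1 + β * z.2)‖ ≤
      2 * (e : ℝ) ^ 2 * √p + 6 * (e : ℝ) ^ 4 := by
  obtain ⟨G, hG⟩ : ∃ G : (ZMod p)[X][X], G = C (C α⁻¹) * (C X - C (C β) * X) := ⟨_, rfl⟩
  have hev : ∀ z : ZMod p × ZMod p, evalXY z G = α⁻¹ * (z.1 - β * z.2) := by
    intro z
    rw [hG, map_mul, map_sub, map_mul, evalXY_C, evalXY_C, evalXY_C, evalXY_X, aeval_C, aeval_C,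
      aeval_X]
    rfl
  have hGd : G.natDegree ≤ 1 := by
    rw [hG]
    refine (natDegree_C_mul_le _ _).trans ((natDegree_sub_le _ _).trans (max_le ?_ ?_))
    · rw [natDegree_C]; exact zero_le_one
    · exact (natDegree_C_mul_le _ _).trans natDegree_X_le
  have hGw : (gradeHom (ZMod p) 1 G).natDegree ≤ 1 := by
    rw [hG, map_mul, map_sub, map_mul, gradeHom_C_X, gradeHom_X, pow_one]
    refine natDegree_mul_le.trans ?_
    rw [natDegree_gradeHom_C_C, zero_add]
    refine (natDegree_sub_le _ _).trans (max_le ?_ ?_)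
    · exact (natDegree_C_mul_le _ _).trans natDegree_X_le
    · refine natDegree_mul_le.trans ?_
      rw [natDegree_gradeHom_C_C, zero_add]
      exact (natDegree_C_mul_le _ _).trans natDegree_X_le
  have hprod : (∏ i ∈ Finset.Icc 1 d, (G + C (C (i : ZMod p)))).natDegree ≤ d := by
    refine (natDegree_prod_le _ _).trans ((Finset.sum_le_card_nsmul _ _ 1 fun i _ => ?_).trans ?_)
    · rw [natDegree_add_C]; exact hGd
    · simp
  have key := norm_sum_ratPts_prod_sub_le hψ hep (G := G) (d := d) (w := 1)
    (hprod.trans_lt hde) ((natDegree_gradeHom_prod_le hGw).trans (by omega))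
  rw [Nat.cast_one, mul_one, mul_one] at key
  refine le_of_eq_of_le (congrArg _ ?_) key
  refine Finset.sum_nbij' (fun z => (α * z.1 + β * z.2, z.2))
    (fun z => (α⁻¹ * (z.1 - β * z.2), z.2)) ?_ ?_ ?_ ?_ ?_
  · intro z hz
    rw [Finset.mem_filter] at hz ⊢
    refine ⟨Finset.mem_univ _, ?_⟩
    rw [hev, ← hz.2]
    congr 1
    field_simp
    ring
  · intro z hz
    rw [Finset.mem_filter] at hz ⊢
    refine ⟨Finset.mem_univ _, ?_⟩
    rw [hz.2, hev]
  · intro z _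
    ext
    · simp [hα]
    · rfl
  · intro z _
    ext
    · simp [hα]
    · rfl
  · intro z _
    rfl

lemma norm_sum_shiftProd_eq_le_of_right {ψ : AddChar (ZMod p) ℂ} (hψ : ψ ≠ 1) {d e w : ℕ}
    (hd : 1 ≤ d) (hde : d < e) (hep : e < p) (hw : e ≤ w * d) {β : ZMod p} (hβ : β ≠ 0) :
    ‖∑ z : ZMod p × ZMod p with shiftProd d z.1 = shiftProd e z.2, ψ (β * z.2)‖ ≤
      2 * w * (d : ℝ) ^ 2 * √p + 6 * w * (d : ℝ) ^ 4 := by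
  obtain ⟨G, hG⟩ : ∃ G : (ZMod p)[X][X], G = C (C β⁻¹) * C X := ⟨_, rfl⟩
  have hev : ∀ z : ZMod p × ZMod p, evalXY z G = β⁻¹ * z.1 := by
    intro z
    rw [hG, map_mul, evalXY_C, evalXY_C, aeval_C, aeval_X]
    rfl
  have hGw : (gradeHom (ZMod p) w G).natDegree ≤ 1 := by
    rw [hG, map_mul, gradeHom_C_X]
    refine natDegree_mul_le.trans ?_
    rw [natDegree_gradeHom_C_C, zero_add]
    exact (natDegree_C_mul_le _ _).trans natDegree_X_le
  have hprod : (∏ i ∈ Finset.Icc 1 e, (G + C (C (i : ZMod p)))).natDegree ≤ 0 := by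
    refine (natDegree_prod_le _ _).trans (Finset.sum_nonpos fun i _ => ?_)
    rw [natDegree_add_C, hG, ← C_mul, natDegree_C]
  have key := norm_sum_ratPts_prod_sub_le hψ (hde.trans hep) (G := G) (d := e) (w := w)
    (hprod.trans_lt hd) ((natDegree_gradeHom_prod_le hGw).trans (by omega))
  refine le_of_eq_of_le (congrArg _ ?_) key
  refine Finset.sum_nbij' (fun z => (β * z.2, z.1)) (fun z => (z.2, β⁻¹ * z.1)) ?_ ?_ ?_ ?_ ?_
  · intro z hz
    rw [Finset.mem_filter] at hz ⊢
    refine ⟨Finset.mem_univ _, ?_⟩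
    rw [hev, hz.2, inv_mul_cancel_left₀ hβ]
  · intro z hz
    rw [Finset.mem_filter] at hz ⊢
    refine ⟨Finset.mem_univ _, ?_⟩
    rw [hz.2, hev]
  · intro z _
    ext
    · rfl
    · simp [hβ]
  · intro z _
    ext
    · simp [hβ]
    · rfl
  · intro z _
    rfl

/-- Exponential sums over the curve `(x + 1) ⋯ (x + d) = (y + 1) ⋯ (y + e)`. -/
theorem norm_sum_shiftProd_eq_le {ψ : AddChar (ZMod p) ℂ} (hψ : ψ ≠ 1) {d e : ℕ}
    (hd : 1 ≤ d) (hde : d < e) (hep : e < p) {α β : ZMod p} (h : α ≠ 0 ∨ β ≠ 0) :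
    ‖∑ z : ZMod p × ZMod p with shiftProd d z.1 = shiftProd e z.2, ψ (α * z.1 + β * z.2)‖ ≤
      4 * (e : ℝ) ^ 2 * √p + 12 * (e : ℝ) ^ 4 := by
  have hs := Real.sqrt_nonneg (p : ℝ)
  by_cases hα : α = 0
  · obtain ⟨w, hw⟩ : ∃ w, w = e / d + 1 := ⟨_, rfl⟩
    have h1 : e ≤ w * d := by
      have := Nat.lt_div_mul_add (a := e) hd
      rw [hw, add_mul]
      omega
    have h2 : w * d ≤ 2 * e := by
      have := Nat.div_mul_le_self e d
      rw [hw, add_mul]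
      omega
    have h2' : (w : ℝ) * d ≤ 2 * e := by exact_mod_cast h2
    have hde' : (d : ℝ) ≤ e := by exact_mod_cast hde.le
    have h3 : (w : ℝ) * d ^ 2 ≤ 2 * e ^ 2 := by
      calc (w : ℝ) * d ^ 2 = (w * d) * d := by ring
        _ ≤ (2 * (e : ℝ)) * e := by gcongr
        _ = 2 * e ^ 2 := by ring
    have h4 : (w : ℝ) * d ^ 4 ≤ 2 * e ^ 4 := by
      calc (w : ℝ) * d ^ 4 = (w * d) * d ^ 3 := by ring
        _ ≤ (2 * (e : ℝ)) * (e : ℝ) ^ 3 := by gcongr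
        _ = 2 * e ^ 4 := by ring
    have key := norm_sum_shiftProd_eq_le_of_right hψ hd hde hep h1 (h.resolve_left (not_not.2 hα))
    subst hα
    simp only [zero_mul, zero_add]
    refine key.trans (add_le_add ?_ (by linarith))
    calc 2 * w * (d : ℝ) ^ 2 * √p = 2 * (w * (d : ℝ) ^ 2) * √p := by ring
      _ ≤ 2 * (2 * e ^ 2) * √p := by gcongr
      _ = _ := by ring
  · refine (norm_sum_shiftProd_eq_le_of_left hψ hde hep hα β).trans ?_
    have : 0 ≤ (e : ℝ) ^ 2 * √p := by positivity
    have : 0 ≤ (e : ℝ) ^ 4 := by positivity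
    linarith

end ShiftProd

end

section

open ZMod

section Completion

variable {p : ℕ} [Fact p.Prime]

lemma sin_lower {v q : ℝ} (hv : 0 < v) (hvq : v < q) :
    1 / Real.sin (Real.pi * v / q) ≤ q / 2 * (1 / v + 1 / (q - v)) := by
  have hq : 0 < q := hv.trans hvq
  have hqv : 0 < q - v := sub_pos.2 hvq
  have h1 : 0 < 1 / v := by positivity
  have h2 : 0 < 1 / (q - v) := by positivity
  have key : ∀ u : ℝ, 0 < u → u ≤ q / 2 →
      1 / Real.sin (Real.pi * u / q) ≤ q / 2 * (1 / u) := by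
    intro u hu huq
    have := Real.mul_le_sin (x := Real.pi * u / q) (by positivity) (by
      rw [div_le_div_iff₀ hq two_pos]
      nlinarith [Real.pi_pos])
    have h3 : 2 / Real.pi * (Real.pi * u / q) = 2 * u / q := by
      field_simp
    rw [h3] at this
    have h4 : 0 < 2 * u / q := by positivity
    refine (one_div_le_one_div_of_le h4 this).trans (le_of_eq ?_)
    field_simp
  rcases le_total v (q / 2) with h | h
  · refine (key v hv h).trans ?_
    gcongr
    linarith
  · have h5 : Real.sin (Real.pi * v / q) = Real.sin (Real.pi * (q - v) / q) := by
      rw [← Real.sin_pi_sub]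
      congr 1
      field_simp
    rw [h5]
    refine (key (q - v) hqv (by linarith)).trans ?_
    gcongr
    linarith

lemma norm_sum_geom_le {z : ℂ} (hz : ‖z‖ = 1) (h1 : z ≠ 1) (N : ℕ) :
    ‖∑ n ∈ Finset.Icc 1 N, z ^ n‖ ≤ 2 / ‖z - 1‖ := by
  have hpos : 0 < ‖z - 1‖ := norm_pos_iff.2 (sub_ne_zero.2 h1)
  have h2 : ∑ n ∈ Finset.Icc 1 N, z ^ n = z * ((z ^ N - 1) / (z - 1)) := by
    rw [← geom_sum_eq h1, Finset.mul_sum, Finset.range_eq_Ico,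
      Finset.sum_Ico_eq_sum_range, ← Finset.Ico_succ_right_eq_Icc, Finset.sum_Ico_eq_sum_range]
    refine Finset.sum_congr (by simp) fun i _ => ?_
    rw [zero_add, ← pow_succ', add_comm]
  rw [h2, norm_mul, hz, one_mul, norm_div]
  gcongr
  refine (norm_sub_le _ _).trans ?_
  rw [norm_pow, hz, one_pow, norm_one]
  norm_num

/-- The Fourier coefficient of the interval `[1, N]`. -/
noncomputable def intervalCoeff (N : ℕ) (α : ZMod p) : ℂ :=
  ∑ n ∈ Finset.Icc 1 N, stdAddChar (-(α * (n : ZMod p)))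

lemma intervalCoeff_zero (N : ℕ) : intervalCoeff N (0 : ZMod p) = N := by
  simp [intervalCoeff]

lemma norm_intervalCoeff_le {α : ZMod p} (hα : α ≠ 0) (N : ℕ) :
    ‖intervalCoeff N α‖ ≤ (p : ℝ) / 2 * (1 / (α.val : ℝ) + 1 / ((p : ℝ) - α.val)) := by
  have hp : (0 : ℝ) < p := by exact_mod_cast (Fact.out : p.Prime).pos
  have hv : 0 < α.val := Nat.pos_of_ne_zero fun h => hα ((ZMod.val_eq_zero α).1 h)
  obtain ⟨z, hz⟩ : ∃ z : ℂ, z = stdAddChar (-α) := ⟨_, rfl⟩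
  have hsum : intervalCoeff N α = ∑ n ∈ Finset.Icc 1 N, z ^ n := by
    refine Finset.sum_congr rfl fun n _ => ?_
    rw [hz, ← AddChar.map_nsmul_eq_pow, nsmul_eq_mul]
    congr 1
    ring
  have hz1 : z ≠ 1 := by
    rw [hz, ← (stdAddChar (N := p)).map_zero_eq_one]
    intro h
    exact hα (neg_eq_zero.1 (injective_stdAddChar h))
  have hze : z = Complex.exp (Complex.I * ((-(2 * Real.pi * α.val / p) : ℝ) : ℂ)) := by
    have h1 : (-α : ZMod p) = ((-(α.val : ℤ) : ℤ) : ZMod p) := by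
      rw [Int.cast_neg, Int.cast_natCast, ZMod.natCast_zmod_val]
    rw [hz, h1, stdAddChar_coe]
    congr 1
    push_cast
    ring
  have hnorm : ‖z‖ = 1 := by
    rw [hze, mul_comm]
    exact Complex.norm_exp_ofReal_mul_I _
  have hsub : ‖z - 1‖ = 2 * |Real.sin (Real.pi * α.val / p)| := by
    rw [hze, Complex.norm_exp_I_mul_ofReal_sub_one]
    have h2 : -(2 * Real.pi * α.val / p) / 2 = -(Real.pi * α.val / p) := by ring
    rw [h2, Real.sin_neg, norm_mul, norm_neg]
    simp
  have hvp : (α.val : ℝ) < p := by exact_mod_cast ZMod.val_lt α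
  have hv' : (0 : ℝ) < α.val := by exact_mod_cast hv
  have hsin : 0 < Real.sin (Real.pi * α.val / p) := by
    apply Real.sin_pos_of_pos_of_lt_pi
    · have := Real.pi_pos
      positivity
    · rw [div_lt_iff₀ hp]
      exact mul_lt_mul_of_pos_left hvp Real.pi_pos
  rw [hsum]
  refine (norm_sum_geom_le hnorm hz1 N).trans (le_of_eq_of_le ?_ (sin_lower hv' hvp))
  rw [hsub, abs_of_pos hsin]
  field_simp

lemma sum_norm_intervalCoeff_le {N : ℕ} (hN : N ≤ p) :
    ∑ α : ZMod p, ‖intervalCoeff N α‖ ≤ p * (2 + Real.log p) := by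
  have hp1 := (Fact.out : p.Prime).one_lt
  have hp : (0 : ℝ) < p := by exact_mod_cast (Fact.out : p.Prime).pos
  have h0 : ‖intervalCoeff N (0 : ZMod p)‖ ≤ p := by
    rw [intervalCoeff_zero, Complex.norm_natCast]
    exact_mod_cast hN
  obtain ⟨m, hm⟩ : ∃ m, p = m + 1 := ⟨p - 1, by omega⟩
  have hH : ∑ v ∈ Finset.range m, 1 / (((v + 1 : ℕ) : ℝ)) ≤ 1 + Real.log p := by
    have h1 := harmonic_le_one_add_log m
    rw [harmonic] at h1
    push_cast at h1
    have h2 : Real.log m ≤ Real.log p := by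
      rcases Nat.eq_zero_or_pos m with h | h
      · omega
      · exact Real.log_le_log (by exact_mod_cast h) (by exact_mod_cast (by omega : m ≤ p))
    push_cast
    simp only [one_div]
    linarith
  have hrefl : ∑ v ∈ Finset.range m, 1 / ((p : ℝ) - ((v + 1 : ℕ) : ℝ)) =
      ∑ v ∈ Finset.range m, 1 / (((v + 1 : ℕ) : ℝ)) := by
    rw [← Finset.sum_range_reflect]
    refine Finset.sum_congr rfl fun v hv => ?_
    rw [Finset.mem_range] at hv
    congr 1
    have : (p : ℝ) = ((m - 1 - v + 1 : ℕ) : ℝ) + ((v + 1 : ℕ) : ℝ) := by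
      rw [← Nat.cast_add]
      congr 1
      omega
    rw [this]
    ring
  have hrest : ∑ α ∈ Finset.univ.erase (0 : ZMod p), ‖intervalCoeff N α‖ ≤
      ∑ v ∈ Finset.range m, (p : ℝ) / 2 * (1 / (((v + 1 : ℕ) : ℝ)) +
        1 / ((p : ℝ) - ((v + 1 : ℕ) : ℝ))) := by
    refine le_of_le_of_eq (Finset.sum_le_sum fun α hα =>
      norm_intervalCoeff_le (Finset.ne_of_mem_erase hα) N) ?_
    have hpos : ∀ α : ZMod p, α ∈ Finset.univ.erase (0 : ZMod p) → 0 < α.val := fun α hα =>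
      Nat.pos_of_ne_zero fun h => (Finset.ne_of_mem_erase hα) ((ZMod.val_eq_zero α).1 h)
    refine Finset.sum_nbij' (fun α => α.val - 1) (fun v => ((v + 1 : ℕ) : ZMod p)) ?_ ?_ ?_ ?_ ?_
    · intro α hα
      have := hpos α hα
      have := ZMod.val_lt α
      rw [Finset.mem_range]
      omega
    · intro v hv
      rw [Finset.mem_range] at hv
      rw [Finset.mem_erase]
      refine ⟨fun h => ?_, Finset.mem_univ _⟩
      rw [ZMod.natCast_eq_zero_iff] at h
      exact absurd (Nat.le_of_dvd (by omega) h) (by omega)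
    · intro α hα
      have := hpos α hα
      rw [Nat.sub_add_cancel this, ZMod.natCast_zmod_val]
    · intro v hv
      rw [Finset.mem_range] at hv
      rw [ZMod.val_natCast_of_lt (by omega), Nat.add_sub_cancel]
    · intro α hα
      have := hpos α hα
      rw [Nat.sub_add_cancel this]
  rw [← Finset.add_sum_erase _ _ (Finset.mem_univ (0 : ZMod p))]
  rw [← Finset.mul_sum, Finset.sum_add_distrib, hrefl] at hrest
  have : (p : ℝ) / 2 * (∑ v ∈ Finset.range m, 1 / (((v + 1 : ℕ) : ℝ)) +
      ∑ v ∈ Finset.range m, 1 / (((v + 1 : ℕ) : ℝ))) ≤ p * (1 + Real.log p) := by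
    nlinarith
  linarith

lemma stdAddChar_inversion (f : ZMod p → ℂ) (y : ZMod p) :
    ∑ α : ZMod p, stdAddChar (-(α * y)) * ∑ x, f x * stdAddChar (α * x) = p * f y := by
  have h1 : ∀ x, ∑ α : ZMod p, stdAddChar (α * (x - y)) = if x = y then (p : ℂ) else 0 := by
    intro x
    rw [AddChar.sum_mulShift _ (isPrimitive_stdAddChar p), ZMod.card]
    simp only [sub_eq_zero]
    split_ifs <;> simp
  simp_rw [Finset.mul_sum]
  rw [Finset.sum_comm]
  have h2 : ∀ x, ∑ α : ZMod p, stdAddChar (-(α * y)) * (f x * stdAddChar (α * x)) =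
      f x * if x = y then (p : ℂ) else 0 := by
    intro x
    rw [← h1, Finset.mul_sum]
    refine Finset.sum_congr rfl fun α _ => ?_
    rw [mul_sub, sub_eq_neg_add, AddChar.map_add_eq_mul]
    ring
  rw [Finset.sum_congr rfl fun x _ => h2 x]
  simp [mul_comm]

lemma sum_intervalCoeff_mul (f : ZMod p → ℂ) (N : ℕ) :
    ∑ α : ZMod p, intervalCoeff N α * ∑ x, f x * stdAddChar (α * x) =
      p * ∑ n ∈ Finset.Icc 1 N, f n := by
  simp_rw [intervalCoeff, Finset.sum_mul]
  rw [Finset.sum_comm, Finset.mul_sum]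
  exact Finset.sum_congr rfl fun n _ => stdAddChar_inversion f n

/-- Completing an incomplete sum. -/
theorem norm_sum_Icc_le_of_complete {f : ZMod p → ℂ} {B : ℝ}
    (hf : ∀ α : ZMod p, ‖∑ x, f x * stdAddChar (α * x)‖ ≤ B) {N : ℕ} (hN : N ≤ p) :
    ‖∑ n ∈ Finset.Icc 1 N, f n‖ ≤ (2 + Real.log p) * B := by
  have hp : (0 : ℝ) < p := by exact_mod_cast (Fact.out : p.Prime).pos
  have hB : 0 ≤ B := (norm_nonneg _).trans (hf 0)
  have h1 : ‖(p : ℂ) * ∑ n ∈ Finset.Icc 1 N, f n‖ ≤ p * (2 + Real.log p) * B := by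
    rw [← sum_intervalCoeff_mul]
    refine (norm_sum_le _ _).trans ((Finset.sum_le_sum fun α _ => ?_).trans
      (le_of_eq_of_le (Finset.sum_mul _ _ _).symm
        (mul_le_mul_of_nonneg_right (sum_norm_intervalCoeff_le hN) hB)))
    rw [norm_mul]
    exact mul_le_mul_of_nonneg_left (hf α) (norm_nonneg _)
  rw [norm_mul, Complex.norm_natCast, mul_assoc] at h1
  exact le_of_mul_le_mul_left h1 hp

/-- Completing in two variables: the number of points of `E` in a box. -/
theorem card_box_le_of_complete {E : Finset (ZMod p × ZMod p)} {B : ℝ}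
    (hB : 0 ≤ B) (hE : ∀ α β : ZMod p, α ≠ 0 ∨ β ≠ 0 →
      ‖∑ z ∈ E, stdAddChar (α * z.1 + β * z.2)‖ ≤ B) {N : ℕ} (hN : N ≤ p) :
    (((Finset.Icc 1 N ×ˢ Finset.Icc 1 N).filter
      fun z : ℕ × ℕ => ((z.1 : ZMod p), (z.2 : ZMod p)) ∈ E).card : ℝ) ≤
      (N / p) ^ 2 * E.card + (2 + Real.log p) ^ 2 * B := by
  have hp : (0 : ℝ) < p := by exact_mod_cast (Fact.out : p.Prime).pos
  obtain ⟨g, hg⟩ : ∃ g : ZMod p → ZMod p → ℂ, g = fun x y => if (x, y) ∈ E then 1 else 0 :=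
    ⟨_, rfl⟩
  have hcard : ((((Finset.Icc 1 N ×ˢ Finset.Icc 1 N).filter
      fun z : ℕ × ℕ => ((z.1 : ZMod p), (z.2 : ZMod p)) ∈ E).card : ℕ) : ℂ) =
      ∑ n ∈ Finset.Icc 1 N, ∑ m ∈ Finset.Icc 1 N, g n m := by
    rw [← Finset.sum_product', hg, Finset.sum_boole]
  have hU : ∀ α β : ZMod p, ∑ x, (∑ y, g x y * stdAddChar (β * y)) * stdAddChar (α * x) =
      ∑ z ∈ E, stdAddChar (α * z.1 + β * z.2) := by
    intro α β
    simp_rw [Finset.sum_mul]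
    rw [← Finset.sum_product', Finset.univ_product_univ, ← Finset.sum_filter_add_sum_filter_not
      _ (fun z => z ∈ E), Finset.filter_univ_mem]
    refine (congrArg₂ (· + ·) (Finset.sum_congr rfl fun z hz => ?_)
      (Finset.sum_eq_zero fun z hz => ?_)).trans (add_zero _)
    · rw [hg]
      simp only [Prod.mk.eta, hz, if_true, one_mul]
      rw [AddChar.map_add_eq_mul, mul_comm]
    · rw [Finset.mem_filter] at hz
      rw [hg]
      simp [hz.2]
  have hexp : (p : ℂ) * (p * ∑ n ∈ Finset.Icc 1 N, ∑ m ∈ Finset.Icc 1 N, g n m) =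
      ∑ α : ZMod p, ∑ β : ZMod p, intervalCoeff N α * intervalCoeff N β *
        ∑ z ∈ E, stdAddChar (α * z.1 + β * z.2) := by
    have h1 : ∀ n : ℕ, (p : ℂ) * ∑ m ∈ Finset.Icc 1 N, g n m =
        ∑ β : ZMod p, intervalCoeff N β * ∑ y, g n y * stdAddChar (β * y) :=
      fun n => (sum_intervalCoeff_mul (g n) N).symm
    rw [Finset.mul_sum, Finset.sum_congr rfl fun n _ => h1 n]
    rw [← sum_intervalCoeff_mul fun x => ∑ β : ZMod p, intervalCoeff N β *
      ∑ y, g x y * stdAddChar (β * y)]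
    refine Finset.sum_congr rfl fun α _ => ?_
    simp_rw [← hU, Finset.sum_mul]
    rw [Finset.sum_comm, Finset.mul_sum]
    refine Finset.sum_congr rfl fun β _ => ?_
    rw [mul_assoc]
    congr 1
    simp_rw [Finset.mul_sum, Finset.sum_mul, mul_assoc]
  have hbound : ∀ α β : ZMod p, ‖intervalCoeff N α * intervalCoeff N β *
      ∑ z ∈ E, stdAddChar (α * z.1 + β * z.2)‖ ≤
      (if α = 0 ∧ β = 0 then (N : ℝ) ^ 2 * E.card else 0) +
        ‖intervalCoeff N α‖ * ‖intervalCoeff N β‖ * B := by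
    intro α β
    rw [norm_mul, norm_mul]
    split_ifs with h
    · obtain ⟨rfl, rfl⟩ := h
      rw [intervalCoeff_zero, Complex.norm_natCast]
      simp only [zero_mul, add_zero, AddChar.map_zero_eq_one, Finset.sum_const, nsmul_eq_mul,
        mul_one, Complex.norm_natCast]
      have : 0 ≤ (N : ℝ) * N * B := by positivity
      nlinarith
    · rw [zero_add]
      refine mul_le_mul_of_nonneg_left (hE α β ?_) (by positivity)
      tauto
  have hfin : (p : ℝ) * (p * (((Finset.Icc 1 N ×ˢ Finset.Icc 1 N).filter
      fun z : ℕ × ℕ => ((z.1 : ZMod p), (z.2 : ZMod p)) ∈ E).card : ℝ)) ≤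
      (N : ℝ) ^ 2 * E.card + (p * (2 + Real.log p)) ^ 2 * B := by
    have h2 : (p : ℝ) * (p * (((Finset.Icc 1 N ×ˢ Finset.Icc 1 N).filter
      fun z : ℕ × ℕ => ((z.1 : ZMod p), (z.2 : ZMod p)) ∈ E).card : ℝ)) =
        ‖(p : ℂ) * (p * ∑ n ∈ Finset.Icc 1 N, ∑ m ∈ Finset.Icc 1 N, g n m)‖ := by
      rw [← hcard, norm_mul, norm_mul, Complex.norm_natCast, Complex.norm_natCast]
    rw [h2, hexp]
    refine (norm_sum_le _ _).trans ((Finset.sum_le_sum fun α _ => (norm_sum_le _ _).trans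
      (Finset.sum_le_sum fun β _ => hbound α β)).trans ?_)
    simp_rw [Finset.sum_add_distrib]
    refine add_le_add (le_of_eq ?_) ?_
    · simp [ite_and]
    · simp_rw [← Finset.sum_mul, ← Finset.mul_sum]
      rw [← Finset.sum_mul, sq]
      have h3 := sum_norm_intervalCoeff_le hN
      have h4 : 0 ≤ ∑ α : ZMod p, ‖intervalCoeff N α‖ :=
        Finset.sum_nonneg fun _ _ => norm_nonneg _
      gcongr
  refine le_of_mul_le_mul_left ?_ (mul_pos hp hp)
  rw [mul_assoc]
  refine hfin.trans (le_of_eq ?_)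
  field_simp

end Completion

end

section

open Polynomial Module

section Moments

variable {p : ℕ} [Fact p.Prime]

/-- Mean square of a weighted character sum. -/
lemma sum_norm_sq_sum_mulChar_le {ι : Type*} {s : Finset ι} {v : ι → ZMod p}
    (hv : ∀ i ∈ s, v i ≠ 0) {c : ι → ℝ} {M : ℝ} (hc : ∀ i ∈ s, 0 ≤ c i) (hcM : ∀ i ∈ s, c i ≤ M) :
    ∑ χ : DirichletCharacter ℂ p, ‖∑ i ∈ s, (c i : ℂ) * χ (v i)‖ ^ 2 ≤
      p * M ^ 2 * ((s ×ˢ s).filter fun z => v z.1 = v z.2).card := by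
  have h1 : ∀ χ : DirichletCharacter ℂ p, ((‖∑ i ∈ s, (c i : ℂ) * χ (v i)‖ ^ 2 : ℝ) : ℂ) =
      ∑ i ∈ s, ∑ j ∈ s, (c i * c j : ℂ) * (χ (v i)⁻¹ * χ (v j)) := by
    intro χ
    rw [Complex.ofReal_pow, ← Complex.conj_mul', map_sum, Finset.sum_mul_sum]
    refine Finset.sum_congr rfl fun i _ => Finset.sum_congr rfl fun j _ => ?_
    rw [map_mul, Complex.conj_ofReal, ← MulChar.inv_apply', ← MulChar.star_apply']
    simp only [RCLike.star_def]
    ring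
  have h2 : ∑ χ : DirichletCharacter ℂ p, ‖∑ i ∈ s, (c i : ℂ) * χ (v i)‖ ^ 2 =
      ∑ i ∈ s, ∑ j ∈ s, c i * c j * if v i = v j then (p.totient : ℝ) else 0 := by
    apply Complex.ofReal_injective
    rw [Complex.ofReal_sum, Finset.sum_congr rfl fun χ _ => h1 χ, Finset.sum_comm,
      Complex.ofReal_sum]
    refine Finset.sum_congr rfl fun i hi => ?_
    rw [Finset.sum_comm, Complex.ofReal_sum]
    refine Finset.sum_congr rfl fun j hj => ?_
    rw [← Finset.mul_sum, DirichletCharacter.sum_char_inv_mul_char_eq ℂ (hv i hi).isUnit]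
    split_ifs <;> push_cast <;> rfl
  have h3 : ((((s ×ˢ s).filter fun z => v z.1 = v z.2).card : ℕ) : ℝ) =
      ∑ i ∈ s, ∑ j ∈ s, if v i = v j then (1 : ℝ) else 0 := by
    rw [← Finset.sum_product', Finset.sum_boole]
  rw [h2, h3, Finset.mul_sum]
  refine Finset.sum_le_sum fun i hi => ?_
  rw [Finset.mul_sum]
  refine Finset.sum_le_sum fun j hj => ?_
  have h4 : (p.totient : ℝ) ≤ p := by exact_mod_cast Nat.totient_le p
  have h5 : c i * c j ≤ M * M :=
    mul_le_mul (hcM i hi) (hcM j hj) (hc j hj) ((hc i hi).trans (hcM i hi))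
  split_ifs
  · rw [mul_one, sq, mul_comm (p : ℝ)]
    exact mul_le_mul h5 h4 (Nat.cast_nonneg _) (mul_self_nonneg M)
  · simp

lemma card_univ_shiftProd_eq_le {d : ℕ} (hd : 1 ≤ d) (c : ZMod p) :
    (Finset.univ.filter fun x : ZMod p => shiftProd d x = c).card ≤ d := by
  classical
  obtain ⟨A, hA⟩ : ∃ A : (ZMod p)[X], A = ∏ i ∈ Finset.Icc 1 d, (X + C (i : ZMod p)) := ⟨_, rfl⟩
  have hAd : A.natDegree = d := by
    rw [hA, natDegree_prod_of_monic _ _ fun i _ => monic_X_add_C _]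
    exact (Finset.sum_congr rfl fun i _ => natDegree_X_add_C _).trans (by simp)
  have hd' : (A - C c).natDegree = d := by rw [natDegree_sub_C, hAd]
  have hne : A - C c ≠ 0 := fun h => by
    rw [h, natDegree_zero] at hd'
    omega
  have hsub : (Finset.univ.filter fun x : ZMod p => shiftProd d x = c) ⊆
      (A - C c).roots.toFinset := by
    intro x hx
    rw [Finset.mem_filter] at hx
    rw [Multiset.mem_toFinset, mem_roots hne, IsRoot, eval_sub, eval_C, hA, eval_prod, sub_eq_zero,
      ← hx.2]
    simp [shiftProd]
  exact (Finset.card_le_card hsub).trans ((Multiset.toFinset_card_le _).trans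
    ((card_roots' _).trans hd'.le))

lemma natCast_injOn_Icc {N : ℕ} (hN : N < p) :
    Set.InjOn (fun n : ℕ => (n : ZMod p)) (Finset.Icc 1 N : Finset ℕ) := by
  intro a ha b hb hab
  rw [Finset.mem_coe, Finset.mem_Icc] at ha hb
  have := congrArg ZMod.val hab
  simp only at this
  rwa [ZMod.val_natCast_of_lt (by omega), ZMod.val_natCast_of_lt (by omega)] at this

lemma card_Icc_shiftProd_eq_le {d N : ℕ} (hd : 1 ≤ d) (hN : N < p) (c : ZMod p) :
    ((Finset.Icc 1 N).filter fun n : ℕ => shiftProd d (n : ZMod p) = c).card ≤ d := by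
  refine (Finset.card_le_card_of_injOn (fun n : ℕ => (n : ZMod p)) ?_ ?_).trans
    (card_univ_shiftProd_eq_le hd c)
  · intro n hn
    have hn := (Finset.mem_filter.1 hn).2
    simpa using hn
  · exact (natCast_injOn_Icc hN).mono fun n hn => (Finset.mem_filter.1 hn).1

lemma shiftProd_mul_factorial (n d : ℕ) :
    shiftProd d (n : ZMod p) * (n.factorial : ZMod p) = ((n + d).factorial : ZMod p) := by
  induction d with
  | zero => simp [shiftProd]
  | succ d ih =>
    have h1 : shiftProd (d + 1) (n : ZMod p) =
        shiftProd d (n : ZMod p) * ((n + d + 1 : ℕ) : ZMod p) := by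
      rw [shiftProd, shiftProd, Finset.prod_Icc_succ_top (by omega)]
      push_cast
      ring
    rw [h1, mul_right_comm, ih, ← Nat.cast_mul, mul_comm, ← add_assoc, Nat.factorial_succ]

lemma factorial_ne_zero_of_lt {n : ℕ} (hn : n < p) : (n.factorial : ZMod p) ≠ 0 := by
  rw [Ne, ZMod.natCast_eq_zero_iff, (Fact.out : p.Prime).dvd_factorial]
  omega

lemma shiftProd_ne_zero {n d : ℕ} (h : n + d < p) : shiftProd d (n : ZMod p) ≠ 0 := by
  intro h0
  have := shiftProd_mul_factorial (p := p) n d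
  rw [h0, zero_mul] at this
  exact factorial_ne_zero_of_lt h this.symm

/-- Incomplete character sums of shifted products. -/
lemma norm_sum_Icc_mulChar_shiftProd_le {d N : ℕ} (hd : 1 ≤ d) (hdp : d < p) (hN : N ≤ p)
    {χ : DirichletCharacter ℂ p} (hχ : χ ≠ 1) :
    ‖∑ n ∈ Finset.Icc 1 N, χ (shiftProd d (n : ZMod p))‖ ≤ (2 + Real.log p) * (d * √p) := by
  refine norm_sum_Icc_le_of_complete (f := fun x => χ (shiftProd d x)) (fun α => ?_) hN
  exact norm_sum_mulChar_shift_le hd hdp hχ (AddChar.mulShift ZMod.stdAddChar α)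

/-- The number of `x, y ≤ N` with `(x + 1) ⋯ (x + d) = (y + 1) ⋯ (y + e)` modulo `p`. -/
def boxCount (p : ℕ) [Fact p.Prime] (d e N : ℕ) : ℕ :=
  ((Finset.Icc 1 N ×ˢ Finset.Icc 1 N).filter fun z : ℕ × ℕ =>
    (shiftProd d (z.1 : ZMod p)) = shiftProd e (z.2 : ZMod p)).card

lemma boxCount_self_le {d N : ℕ} (hd : 1 ≤ d) (hN : N < p) : boxCount p d d N ≤ N * d := by
  classical
  rw [boxCount]
  have := Finset.card_le_mul_card_image_of_maps_to (s := ((Finset.Icc 1 N ×ˢ Finset.Icc 1 N).filter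
    fun z : ℕ × ℕ => (shiftProd d (z.1 : ZMod p)) = shiftProd d (z.2 : ZMod p)))
    (t := Finset.Icc 1 N) (f := Prod.snd) (fun z hz => by
      rw [Finset.mem_filter, Finset.mem_product] at hz
      exact hz.1.2) d (fun m hm => by
      refine (Finset.card_le_card_of_injOn Prod.fst (fun z hz => ?_) ?_).trans
        (card_Icc_shiftProd_eq_le hd hN (shiftProd d (m : ZMod p)))
      · have hz := Finset.mem_filter.1 hz
        have hz1 := Finset.mem_filter.1 hz.1
        have hz2 := hz1.2
        rw [hz.2] at hz2
        exact Finset.mem_filter.2 ⟨(Finset.mem_product.1 hz1.1).1, hz2⟩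
      · intro z hz z' hz' h
        exact Prod.ext h ((Finset.mem_filter.1 hz).2.trans (Finset.mem_filter.1 hz').2.symm))
  simpa [mul_comm] using this

lemma boxCount_comm (d e N : ℕ) : boxCount p d e N = boxCount p e d N := by
  refine Finset.card_nbij' Prod.swap Prod.swap ?_ ?_ ?_ ?_
  · intro z hz
    simp only [Finset.coe_filter, Finset.mem_product, Set.mem_ofPred_eq] at hz ⊢
    exact ⟨⟨hz.1.2, hz.1.1⟩, hz.2.symm⟩
  · intro z hz
    simp only [Finset.coe_filter, Finset.mem_product, Set.mem_ofPred_eq] at hz ⊢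
    exact ⟨⟨hz.1.2, hz.1.1⟩, hz.2.symm⟩
  · intro z _; rfl
  · intro z _; rfl

lemma card_curve_le {d : ℕ} (hd : 1 ≤ d) (e : ℕ) :
    (Finset.univ.filter fun z : ZMod p × ZMod p => shiftProd d z.1 = shiftProd e z.2).card ≤
      d * p := by
  classical
  have := Finset.card_le_mul_card_image_of_maps_to (s := (Finset.univ.filter
    fun z : ZMod p × ZMod p => shiftProd d z.1 = shiftProd e z.2))
    (t := Finset.univ) (f := Prod.snd) (fun z hz => Finset.mem_univ _) d (fun m hm => by
      refine (Finset.card_le_card_of_injOn Prod.fst (fun z hz => ?_) ?_).trans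
        (card_univ_shiftProd_eq_le hd (shiftProd e m))
      · have hz := Finset.mem_filter.1 hz
        have hz2 := (Finset.mem_filter.1 hz.1).2
        rw [hz.2] at hz2
        exact Finset.mem_filter.2 ⟨Finset.mem_univ _, hz2⟩
      · intro z hz z' hz' h
        exact Prod.ext h ((Finset.mem_filter.1 hz).2.trans (Finset.mem_filter.1 hz').2.symm))
  simpa using this

/-- The upper bound for `boxCount p d e N` with `d ≠ e` and `d, e ≤ K`. -/
noncomputable def boxBound (p K N : ℕ) : ℝ :=
  (N / p) ^ 2 * (K * p) + (2 + Real.log p) ^ 2 * (4 * (K : ℝ) ^ 2 * √p + 12 * (K : ℝ) ^ 4)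

lemma boxCount_le_of_lt {d e K N : ℕ} (hd : 1 ≤ d) (hde : d < e) (heK : e ≤ K) (hKp : K < p)
    (hN : N ≤ p) : (boxCount p d e N : ℝ) ≤ boxBound p K N := by
  have hψ : (ZMod.stdAddChar : AddChar (ZMod p) ℂ) ≠ 1 := by
    have := (ZMod.isPrimitive_stdAddChar p) one_ne_zero
    rwa [AddChar.mulShift_one] at this
  have key := card_box_le_of_complete
    (E := Finset.univ.filter fun z : ZMod p × ZMod p => shiftProd d z.1 = shiftProd e z.2)
    (B := 4 * (e : ℝ) ^ 2 * √p + 12 * (e : ℝ) ^ 4) (by positivity)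
    (fun α β h => norm_sum_shiftProd_eq_le hψ hd hde (by omega) h) hN
  simp only [Finset.mem_filter, Finset.mem_univ, true_and] at key
  have hc : ((Finset.univ.filter fun z : ZMod p × ZMod p =>
      shiftProd d z.1 = shiftProd e z.2).card : ℝ) ≤ K * p := by
    exact_mod_cast (card_curve_le hd e).trans (Nat.mul_le_mul_right p (by omega))
  have he : (e : ℝ) ≤ K := by exact_mod_cast heK
  refine key.trans ?_
  rw [boxBound]
  gcongr

lemma boxCount_le_of_ne {d e K N : ℕ} (hd : 1 ≤ d) (he : 1 ≤ e) (hde : d ≠ e) (hdK : d ≤ K)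
    (heK : e ≤ K) (hKp : K < p) (hN : N ≤ p) : (boxCount p d e N : ℝ) ≤ boxBound p K N := by
  rcases lt_or_gt_of_ne hde with h | h
  · exact boxCount_le_of_lt hd h heK hKp hN
  · rw [boxCount_comm]
    exact boxCount_le_of_lt he h hdK hKp hN

/-- The smoothed sum of the correlations `∑ χ ((n + 1) ⋯ (n + d))` over `d < K`. -/
noncomputable def corrSum (K N : ℕ) (χ : DirichletCharacter ℂ p) : ℂ :=
  ∑ d ∈ Finset.Ico 1 K, ((K - d : ℕ) : ℂ) * ∑ n ∈ Finset.Icc 1 N, χ (shiftProd d (n : ZMod p))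

omit [Fact p.Prime] in
lemma boxBound_nonneg (K N : ℕ) : 0 ≤ boxBound p K N := by
  rw [boxBound]
  positivity

lemma sum_norm_sq_corrSum_le {K N : ℕ} (hKN : N + K < p) :
    ∑ χ : DirichletCharacter ℂ p, ‖corrSum K N χ‖ ^ 2 ≤
      p * (K : ℝ) ^ 2 * ((K : ℝ) ^ 2 * N + (K : ℝ) ^ 2 * boxBound p K N) := by
  have h1 : ∀ χ : DirichletCharacter ℂ p, corrSum K N χ =
      ∑ i ∈ Finset.Ico 1 K ×ˢ Finset.Icc 1 N, (((K - i.1 : ℕ) : ℝ) : ℂ) *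
        χ (shiftProd i.1 (i.2 : ZMod p)) := by
    intro χ
    rw [corrSum, Finset.sum_product]
    refine Finset.sum_congr rfl fun d _ => ?_
    rw [Finset.mul_sum]
    push_cast
    rfl
  rw [Finset.sum_congr rfl fun χ _ => by rw [h1 χ]]
  refine (sum_norm_sq_sum_mulChar_le (M := K)
    (v := fun i : ℕ × ℕ => shiftProd i.1 (i.2 : ZMod p)) (fun i hi => ?_)
    (fun i _ => Nat.cast_nonneg _)
    (fun i _ => by exact_mod_cast Nat.sub_le K i.1)).trans ?_
  · rw [Finset.mem_product, Finset.mem_Ico, Finset.mem_Icc] at hi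
    exact shiftProd_ne_zero (by omega)
  refine mul_le_mul_of_nonneg_left ?_ (by positivity)
  have h2 : ((((Finset.Ico 1 K ×ˢ Finset.Icc 1 N) ×ˢ (Finset.Ico 1 K ×ˢ Finset.Icc 1 N)).filter
      fun z : (ℕ × ℕ) × (ℕ × ℕ) => shiftProd z.1.1 (z.1.2 : ZMod p) =
        shiftProd z.2.1 (z.2.2 : ZMod p)).card : ℝ) =
      ∑ d ∈ Finset.Ico 1 K, ∑ e ∈ Finset.Ico 1 K, (boxCount p d e N : ℝ) := by
    rw [← Finset.sum_boole (R := ℝ), Finset.sum_product, Finset.sum_product]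
    refine Finset.sum_congr rfl fun d _ => ?_
    simp_rw [Finset.sum_product]
    rw [Finset.sum_comm]
    refine Finset.sum_congr rfl fun e _ => ?_
    rw [boxCount, ← Finset.sum_boole (R := ℝ), Finset.sum_product]
  rw [h2]
  have h3 : ∀ d ∈ Finset.Ico 1 K, ∀ e ∈ Finset.Ico 1 K, (boxCount p d e N : ℝ) ≤
      (if d = e then (K : ℝ) * N else 0) + boxBound p K N := by
    intro d hd e he
    rw [Finset.mem_Ico] at hd he
    split_ifs with h
    · subst h
      have h4 : (boxCount p d d N : ℝ) ≤ K * N := by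
        exact_mod_cast (boxCount_self_le hd.1 (by omega)).trans
          (by rw [mul_comm]; exact Nat.mul_le_mul_right N hd.2.le)
      linarith [boxBound_nonneg (p := p) K N]
    · rw [zero_add]
      exact boxCount_le_of_ne hd.1 he.1 h hd.2.le he.2.le (by omega) (by omega)
  refine (Finset.sum_le_sum fun d hd => Finset.sum_le_sum fun e he => h3 d hd e he).trans ?_
  simp_rw [Finset.sum_add_distrib, Finset.sum_ite_eq, Finset.sum_ite_mem, Finset.inter_self,
    Finset.sum_const, Nat.card_Ico, nsmul_eq_mul]
  have hK : ((K - 1 : ℕ) : ℝ) ≤ K := by exact_mod_cast Nat.sub_le K 1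
  have hb := boxBound_nonneg (p := p) K N
  refine add_le_add ?_ ?_
  · calc ((K - 1 : ℕ) : ℝ) * (K * N) ≤ K * (K * N) := by gcongr
      _ = _ := by ring
  · calc ((K - 1 : ℕ) : ℝ) * (((K - 1 : ℕ) : ℝ) * boxBound p K N)
        ≤ K * (K * boxBound p K N) := by gcongr
      _ = _ := by ring

/-- The character sum over factorials. -/
noncomputable def factSum (N : ℕ) (χ : DirichletCharacter ℂ p) : ℂ :=
  ∑ n ∈ Finset.Icc 1 N, χ (n.factorial : ZMod p)

lemma card_lt_factorial_eq_le {H N : ℕ} (hN : N < p) :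
    ((Finset.Icc 1 N ×ˢ Finset.Icc 1 N).filter fun z : ℕ × ℕ =>
      z.1 < z.2 ∧ z.2 < z.1 + H ∧ (z.1.factorial : ZMod p) = z.2.factorial).card ≤ H * H := by
  classical
  have := Finset.card_le_mul_card_image_of_maps_to (s := ((Finset.Icc 1 N ×ˢ Finset.Icc 1 N).filter
      fun z : ℕ × ℕ => z.1 < z.2 ∧ z.2 < z.1 + H ∧ (z.1.factorial : ZMod p) = z.2.factorial))
    (t := Finset.Ico 1 H) (f := fun z => z.2 - z.1) (fun z hz => by
      rw [Finset.mem_filter] at hz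
      rw [Finset.mem_Ico]
      omega) H (fun d hd => by
      rw [Finset.mem_Ico] at hd
      refine (Finset.card_le_card_of_injOn Prod.fst (fun z hz => ?_) ?_).trans
        ((card_Icc_shiftProd_eq_le hd.1 hN 1).trans hd.2.le)
      · have hz := Finset.mem_filter.1 hz
        have hz1 := Finset.mem_filter.1 hz.1
        have hm := Finset.mem_product.1 hz1.1
        have hm1 := Finset.mem_Icc.1 hm.1
        refine Finset.mem_filter.2 ⟨hm.1, ?_⟩
        have h1 := shiftProd_mul_factorial (p := p) z.1 d
        have h2 : z.1 + d = z.2 := by omega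
        rw [h2, ← hz1.2.2.2] at h1
        exact mul_eq_right₀ (factorial_ne_zero_of_lt (by omega)) |>.1 h1
      · intro z hz z' hz' h
        have hz1 := Finset.mem_filter.1 hz
        have hz2 := Finset.mem_filter.1 hz'
        have h1 := (Finset.mem_filter.1 hz1.1).2.1
        have h2 := (Finset.mem_filter.1 hz2.1).2.1
        have h3 := hz1.2
        have h4 := hz2.2
        exact Prod.ext h (by omega))
  refine this.trans (Nat.mul_le_mul_left H ?_)
  simp

lemma card_near_factorial_eq_le {H N : ℕ} (hN : N < p) :
    ((Finset.Icc 1 N ×ˢ Finset.Icc 1 N).filter fun z : ℕ × ℕ =>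
      z.2 < z.1 + H ∧ z.1 < z.2 + H ∧ (z.1.factorial : ZMod p) = z.2.factorial).card ≤
      N + 2 * (H * H) := by
  classical
  obtain ⟨L, hL⟩ : ∃ L : Finset (ℕ × ℕ), L = (Finset.Icc 1 N ×ˢ Finset.Icc 1 N).filter
    fun z : ℕ × ℕ => z.1 < z.2 ∧ z.2 < z.1 + H ∧ (z.1.factorial : ZMod p) = z.2.factorial :=
    ⟨_, rfl⟩
  have hLc : L.card ≤ H * H := hL ▸ card_lt_factorial_eq_le hN
  have hsub : ((Finset.Icc 1 N ×ˢ Finset.Icc 1 N).filter fun z : ℕ × ℕ =>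
      z.2 < z.1 + H ∧ z.1 < z.2 + H ∧ (z.1.factorial : ZMod p) = z.2.factorial) ⊆
      (Finset.Icc 1 N).diag ∪ (L ∪ L.image Prod.swap) := by
    intro z hz
    rw [Finset.mem_filter, Finset.mem_product] at hz
    rw [Finset.mem_union, Finset.mem_union, Finset.mem_diag, Finset.mem_image]
    rcases lt_trichotomy z.1 z.2 with h | h | h
    · right; left
      rw [hL, Finset.mem_filter, Finset.mem_product]
      exact ⟨hz.1, h, hz.2.1, hz.2.2.2⟩
    · left
      exact ⟨hz.1.1, h⟩
    · right; right
      refine ⟨z.swap, ?_, rfl⟩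
      rw [hL, Finset.mem_filter, Finset.mem_product]
      exact ⟨⟨hz.1.2, hz.1.1⟩, h, hz.2.2.1, hz.2.2.2.symm⟩
  have h1 := Finset.card_le_card hsub
  have h2 := Finset.card_union_le (Finset.Icc 1 N).diag (L ∪ L.image Prod.swap)
  have h3 := Finset.card_union_le L (L.image Prod.swap)
  have h4 := Finset.card_image_le (s := L) (f := Prod.swap)
  rw [Finset.diag_card, Nat.card_Icc] at h2
  omega

lemma sum_norm_sq_factSum_le_of_block {H N : ℕ} (hH : 1 ≤ H) (hN : N < p) :
    ∑ χ : DirichletCharacter ℂ p, ‖factSum N χ‖ ^ 2 ≤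
      ((N / H + 1 : ℕ) : ℝ) * (p * ((N + 2 * (H * H) : ℕ) : ℝ)) := by
  have h1 : ∀ χ : DirichletCharacter ℂ p, ‖factSum N χ‖ ^ 2 ≤ ((N / H + 1 : ℕ) : ℝ) *
      ∑ b ∈ Finset.range (N / H + 1),
        ‖∑ n ∈ (Finset.Icc 1 N).filter fun n => n / H = b,
          ((1 : ℝ) : ℂ) * χ (n.factorial : ZMod p)‖ ^ 2 := by
    intro χ
    have h2 : factSum N χ = ∑ b ∈ Finset.range (N / H + 1),
        ∑ n ∈ (Finset.Icc 1 N).filter fun n => n / H = b,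
          ((1 : ℝ) : ℂ) * χ (n.factorial : ZMod p) := by
      rw [factSum, ← Finset.sum_fiberwise_of_maps_to (t := Finset.range (N / H + 1))
        (g := fun n => n / H)]
      · simp
      · intro n hn
        rw [Finset.mem_Icc] at hn
        rw [Finset.mem_range, Nat.lt_succ_iff]
        exact Nat.div_le_div_right hn.2
    rw [h2]
    refine (pow_le_pow_left₀ (norm_nonneg _) (norm_sum_le _ _) 2).trans
      (sq_sum_le_card_mul_sum_sq.trans ?_)
    rw [Finset.card_range]
  refine (Finset.sum_le_sum fun χ _ => h1 χ).trans ?_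
  rw [← Finset.mul_sum, Finset.sum_comm]
  refine mul_le_mul_of_nonneg_left ?_ (Nat.cast_nonneg _)
  refine (Finset.sum_le_sum fun b _ => sum_norm_sq_sum_mulChar_le (M := 1)
    (v := fun n : ℕ => (n.factorial : ZMod p)) (c := fun _ => 1) (fun n hn => ?_)
    (fun _ _ => zero_le_one) (fun _ _ => le_rfl)).trans ?_
  · have := Finset.mem_Icc.1 (Finset.mem_filter.1 hn).1
    exact factorial_ne_zero_of_lt (by omega)
  rw [← Finset.mul_sum, one_pow, mul_one]
  refine mul_le_mul_of_nonneg_left ?_ (Nat.cast_nonneg _)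
  rw [← Nat.cast_sum, Nat.cast_le]
  refine le_trans ?_ (card_near_factorial_eq_le (H := H) hN)
  rw [← Finset.card_sigma]
  refine Finset.card_le_card_of_injOn Sigma.snd ?_ ?_
  · rintro ⟨b, z⟩ hz
    simp only [Finset.mem_coe, Finset.mem_sigma, Finset.mem_filter, Finset.mem_product] at hz ⊢
    refine ⟨⟨hz.2.1.1.1, hz.2.1.2.1⟩, ?_, ?_, hz.2.2⟩
    · have h3 := hz.2.1.1.2
      have h4 := hz.2.1.2.2
      have h5 := Nat.div_add_mod z.1 H
      have h6 := Nat.div_add_mod z.2 H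
      have h7 := Nat.mod_lt z.2 hH
      rw [h3] at h5
      rw [h4] at h6
      omega
    · have h3 := hz.2.1.1.2
      have h4 := hz.2.1.2.2
      have h5 := Nat.div_add_mod z.1 H
      have h6 := Nat.div_add_mod z.2 H
      have h7 := Nat.mod_lt z.1 hH
      rw [h3] at h5
      rw [h4] at h6
      omega
  · rintro ⟨b, z⟩ hz ⟨b', z'⟩ hz' h
    simp only [Finset.mem_coe, Finset.mem_sigma, Finset.mem_filter, Finset.mem_product] at hz hz'
    dsimp only at h
    subst h
    have h8 : b = b' := hz.2.1.1.2.symm.trans hz'.2.1.1.2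
    subst h8
    rfl

/-- Mean square of the character sum over factorials. -/
lemma sum_norm_sq_factSum_le {N : ℕ} (hN1 : 1 ≤ N) (hN : N < p) :
    ∑ χ : DirichletCharacter ℂ p, ‖factSum N χ‖ ^ 2 ≤ 12 * p * N * √N := by
  obtain ⟨H, hH⟩ : ∃ H, H = Nat.sqrt N := ⟨_, rfl⟩
  have hH1 : 1 ≤ H := by rw [hH]; exact Nat.sqrt_pos.2 hN1
  have h1 : H * H ≤ N := hH ▸ Nat.sqrt_le N
  have h2 : N < (H + 1) * (H + 1) := hH ▸ Nat.lt_succ_sqrt N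
  refine (sum_norm_sq_factSum_le_of_block hH1 hN).trans ?_
  have h3 : N / H + 1 ≤ 4 * H := by
    have : N / H < H + 3 := by
      rw [Nat.div_lt_iff_lt_mul hH1]
      nlinarith
    omega
  have h4 : (H : ℝ) ≤ √N := Real.le_sqrt_of_sq_le (by rw [sq]; exact_mod_cast h1)
  have h5 : ((N / H + 1 : ℕ) : ℝ) ≤ 4 * √N := by
    have : ((N / H + 1 : ℕ) : ℝ) ≤ ((4 * H : ℕ) : ℝ) := by exact_mod_cast h3
    push_cast at this ⊢
    linarith
  have h6 : ((N + 2 * (H * H) : ℕ) : ℝ) ≤ 3 * N := by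
    have : N + 2 * (H * H) ≤ 3 * N := by omega
    exact_mod_cast this
  calc ((N / H + 1 : ℕ) : ℝ) * (p * ((N + 2 * (H * H) : ℕ) : ℝ)) ≤ 4 * √N * (p * (3 * N)) := by
        gcongr
    _ = 12 * p * N * √N := by ring

end Moments

end

section Shift

lemma norm_sum_Icc_shift_sub_le {f : ℕ → ℂ} (hf : ∀ n, ‖f n‖ ≤ 1) (N l : ℕ) :
    ‖∑ n ∈ Finset.Icc 1 N, f (n + l) - ∑ n ∈ Finset.Icc 1 N, f n‖ ≤ 2 * l := by
  induction l with
  | zero => simp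
  | succ l ih =>
    have h1 : ∑ n ∈ Finset.Icc 1 N, f (n + (l + 1)) - ∑ n ∈ Finset.Icc 1 N, f (n + l) =
        f (N + l + 1) - f (l + 1) := by
      rw [← Finset.sum_sub_distrib, ← Finset.Ico_succ_right_eq_Icc, Finset.sum_Ico_eq_sum_range]
      have := Finset.sum_range_sub (fun n => f (n + l + 1)) N
      rw [zero_add] at this
      rw [← this]
      refine Finset.sum_congr (by simp) fun n _ => ?_
      congr 2 <;> ring
    have h2 : ∑ n ∈ Finset.Icc 1 N, f (n + (l + 1)) - ∑ n ∈ Finset.Icc 1 N, f n =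
        (f (N + l + 1) - f (l + 1)) +
          (∑ n ∈ Finset.Icc 1 N, f (n + l) - ∑ n ∈ Finset.Icc 1 N, f n) := by
      rw [← h1]
      ring
    rw [h2]
    refine (norm_add_le _ _).trans ?_
    have h3 := (norm_sub_le (f (N + l + 1)) (f (l + 1))).trans (add_le_add (hf _) (hf _))
    push_cast
    linarith

lemma norm_sq_sum_range (a : ℕ → ℂ) (K : ℕ) :
    ‖∑ k ∈ Finset.range K, a k‖ ^ 2 = ∑ k ∈ Finset.range K, ‖a k‖ ^ 2 +
      2 * (∑ k ∈ Finset.range K, ∑ l ∈ Finset.range k, a k * (starRingEnd ℂ) (a l)).re := by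
  induction K with
  | zero => simp
  | succ K ih =>
    rw [Finset.sum_range_succ, add_comm, ← Complex.normSq_eq_norm_sq, Complex.normSq_add,
      Complex.normSq_eq_norm_sq, Complex.normSq_eq_norm_sq, ih, Finset.sum_range_succ,
      Finset.sum_range_succ, Complex.add_re, map_sum, Finset.mul_sum]
    ring

lemma sum_range_sum_range_sub (T : ℕ → ℂ) (K : ℕ) :
    ∑ k ∈ Finset.range K, ∑ l ∈ Finset.range k, T (k - l) =
      ∑ d ∈ Finset.Ico 1 K, ((K - d : ℕ) : ℂ) * T d := by
  induction K with
  | zero => simp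
  | succ K ih =>
    rw [Finset.sum_range_succ, ih]
    have h1 : ∑ l ∈ Finset.range K, T (K - l) = ∑ d ∈ Finset.Ico 1 (K + 1), T d := by
      rw [Finset.sum_Ico_eq_sum_range, ← Finset.sum_range_reflect]
      refine Finset.sum_congr rfl fun l hl => ?_
      rw [Finset.mem_range] at hl
      congr 1
      omega
    have h2 : ∑ d ∈ Finset.Ico 1 K, ((K - d : ℕ) : ℂ) * T d =
        ∑ d ∈ Finset.Ico 1 (K + 1), ((K - d : ℕ) : ℂ) * T d := by
      rcases Nat.eq_zero_or_pos K with rfl | hK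
      · simp
      · rw [Finset.sum_Ico_succ_top hK]
        simp
    rw [h1, h2, ← Finset.sum_add_distrib]
    refine Finset.sum_congr rfl fun d hd => ?_
    rw [Finset.mem_Ico] at hd
    have : K + 1 - d = (K - d) + 1 := by omega
    rw [this]
    push_cast
    ring

variable {p : ℕ} [Fact p.Prime]

lemma mulChar_factorial_mul_conj {n k l : ℕ} (hlk : l ≤ k) (h : n + k < p)
    (χ : DirichletCharacter ℂ p) :
    χ ((n + k).factorial : ZMod p) * (starRingEnd ℂ) (χ ((n + l).factorial : ZMod p)) =
      χ (shiftProd (k - l) ((n + l : ℕ) : ZMod p)) := by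
  have h1 := shiftProd_mul_factorial (p := p) (n + l) (k - l)
  have h2 : n + l + (k - l) = n + k := by omega
  rw [h2] at h1
  have h3 : (starRingEnd ℂ) (χ ((n + l).factorial : ZMod p)) =
      χ (((n + l).factorial : ZMod p)⁻¹) := by
    rw [← MulChar.inv_apply', ← MulChar.star_apply']
    rfl
  rw [h3, ← map_mul, ← h1, mul_assoc, mul_inv_cancel₀ (factorial_ne_zero_of_lt (by omega)), mul_one]

lemma norm_sum_correlations_sub_le {K N : ℕ} (hKN : N + K < p) (χ : DirichletCharacter ℂ p) :
    ‖∑ n ∈ Finset.Icc 1 N, ∑ k ∈ Finset.range K, ∑ l ∈ Finset.range k,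
      χ ((n + k).factorial : ZMod p) * (starRingEnd ℂ) (χ ((n + l).factorial : ZMod p)) -
        corrSum K N χ‖ ≤ (K : ℝ) ^ 3 := by
  have h1 : ∑ n ∈ Finset.Icc 1 N, ∑ k ∈ Finset.range K, ∑ l ∈ Finset.range k,
      χ ((n + k).factorial : ZMod p) * (starRingEnd ℂ) (χ ((n + l).factorial : ZMod p)) =
      ∑ k ∈ Finset.range K, ∑ l ∈ Finset.range k, ∑ n ∈ Finset.Icc 1 N,
        χ (shiftProd (k - l) ((n + l : ℕ) : ZMod p)) := by
    rw [Finset.sum_comm]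
    refine Finset.sum_congr rfl fun k hk => ?_
    rw [Finset.sum_comm]
    refine Finset.sum_congr rfl fun l hl => Finset.sum_congr rfl fun n hn => ?_
    rw [Finset.mem_range] at hk hl
    rw [Finset.mem_Icc] at hn
    exact mulChar_factorial_mul_conj hl.le (by omega) χ
  rw [h1, corrSum, ← sum_range_sum_range_sub fun d => ∑ n ∈ Finset.Icc 1 N,
    χ (shiftProd d (n : ZMod p)), ← Finset.sum_sub_distrib]
  have h2 : ∀ k ∈ Finset.range K, ‖∑ l ∈ Finset.range k, ∑ n ∈ Finset.Icc 1 N,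
        χ (shiftProd (k - l) ((n + l : ℕ) : ZMod p)) -
      ∑ l ∈ Finset.range k, ∑ n ∈ Finset.Icc 1 N, χ (shiftProd (k - l) (n : ZMod p))‖ ≤
      (K : ℝ) ^ 2 := by
    intro k hk
    rw [Finset.mem_range] at hk
    rw [← Finset.sum_sub_distrib]
    refine (norm_sum_le_of_le _ fun l hl => norm_sum_Icc_shift_sub_le
      (f := fun n => χ (shiftProd (k - l) (n : ZMod p)))
      (fun n => norm_mulChar_le_one χ _) N l).trans ?_
    rw [← Finset.mul_sum, ← Nat.cast_sum, ← Nat.cast_ofNat, ← Nat.cast_mul, ← Nat.cast_pow,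
      Nat.cast_le, mul_comm, Finset.sum_range_id_mul_two, sq]
    exact Nat.mul_le_mul hk.le (by omega)
  refine (norm_sum_le_of_le _ h2).trans ?_
  rw [Finset.sum_const, Finset.card_range, nsmul_eq_mul]
  exact le_of_eq (by ring)

lemma sq_le_of_mul_le_of_sq_le {S A Θ N K : ℝ} (hK : 1 ≤ K) (hN : K ^ 2 ≤ N) (hS : 0 ≤ S)
    (h1 : K * S ≤ A + K ^ 2) (h2 : A ^ 2 ≤ N * (N * K + 2 * (Θ + K ^ 3))) :
    S ^ 2 ≤ 8 * N ^ 2 / K + 4 * N / K ^ 2 * Θ := by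
  have hK0 : 0 < K := by linarith
  have hN0 : 0 < N := by nlinarith
  have h3 : (K * S) ^ 2 ≤ 2 * A ^ 2 + 2 * K ^ 4 := by
    have : (K * S) ^ 2 ≤ (A + K ^ 2) ^ 2 := pow_le_pow_left₀ (by positivity) h1 2
    nlinarith [sq_nonneg (A - K ^ 2)]
  have h4 : K ^ 4 ≤ N ^ 2 * K := by
    calc K ^ 4 = K ^ 2 * K ^ 2 := by ring
      _ ≤ N * N := by gcongr
      _ ≤ N ^ 2 * K := by nlinarith [sq_nonneg N]
  have h5 : N * K ^ 3 ≤ N ^ 2 * K := by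
    calc N * K ^ 3 = N * K * K ^ 2 := by ring
      _ ≤ N * K * N := by gcongr
      _ = N ^ 2 * K := by ring
  have h6 : 8 * N ^ 2 / K + 4 * N / K ^ 2 * Θ = (8 * N ^ 2 * K + 4 * N * Θ) / K ^ 2 := by
    field_simp
  rw [h6, le_div_iff₀ (by positivity)]
  nlinarith

/-- Bounding the character sum over factorials by correlations. -/
theorem norm_sq_factSum_le {K N : ℕ} (hK : 1 ≤ K) (hK2 : K ^ 2 ≤ N) (hKN : N + K < p)
    (χ : DirichletCharacter ℂ p) :
    ‖factSum N χ‖ ^ 2 ≤ 8 * (N : ℝ) ^ 2 / K + 4 * N / (K : ℝ) ^ 2 * ‖corrSum K N χ‖ := by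
  obtain ⟨A, hA⟩ : ∃ A : ℕ → ℂ, A = fun n => ∑ k ∈ Finset.range K,
    χ ((n + k).factorial : ZMod p) := ⟨_, rfl⟩
  have h1 : (K : ℝ) * ‖factSum N χ‖ ≤ ∑ n ∈ Finset.Icc 1 N, ‖A n‖ + (K : ℝ) ^ 2 := by
    have h2 : ‖∑ n ∈ Finset.Icc 1 N, A n - K * factSum N χ‖ ≤ (K : ℝ) ^ 2 := by
      have h3 : ∑ n ∈ Finset.Icc 1 N, A n - K * factSum N χ = ∑ k ∈ Finset.range K,
          (∑ n ∈ Finset.Icc 1 N, χ ((n + k).factorial : ZMod p) -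
            ∑ n ∈ Finset.Icc 1 N, χ (n.factorial : ZMod p)) := by
        rw [Finset.sum_sub_distrib, hA, Finset.sum_comm, Finset.sum_const, Finset.card_range,
          nsmul_eq_mul]
        rfl
      rw [h3]
      refine (norm_sum_le_of_le _ fun k _ => norm_sum_Icc_shift_sub_le
        (f := fun n => χ (n.factorial : ZMod p)) (fun n => norm_mulChar_le_one χ _) N k).trans ?_
      rw [← Finset.mul_sum, ← Nat.cast_sum, ← Nat.cast_ofNat, ← Nat.cast_mul, ← Nat.cast_pow,
        Nat.cast_le, mul_comm, Finset.sum_range_id_mul_two, sq]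
      exact Nat.mul_le_mul le_rfl (by omega)
    have h4 := norm_sub_norm_le ((K : ℂ) * factSum N χ) (∑ n ∈ Finset.Icc 1 N, A n)
    rw [norm_sub_rev, norm_mul, Complex.norm_natCast] at h4
    have h5 := norm_sum_le (Finset.Icc 1 N) A
    linarith
  have h6 : (∑ n ∈ Finset.Icc 1 N, ‖A n‖) ^ 2 ≤
      (N : ℝ) * (N * K + 2 * (‖corrSum K N χ‖ + (K : ℝ) ^ 3)) := by
    refine sq_sum_le_card_mul_sum_sq.trans ?_
    rw [Nat.card_Icc, Nat.add_sub_cancel]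
    refine mul_le_mul_of_nonneg_left ?_ (Nat.cast_nonneg _)
    rw [Finset.sum_congr rfl fun n _ => by rw [hA, norm_sq_sum_range], Finset.sum_add_distrib,
      ← Finset.mul_sum, ← Complex.re_sum]
    refine add_le_add ?_ (mul_le_mul_of_nonneg_left ?_ two_pos.le)
    · refine (Finset.sum_le_card_nsmul _ _ (K : ℝ) fun n _ => ?_).trans ?_
      · refine (Finset.sum_le_card_nsmul _ _ (1 : ℝ) fun k _ =>
          pow_le_one₀ (norm_nonneg _) (norm_mulChar_le_one χ _)).trans ?_
        simp
      · simp
    · refine (Complex.re_le_norm _).trans ?_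
      have h7 := norm_sum_correlations_sub_le hKN χ
      have h8 := norm_le_norm_add_norm_sub' (∑ n ∈ Finset.Icc 1 N, ∑ k ∈ Finset.range K,
        ∑ l ∈ Finset.range k, χ ((n + k).factorial : ZMod p) *
          (starRingEnd ℂ) (χ ((n + l).factorial : ZMod p))) (corrSum K N χ)
      linarith
  exact sq_le_of_mul_le_of_sq_le (by exact_mod_cast hK) (by exact_mod_cast hK2) (norm_nonneg _)
    h1 h6

/-- Pointwise bound for the character sum over factorials. -/
theorem norm_sq_factSum_le_of_ne_one {K N : ℕ} (hK : 1 ≤ K) (hK2 : K ^ 2 ≤ N) (hKN : N + K < p)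
    {χ : DirichletCharacter ℂ p} (hχ : χ ≠ 1) :
    ‖factSum N χ‖ ^ 2 ≤ 8 * (N : ℝ) ^ 2 / K + 4 * N * K * ((2 + Real.log p) * √p) := by
  have hp : (1 : ℝ) ≤ p := by exact_mod_cast (Fact.out : p.Prime).one_lt.le
  have hlog : 0 ≤ Real.log p := Real.log_nonneg hp
  have hK0 : (0 : ℝ) < K := by exact_mod_cast hK
  refine (norm_sq_factSum_le hK hK2 hKN χ).trans (add_le_add_right ?_ _)
  have h1 : ‖corrSum K N χ‖ ≤ (K : ℝ) ^ 3 * ((2 + Real.log p) * √p) := by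
    rw [corrSum]
    refine (norm_sum_le_of_le (f := fun d => ((K - d : ℕ) : ℂ) * ∑ n ∈ Finset.Icc 1 N,
      χ (shiftProd d (n : ZMod p))) (Finset.Ico 1 K)
      (n := fun _ => (K : ℝ) ^ 2 * ((2 + Real.log p) * √p)) fun d hd => ?_).trans ?_
    · rw [Finset.mem_Ico] at hd
      rw [norm_mul, Complex.norm_natCast]
      have h2 := norm_sum_Icc_mulChar_shiftProd_le hd.1 (by omega) (N := N) (by omega) hχ
      have h3 : ((K - d : ℕ) : ℝ) ≤ K := by exact_mod_cast Nat.sub_le K d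
      have h4 : (d : ℝ) ≤ K := by exact_mod_cast hd.2.le
      calc ((K - d : ℕ) : ℝ) * ‖∑ n ∈ Finset.Icc 1 N, χ (shiftProd d (n : ZMod p))‖
          ≤ K * ((2 + Real.log p) * (K * √p)) := by
            refine mul_le_mul h3 (h2.trans ?_) (norm_nonneg _) hK0.le
            gcongr
        _ = _ := by ring
    · rw [Finset.sum_const, Nat.card_Ico, nsmul_eq_mul]
      have h5 : ((K - 1 : ℕ) : ℝ) ≤ K := by exact_mod_cast Nat.sub_le K 1
      calc ((K - 1 : ℕ) : ℝ) * ((K : ℝ) ^ 2 * ((2 + Real.log p) * √p))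
          ≤ K * ((K : ℝ) ^ 2 * ((2 + Real.log p) * √p)) := by gcongr
        _ = _ := by ring
  calc 4 * N / (K : ℝ) ^ 2 * ‖corrSum K N χ‖
      ≤ 4 * N / (K : ℝ) ^ 2 * ((K : ℝ) ^ 3 * ((2 + Real.log p) * √p)) := by gcongr
    _ = _ := by field_simp

end Shift

section Assembly

variable {p : ℕ} [Fact p.Prime]

lemma factSum_one {N : ℕ} (hN : N < p) : factSum N (1 : DirichletCharacter ℂ p) = N := by
  rw [factSum, Finset.sum_congr rfl fun n hn => MulChar.one_apply
    (factorial_ne_zero_of_lt (p := p) ((Finset.mem_Icc.1 hn).2.trans_lt hN)).isUnit]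
  simp

/-- If the nontrivial characters contribute little, every class is a product of seven
factorials. -/
theorem exists_prod_factorial_eq {N : ℕ} (hN : N < p)
    (h : ∑ χ ∈ Finset.univ.erase (1 : DirichletCharacter ℂ p), ‖factSum N χ‖ ^ 7 < (N : ℝ) ^ 7)
    {a : ZMod p} (ha : a ≠ 0) :
    ∃ n : Fin 7 → ℕ, (∀ i, 0 < n i ∧ n i ≤ N) ∧ ∏ i, ((n i).factorial : ZMod p) = a := by
  by_contra! hcon
  have h1 : ∀ χ : DirichletCharacter ℂ p, χ a⁻¹ * factSum N χ ^ 7 =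
      ∑ n ∈ Fintype.piFinset fun _ : Fin 7 => Finset.Icc 1 N,
        χ a⁻¹ * χ (∏ i, ((n i).factorial : ZMod p)) := by
    intro χ
    have h2 : factSum N χ ^ 7 = ∏ _i : Fin 7, factSum N χ := by simp
    rw [h2]
    simp_rw [factSum]
    rw [Finset.prod_univ_sum, Finset.mul_sum]
    simp_rw [map_prod]
  have h3 : ∑ χ : DirichletCharacter ℂ p, χ a⁻¹ * factSum N χ ^ 7 = 0 := by
    rw [Finset.sum_congr rfl fun χ _ => h1 χ, Finset.sum_comm]
    refine Finset.sum_eq_zero fun n hn => ?_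
    rw [DirichletCharacter.sum_char_inv_mul_char_eq ℂ ha.isUnit, if_neg]
    refine (hcon n fun i => ?_).symm
    have := Finset.mem_Icc.1 (Fintype.mem_piFinset.1 hn i)
    exact ⟨this.1, this.2⟩
  rw [← Finset.add_sum_erase _ _ (Finset.mem_univ (1 : DirichletCharacter ℂ p)), factSum_one hN,
    MulChar.one_apply (inv_ne_zero ha).isUnit, one_mul, add_eq_zero_iff_eq_neg] at h3
  have h4 : (N : ℝ) ^ 7 = ‖(N : ℂ) ^ 7‖ := by rw [norm_pow, Complex.norm_natCast]
  rw [h4, h3, norm_neg] at h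
  refine absurd h (not_lt.2 (norm_sum_le_of_le _ fun χ _ => ?_))
  rw [norm_mul, norm_pow]
  exact mul_le_of_le_one_left (by positivity) (norm_mulChar_le_one χ _)

lemma pow_seven_le {S Λ Θ N K : ℝ} (hK : 0 < K) (hN : 0 ≤ N) (hS : 0 ≤ S) (hSΛ : S ≤ Λ)
    (h : S ^ 2 ≤ 8 * N ^ 2 / K + 4 * N / K ^ 2 * Θ) :
    S ^ 7 ≤ (4 * N / √K) ^ 5 * S ^ 2 + Λ ^ 3 * (64 * N ^ 2 / K ^ 4) * Θ ^ 2 := by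
  have hΛ : 0 ≤ Λ := hS.trans hSΛ
  rcases le_or_gt S (4 * N / √K) with h1 | h1
  · have h2 : S ^ 7 ≤ (4 * N / √K) ^ 5 * S ^ 2 := by
      calc S ^ 7 = S ^ 5 * S ^ 2 := by ring
        _ ≤ _ := by gcongr
    have h3 : 0 ≤ Λ ^ 3 * (64 * N ^ 2 / K ^ 4) * Θ ^ 2 := by positivity
    linarith
  · have h2 : 16 * N ^ 2 / K ≤ S ^ 2 := by
      have := pow_le_pow_left₀ (by positivity) h1.le 2
      rwa [div_pow, Real.sq_sqrt hK.le, mul_pow, show (4 : ℝ) ^ 2 = 16 by norm_num] at this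
    have h3 : S ^ 2 ≤ 8 * N / K ^ 2 * Θ := by
      have e1 : 16 * N ^ 2 / K = 2 * (8 * N ^ 2 / K) := by ring
      have e2 : 8 * N / K ^ 2 * Θ = 2 * (4 * N / K ^ 2 * Θ) := by ring
      linarith
    have h4 : S ^ 7 ≤ Λ ^ 3 * (64 * N ^ 2 / K ^ 4) * Θ ^ 2 := by
      calc S ^ 7 = S ^ 3 * (S ^ 2) ^ 2 := by ring
        _ ≤ Λ ^ 3 * (8 * N / K ^ 2 * Θ) ^ 2 := by gcongr
        _ = _ := by
          field_simp
          ring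
    have h5 : 0 ≤ (4 * N / √K) ^ 5 * S ^ 2 := by positivity
    linarith

/-- The contribution of the nontrivial characters. -/
theorem sum_norm_pow_seven_le {K N : ℕ} {Λ : ℝ} (hK : 1 ≤ K) (hK2 : K ^ 2 ≤ N) (hKN : N + K < p)
    (hΛ0 : 0 ≤ Λ) (hΛ : ∀ χ : DirichletCharacter ℂ p, χ ≠ 1 → ‖factSum N χ‖ ≤ Λ) :
    ∑ χ ∈ Finset.univ.erase (1 : DirichletCharacter ℂ p), ‖factSum N χ‖ ^ 7 ≤
      (4 * N / √K) ^ 5 * (12 * p * N * √N) +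
        64 * Λ ^ 3 * N ^ 2 * p * (N + boxBound p K N) := by
  have hK0 : (0 : ℝ) < K := by exact_mod_cast hK
  have hN1 : 1 ≤ N := by nlinarith
  refine (Finset.sum_le_sum fun χ hχ => pow_seven_le hK0 (Nat.cast_nonneg N) (norm_nonneg _)
    (hΛ χ (Finset.ne_of_mem_erase hχ)) (norm_sq_factSum_le hK hK2 hKN χ)).trans ?_
  rw [Finset.sum_add_distrib, ← Finset.mul_sum, ← Finset.mul_sum]
  have h1 : ∀ g : DirichletCharacter ℂ p → ℝ, (∀ χ, 0 ≤ g χ) →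
      ∑ χ ∈ Finset.univ.erase (1 : DirichletCharacter ℂ p), g χ ≤ ∑ χ, g χ := fun g hg =>
    Finset.sum_le_sum_of_subset_of_nonneg (Finset.erase_subset _ _) fun χ _ _ => hg χ
  have h2 := (h1 (fun χ => ‖factSum N χ‖ ^ 2) fun _ => by positivity).trans
    (sum_norm_sq_factSum_le hN1 (by omega : N < p))
  have h3 := (h1 (fun χ => ‖corrSum K N χ‖ ^ 2) fun _ => by positivity).trans
    (sum_norm_sq_corrSum_le hKN)
  refine add_le_add (mul_le_mul_of_nonneg_left h2 (by positivity))
    ((mul_le_mul_of_nonneg_left h3 (by positivity)).trans (le_of_eq ?_))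
  field_simp

end Assembly

section Asymptotics

variable {x ε : ℝ}

lemma mul_rpow_le_rpow (hx : 1 ≤ x) {c a b d : ℝ} (hc : c ≤ x ^ d) (h : a + d ≤ b) :
    c * x ^ a ≤ x ^ b := by
  have hx0 : 0 < x := by linarith
  calc c * x ^ a ≤ x ^ d * x ^ a := by gcongr
    _ = x ^ (a + d) := by rw [← Real.rpow_add hx0, add_comm]
    _ ≤ x ^ b := Real.rpow_le_rpow_of_exponent_le hx h

lemma mul_rpow_lt_rpow (hx : 1 ≤ x) {c a b d : ℝ} (hc : c < x ^ d) (h : a + d ≤ b) :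
    c * x ^ a < x ^ b := by
  have hx0 : 0 < x := by linarith
  calc c * x ^ a < x ^ d * x ^ a := by gcongr
    _ = x ^ (a + d) := by rw [← Real.rpow_add hx0, add_comm]
    _ ≤ x ^ b := Real.rpow_le_rpow_of_exponent_le hx h

lemma rpow_pow_eq (hx : 1 ≤ x) (a : ℝ) (n : ℕ) : (x ^ a) ^ n = x ^ (a * n) := by
  rw [Real.rpow_mul_natCast (by linarith)]

lemma character_bound_le (hx : 1 ≤ x) (hε : 0 < ε) (hbig : 10 ^ 10 < x ^ ε) {N K L : ℝ}
    (hL0 : 0 ≤ L) (hL : L ≤ x ^ ε) (hN0 : 0 ≤ N) (hN : N ≤ x ^ (6 / 7 + ε))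
    (hK : x ^ (5 / 28 : ℝ) ≤ K) (hK2 : K ≤ 2 * x ^ (5 / 28 : ℝ)) :
    8 * N ^ 2 / K + 4 * N * K * (L * √x) ≤ (x ^ (43 / 56 + 2 * ε)) ^ 2 := by
  have hx0 : 0 < x := by linarith
  have hKp : 0 < x ^ (5 / 28 : ℝ) := by positivity
  have h1 : 8 * N ^ 2 / K ≤ 8 * x ^ (43 / 28 + 2 * ε) := by
    calc 8 * N ^ 2 / K ≤ 8 * (x ^ (6 / 7 + ε)) ^ 2 / x ^ (5 / 28 : ℝ) := by gcongr
      _ = 8 * x ^ (43 / 28 + 2 * ε) := by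
        rw [rpow_pow_eq hx, mul_div_assoc, ← Real.rpow_sub hx0]
        congr 2; push_cast; ring
  have h2 : 4 * N * K * (L * √x) ≤ 8 * x ^ (43 / 28 + 2 * ε) := by
    calc 4 * N * K * (L * √x)
        ≤ 4 * x ^ (6 / 7 + ε) * (2 * x ^ (5 / 28 : ℝ)) * (x ^ ε * √x) := by
          have : 0 ≤ K := by linarith
          gcongr
      _ = 8 * (x ^ (6 / 7 + ε) * x ^ (5 / 28 : ℝ) * x ^ ε * x ^ (1 / 2 : ℝ)) := by
        rw [Real.sqrt_eq_rpow]; ring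
      _ = 8 * x ^ (43 / 28 + 2 * ε) := by
        simp only [← Real.rpow_add hx0]
        congr 2; ring
  calc 8 * N ^ 2 / K + 4 * N * K * (L * √x) ≤ 16 * x ^ (43 / 28 + 2 * ε) := by linarith
    _ ≤ x ^ (43 / 28 + 3 * ε) := mul_rpow_le_rpow hx (d := ε) (by linarith) (by linarith)
    _ ≤ (x ^ (43 / 56 + 2 * ε)) ^ 2 := by
      rw [rpow_pow_eq hx]
      exact Real.rpow_le_rpow_of_exponent_le hx (by push_cast; linarith)

lemma short_interval_term_lt (hx : 1 ≤ x) (hbig : 10 ^ 10 < x ^ ε) {N K : ℝ}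
    (hN : x ^ (6 / 7 + ε) ≤ 2 * N) (hK : x ^ (8 / 35 : ℝ) ≤ K) :
    (4 * N / √K) ^ 5 * (12 * x * N * √N) < N ^ 7 / 2 := by
  have hx0 : 0 < x := by linarith
  have hN0 : 0 < N := by have := Real.rpow_pos_of_pos hx0 (6 / 7 + ε); linarith
  have hK0 : 0 < K := (Real.rpow_pos_of_pos hx0 _).trans_le hK
  have hsq : (24576 * x) ^ 2 < (√K ^ 5 * √N) ^ 2 := by
    calc (24576 * x) ^ 2 = 24576 ^ 2 * x ^ (2 : ℝ) := by rw [Real.rpow_two]; ring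
      _ < x ^ (2 + ε) / 2 := by
        have := mul_rpow_lt_rpow hx (c := 2 * 24576 ^ 2) (a := 2) (b := 2 + ε) (d := ε)
          (by linarith) le_rfl
        linarith
      _ = (x ^ (8 / 35 : ℝ)) ^ 5 * (x ^ (6 / 7 + ε) / 2) := by
        rw [rpow_pow_eq hx, mul_div_assoc', ← Real.rpow_add hx0]
        congr 2; push_cast; ring
      _ ≤ K ^ 5 * N := by gcongr; linarith
      _ = (√K ^ 5 * √N) ^ 2 := by
        rw [mul_pow, ← pow_mul, mul_comm 5 2, pow_mul, Real.sq_sqrt hK0.le, Real.sq_sqrt hN0.le]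
  have hlt : 24576 * x < √K ^ 5 * √N := lt_of_pow_lt_pow_left₀ 2 (by positivity) hsq
  have hsK : 0 < √K := Real.sqrt_pos.2 hK0
  have hsN : 0 < √N := Real.sqrt_pos.2 hN0
  have e : (4 * N / √K) ^ 5 * (12 * x * N * √N) = (24576 * x) * (N ^ 6 * √N) / (2 * √K ^ 5) := by
    field_simp; ring
  rw [e, div_lt_iff₀ (by positivity)]
  calc (24576 * x) * (N ^ 6 * √N) < (√K ^ 5 * √N) * (N ^ 6 * √N) := by gcongr
    _ = √K ^ 5 * N ^ 6 * (√N * √N) := by ring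
    _ = N ^ 7 / 2 * (2 * √K ^ 5) := by rw [Real.mul_self_sqrt hN0.le]; ring

lemma box_term_le (hx : 1 ≤ x) (hε : 0 < ε) (hε1 : ε ≤ 1 / 1000) (hbig : 10 ^ 10 < x ^ ε)
    {N K L : ℝ} (hL0 : 0 ≤ L) (hL : L ≤ x ^ ε) (hN0 : 0 ≤ N) (hN : N ≤ x ^ (6 / 7 + ε))
    (hK0 : 0 ≤ K) (hK2 : K ≤ 2 * x ^ (8 / 35 : ℝ)) :
    N + ((N / x) ^ 2 * (K * x) + L ^ 2 * (4 * K ^ 2 * √x + 12 * K ^ 4)) ≤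
      x ^ (67 / 70 + 3 * ε) := by
  have hx0 : 0 < x := by linarith
  have hmono : ∀ {a : ℝ}, a ≤ 67 / 70 + 2 * ε → x ^ a ≤ x ^ (67 / 70 + 2 * ε) := fun h =>
    Real.rpow_le_rpow_of_exponent_le hx h
  have h1 : N ≤ x ^ (67 / 70 + 2 * ε) := hN.trans (hmono (by linarith))
  have h2 : (N / x) ^ 2 * (K * x) ≤ 2 * x ^ (67 / 70 + 2 * ε) := by
    calc (N / x) ^ 2 * (K * x) ≤ (x ^ (6 / 7 + ε) / x ^ (1 : ℝ)) ^ 2 *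
          (2 * x ^ (8 / 35 : ℝ) * x ^ (1 : ℝ)) := by rw [Real.rpow_one]; gcongr
      _ = 2 * x ^ (33 / 35 + 2 * ε) := by
        rw [← Real.rpow_sub hx0, rpow_pow_eq hx, mul_assoc, mul_left_comm]
        simp only [← Real.rpow_add hx0]
        congr 2; push_cast; ring
      _ ≤ 2 * x ^ (67 / 70 + 2 * ε) := by gcongr 2 * ?_; exact hmono (by linarith)
  have h3 : L ^ 2 * (4 * K ^ 2 * √x) ≤ 16 * x ^ (67 / 70 + 2 * ε) := by
    calc L ^ 2 * (4 * K ^ 2 * √x) ≤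
          (x ^ ε) ^ 2 * (4 * (2 * x ^ (8 / 35 : ℝ)) ^ 2 * x ^ (1 / 2 : ℝ)) := by
          rw [← Real.sqrt_eq_rpow]; gcongr
      _ = 16 * ((x ^ ε) ^ 2 * (x ^ (8 / 35 : ℝ)) ^ 2 * x ^ (1 / 2 : ℝ)) := by ring
      _ = 16 * x ^ (67 / 70 + 2 * ε) := by
        simp only [rpow_pow_eq hx, ← Real.rpow_add hx0]
        congr 2; push_cast; ring
  have h4 : L ^ 2 * (12 * K ^ 4) ≤ 192 * x ^ (67 / 70 + 2 * ε) := by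
    calc L ^ 2 * (12 * K ^ 4) ≤ (x ^ ε) ^ 2 * (12 * (2 * x ^ (8 / 35 : ℝ)) ^ 4) := by gcongr
      _ = 192 * ((x ^ ε) ^ 2 * (x ^ (8 / 35 : ℝ)) ^ 4) := by ring
      _ ≤ 192 * x ^ (67 / 70 + 2 * ε) := by
        simp only [rpow_pow_eq hx, ← Real.rpow_add hx0]
        gcongr 192 * ?_
        exact hmono (by push_cast; linarith)
  have h5 := mul_rpow_le_rpow hx (c := 211) (a := 67 / 70 + 2 * ε) (b := 67 / 70 + 3 * ε)
    (d := ε) (by linarith) (by linarith)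
  rw [mul_add]
  linarith

lemma large_value_term_lt (hx : 1 ≤ x) (hε : 0 < ε) (hε1 : ε ≤ 1 / 1000)
    (hbig : 10 ^ 10 < x ^ ε) {N B : ℝ} (hN : x ^ (6 / 7 + ε) ≤ 2 * N)
    (hN2 : N ≤ x ^ (6 / 7 + ε)) (hB0 : 0 ≤ B) (hB : B ≤ x ^ (67 / 70 + 3 * ε)) :
    64 * (x ^ (43 / 56 + 2 * ε)) ^ 3 * N ^ 2 * x * B < N ^ 7 / 2 := by
  have hx0 : 0 < x := by linarith
  have hN0 : 0 < N := by have := Real.rpow_pos_of_pos hx0 (6 / 7 + ε); linarith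
  have h := mul_rpow_lt_rpow hx (c := 64 * 256) (a := 1673 / 280 + 11 * ε) (b := 6 + 7 * ε)
    (d := ε) (by linarith) (by linarith)
  calc 64 * (x ^ (43 / 56 + 2 * ε)) ^ 3 * N ^ 2 * x * B
      ≤ 64 * (x ^ (43 / 56 + 2 * ε)) ^ 3 * (x ^ (6 / 7 + ε)) ^ 2 * x ^ (1 : ℝ) *
        x ^ (67 / 70 + 3 * ε) := by rw [Real.rpow_one]; gcongr
    _ = 64 * ((x ^ (43 / 56 + 2 * ε)) ^ 3 * (x ^ (6 / 7 + ε)) ^ 2 * x ^ (1 : ℝ) *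
        x ^ (67 / 70 + 3 * ε)) := by ring
    _ = 64 * x ^ (1673 / 280 + 11 * ε) := by
      simp only [rpow_pow_eq hx, ← Real.rpow_add hx0]
      congr 2; push_cast; ring
    _ < x ^ (6 + 7 * ε) / 256 := by linarith
    _ = (x ^ (6 / 7 + ε) / 2) ^ 7 / 2 := by
      rw [div_pow, rpow_pow_eq hx, div_div]
      congr 2
      · push_cast; ring
      · norm_num
    _ ≤ N ^ 7 / 2 := by gcongr; linarith

lemma sq_le_of_le_rpow (hx : 1 ≤ x) (hbig : 10 ^ 10 < x ^ ε) {N K e : ℝ}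
    (hN : x ^ (6 / 7 + ε) ≤ 2 * N) (he : e ≤ 8 / 35) (hK0 : 0 ≤ K) (hK : K ≤ 2 * x ^ e) :
    K ^ 2 ≤ N := by
  have h : (2 * x ^ e) ^ 2 ≤ N := by
    have := mul_rpow_le_rpow hx (c := 8) (a := e * 2) (b := 6 / 7 + ε) (d := ε)
      (by linarith) (by linarith)
    have e2 : (2 * x ^ e) ^ 2 = 4 * x ^ (e * 2) := by
      rw [mul_pow, rpow_pow_eq hx]; push_cast; ring
    rw [e2]; linarith
  exact (pow_le_pow_left₀ hK0 hK 2).trans h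

lemma add_lt_self (hx : 1 ≤ x) (hε : 0 < ε) (hε1 : ε ≤ 1 / 1000) (hbig : 10 ^ 10 < x ^ ε)
    {N K e : ℝ} (hN : N ≤ x ^ (6 / 7 + ε)) (he : e ≤ 8 / 35) (hK : K ≤ 2 * x ^ e) :
    N + K < x := by
  have h1 := mul_rpow_lt_rpow hx (c := 2) (a := 6 / 7 + ε) (b := 1) (d := ε)
      (by linarith) (by linarith)
  have h2 := mul_rpow_lt_rpow hx (c := 4) (a := e) (b := 1) (d := ε)
      (by linarith) (by linarith)
  rw [Real.rpow_one] at h1 h2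
  linarith

lemma ceil_rpow_bounds (hx : 1 ≤ x) {e : ℝ} (he : 0 ≤ e) :
    x ^ e ≤ (⌈x ^ e⌉₊ : ℝ) ∧ (⌈x ^ e⌉₊ : ℝ) ≤ 2 * x ^ e ∧ 1 ≤ ⌈x ^ e⌉₊ := by
  have h1 : 1 ≤ x ^ e := Real.one_le_rpow hx he
  refine ⟨Nat.le_ceil _, ?_, Nat.one_le_ceil_iff.2 (by linarith)⟩
  have := Nat.ceil_lt_add_one (a := x ^ e) (by linarith)
  linarith

lemma floor_rpow_bounds (hx : 1 ≤ x) {e : ℝ} (he : 0 ≤ e) :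
    x ^ e ≤ 2 * (⌊x ^ e⌋₊ : ℝ) ∧ (⌊x ^ e⌋₊ : ℝ) ≤ x ^ e := by
  have h1 : 1 ≤ x ^ e := Real.one_le_rpow hx he
  refine ⟨?_, Nat.floor_le (by linarith)⟩
  have := Nat.lt_floor_add_one (x ^ e)
  have h2 : (1 : ℝ) ≤ (⌊x ^ e⌋₊ : ℝ) := by exact_mod_cast Nat.one_le_floor_iff _ |>.2 h1
  linarith

lemma eventually_rpow_large (hε : 0 < ε) :
    ∀ᶠ x : ℝ in Filter.atTop, 1 ≤ x ∧ 10 ^ 10 < x ^ ε ∧ 2 + Real.log x ≤ x ^ ε := by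
  have h1 := (tendsto_rpow_atTop hε).eventually (Filter.eventually_gt_atTop (10 ^ 10 : ℝ))
  have h2 := (isLittleO_log_rpow_atTop hε).def (c := 1 / 2) (by norm_num)
  filter_upwards [h1, h2, Filter.eventually_ge_atTop 1] with x hx1 hx2 hx3
  refine ⟨hx3, hx1, ?_⟩
  rw [Real.norm_of_nonneg (Real.log_nonneg hx3), Real.norm_of_nonneg (by positivity)] at hx2
  linarith

end Asymptotics

section Conclusion

variable {p : ℕ} [Fact p.Prime]

lemma exists_prod_factorial_eq_of_large {ε : ℝ} (hε : 0 < ε) (hε1 : ε ≤ 1 / 1000)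
    (hbig : (10 : ℝ) ^ 10 < (p : ℝ) ^ ε) (hlog : 2 + Real.log p ≤ (p : ℝ) ^ ε)
    {a : ZMod p} (ha : a ≠ 0) :
    ∃ n : Fin 7 → ℕ, (∀ i, 0 < n i ∧ (n i : ℝ) ≤ (p : ℝ) ^ (6 / 7 + ε)) ∧
      ∏ i, ((n i).factorial : ZMod p) = a := by
  have hp : (1 : ℝ) ≤ p := by exact_mod_cast (Fact.out : p.Prime).one_lt.le
  have hL0 : 0 ≤ 2 + Real.log p := by linarith [Real.log_nonneg hp]
  obtain ⟨N, hNdef⟩ : ∃ N : ℕ, N = ⌊(p : ℝ) ^ (6 / 7 + ε)⌋₊ := ⟨_, rfl⟩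
  obtain ⟨K, hKdef⟩ : ∃ K : ℕ, K = ⌈(p : ℝ) ^ (8 / 35 : ℝ)⌉₊ := ⟨_, rfl⟩
  obtain ⟨J, hJdef⟩ : ∃ J : ℕ, J = ⌈(p : ℝ) ^ (5 / 28 : ℝ)⌉₊ := ⟨_, rfl⟩
  obtain ⟨hN1, hN2⟩ := hNdef ▸ floor_rpow_bounds hp (e := 6 / 7 + ε) (by linarith)
  obtain ⟨hK1, hK2, hK⟩ := hKdef ▸ ceil_rpow_bounds hp (e := 8 / 35) (by norm_num)
  obtain ⟨hJ1, hJ2, hJ⟩ := hJdef ▸ ceil_rpow_bounds hp (e := 5 / 28) (by norm_num)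
  have hKN : K ^ 2 ≤ N := by
    exact_mod_cast sq_le_of_le_rpow hp hbig hN1 le_rfl (Nat.cast_nonneg K) hK2
  have hJN : J ^ 2 ≤ N := by
    exact_mod_cast sq_le_of_le_rpow hp hbig hN1 (by norm_num) (Nat.cast_nonneg J) hJ2
  have hNK : N + K < p := by
    exact_mod_cast add_lt_self hp hε hε1 hbig hN2 le_rfl hK2
  have hNJ : N + J < p := by
    exact_mod_cast add_lt_self hp hε hε1 hbig hN2 (by norm_num) hJ2
  have hΛ0 : 0 ≤ (p : ℝ) ^ (43 / 56 + 2 * ε) := by positivity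
  have hΛ : ∀ χ : DirichletCharacter ℂ p, χ ≠ 1 →
      ‖factSum N χ‖ ≤ (p : ℝ) ^ (43 / 56 + 2 * ε) := fun χ hχ =>
    (pow_le_pow_iff_left₀ (norm_nonneg _) hΛ0 two_ne_zero).1 <|
      (norm_sq_factSum_le_of_ne_one hJ hJN hNJ hχ).trans
        (character_bound_le hp hε hbig hL0 hlog (Nat.cast_nonneg N) hN2 hJ1 hJ2)
  have hbox : (N : ℝ) + boxBound p K N ≤ (p : ℝ) ^ (67 / 70 + 3 * ε) :=
    box_term_le hp hε hε1 hbig hL0 hlog (Nat.cast_nonneg N) hN2 (Nat.cast_nonneg K) hK2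
  have hsum := sum_norm_pow_seven_le hK hKN hNK hΛ0 hΛ
  have hshort := short_interval_term_lt hp hbig hN1 hK1
  have hlarge := large_value_term_lt hp hε hε1 hbig hN1 hN2
    (add_nonneg N.cast_nonneg (boxBound_nonneg (p := p) K N)) hbox
  obtain ⟨n, hn, hprod⟩ := exists_prod_factorial_eq (N := N) (by omega)
    (hsum.trans_lt (by linarith)) ha
  exact ⟨n, fun i => ⟨(hn i).1, le_trans (by exact_mod_cast (hn i).2) hN2⟩, hprod⟩

/-- Wilson's theorem in the form `n! (p - n)! ≡ (-1)ⁿ n`. -/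
lemma factorial_mul_factorial_sub {n : ℕ} (hn : 1 ≤ n) (hnp : n < p) :
    (n.factorial : ZMod p) * ((p - n).factorial : ZMod p) = (-1) ^ n * n := by
  induction n, hn using Nat.le_induction with
  | base => simp [ZMod.wilsons_lemma]
  | succ n hn ih =>
    have h := ih (by omega)
    have e : p - n = p - (n + 1) + 1 := by omega
    have hcast : ((p - (n + 1) : ℕ) : ZMod p) + 1 = -n := by
      have : ((p - (n + 1) + 1 : ℕ) : ZMod p) = -n := by
        rw [← e, Nat.cast_sub (by omega)]; simp
      exact_mod_cast this
    have hn0 : (n : ZMod p) ≠ 0 := by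
      rw [Ne, ZMod.natCast_eq_zero_iff]
      exact Nat.not_dvd_of_pos_of_lt hn (by omega)
    rw [e, Nat.factorial_succ] at h
    push_cast at h
    rw [hcast] at h
    rw [Nat.factorial_succ]
    push_cast
    apply mul_left_cancel₀ hn0
    linear_combination (-(n : ZMod p) - 1) * h

lemma exists_prod_factorial_eq_lt {a : ZMod p} (ha : a ≠ 0) :
    ∃ n : Fin 7 → ℕ, (∀ i, 0 < n i ∧ n i ≤ p) ∧ ∏ i, ((n i).factorial : ZMod p) = a := by
  have hp := (Fact.out : p.Prime).two_le
  have hlt := ZMod.val_lt a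
  have hpos : 1 ≤ a.val := Nat.one_le_iff_ne_zero.2 (by simpa using ha)
  have h := factorial_mul_factorial_sub (p := p) hpos hlt
  rw [ZMod.natCast_zmod_val] at h
  rcases Nat.even_or_odd a.val with he | ho
  · refine ⟨![a.val, p - a.val, 1, 1, 1, 1, 1], fun i => ?_, ?_⟩
    · fin_cases i <;> simp [Nat.pos_iff_ne_zero, ha] <;> omega
    · rw [he.neg_one_pow, one_mul] at h
      simpa [Fin.prod_univ_succ] using h
  · refine ⟨![a.val, p - a.val, p - 1, 1, 1, 1, 1], fun i => ?_, ?_⟩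
    · fin_cases i <;> simp [Nat.pos_iff_ne_zero, ha] <;> omega
    · rw [ho.neg_one_pow] at h
      simp [Fin.prod_univ_succ, ZMod.wilsons_lemma, h]

end Conclusion

end SevenFact

/-- **Theorem 3.** Fix `0 < ε < 1/7`. Every nonzero residue class modulo a prime `p` is a
product of seven factorials `n₁!⋯n₇!` with each `nᵢ ≤ C·p^{6/7+ε}` for a constant
`C = C(ε) > 0`. -/
theorem seven_factorials_represent (ε : ℝ) (hε0 : 0 < ε) (hε1 : ε < 1 / 7) :
    ∃ C : ℝ, C > 0 ∧ ∀ p : ℕ, p.Prime → ∀ a : ZMod p, a ≠ 0 →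
      ∃ n : Fin 7 → ℕ,
        (∀ i, 0 < n i ∧ ((n i : ℝ) ≤ C * (p : ℝ) ^ ((6 : ℝ) / 7 + ε))) ∧
        (∏ i, ((n i).factorial : ZMod p)) = a := by
  obtain ⟨δ, hδ⟩ : ∃ δ : ℝ, δ = min ε (1 / 1000) := ⟨_, rfl⟩
  have hδ0 : 0 < δ := hδ ▸ lt_min hε0 (by norm_num)
  obtain ⟨X, hX⟩ := Filter.eventually_atTop.1 (SevenFact.eventually_rpow_large hδ0)
  refine ⟨max 1 X, by positivity, fun p hp a ha => ?_⟩
  have := Fact.mk hp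
  have hp1 : (1 : ℝ) ≤ p := by exact_mod_cast hp.one_lt.le
  rcases le_or_gt X p with hXp | hXp
  · obtain ⟨-, hbig, hlog⟩ := hX p hXp
    obtain ⟨n, hn, hprod⟩ := SevenFact.exists_prod_factorial_eq_of_large hδ0
      (hδ ▸ min_le_right _ _) hbig hlog ha
    refine ⟨n, fun i => ⟨(hn i).1, (hn i).2.trans ?_⟩, hprod⟩
    calc (p : ℝ) ^ (6 / 7 + δ) ≤ (p : ℝ) ^ (6 / 7 + ε) :=
          Real.rpow_le_rpow_of_exponent_le hp1 (by linarith [hδ ▸ min_le_left ε (1 / 1000)])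
      _ ≤ max 1 X * (p : ℝ) ^ (6 / 7 + ε) :=
          le_mul_of_one_le_left (by positivity) (le_max_left _ _)
  · obtain ⟨n, hn, hprod⟩ := SevenFact.exists_prod_factorial_eq_lt ha
    refine ⟨n, fun i => ⟨(hn i).1, ?_⟩, hprod⟩
    calc (n i : ℝ) ≤ p := by exact_mod_cast (hn i).2
      _ ≤ max 1 X := hXp.le.trans (le_max_right _ _)
      _ ≤ max 1 X * (p : ℝ) ^ (6 / 7 + ε) :=
          le_mul_of_one_le_right (by positivity) (Real.one_le_rpow hp1 (by linarith))
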